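/- Let a₁, a₂, a₃, r₁, r₂, r₃ be positive integers with gcd(rᵢ, aᵢ) = 1, gcd(rᵢ, aᵢ − aⱼ) = 1, and gcd(rᵢ, rⱼ) = 1 for all i ≠ j. Let Lᵢ(x) = aᵢx + 1, and let C be any positive integer. Then there exist indices i, j with 1 ≤ i < j ≤ 3 such that there are infinitely many positive integers x with both Lᵢ(x)/rᵢ ∈ E₂(C) and Lⱼ(x)/rⱼ ∈ E₂(C). -/

import Mathlib

/-- `E2 C` is the set of products `p₁ * p₂` of two distinct primes both exceeding `C`. -/
def E2 (C : ℕ) : Set ℕ :=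
  {m | ∃ p q : ℕ, p.Prime ∧ q.Prime ∧ p ≠ q ∧ C < p ∧ C < q ∧ m = p * q}

section BalancedIndicator

open Finset

/-- The indicator of the residue class `u` among the units modulo `p`, minus its mean. -/
noncomputable def balInd (p : ℕ) (x u : ZMod p) : ℝ :=
  if x = 0 then 0 else (if x = u then 1 else 0) - 1 / ((p : ℝ) - 1)

/-- The kernel of the projection onto functions of mean zero on the units modulo `p`. -/
noncomputable def balKernel (p : ℕ) (x y : ZMod p) : ℝ :=
  if x = 0 ∨ y = 0 then 0 else (if x = y then 1 else 0) - 1 / ((p : ℝ) - 1)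

lemma sum_balInd_mul (p : ℕ) [Fact p.Prime] (x y : ZMod p) :
    ∑ u : (ZMod p)ˣ, balInd p x u * balInd p y u = balKernel p x y := by
  classical
  have hp : (1 : ℝ) < p := by exact_mod_cast (Fact.out : p.Prime).one_lt
  by_cases hx : x = 0
  · simp [balInd, balKernel, hx]
  by_cases hy : y = 0
  · simp [balInd, balKernel, hy]
  obtain ⟨a, rfl⟩ := (isUnit_iff_ne_zero.mpr hx)
  obtain ⟨b, rfl⟩ := (isUnit_iff_ne_zero.mpr hy)
  simp only [balInd, balKernel, hx, hy, if_false, or_self, Units.val_inj]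
  set c : ℝ := 1 / ((p : ℝ) - 1) with hc
  have e : ∀ u : (ZMod p)ˣ, ((if a = u then (1 : ℝ) else 0) - c) * ((if b = u then 1 else 0) - c)
      = (if a = u then (if a = b then (1 : ℝ) else 0) else 0) - c * (if a = u then 1 else 0)
        - c * (if b = u then 1 else 0) + c * c := by
    intro u
    by_cases h1 : a = u
    · by_cases h2 : b = u
      · simp [h1, h2]; ring
      · simp [h1, h2, Ne.symm h2]; ring
    · by_cases h2 : b = u
      · simp [h1, h2]; ring
      · simp [h1, h2]
  have hcard : (Fintype.card (ZMod p)ˣ : ℝ) = (p : ℝ) - 1 := by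
    rw [ZMod.card_units_eq_totient, Nat.totient_prime Fact.out,
      Nat.cast_sub (Fact.out : p.Prime).one_le, Nat.cast_one]
  rw [sum_congr rfl fun u _ => e u]
  rw [sum_add_distrib, sum_sub_distrib, sum_sub_distrib, ← mul_sum, ← mul_sum]
  simp only [sum_ite_eq, mem_univ, if_true, sum_const, card_univ, nsmul_eq_mul, hcard]
  have : ((p : ℝ) - 1) * (c * c) = c := by
    rw [hc]; field_simp [sub_ne_zero.mpr hp.ne']
  rw [this]; ring

lemma sum_balInd_mul_div (p : ℕ) [Fact p.Prime] (x y : ZMod p) (r : (ZMod p)ˣ) :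
    ∑ u : (ZMod p)ˣ, balInd p x u * balInd p y ((r / u : (ZMod p)ˣ) : ZMod p)
      = balInd p (x * y) r := by
  by_cases hy : y = 0
  · simp [balInd, hy]
  obtain ⟨b, rfl⟩ := (isUnit_iff_ne_zero.mpr hy)
  have h : ∀ u : (ZMod p)ˣ, balInd p b ((r / u : (ZMod p)ˣ) : ZMod p)
      = balInd p ((r / b : (ZMod p)ˣ) : ZMod p) u := by
    intro u
    simp only [balInd, Units.ne_zero, if_false, Units.val_inj]
    congr 2
    rw [eq_iff_iff, eq_div_iff_mul_eq', div_eq_iff_eq_mul, mul_comm, eq_comm, mul_comm]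
  rw [sum_congr rfl fun u _ => by rw [h u], sum_balInd_mul]
  by_cases hx : x = 0
  · simp [balInd, balKernel, hx]
  obtain ⟨a, rfl⟩ := (isUnit_iff_ne_zero.mpr hx)
  simp only [balInd, balKernel, ← Units.val_mul, Units.ne_zero, if_false, or_self, Units.val_inj]
  congr 2
  rw [eq_iff_iff, eq_div_iff_mul_eq']

/-- The squared norm of the part of `∑ α x δ_x`, `x ∈ T`, that is primitive modulo each prime
in `Q`. -/
noncomputable def primNorm (Q T : Finset ℕ) (α : ℕ → ℂ) : ℝ :=
  (∑ x ∈ T, ∑ y ∈ T, α x * (starRingEnd ℂ) (α y) * ∏ p ∈ Q, ((balKernel p x y : ℝ) : ℂ)).re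

section
variable {Q : Finset ℕ} [hQ : ∀ p : Q, Fact (p : ℕ).Prime] (T : Finset ℕ) (α β : ℕ → ℂ)

lemma sum_normSq_balInd :
    ∑ u : ((p : Q) → (ZMod p)ˣ),
      ‖∑ x ∈ T, α x * ∏ p : Q, ((balInd p x (u p) : ℝ) : ℂ)‖ ^ 2 = primNorm Q T α := by
  rw [primNorm, ← Complex.ofReal_re (∑ u : ((p : Q) → (ZMod p)ˣ), _)]
  congr 1
  push_cast
  have h1 : ∀ u : ((p : Q) → (ZMod p)ˣ),
      ((‖∑ x ∈ T, α x * ∏ p : Q, ((balInd p x (u p) : ℝ) : ℂ)‖ : ℝ) : ℂ) ^ 2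
      = ∑ x ∈ T, ∑ y ∈ T, α x * (starRingEnd ℂ) (α y) *
          ∏ p : Q, ((balInd p x (u p) * balInd p y (u p) : ℝ) : ℂ) := by
    intro u
    rw [← Complex.mul_conj', map_sum, sum_mul_sum]
    refine sum_congr rfl fun x _ => sum_congr rfl fun y _ => ?_
    simp only [map_mul, map_prod, Complex.conj_ofReal, Complex.ofReal_mul, prod_mul_distrib]
    ring
  rw [sum_congr rfl fun u _ => h1 u, sum_comm]
  refine sum_congr rfl fun x _ => ?_
  rw [sum_comm]
  refine sum_congr rfl fun y _ => ?_
  rw [← mul_sum]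
  congr 1
  have := Finset.prod_univ_sum (fun p : Q => (univ : Finset (ZMod p)ˣ))
    (fun (p : Q) (u : (ZMod p)ˣ) => (((balInd p x u * balInd p y u : ℝ)) : ℂ))
  rw [Fintype.piFinset_univ] at this
  refine this.symm.trans ?_
  rw [← Finset.prod_coe_sort Q]
  refine prod_congr rfl fun p _ => ?_
  rw [← sum_balInd_mul]
  push_cast
  rfl

lemma primNorm_nonneg : 0 ≤ primNorm Q T α := by
  rw [← sum_normSq_balInd]; positivity

lemma norm_bilinear_sq_le (T' : Finset ℕ) (r : (p : Q) → (ZMod p)ˣ) :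
    ‖∑ x ∈ T, ∑ y ∈ T', α x * β y * ∏ p : Q, ((balInd p (x * y) (r p) : ℝ) : ℂ)‖ ^ 2
      ≤ primNorm Q T α * primNorm Q T' β := by
  set F : ((p : Q) → (ZMod p)ˣ) → ℂ := fun u => ∑ x ∈ T, α x * ∏ p : Q, ((balInd p x (u p) : ℝ) : ℂ)
  set G : ((p : Q) → (ZMod p)ˣ) → ℂ := fun u => ∑ x ∈ T', β x * ∏ p : Q, ((balInd p x (u p) : ℝ) : ℂ)
  have h1 : ∑ x ∈ T, ∑ y ∈ T', α x * β y * ∏ p : Q, ((balInd p (x * y) (r p) : ℝ) : ℂ)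
      = ∑ u, F u * G (r / u) := by
    have h2 : ∀ u, F u * G (r / u) = ∑ x ∈ T, ∑ y ∈ T', α x * β y *
        ∏ p : Q, ((balInd p x (u p) * balInd p y ((r / u) p) : ℝ) : ℂ) := by
      intro u
      simp only [F, G]
      rw [sum_mul_sum]
      refine sum_congr rfl fun x _ => sum_congr rfl fun y _ => ?_
      simp only [Complex.ofReal_mul, prod_mul_distrib]
      ring
    rw [sum_congr rfl fun u _ => h2 u]
    symm
    rw [sum_comm]
    refine sum_congr rfl fun x _ => ?_
    rw [sum_comm]
    refine sum_congr rfl fun y _ => ?_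
    rw [← mul_sum]
    congr 1
    have := Finset.prod_univ_sum (fun p : Q => (univ : Finset (ZMod p)ˣ))
      (fun (p : Q) (u : (ZMod p)ˣ) => (((balInd p x u * balInd p y ((r p / u : (ZMod p)ˣ) : ZMod p) : ℝ)) : ℂ))
    rw [Fintype.piFinset_univ] at this
    simp only [Pi.div_apply]
    refine this.symm.trans ?_
    refine prod_congr rfl fun p _ => ?_
    rw [← sum_balInd_mul_div]
    push_cast
    rfl
  rw [h1, ← sum_normSq_balInd, ← sum_normSq_balInd]
  have h3 : ∑ u, ‖G u‖ ^ 2 = ∑ u, ‖G (r / u)‖ ^ 2 :=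
    (Equiv.sum_comp (Equiv.divLeft r) (fun u => ‖G u‖ ^ 2)).symm
  change _ ≤ (∑ u, ‖F u‖ ^ 2) * ∑ u, ‖G u‖ ^ 2
  rw [h3]
  calc ‖∑ u, F u * G (r / u)‖ ^ 2 ≤ (∑ u, ‖F u‖ * ‖G (r / u)‖) ^ 2 := by
        gcongr
        refine (norm_sum_le _ _).trans (le_of_eq ?_)
        simp
    _ ≤ _ := sum_mul_sq_le_sq_mul_sq _ _ _

lemma primNorm_sum_le {B : Type*} (s : Finset B) (γ : B → ℕ → ℂ) :
    primNorm Q T (fun x => ∑ b ∈ s, γ b x) ≤ #s * ∑ b ∈ s, primNorm Q T (γ b) := by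
  rw [← sum_normSq_balInd]
  simp_rw [← sum_normSq_balInd]
  rw [sum_comm, mul_sum]
  refine sum_le_sum fun u _ => ?_
  simp_rw [sum_mul]
  rw [sum_comm]
  calc _ ≤ (∑ b ∈ s, ‖∑ x ∈ T, γ b x * ∏ p : Q, ((balInd p x (u p) : ℝ) : ℂ)‖) ^ 2 := by
        gcongr; exact norm_sum_le _ _
    _ ≤ _ := sq_sum_le_card_mul_sum_sq

end

end BalancedIndicator

section LargeSieve

open Finset MeasureTheory

/-- The exponential sum `∑ α x e(x t)` over `x ∈ T`. -/
noncomputable def expSum (T : Finset ℕ) (α : ℕ → ℂ) (t : ℝ) : ℂ :=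
  ∑ x ∈ T, α x * Complex.exp (2 * Real.pi * Complex.I * x * t)

lemma hasDerivAt_expSum (T : Finset ℕ) (α : ℕ → ℂ) (t : ℝ) :
    HasDerivAt (expSum T α) (expSum T (fun x => α x * (2 * Real.pi * Complex.I * x)) t) t := by
  unfold expSum
  refine HasDerivAt.fun_sum fun x _ => ?_
  have h : HasDerivAt (fun t : ℝ => 2 * Real.pi * Complex.I * x * (t : ℂ))
      (2 * Real.pi * Complex.I * x) t := by
    simpa using (Complex.ofRealCLM.hasDerivAt (x := t)).const_mul (2 * Real.pi * Complex.I * (x : ℂ))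
  refine (h.cexp.const_mul (α x)).congr_deriv ?_
  ring

lemma continuous_expSum (T : Finset ℕ) (α : ℕ → ℂ) : Continuous (expSum T α) :=
  continuous_iff_continuousAt.mpr fun t => (hasDerivAt_expSum T α t).continuousAt

lemma integral_exp_int (k : ℤ) (a : ℤ) :
    ∫ t in (a : ℝ)..(a + 1), Complex.exp (2 * Real.pi * Complex.I * k * t) = if k = 0 then 1 else 0 := by
  split_ifs with h
  · simp [h]
  · have h0 : (2 * Real.pi * Complex.I * k : ℂ) ≠ 0 := by
      simp [Real.pi_ne_zero, h]
    rw [integral_exp_mul_complex h0, div_eq_zero_iff, sub_eq_zero]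
    left
    rw [Complex.exp_eq_exp_iff_exists_int]
    exact ⟨k, by push_cast; ring⟩

lemma integral_normSq_expSum (T : Finset ℕ) (α : ℕ → ℂ) (a : ℤ) :
    ∫ t in (a : ℝ)..(a + 1), ‖expSum T α t‖ ^ 2 = ∑ x ∈ T, ‖α x‖ ^ 2 := by
  have h : ∫ t in (a : ℝ)..(a + 1), (((‖expSum T α t‖ ^ 2 : ℝ)) : ℂ)
      = ((∑ x ∈ T, ‖α x‖ ^ 2 : ℝ) : ℂ) := by
    have e : ∀ t : ℝ, (((‖expSum T α t‖ ^ 2 : ℝ)) : ℂ) = ∑ x ∈ T, ∑ y ∈ T,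
        (α x * (starRingEnd ℂ) (α y)) * Complex.exp (2 * Real.pi * Complex.I * ((x : ℤ) - (y : ℤ) : ℤ) * t) := by
      intro t
      rw [Complex.ofReal_pow, ← Complex.mul_conj', expSum, map_sum, sum_mul_sum]
      refine sum_congr rfl fun x _ => sum_congr rfl fun y _ => ?_
      rw [map_mul, ← Complex.exp_conj, mul_mul_mul_comm, ← Complex.exp_add]
      congr 2
      simp only [map_mul, Complex.conj_ofReal, Complex.conj_I, map_ofNat, map_natCast]
      push_cast; ring
    simp_rw [e]
    rw [intervalIntegral.integral_finsetSum]
    · rw [Complex.ofReal_sum]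
      refine sum_congr rfl fun x hx => ?_
      rw [intervalIntegral.integral_finsetSum]
      · simp_rw [intervalIntegral.integral_const_mul, integral_exp_int]
        rw [sum_eq_single x]
        · simp [Complex.mul_conj']
        · intro y _ hy
          have : ((x : ℤ) - (y : ℤ)) ≠ 0 := by
            rw [sub_ne_zero]; exact_mod_cast hy.symm
          simp [this]
        · intro h; exact absurd hx h
      · intro y _
        exact (by fun_prop : Continuous _).intervalIntegrable _ _
    · intro x _
      exact (by fun_prop : Continuous _).intervalIntegrable _ _
  rw [intervalIntegral.integral_ofReal] at h
  exact_mod_cast h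

lemma mul_norm_le_integral {F F' : ℝ → ℂ} (hF : ∀ t, HasDerivAt F (F' t) t) (hF' : Continuous F')
    (x : ℝ) {h : ℝ} (hh : 0 < h) :
    2 * h * ‖F x‖ ≤ ∫ t in Set.Ioo (x - h) (x + h), (‖F t‖ + 2 * h * ‖F' t‖) := by
  have hFc : Continuous F := continuous_iff_continuousAt.mpr fun t => (hF t).continuousAt
  set J := ∫ t in Set.Ioo (x - h) (x + h), ‖F' t‖ with hJ
  have intF' : IntegrableOn (fun t => ‖F' t‖) (Set.Ioo (x - h) (x + h)) :=
    (hF'.norm.integrableOn_Icc).mono_set Set.Ioo_subset_Icc_self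
  have intF : IntegrableOn (fun t => ‖F t‖) (Set.Ioo (x - h) (x + h)) :=
    (hFc.norm.integrableOn_Icc).mono_set Set.Ioo_subset_Icc_self
  have vol : volume.real (Set.Ioo (x - h) (x + h)) = 2 * h := by
    rw [Real.volume_real_Ioo_of_le (by linarith)]; ring
  have key : ∀ t ∈ Set.Ioo (x - h) (x + h), ‖F x‖ ≤ ‖F t‖ + J := by
    intro t ht
    have e : F x - F t = ∫ s in t..x, F' s :=
      (intervalIntegral.integral_eq_sub_of_hasDerivAt (fun s _ => hF s)
        (hF'.intervalIntegrable _ _)).symm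
    have e2 : ‖F x - F t‖ ≤ J := by
      rw [e]
      refine (intervalIntegral.norm_integral_le_integral_norm_uIoc).trans ?_
      refine setIntegral_mono_set intF' (by filter_upwards with s; positivity) ?_
      refine Filter.Eventually.of_forall fun s hs => ?_
      replace hs : s ∈ Set.uIoc t x := hs
      rw [Set.mem_uIoc] at hs
      simp only [Set.mem_Ioo] at ht ⊢
      change s ∈ Set.Ioo _ _
      rcases hs with hs | hs <;> constructor <;> linarith [hs.1, hs.2, ht.1, ht.2]
    calc ‖F x‖ = ‖F t + (F x - F t)‖ := by ring_nf
      _ ≤ ‖F t‖ + ‖F x - F t‖ := norm_add_le _ _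
      _ ≤ _ := by gcongr
  have h1 : ∫ _ in Set.Ioo (x - h) (x + h), ‖F x‖ ≤ ∫ t in Set.Ioo (x - h) (x + h), (‖F t‖ + J) := by
    refine setIntegral_mono_on (integrableOn_const (by simp)) ?_ measurableSet_Ioo key
    exact intF.add (integrableOn_const (by simp))
  rw [setIntegral_const, vol, smul_eq_mul, integral_add intF (integrableOn_const (by simp)),
    setIntegral_const, vol, smul_eq_mul] at h1
  rw [integral_add intF (intF'.const_mul _), integral_const_mul]
  exact h1

/-- The large sieve inequality for Farey fractions (Gallagher). -/
theorem large_sieve (T : Finset ℕ) (α : ℕ → ℂ) {M R : ℕ} (hM : 0 < M) (hR : 0 < R)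
    (hT : ∀ x ∈ T, x ≤ M) :
    ∑ q ∈ Icc 1 R, ∑ b ∈ (range q).filter (Nat.Coprime q), ‖expSum T α ((b : ℝ) / q)‖ ^ 2
      ≤ 39 * ((R : ℝ) ^ 2 + M) * ∑ x ∈ T, ‖α x‖ ^ 2 := by
  set h : ℝ := 1 / (2 * (R : ℝ) ^ 2) with hh
  have hR' : (1 : ℝ) ≤ R := by exact_mod_cast hR
  have hpos : 0 < h := by positivity
  have hle : h ≤ 1 := by
    rw [hh, div_le_one (by positivity)]; nlinarith
  set S := expSum T α
  set S' := expSum T (fun x => α x * (2 * Real.pi * Complex.I * x))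
  have hSc : Continuous S := continuous_expSum _ _
  have hSc' : Continuous S' := continuous_expSum _ _
  set A : ℝ := 2 * Real.pi * M with hA
  have hApos : 0 < A := by positivity
  set G : ℝ → ℝ := fun t => ‖S t‖ ^ 2 + 2 * h * (A * ‖S t‖ ^ 2 + A⁻¹ * ‖S' t‖ ^ 2) with hG
  have hGc : Continuous G := by fun_prop
  have hG0 : ∀ t, 0 ≤ G t := fun t => by simp only [hG]; positivity
  have pt : ∀ x : ℝ, 2 * h * ‖S x‖ ^ 2 ≤ ∫ t in Set.Ioo (x - h) (x + h), G t := by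
    intro x
    have hd : ∀ t, HasDerivAt (fun t => S t ^ 2) (2 * S t * S' t) t := fun t => by
      simpa only [Nat.cast_ofNat, Nat.add_one_sub_one, pow_one] using (hasDerivAt_expSum T α t).fun_pow 2
    have := mul_norm_le_integral hd (by fun_prop) x hpos
    rw [norm_pow] at this
    refine this.trans (setIntegral_mono_on ?_ ?_ measurableSet_Ioo fun t _ => ?_)
    · exact (Continuous.integrableOn_Icc (by fun_prop)).mono_set Set.Ioo_subset_Icc_self
    · exact (hGc.integrableOn_Icc).mono_set Set.Ioo_subset_Icc_self
    · simp only [hG, norm_pow, norm_mul, Complex.norm_ofNat]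
      gcongr
      have h1 : A⁻¹ * ‖S' t‖ ^ 2 = A * (A⁻¹ * ‖S' t‖) ^ 2 := by field_simp
      have h2 : 2 * ‖S t‖ * ‖S' t‖ = A * (2 * ‖S t‖ * (A⁻¹ * ‖S' t‖)) := by field_simp
      rw [h1, h2, ← mul_add]
      gcongr
      nlinarith [sq_nonneg (‖S t‖ - A⁻¹ * ‖S' t‖)]
  set Pts := (Icc 1 R).sigma fun q => (range q).filter (Nat.Coprime q) with hPts
  have mem : ∀ s ∈ Pts, 1 ≤ s.1 ∧ s.1 ≤ R ∧ s.2 < s.1 ∧ Nat.Coprime s.1 s.2 := by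
    intro s hs
    simp only [hPts, mem_sigma, mem_Icc, mem_filter, mem_range] at hs
    tauto
  have disj : (Pts : Set (Σ _ : ℕ, ℕ)).PairwiseDisjoint
      (fun s => Set.Ioo ((s.2 : ℝ) / s.1 - h) ((s.2 : ℝ) / s.1 + h)) := by
    intro s hs s' hs' hne
    obtain ⟨h1, h2, h3, h4⟩ := mem s hs
    obtain ⟨h1', h2', h3', h4'⟩ := mem s' hs'
    rw [Function.onFun, Set.disjoint_left]
    intro t ht ht'
    have hq : (1 : ℝ) ≤ s.1 := by exact_mod_cast h1
    have hq' : (1 : ℝ) ≤ s'.1 := by exact_mod_cast h1'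
    have habs : |(s.2 : ℝ) / s.1 - s'.2 / s'.1| < 1 / (R : ℝ) ^ 2 := by
      have : 1 / (R : ℝ) ^ 2 = 2 * h := by rw [hh]; field_simp
      rw [this, abs_lt]; constructor <;> linarith [ht.1, ht.2, ht'.1, ht'.2]
    rw [div_sub_div _ _ (by positivity) (by positivity), abs_div, abs_of_pos (by positivity : (0:ℝ) < s.1 * s'.1),
      div_lt_div_iff₀ (by positivity) (by positivity)] at habs
    have hlt : |(s.2 : ℝ) * s'.1 - s.1 * s'.2| < 1 := by
      have hRR : (s.1 : ℝ) * s'.1 ≤ (R : ℝ) ^ 2 := by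
        rw [sq]; gcongr
      by_contra hcon
      push Not at hcon
      nlinarith [sq_nonneg (R : ℝ)]
    have hz : (s.2 : ℤ) * s'.1 - s.1 * s'.2 = 0 := by
      rw [← Int.abs_lt_one_iff]; exact_mod_cast hlt
    have hn : s.2 * s'.1 = s.1 * s'.2 := by
      have := sub_eq_zero.mp hz; exact_mod_cast this
    apply hne
    have d1 : s.1 ∣ s'.1 := h4.dvd_of_dvd_mul_left (Dvd.intro _ hn.symm)
    have d2 : s'.1 ∣ s.1 := h4'.dvd_of_dvd_mul_right (Dvd.intro_left _ hn)
    have e1 : s.1 = s'.1 := Nat.dvd_antisymm d1 d2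
    have e2 : s.2 = s'.2 := by
      rw [← e1, mul_comm] at hn
      exact Nat.eq_of_mul_eq_mul_left h1 hn
    exact Sigma.ext e1 (heq_of_eq e2)
  have tot : ∫ t in Set.Ioc (-1 : ℝ) 2, G t = 3 * (1 + 4 * h * A) * ∑ x ∈ T, ‖α x‖ ^ 2 -
      3 * (2 * h) * (A * ∑ x ∈ T, ‖α x‖ ^ 2 -
        A⁻¹ * ∑ x ∈ T, ‖α x * (2 * Real.pi * Complex.I * x)‖ ^ 2) := by
    have one : ∀ a : ℤ, ∫ t in (a : ℝ)..(a + 1), G t = (∑ x ∈ T, ‖α x‖ ^ 2) +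
        2 * h * (A * (∑ x ∈ T, ‖α x‖ ^ 2) +
          A⁻¹ * ∑ x ∈ T, ‖α x * (2 * Real.pi * Complex.I * x)‖ ^ 2) := by
      intro a
      have c1 : Continuous fun t => ‖S t‖ ^ 2 := by fun_prop
      have c2 : Continuous fun t => ‖S' t‖ ^ 2 := by fun_prop
      simp only [hG]
      rw [intervalIntegral.integral_add (c1.intervalIntegrable _ _)
          ((by fun_prop : Continuous _).intervalIntegrable _ _),
        intervalIntegral.integral_const_mul,
        intervalIntegral.integral_add ((c1.const_mul _).intervalIntegrable _ _)
          ((c2.const_mul _).intervalIntegrable _ _),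
        intervalIntegral.integral_const_mul, intervalIntegral.integral_const_mul,
        integral_normSq_expSum, integral_normSq_expSum]
    have i : ∀ u v : ℝ, IntervalIntegrable G volume u v := fun u v => hGc.intervalIntegrable u v
    rw [← intervalIntegral.integral_of_le (by norm_num),
      ← intervalIntegral.integral_add_adjacent_intervals (i (-1) 0) (i 0 2),
      ← intervalIntegral.integral_add_adjacent_intervals (i 0 1) (i 1 2)]
    have o1 := one (-1); have o2 := one 0; have o3 := one 1
    norm_num at o1 o2 o3
    norm_num
    rw [o1, o2, o3]; ring
  have der : A⁻¹ * ∑ x ∈ T, ‖α x * (2 * Real.pi * Complex.I * x)‖ ^ 2 ≤ A * ∑ x ∈ T, ‖α x‖ ^ 2 := by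
    rw [mul_sum, mul_sum]
    refine sum_le_sum fun x hx => ?_
    have hx' : (x : ℝ) ≤ M := by exact_mod_cast hT x hx
    have : ‖α x * (2 * Real.pi * Complex.I * x)‖ = ‖α x‖ * (2 * Real.pi * x) := by
      simp [abs_of_pos Real.pi_pos]
    rw [this]
    have h2 : 2 * Real.pi * x ≤ A := by rw [hA]; gcongr
    have h3 : A⁻¹ * A ^ 2 = A := by field_simp
    calc A⁻¹ * (‖α x‖ * (2 * Real.pi * x)) ^ 2 ≤ A⁻¹ * (‖α x‖ * A) ^ 2 := by gcongr
      _ = A * ‖α x‖ ^ 2 := by rw [mul_pow]; linear_combination ‖α x‖ ^ 2 * h3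
  have main : 2 * h * ∑ s ∈ Pts, ‖S ((s.2 : ℝ) / s.1)‖ ^ 2
      ≤ 3 * (1 + 4 * h * A) * ∑ x ∈ T, ‖α x‖ ^ 2 := by
    calc _ = ∑ s ∈ Pts, 2 * h * ‖S ((s.2 : ℝ) / s.1)‖ ^ 2 := mul_sum _ _ _
      _ ≤ ∑ s ∈ Pts, ∫ t in Set.Ioo ((s.2 : ℝ) / s.1 - h) ((s.2 : ℝ) / s.1 + h), G t :=
        sum_le_sum fun s _ => pt _
      _ = ∫ t in ⋃ s ∈ Pts, Set.Ioo ((s.2 : ℝ) / s.1 - h) ((s.2 : ℝ) / s.1 + h), G t := by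
        rw [integral_biUnion_finset _ (fun _ _ => measurableSet_Ioo) disj]
        exact fun s _ => (hGc.integrableOn_Icc).mono_set Set.Ioo_subset_Icc_self
      _ ≤ ∫ t in Set.Ioc (-1 : ℝ) 2, G t := by
        refine setIntegral_mono_set ((hGc.integrableOn_Icc).mono_set Set.Ioc_subset_Icc_self)
          (Filter.Eventually.of_forall hG0) (Filter.Eventually.of_forall ?_)
        intro t ht
        obtain ⟨s, hs, ht⟩ := Set.mem_iUnion₂.mp ht
        obtain ⟨h1, h2, h3, h4⟩ := mem s hs
        have hq : (1 : ℝ) ≤ s.1 := by exact_mod_cast h1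
        have u1 : 0 ≤ (s.2 : ℝ) / s.1 := by positivity
        have u2 : (s.2 : ℝ) / s.1 < 1 := by
          rw [div_lt_one (by positivity)]; exact_mod_cast h3
        exact ⟨by linarith [ht.1], by linarith [ht.2]⟩
      _ ≤ _ := by
        rw [tot]
        have : 0 ≤ 3 * (2 * h) * (A * ∑ x ∈ T, ‖α x‖ ^ 2 -
          A⁻¹ * ∑ x ∈ T, ‖α x * (2 * Real.pi * Complex.I * x)‖ ^ 2) :=
          mul_nonneg (by positivity) (by linarith)
        linarith
  rw [Finset.sum_sigma'] 
  set Y := ∑ x ∈ T, ‖α x‖ ^ 2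
  have hY : 0 ≤ Y := sum_nonneg fun _ _ => by positivity
  have e : 2 * h = 1 / (R : ℝ) ^ 2 := by rw [hh]; field_simp
  have hR2 : (0 : ℝ) < (R : ℝ) ^ 2 := by positivity
  rw [e, one_div, inv_mul_le_iff₀ hR2] at main
  refine main.trans ?_
  have e3 : (R : ℝ) ^ 2 * (3 * (1 + 4 * h * A) * Y) = (3 * R ^ 2 + 12 * Real.pi * M) * Y := by
    rw [hh, hA]; field_simp; ring
  rw [e3]
  gcongr
  have : Real.pi < 3.15 := Real.pi_lt_d2
  have hM' : (0 : ℝ) < M := by exact_mod_cast hM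
  nlinarith

end LargeSieve

section Ramanujan

open Finset

instance fact_prime_of_mem_primeFactors (q : ℕ) (p : q.primeFactors) : Fact (p : ℕ).Prime :=
  ⟨Nat.prime_of_mem_primeFactors p.2⟩

lemma sum_divisors_eq_sum_powerset {M : Type*} [AddCommMonoid M] {q : ℕ} (hq : Squarefree q)
    (f : Finset ℕ → M) :
    ∑ d ∈ q.divisors, f d.primeFactors = ∑ U ∈ q.primeFactors.powerset, f U := by
  refine sum_bij' (fun d _ => d.primeFactors) (fun U _ => ∏ p ∈ U, p) ?_ ?_ ?_ ?_ ?_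
  · intro d hd
    exact mem_powerset.mpr (Nat.primeFactors_mono (Nat.dvd_of_mem_divisors hd) hq.ne_zero)
  · intro U hU
    rw [Nat.mem_divisors]
    refine ⟨?_, hq.ne_zero⟩
    rw [← Nat.prod_primeFactors_of_squarefree hq]
    exact prod_dvd_prod_of_subset _ _ _ (mem_powerset.mp hU)
  · intro d hd
    exact Nat.prod_primeFactors_of_squarefree (hq.squarefree_of_dvd (Nat.dvd_of_mem_divisors hd))
  · intro U hU
    exact Nat.primeFactors_prod fun p hp => Nat.prime_of_mem_primeFactors (mem_powerset.mp hU hp)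
  · intro _ _; rfl

/-- The Ramanujan sum `c_q(n)`. -/
noncomputable def ramSum (q : ℕ) (n : ℤ) : ℂ :=
  ∑ b ∈ (range q).filter (Nat.Coprime q), Complex.exp (2 * Real.pi * Complex.I * n * (b / q))

lemma sum_range_exp {q : ℕ} (hq : 0 < q) (n : ℤ) :
    ∑ b ∈ range q, Complex.exp (2 * Real.pi * Complex.I * n * (b / q))
      = if (q : ℤ) ∣ n then (q : ℂ) else 0 := by
  have hq0 : (q : ℂ) ≠ 0 := by exact_mod_cast hq.ne'
  set w := Complex.exp (2 * Real.pi * Complex.I * n / q) with hw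
  have h : ∀ b ∈ range q, Complex.exp (2 * Real.pi * Complex.I * n * (b / q)) = w ^ b := by
    intro b _
    rw [hw, ← Complex.exp_nat_mul]; congr 1; ring
  rw [sum_congr rfl h]
  have hwq : w ^ q = 1 := by
    rw [hw, ← Complex.exp_nat_mul, Complex.exp_eq_one_iff]
    exact ⟨n, by field_simp⟩
  have h1 : w = 1 ↔ (q : ℤ) ∣ n := by
    rw [hw, Complex.exp_eq_one_iff]
    constructor
    · rintro ⟨k, hk⟩
      refine ⟨k, ?_⟩
      have h2 : (2 * Real.pi * Complex.I : ℂ) ≠ 0 := by simp [Real.pi_ne_zero]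
      have : (2 * Real.pi * Complex.I : ℂ) * n = (2 * Real.pi * Complex.I) * (q * k) := by
        field_simp at hk
        linear_combination (2 * Real.pi * Complex.I) * hk
      exact_mod_cast mul_left_cancel₀ h2 this
    · rintro ⟨k, rfl⟩
      exact ⟨k, by push_cast; field_simp⟩
  split_ifs with hd
  · simp [h1.mpr hd]
  · have hne : w ≠ 1 := fun h => hd (h1.mp h)
    rw [geom_sum_eq hne, hwq, sub_self, zero_div]

lemma sum_divisors_ramSum {q : ℕ} (hq : 0 < q) (n : ℤ) :
    ∑ d ∈ q.divisors, ramSum d n = if (q : ℤ) ∣ n then (q : ℂ) else 0 := by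
  rw [← sum_range_exp hq n]
  simp only [ramSum]
  rw [sum_sigma']
  refine sum_bij' (fun s _ => s.2 * (q / s.1)) (fun b _ => ⟨q / Nat.gcd q b, b / Nat.gcd q b⟩)
    ?_ ?_ ?_ ?_ ?_
  · rintro ⟨d, b⟩ h
    simp only [mem_sigma, Nat.mem_divisors, mem_filter, mem_range] at h ⊢
    obtain ⟨⟨⟨e, rfl⟩, h0⟩, hb, _⟩ := h
    have hd : 0 < d := by omega
    have he : 0 < e := Nat.pos_of_ne_zero fun h => by simp [h] at h0
    rw [Nat.mul_div_cancel_left _ hd]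
    exact Nat.mul_lt_mul_of_pos_right hb he
  · intro b hb
    rw [mem_range] at hb
    have hg : 0 < Nat.gcd q b := Nat.gcd_pos_of_pos_left _ hq
    simp only [mem_sigma, Nat.mem_divisors, mem_filter, mem_range]
    refine ⟨⟨Nat.div_dvd_of_dvd (Nat.gcd_dvd_left _ _), hq.ne'⟩, ?_, Nat.coprime_div_gcd_div_gcd hg⟩
    exact Nat.div_lt_div_of_lt_of_dvd (Nat.gcd_dvd_left _ _) hb
  · rintro ⟨d, b⟩ h
    simp only [mem_sigma, Nat.mem_divisors, mem_filter, mem_range] at h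
    obtain ⟨⟨⟨e, rfl⟩, h0⟩, hb, hc⟩ := h
    have hd : 0 < d := by omega
    have he : 0 < e := Nat.pos_of_ne_zero fun h => by simp [h] at h0
    simp only [Nat.mul_div_cancel_left _ hd]
    have : Nat.gcd (d * e) (b * e) = e := by
      rw [Nat.gcd_mul_right, hc, one_mul]
    rw [this, Nat.mul_div_cancel _ he, Nat.mul_div_cancel _ he]
  · intro b hb
    dsimp only
    have hg : 0 < Nat.gcd q b := Nat.gcd_pos_of_pos_left _ hq
    rw [Nat.div_div_self (Nat.gcd_dvd_left _ _) hq.ne', Nat.div_mul_cancel (Nat.gcd_dvd_right _ _)]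
  · rintro ⟨d, b⟩ h
    simp only [mem_sigma, Nat.mem_divisors, mem_filter, mem_range] at h
    obtain ⟨⟨⟨e, rfl⟩, h0⟩, hb, hc⟩ := h
    have hd : 0 < d := by omega
    have he : 0 < e := Nat.pos_of_ne_zero fun h => by simp [h] at h0
    have hd' : (d : ℂ) ≠ 0 := by exact_mod_cast hd.ne'
    have he' : (e : ℂ) ≠ 0 := by exact_mod_cast he.ne'
    dsimp only
    rw [Nat.mul_div_cancel_left _ hd]
    congr 2
    push_cast
    field_simp

lemma ramSum_eq_prod {q : ℕ} (hq : Squarefree q) (n : ℤ) :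
    ramSum q n = ∏ p ∈ q.primeFactors, ((if (p : ℤ) ∣ n then (p : ℂ) else 0) - 1) := by
  induction q using Nat.strong_induction_on with
  | _ q ih =>
    have hpos : 0 < q := Nat.pos_of_ne_zero hq.ne_zero
    have h1 := sum_divisors_ramSum hpos n
    have h2 := sum_divisors_eq_sum_powerset hq
      (fun U => ∏ p ∈ U, ((if (p : ℤ) ∣ n then (p : ℂ) else 0) - 1))
    rw [← prod_one_add] at h2
    have h3 : ∏ p ∈ q.primeFactors, (1 + ((if (p : ℤ) ∣ n then (p : ℂ) else 0) - 1))
        = if (q : ℤ) ∣ n then (q : ℂ) else 0 := by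
      simp only [add_sub_cancel]
      split_ifs with h
      · rw [prod_congr rfl fun p hp => if_pos ((Int.natCast_dvd_natCast.mpr
          (Nat.dvd_of_mem_primeFactors hp)).trans h), ← Nat.cast_prod,
          Nat.prod_primeFactors_of_squarefree hq]
      · obtain ⟨p, hp, hpn⟩ : ∃ p ∈ q.primeFactors, ¬ (p : ℤ) ∣ n := by
          by_contra hcon
          push Not at hcon
          apply h
          rw [← Nat.prod_primeFactors_of_squarefree hq, Int.natCast_dvd]
          refine Finset.prod_primes_dvd _ (fun p hp => (Nat.prime_of_mem_primeFactors hp).prime) ?_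
          intro p hp
          exact Int.natCast_dvd.mp (hcon p hp)
        exact prod_eq_zero hp (if_neg hpn)
    rw [h3, ← h1, ← Nat.cons_self_properDivisors hq.ne_zero, sum_cons, sum_cons] at h2
    have h4 : ∑ d ∈ q.properDivisors, ramSum d n = ∑ d ∈ q.properDivisors,
        ∏ p ∈ d.primeFactors, ((if (p : ℤ) ∣ n then (p : ℂ) else 0) - 1) := by
      refine sum_congr rfl fun d hd => ?_
      rw [Nat.mem_properDivisors] at hd
      exact ih d hd.2 (hq.squarefree_of_dvd hd.1)
    rw [h4] at h2
    exact (add_right_cancel h2).symm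

/-- The rank-one correction relating the projection onto nontrivial additive characters modulo
`p` to `balKernel`. -/
noncomputable def unitWeight (p : ℕ) (x : ZMod p) : ℝ := if x = 0 then 1 else - 1 / ((p : ℝ) - 1)

lemma ite_sub_one_eq {p : ℕ} (hp : p.Prime) (x y : ZMod p) :
    (if x = y then (p : ℝ) else 0) - 1
      = p * balKernel p x y + ((p : ℝ) - 1) * (unitWeight p x * unitWeight p y) := by
  have h1 : (1 : ℝ) < p := by exact_mod_cast hp.one_lt
  have h2 : (p : ℝ) - 1 ≠ 0 := by linarith
  unfold balKernel unitWeight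
  by_cases hx : x = 0 <;> by_cases hy : y = 0
  · simp [hx, hy]
  · simp [hx, hy, Ne.symm hy]; field_simp
  · simp [hx, hy]; field_simp
  · simp only [hx, hy, or_self, if_false]
    split_ifs <;> field_simp <;> ring

lemma sum_normSq_expSum_eq {q : ℕ} (hq : Squarefree q) (T : Finset ℕ) (α : ℕ → ℂ) :
    ∑ b ∈ (range q).filter (Nat.Coprime q), ‖expSum T α ((b : ℝ) / q)‖ ^ 2
      = ∑ U ∈ q.primeFactors.powerset, (∏ p ∈ U, (p : ℝ)) *
          (∏ p ∈ q.primeFactors \ U, ((p : ℝ) - 1)) *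
          primNorm U T (fun x => α x * ∏ p ∈ q.primeFactors \ U, ((unitWeight p x : ℝ) : ℂ)) := by
  have h1 : ((∑ b ∈ (range q).filter (Nat.Coprime q), ‖expSum T α ((b : ℝ) / q)‖ ^ 2 : ℝ) : ℂ)
      = ∑ x ∈ T, ∑ y ∈ T, α x * (starRingEnd ℂ) (α y) * ramSum q ((x : ℤ) - y) := by
    have e : ∀ t : ℝ, (((‖expSum T α t‖ ^ 2 : ℝ)) : ℂ) = ∑ x ∈ T, ∑ y ∈ T,
        (α x * (starRingEnd ℂ) (α y)) * Complex.exp (2 * Real.pi * Complex.I * ((x : ℤ) - (y : ℤ) : ℤ) * t) := by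
      intro t
      rw [Complex.ofReal_pow, ← Complex.mul_conj', expSum, map_sum, sum_mul_sum]
      refine sum_congr rfl fun x _ => sum_congr rfl fun y _ => ?_
      rw [map_mul, ← Complex.exp_conj, mul_mul_mul_comm, ← Complex.exp_add]
      congr 2
      simp only [map_mul, Complex.conj_ofReal, Complex.conj_I, map_ofNat, map_natCast]
      push_cast; ring
    rw [Complex.ofReal_sum, sum_congr rfl fun b _ => e _, sum_comm]
    refine sum_congr rfl fun x _ => ?_
    rw [sum_comm]
    refine sum_congr rfl fun y _ => ?_
    rw [← mul_sum, ramSum]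
    push_cast
    rfl
  have h2 : ∀ x y : ℕ, ramSum q ((x : ℤ) - y) = ∑ U ∈ q.primeFactors.powerset,
      (((∏ p ∈ U, (p : ℝ)) * (∏ p ∈ q.primeFactors \ U, ((p : ℝ) - 1)) : ℝ) : ℂ) *
      ((∏ p ∈ q.primeFactors \ U, ((unitWeight p x : ℝ) : ℂ)) *
       (∏ p ∈ q.primeFactors \ U, ((unitWeight p y : ℝ) : ℂ)) *
        ∏ p ∈ U, ((balKernel p x y : ℝ) : ℂ)) := by
    intro x y
    rw [ramSum_eq_prod hq]
    have : ∀ p ∈ q.primeFactors, ((if (p : ℤ) ∣ (x : ℤ) - y then (p : ℂ) else 0) - 1)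
        = (((p : ℝ) * balKernel p x y : ℝ) : ℂ) +
          ((((p : ℝ) - 1) * (unitWeight p x * unitWeight p y) : ℝ) : ℂ) := by
      intro p hp
      rw [← Complex.ofReal_add, ← ite_sub_one_eq (Nat.prime_of_mem_primeFactors hp)]
      have hiff : ((p : ℤ) ∣ (x : ℤ) - y) ↔ ((x : ZMod p) = y) := by
        rw [← ZMod.intCast_zmod_eq_zero_iff_dvd (a := (x : ℤ) - y) p]
        push_cast
        rw [sub_eq_zero]
      simp only [hiff]
      split_ifs <;> simp
    rw [prod_congr rfl this, prod_add]
    refine sum_congr rfl fun U _ => ?_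
    push_cast
    simp only [prod_mul_distrib]
    ring
  have h3 : ∑ b ∈ (range q).filter (Nat.Coprime q), ‖expSum T α ((b : ℝ) / q)‖ ^ 2
      = (∑ x ∈ T, ∑ y ∈ T, α x * (starRingEnd ℂ) (α y) * ramSum q ((x : ℤ) - y)).re := by
    rw [← h1, Complex.ofReal_re]
  rw [h3]
  simp_rw [h2, mul_sum]
  rw [sum_congr rfl fun x _ => sum_comm, sum_comm, Complex.re_sum]
  refine sum_congr rfl fun U _ => ?_
  rw [primNorm, ← Complex.re_ofReal_mul, mul_sum]
  congr 1
  refine sum_congr rfl fun x _ => ?_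
  rw [mul_sum]
  refine sum_congr rfl fun y _ => ?_
  simp only [map_mul, map_prod, Complex.conj_ofReal]
  ring

end Ramanujan

section LargeSievePrim

open Finset

lemma primNorm_nonneg_of_subset {q : ℕ} {U : Finset ℕ} (hU : U ⊆ q.primeFactors) (T : Finset ℕ)
    (α : ℕ → ℂ) : 0 ≤ primNorm U T α := by
  have : ∀ p : U, Fact (p : ℕ).Prime := fun p => ⟨Nat.prime_of_mem_primeFactors (hU p.2)⟩
  exact primNorm_nonneg T α

lemma primNorm_smul (Q T : Finset ℕ) (α : ℕ → ℂ) (c : ℝ) :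
    primNorm Q T (fun x => α x * c) = c ^ 2 * primNorm Q T α := by
  rw [primNorm, primNorm, ← Complex.re_ofReal_mul, mul_sum]
  congr 1
  refine sum_congr rfl fun x _ => ?_
  rw [mul_sum]
  refine sum_congr rfl fun y _ => ?_
  simp only [map_mul, Complex.conj_ofReal]
  push_cast; ring

lemma primNorm_congr {Q T : Finset ℕ} {α β : ℕ → ℂ} (h : ∀ x ∈ T, α x = β x) :
    primNorm Q T α = primNorm Q T β := by
  rw [primNorm, primNorm]
  congr 1
  exact sum_congr rfl fun x hx => sum_congr rfl fun y hy => by rw [h x hx, h y hy]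

lemma large_sieve_term_nonneg {q : ℕ} (T : Finset ℕ) (α : ℕ → ℂ) {U : Finset ℕ}
    (hU : U ∈ q.primeFactors.powerset) : 0 ≤ (∏ p ∈ U, (p : ℝ)) *
          (∏ p ∈ q.primeFactors \ U, ((p : ℝ) - 1)) *
          primNorm U T (fun x => α x * ∏ p ∈ q.primeFactors \ U, ((unitWeight p x : ℝ) : ℂ)) := by
  refine mul_nonneg (mul_nonneg (prod_nonneg fun _ _ => by positivity) (prod_nonneg fun p hp => ?_))
    (primNorm_nonneg_of_subset (mem_powerset.mp hU) _ _)
  have : (1 : ℝ) ≤ p := by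
    exact_mod_cast (Nat.prime_of_mem_primeFactors (mem_sdiff.mp hp).1).one_le
  linarith

lemma large_sieve_squarefree (T : Finset ℕ) (α : ℕ → ℂ) {M R : ℕ} (hM : 0 < M) (hR : 0 < R)
    (hT : ∀ x ∈ T, x ≤ M) :
    ∑ q ∈ (Icc 1 R).filter Squarefree, ∑ U ∈ q.primeFactors.powerset, (∏ p ∈ U, (p : ℝ)) *
          (∏ p ∈ q.primeFactors \ U, ((p : ℝ) - 1)) *
          primNorm U T (fun x => α x * ∏ p ∈ q.primeFactors \ U, ((unitWeight p x : ℝ) : ℂ))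
      ≤ 39 * ((R : ℝ) ^ 2 + M) * ∑ x ∈ T, ‖α x‖ ^ 2 := by
  refine le_trans ?_ (large_sieve T α hM hR hT)
  rw [sum_congr rfl fun q hq => (sum_normSq_expSum_eq (mem_filter.mp hq).2 T α).symm]
  exact sum_le_sum_of_subset_of_nonneg (filter_subset _ _)
    fun q _ _ => sum_nonneg fun b _ => by positivity

lemma large_sieve_prim (T : Finset ℕ) (α : ℕ → ℂ) {M R : ℕ} (hM : 0 < M) (hR : 0 < R)
    (hT : ∀ x ∈ T, x ≤ M) :
    ∑ q ∈ (Icc 1 R).filter Squarefree, q * primNorm q.primeFactors T α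
      ≤ 39 * ((R : ℝ) ^ 2 + M) * ∑ x ∈ T, ‖α x‖ ^ 2 := by
  refine le_trans (sum_le_sum fun q hq => ?_) (large_sieve_squarefree T α hM hR hT)
  have hsq := (mem_filter.mp hq).2
  refine le_trans (le_of_eq ?_) (single_le_sum (f := fun U : Finset ℕ => (∏ p ∈ U, (p : ℝ)) *
          (∏ p ∈ q.primeFactors \ U, ((p : ℝ) - 1)) *
          primNorm U T (fun x => α x * ∏ p ∈ q.primeFactors \ U, ((unitWeight p x : ℝ) : ℂ)))
    (fun U hU => large_sieve_term_nonneg T α hU) (mem_powerset_self q.primeFactors))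
  simp only [Finset.sdiff_self, prod_empty, mul_one]
  rw [← Nat.cast_prod, Nat.prod_primeFactors_of_squarefree hsq]

lemma prod_sub_one_mul_sq_ge {r : ℕ} (hr : Squarefree r) :
    1 / (r : ℝ) ≤ (∏ p ∈ r.primeFactors, ((p : ℝ) - 1)) *
      (∏ p ∈ r.primeFactors, (- 1 / ((p : ℝ) - 1))) ^ 2 := by
  conv_lhs => rw [← Nat.prod_primeFactors_of_squarefree hr]
  rw [← prod_pow, ← prod_mul_distrib, Nat.cast_prod, one_div, ← prod_inv_distrib]
  refine prod_le_prod (fun p _ => by positivity) fun p hp => ?_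
  have h1 : (1 : ℝ) < p := by exact_mod_cast (Nat.prime_of_mem_primeFactors hp).one_lt
  have h2 : (0 : ℝ) < p - 1 := by linarith
  have : ((p : ℝ) - 1) * (-1 / ((p : ℝ) - 1)) ^ 2 = ((p : ℝ) - 1)⁻¹ := by field_simp
  rw [this]
  gcongr
  linarith

/-- The large sieve of Bombieri and Davenport, for coefficients supported on integers without
small prime factors. -/
lemma large_sieve_bombieri_davenport (T : Finset ℕ) (α : ℕ → ℂ) {M z : ℕ} (hM : 0 < M)
    (hz : 0 < z) (hT : ∀ x ∈ T, x ≤ M) (hTz : ∀ x ∈ T, ∀ p, p.Prime → p ≤ z → ¬ p ∣ x) :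
    ∑ q ∈ (Icc 1 z).filter Squarefree, ∑ r ∈ (Icc 1 z).filter (fun r => Squarefree r ∧ q.Coprime r),
      (q : ℝ) / r * primNorm q.primeFactors T α
      ≤ 39 * ((z : ℝ) ^ 4 + M) * ∑ x ∈ T, ‖α x‖ ^ 2 := by
  have hzz : 0 < z ^ 2 := by positivity
  have := large_sieve_squarefree T α hM hzz hT
  have e : ((z ^ 2 : ℕ) : ℝ) ^ 2 = (z : ℝ) ^ 4 := by push_cast; ring
  rw [e] at this
  refine le_trans ?_ this
  rw [sum_sigma']
  set D := ((Icc 1 z).filter Squarefree).sigma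
    fun q => (Icc 1 z).filter (fun r => Squarefree r ∧ q.Coprime r) with hD
  have mem : ∀ s ∈ D, (1 ≤ s.1 ∧ s.1 ≤ z) ∧ Squarefree s.1 ∧ (1 ≤ s.2 ∧ s.2 ≤ z) ∧
      Squarefree s.2 ∧ s.1.Coprime s.2 := by
    intro s hs
    simp only [hD, mem_sigma, mem_filter, mem_Icc] at hs
    tauto
  have maps : ∀ s ∈ D, s.1 * s.2 ∈ (Icc 1 (z ^ 2)).filter Squarefree := by
    intro s hs
    obtain ⟨⟨h1, h2⟩, h3, ⟨h4, h5⟩, h6, h7⟩ := mem s hs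
    rw [mem_filter, mem_Icc]
    refine ⟨⟨Nat.mul_pos h1 h4, ?_⟩, (Nat.squarefree_mul h7).mpr ⟨h3, h6⟩⟩
    rw [sq]; exact Nat.mul_le_mul h2 h5
  rw [← sum_fiberwise_of_maps_to maps]
  refine sum_le_sum fun k hk => ?_
  set f : Finset ℕ → ℝ := fun U => (∏ p ∈ U, (p : ℝ)) *
          (∏ p ∈ k.primeFactors \ U, ((p : ℝ) - 1)) *
          primNorm U T (fun x => α x * ∏ p ∈ k.primeFactors \ U, ((unitWeight p x : ℝ) : ℂ)) with hf
  have step : ∀ s ∈ D.filter (fun s => s.1 * s.2 = k),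
      (s.1 : ℝ) / s.2 * primNorm s.1.primeFactors T α ≤ f s.1.primeFactors := by
    intro s hs
    rw [mem_filter] at hs
    obtain ⟨hs, rfl⟩ := hs
    obtain ⟨⟨h1, h2⟩, h3, ⟨h4, h5⟩, h6, h7⟩ := mem s hs
    have hdiff : (s.1 * s.2).primeFactors \ s.1.primeFactors = s.2.primeFactors := by
      rw [h7.primeFactors_mul, union_sdiff_cancel_left h7.disjoint_primeFactors]
    simp only [hf, hdiff]
    have hw : ∀ x ∈ T, α x * ∏ p ∈ s.2.primeFactors, ((unitWeight p x : ℝ) : ℂ)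
        = α x * ((∏ p ∈ s.2.primeFactors, (- 1 / ((p : ℝ) - 1)) : ℝ) : ℂ) := by
      intro x hx
      rw [Complex.ofReal_prod]
      congr 1
      refine prod_congr rfl fun p hp => ?_
      have hp' := Nat.prime_of_mem_primeFactors hp
      have : (x : ZMod p) ≠ 0 := by
        rw [Ne, ZMod.natCast_eq_zero_iff]
        exact hTz x hx p hp' ((Nat.le_of_mem_primeFactors hp).trans h5)
      rw [unitWeight, if_neg this]
    rw [primNorm_congr hw, primNorm_smul, ← Nat.cast_prod, Nat.prod_primeFactors_of_squarefree h3]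
    have h8 := prod_sub_one_mul_sq_ge h6
    have h9 : 0 ≤ primNorm s.1.primeFactors T α := primNorm_nonneg T α
    calc (s.1 : ℝ) / s.2 * primNorm s.1.primeFactors T α
        = s.1 * (1 / s.2) * primNorm s.1.primeFactors T α := by ring
      _ ≤ s.1 * ((∏ p ∈ s.2.primeFactors, ((p : ℝ) - 1)) *
          (∏ p ∈ s.2.primeFactors, (- 1 / ((p : ℝ) - 1))) ^ 2) * primNorm s.1.primeFactors T α := by
        gcongr
      _ = _ := by ring
  refine (sum_le_sum step).trans ?_
  have inj : Set.InjOn (fun s : Σ _ : ℕ, ℕ => s.1.primeFactors)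
      (D.filter (fun s => s.1 * s.2 = k) : Finset (Σ _ : ℕ, ℕ)) := by
    intro s hs s' hs' heq
    rw [mem_coe, mem_filter] at hs hs'
    obtain ⟨⟨h1, h2⟩, h3, ⟨h4, h5⟩, h6, h7⟩ := mem s hs.1
    obtain ⟨⟨h1', h2'⟩, h3', ⟨h4', h5'⟩, h6', h7'⟩ := mem s' hs'.1
    dsimp only at heq
    have e1 : s.1 = s'.1 := by
      rw [← Nat.prod_primeFactors_of_squarefree h3, heq, Nat.prod_primeFactors_of_squarefree h3']
    have e2 : s.2 = s'.2 := by
      have := hs.2.trans hs'.2.symm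
      rw [e1] at this
      exact Nat.eq_of_mul_eq_mul_left h1' this
    exact Sigma.ext e1 (heq_of_eq e2)
  rw [← sum_image (f := f) inj]
  refine sum_le_sum_of_subset_of_nonneg ?_ fun U hU _ => large_sieve_term_nonneg T α hU
  intro U hU
  rw [mem_image] at hU
  obtain ⟨s, hs, rfl⟩ := hU
  rw [mem_filter] at hs
  have hk0 : k ≠ 0 := (mem_filter.mp hk).2.ne_zero
  exact mem_powerset.mpr (Nat.primeFactors_mono (Dvd.intro _ hs.2) hk0)

lemma sum_Icc_one_div_sq_le (n : ℕ) : ∑ m ∈ Icc 1 n, 1 / (m : ℝ) ^ 2 ≤ 2 := by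
  have h := sum_Ioo_inv_sq_le (α := ℝ) 0 (n + 1)
  have e : Ioo 0 (n + 1) = Icc 1 n := by ext x; simp [mem_Ioo, mem_Icc]; omega
  rw [e] at h
  simpa [one_div] using h

lemma log_le_sum_squarefree_coprime {q z : ℕ} (hq : Squarefree q) :
    Real.log (z + 1) ≤ 2 * 2 ^ #q.primeFactors *
      ∑ r ∈ (Icc 1 z).filter (fun r => Squarefree r ∧ q.Coprime r), 1 / (r : ℝ) := by
  have h1 : Real.log (z + 1) ≤ ∑ n ∈ Icc 1 z, 1 / (n : ℝ) := by
    have := log_add_one_le_harmonic z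
    rw [harmonic_eq_sum_Icc] at this
    push_cast at this
    simpa [one_div] using this
  set A := (Icc 1 z).filter (fun r => Squarefree r ∧ q.Coprime r)
  set I := (q.divisors ×ˢ Icc 1 z) ×ˢ A
  set g : (ℕ × ℕ) × ℕ → ℕ := fun s => s.1.1 * s.2 * s.1.2 ^ 2
  have hsub : Icc 1 z ⊆ I.image g := by
    intro n hn
    rw [mem_Icc] at hn
    obtain ⟨a, b, hab, ha⟩ := Nat.sq_mul_squarefree n
    have hn0 : n ≠ 0 := by omega
    have hb0 : 0 < b := Nat.pos_of_ne_zero fun h => by simp [h] at hab; omega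
    have ha0 : 0 < a := Nat.pos_of_ne_zero ha.ne_zero
    obtain ⟨c, hc⟩ := Nat.gcd_dvd_left a q
    have hg : 0 < a.gcd q := Nat.gcd_pos_of_pos_left _ ha0
    have hc0 : 0 < c := Nat.pos_of_ne_zero fun h => by rw [h] at hc; omega
    have hcop : (a.gcd q).Coprime c := by
      have := hc ▸ ha
      exact (Nat.squarefree_mul_iff.mp this).1
    have hcq : q.Coprime c := by
      have : Nat.gcd c q = 1 := by
        have h1 : Nat.gcd c q ∣ a.gcd q :=
          Nat.dvd_gcd ((Nat.gcd_dvd_left _ _).trans (Dvd.intro_left _ hc.symm)) (Nat.gcd_dvd_right _ _)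
        exact Nat.eq_one_of_dvd_coprimes hcop h1 (Nat.gcd_dvd_left _ _)
      exact (Nat.coprime_iff_gcd_eq_one.mpr this).symm
    refine mem_image.mpr ⟨((a.gcd q, b), c), ?_, ?_⟩
    · simp only [I, A, mem_product, Nat.mem_divisors, mem_Icc, mem_filter]
      have hbn : b ≤ n := by
        rw [← hab]; nlinarith
      have hcn : c ≤ n := by
        have : c ≤ a := Nat.le_of_dvd ha0 (Dvd.intro_left _ hc.symm)
        rw [← hab]; nlinarith [Nat.pow_pos (n := 2) hb0]
      exact ⟨⟨⟨Nat.gcd_dvd_right _ _, hq.ne_zero⟩, hb0, hbn.trans hn.2⟩, ⟨hc0, hcn.trans hn.2⟩,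
        (hc ▸ ha).squarefree_of_dvd (Dvd.intro_left _ rfl), hcq⟩
    · simp only [g]
      rw [← hc, ← hab]; ring
  calc Real.log (z + 1) ≤ ∑ n ∈ Icc 1 z, 1 / (n : ℝ) := h1
    _ ≤ ∑ n ∈ I.image g, 1 / (n : ℝ) :=
      sum_le_sum_of_subset_of_nonneg hsub fun _ _ _ => by positivity
    _ ≤ ∑ s ∈ I, 1 / (g s : ℝ) := sum_image_le_of_nonneg fun _ _ => by positivity
    _ = (∑ d ∈ q.divisors, 1 / (d : ℝ)) * (∑ m ∈ Icc 1 z, 1 / (m : ℝ) ^ 2) *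
          ∑ r ∈ A, 1 / (r : ℝ) := by
      rw [sum_mul_sum, ← sum_product', sum_mul_sum, ← sum_product']
      refine sum_congr rfl fun s _ => ?_
      simp only [g]; push_cast; rw [div_mul_div_comm, div_mul_div_comm]; ring_nf
    _ ≤ (∑ d ∈ q.divisors, 1) * 2 * ∑ r ∈ A, 1 / (r : ℝ) := by
      gcongr with d hd
      · have : (1 : ℝ) ≤ d := by exact_mod_cast Nat.pos_of_mem_divisors hd
        rw [div_le_one (by linarith)]; exact this
      · exact sum_Icc_one_div_sq_le z
    _ = _ := by
      have : ∑ d ∈ q.divisors, (1 : ℝ) = 2 ^ #q.primeFactors := by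
        rw [sum_divisors_eq_sum_powerset hq (fun _ => (1 : ℝ))]
        simp [card_powerset]
      rw [this]
      ring

lemma large_sieve_small_moduli (T : Finset ℕ) (α : ℕ → ℂ) {M z : ℕ} (hM : 0 < M)
    (hz : 0 < z) (hT : ∀ x ∈ T, x ≤ M) (hTz : ∀ x ∈ T, ∀ p, p.Prime → p ≤ z → ¬ p ∣ x) :
    Real.log (z + 1) * ∑ q ∈ (Icc 1 z).filter Squarefree,
      (q : ℝ) / 2 ^ #q.primeFactors * primNorm q.primeFactors T α
      ≤ 78 * ((z : ℝ) ^ 4 + M) * ∑ x ∈ T, ‖α x‖ ^ 2 := by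
  have h := large_sieve_bombieri_davenport T α hM hz hT hTz
  rw [mul_sum]
  have : ∑ q ∈ (Icc 1 z).filter Squarefree,
      Real.log (z + 1) * ((q : ℝ) / 2 ^ #q.primeFactors * primNorm q.primeFactors T α)
      ≤ 2 * ∑ q ∈ (Icc 1 z).filter Squarefree,
        ∑ r ∈ (Icc 1 z).filter (fun r => Squarefree r ∧ q.Coprime r),
      (q : ℝ) / r * primNorm q.primeFactors T α := by
    rw [mul_sum]
    refine sum_le_sum fun q hq => ?_
    have h1 := log_le_sum_squarefree_coprime (z := z) (mem_filter.mp hq).2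
    have h9 : 0 ≤ primNorm q.primeFactors T α := primNorm_nonneg T α
    calc _ ≤ (2 * 2 ^ #q.primeFactors *
      ∑ r ∈ (Icc 1 z).filter (fun r => Squarefree r ∧ q.Coprime r), 1 / (r : ℝ)) *
        ((q : ℝ) / 2 ^ #q.primeFactors * primNorm q.primeFactors T α) := by gcongr
      _ = 2 * (∑ r ∈ (Icc 1 z).filter (fun r => Squarefree r ∧ q.Coprime r), 1 / (r : ℝ)) *
        (q * primNorm q.primeFactors T α) := by field_simp
      _ = _ := by
        rw [mul_assoc, sum_mul]
        congr 1
        exact sum_congr rfl fun r _ => by ring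
  linarith

end LargeSievePrim

section DyadicBlocks

open Finset

lemma primNorm_filter (Q T : Finset ℕ) (α : ℕ → ℂ) (P : ℕ → Prop) [DecidablePred P] :
    primNorm Q T (fun x => if P x then α x else 0) = primNorm Q (T.filter P) α := by
  simp only [primNorm, sum_filter]
  congr 1
  refine sum_congr rfl fun x _ => ?_
  split_ifs with hx
  · refine sum_congr rfl fun y _ => ?_
    split_ifs <;> simp
  · simp

lemma primNorm_le_blocks {Q : Finset ℕ} [∀ p : Q, Fact (p : ℕ).Prime] {T : Finset ℕ}
    (α : ℕ → ℂ) {k₀ B : ℕ} (hT : ∀ p ∈ T, Nat.log 2 p ∈ Ico k₀ (k₀ + B)) :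
    primNorm Q T α ≤ B * ∑ k ∈ Ico k₀ (k₀ + B), primNorm Q (T.filter (Nat.log 2 · = k)) α := by
  have h := primNorm_sum_le (Q := Q) T (Ico k₀ (k₀ + B))
    (fun k x => if Nat.log 2 x = k then α x else 0)
  simp_rw [primNorm_filter, Nat.card_Ico, Nat.add_sub_cancel_left] at h
  refine le_trans (le_of_eq (primNorm_congr fun x hx => ?_)) h
  rw [sum_ite_eq, if_pos (hT x hx)]

lemma sum_block_inv_sq_le {T : Finset ℕ} {k : ℕ} (hk : 0 < k) (hT : ∀ p ∈ T, p.Prime)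
    (hTk : ∀ p ∈ T, Nat.log 2 p = k) : ∑ p ∈ T, 1 / (p : ℝ) ^ 2 ≤ (4 : ℝ) / (k * 2 ^ k) := by
  have hb : ∀ p ∈ T, 2 ^ k ≤ p ∧ p < 2 ^ (k + 1) := fun p hp => by
    rw [← hTk p hp]
    exact ⟨Nat.pow_log_le_self 2 (hT p hp).ne_zero, Nat.lt_pow_succ_log_self (by norm_num) p⟩
  have hl2 : 0 < Real.log 2 := Real.log_pos (by norm_num)
  have h1 : ∑ p ∈ T, Real.log p ≤ Real.log 4 * 2 ^ (k + 1) := by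
    refine le_trans ?_ (Chebyshev.theta_le_log4_mul_x (x := 2 ^ (k + 1)) (by positivity))
    rw [Chebyshev.theta]
    refine sum_le_sum_of_subset_of_nonneg (fun p hp => ?_) fun p _ _ => Real.log_natCast_nonneg p
    simp only [mem_filter, mem_Ioc]
    refine ⟨⟨(hT p hp).pos, Nat.le_floor ?_⟩, hT p hp⟩
    exact_mod_cast (hb p hp).2.le
  have h4 : Real.log 4 = 2 * Real.log 2 := by
    rw [show (4 : ℝ) = 2 ^ 2 by norm_num, Real.log_pow]; norm_num
  have h2 : ∀ p ∈ T, 1 / (p : ℝ) ^ 2 ≤ Real.log p / (k * Real.log 2 * 4 ^ k) := fun p hp => by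
    have hp0 : (0 : ℝ) < p := by exact_mod_cast (hT p hp).pos
    have h3 : (2 : ℝ) ^ k ≤ p := by exact_mod_cast (hb p hp).1
    have hk' : (0 : ℝ) < k := by exact_mod_cast hk
    have h5 : k * Real.log 2 ≤ Real.log p := by
      rw [← Real.log_pow]; exact Real.log_le_log (by positivity) h3
    have h6 : (4 : ℝ) ^ k ≤ (p : ℝ) ^ 2 := by
      calc (4 : ℝ) ^ k = (2 ^ k) ^ 2 := by rw [← pow_mul, mul_comm, pow_mul]; norm_num
        _ ≤ _ := by gcongr
    rw [div_le_div_iff₀ (by positivity) (by positivity)]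
    calc 1 * (k * Real.log 2 * 4 ^ k) ≤ Real.log p * 4 ^ k := by rw [one_mul]; gcongr
      _ ≤ _ := by gcongr
  refine (sum_le_sum h2).trans ?_
  rw [← sum_div]
  have hk' : (0 : ℝ) < k := by exact_mod_cast hk
  rw [div_le_div_iff₀ (by positivity) (by positivity)]
  have e : (4 : ℝ) ^ k = 2 ^ k * 2 ^ k := by rw [← mul_pow]; norm_num
  calc (∑ p ∈ T, Real.log p) * (k * 2 ^ k) ≤ (Real.log 4 * 2 ^ (k + 1)) * (k * 2 ^ k) := by gcongr
    _ = _ := by rw [h4, e, pow_succ]; ring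

variable {T : Finset ℕ} {α : ℕ → ℂ} {K : ℝ} {k₀ B : ℕ}

lemma sum_block_normSq_le {k : ℕ} (hk : 0 < k) (hT : ∀ p ∈ T, p.Prime)
    (hα : ∀ p ∈ T, ‖α p‖ ≤ K / p) :
    ∑ p ∈ T.filter (Nat.log 2 · = k), ‖α p‖ ^ 2 ≤ 4 * K ^ 2 / (k * 2 ^ k) := by
  calc ∑ p ∈ T.filter (Nat.log 2 · = k), ‖α p‖ ^ 2
      ≤ ∑ p ∈ T.filter (Nat.log 2 · = k), K ^ 2 * (1 / (p : ℝ) ^ 2) := sum_le_sum fun p hp => by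
        refine (pow_le_pow_left₀ (norm_nonneg _) (hα p (mem_filter.mp hp).1) 2).trans_eq ?_
        ring
    _ ≤ K ^ 2 * (4 / (k * 2 ^ k)) := by
        rw [← mul_sum]
        gcongr
        exact sum_block_inv_sq_le hk (fun p hp => hT p (mem_filter.mp hp).1)
          fun p hp => (mem_filter.mp hp).2
    _ = _ := by ring

lemma large_sieve_blocks_small (hk₀ : 0 < k₀) {z : ℕ} (hz : 0 < z) (hzk : z ^ 4 ≤ 2 ^ (k₀ + 1))
    (hT : ∀ p ∈ T, p.Prime) (hTk : ∀ p ∈ T, Nat.log 2 p ∈ Ico k₀ (k₀ + B))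
    (hα : ∀ p ∈ T, ‖α p‖ ≤ K / p) :
    Real.log (z + 1) * ∑ q ∈ (Icc 1 z).filter Squarefree,
      (q : ℝ) / 2 ^ #q.primeFactors * primNorm q.primeFactors T α ≤ 1248 * B ^ 2 * K ^ 2 / k₀ := by
  have hk₀' : (0 : ℝ) < k₀ := by exact_mod_cast hk₀
  have hlog : 0 ≤ Real.log (z + 1) := Real.log_nonneg (by simp)
  have hblock : ∀ k ∈ Ico k₀ (k₀ + B), Real.log (z + 1) * ∑ q ∈ (Icc 1 z).filter Squarefree,
      (q : ℝ) / 2 ^ #q.primeFactors * primNorm q.primeFactors (T.filter (Nat.log 2 · = k)) α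
      ≤ 1248 * K ^ 2 / k₀ := fun k hk => by
    have hkk : k₀ ≤ k := (mem_Ico.mp hk).1
    have hk0 : 0 < k := hk₀.trans_le hkk
    have hzk' : z ^ 4 ≤ 2 ^ (k + 1) := hzk.trans (Nat.pow_le_pow_right (by norm_num) (by omega))
    have hzlt : z < 2 ^ k := by
      by_contra! hcon
      have := Nat.pow_le_pow_left hcon 4
      rw [← pow_mul] at this
      have := (Nat.pow_le_pow_iff_right (by norm_num : 1 < 2)).mp (this.trans hzk')
      omega
    have hmem : ∀ p ∈ T.filter (Nat.log 2 · = k), p.Prime ∧ 2 ^ k ≤ p ∧ p ≤ 2 ^ (k + 1) :=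
      fun p hp => by
        obtain ⟨h1, h2⟩ := mem_filter.mp hp
        rw [← h2]
        exact ⟨hT p h1, Nat.pow_log_le_self 2 (hT p h1).ne_zero,
          (Nat.lt_pow_succ_log_self (by norm_num) p).le⟩
    refine (large_sieve_small_moduli _ α (M := 2 ^ (k + 1)) (by positivity) hz
      (fun p hp => (hmem p hp).2.2) fun p hp p' hp' hle hdvd => ?_).trans ?_
    · have := (Nat.prime_dvd_prime_iff_eq hp' (hmem p hp).1).mp hdvd
      have := (hmem p hp).2.1
      omega
    · have hz4 : (z : ℝ) ^ 4 ≤ 2 ^ (k + 1) := by exact_mod_cast hzk'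
      have hkk' : (k₀ : ℝ) ≤ k := by exact_mod_cast hkk
      calc 78 * ((z : ℝ) ^ 4 + (2 ^ (k + 1) : ℕ)) * ∑ x ∈ T.filter (Nat.log 2 · = k), ‖α x‖ ^ 2
          ≤ 78 * ((2 : ℝ) ^ (k + 1) + 2 ^ (k + 1)) * (4 * K ^ 2 / (k * 2 ^ k)) := by
            push_cast
            gcongr
            exact sum_block_normSq_le hk0 hT hα
        _ = 1248 * K ^ 2 / k := by
            have : (0 : ℝ) < k := by exact_mod_cast hk0
            rw [pow_succ]; field_simp; ring
        _ ≤ _ := by gcongr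
  calc Real.log (z + 1) * ∑ q ∈ (Icc 1 z).filter Squarefree,
      (q : ℝ) / 2 ^ #q.primeFactors * primNorm q.primeFactors T α
      ≤ Real.log (z + 1) * ∑ q ∈ (Icc 1 z).filter Squarefree, (q : ℝ) / 2 ^ #q.primeFactors *
        (B * ∑ k ∈ Ico k₀ (k₀ + B),
          primNorm q.primeFactors (T.filter (Nat.log 2 · = k)) α) := by
        gcongr
        exact primNorm_le_blocks α hTk
    _ = B * ∑ k ∈ Ico k₀ (k₀ + B), (Real.log (z + 1) * ∑ q ∈ (Icc 1 z).filter Squarefree,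
      (q : ℝ) / 2 ^ #q.primeFactors * primNorm q.primeFactors (T.filter (Nat.log 2 · = k)) α) := by
        simp_rw [mul_sum]
        rw [sum_comm]
        refine sum_congr rfl fun _ _ => sum_congr rfl fun _ _ => by ring
    _ ≤ B * ∑ k ∈ Ico k₀ (k₀ + B), 1248 * K ^ 2 / k₀ := by gcongr with k hk; exact hblock k hk
    _ = _ := by rw [sum_const, Nat.card_Ico, Nat.add_sub_cancel_left]; simp; ring

lemma large_sieve_blocks (hk₀ : 0 < k₀) {R : ℕ} (hR : 0 < R)
    (hT : ∀ p ∈ T, p.Prime) (hTk : ∀ p ∈ T, Nat.log 2 p ∈ Ico k₀ (k₀ + B))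
    (hα : ∀ p ∈ T, ‖α p‖ ≤ K / p) :
    ∑ q ∈ (Icc 1 R).filter Squarefree, (q : ℝ) * primNorm q.primeFactors T α
      ≤ 312 * B ^ 2 * K ^ 2 * (1 + (R : ℝ) ^ 2 / 2 ^ k₀) := by
  have hblock : ∀ k ∈ Ico k₀ (k₀ + B), ∑ q ∈ (Icc 1 R).filter Squarefree,
      (q : ℝ) * primNorm q.primeFactors (T.filter (Nat.log 2 · = k)) α
      ≤ 312 * K ^ 2 * (1 + (R : ℝ) ^ 2 / 2 ^ k₀) := fun k hk => by
    have hkk : k₀ ≤ k := (mem_Ico.mp hk).1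
    have hk0 : 0 < k := hk₀.trans_le hkk
    have hk1 : (1 : ℝ) ≤ k := by exact_mod_cast hk0
    refine (large_sieve_prim _ α (M := 2 ^ (k + 1)) (by positivity) hR
      fun p hp => ?_).trans ?_
    · rw [← (mem_filter.mp hp).2]
      exact (Nat.lt_pow_succ_log_self (by norm_num) p).le
    · calc 39 * ((R : ℝ) ^ 2 + (2 ^ (k + 1) : ℕ)) * ∑ x ∈ T.filter (Nat.log 2 · = k), ‖α x‖ ^ 2
          ≤ 39 * ((R : ℝ) ^ 2 + 2 ^ (k + 1)) * (4 * K ^ 2 / (k * 2 ^ k)) := by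
            push_cast
            gcongr
            exact sum_block_normSq_le hk0 hT hα
        _ ≤ 39 * ((R : ℝ) ^ 2 + 2 ^ (k + 1)) * (4 * K ^ 2 / (1 * 2 ^ k)) := by gcongr
        _ = 156 * K ^ 2 * (2 + (R : ℝ) ^ 2 / 2 ^ k) := by rw [pow_succ]; field_simp; ring
        _ ≤ 156 * K ^ 2 * (2 + (R : ℝ) ^ 2 / 2 ^ k₀) := by gcongr; norm_num
        _ ≤ 156 * K ^ 2 * (2 * (1 + (R : ℝ) ^ 2 / 2 ^ k₀)) := by
            gcongr
            have : 0 ≤ (R : ℝ) ^ 2 / 2 ^ k₀ := by positivity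
            linarith
        _ = _ := by ring
  calc ∑ q ∈ (Icc 1 R).filter Squarefree, (q : ℝ) * primNorm q.primeFactors T α
      ≤ ∑ q ∈ (Icc 1 R).filter Squarefree, (q : ℝ) *
        (B * ∑ k ∈ Ico k₀ (k₀ + B),
          primNorm q.primeFactors (T.filter (Nat.log 2 · = k)) α) := by
        gcongr
        exact primNorm_le_blocks α hTk
    _ = B * ∑ k ∈ Ico k₀ (k₀ + B), ∑ q ∈ (Icc 1 R).filter Squarefree,
      (q : ℝ) * primNorm q.primeFactors (T.filter (Nat.log 2 · = k)) α := by
        simp_rw [mul_sum]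
        rw [sum_comm]
        refine sum_congr rfl fun _ _ => sum_congr rfl fun _ _ => by ring
    _ ≤ B * ∑ k ∈ Ico k₀ (k₀ + B), 312 * K ^ 2 * (1 + (R : ℝ) ^ 2 / 2 ^ k₀) := by
        gcongr with k hk; exact hblock k hk
    _ = _ := by rw [sum_const, Nat.card_Ico, Nat.add_sub_cancel_left]; simp; ring

lemma exists_pow_card_primeFactors_le (K : ℕ) {τ : ℝ} (hτ : 0 < τ) :
    ∃ C, 0 < C ∧ ∀ q : ℕ, 0 < q → (K : ℝ) ^ #q.primeFactors ≤ C * (q : ℝ) ^ τ := by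
  obtain ⟨n, hn⟩ := exists_nat_ge (((K : ℝ) + 1) ^ τ⁻¹)
  refine ⟨((K : ℝ) + 1) ^ n, by positivity, fun q hq => ?_⟩
  have h1 : ∀ p ∈ q.primeFactors, (K : ℝ) ≤ (if p < n then (K : ℝ) + 1 else 1) * (p : ℝ) ^ τ := by
    intro p hp
    have hp1 : (1 : ℝ) ≤ p := by exact_mod_cast (Nat.prime_of_mem_primeFactors hp).one_le
    have hp2 : 1 ≤ (p : ℝ) ^ τ := Real.one_le_rpow hp1 hτ.le
    split_ifs with h
    · nlinarith [(Nat.cast_nonneg K : (0 : ℝ) ≤ K)]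
    · rw [one_mul]
      have h2 : ((K : ℝ) + 1) ^ τ⁻¹ ≤ p := hn.trans (by exact_mod_cast not_lt.mp h)
      have h3 := Real.rpow_le_rpow (by positivity) h2 hτ.le
      rw [← Real.rpow_mul (by positivity), inv_mul_cancel₀ hτ.ne', Real.rpow_one] at h3
      linarith
  calc (K : ℝ) ^ #q.primeFactors = ∏ p ∈ q.primeFactors, (K : ℝ) := by simp
    _ ≤ ∏ p ∈ q.primeFactors, (if p < n then (K : ℝ) + 1 else 1) * (p : ℝ) ^ τ :=
        prod_le_prod (fun _ _ => by positivity) h1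
    _ = ((K : ℝ) + 1) ^ #(q.primeFactors.filter (· < n)) * (∏ p ∈ q.primeFactors, (p : ℝ)) ^ τ := by
        rw [prod_mul_distrib, prod_ite, prod_const, prod_const_one, mul_one,
          Real.finsetProd_rpow _ _ fun _ _ => by positivity]
    _ ≤ _ := by
        gcongr
        · simp
        · refine (card_le_card (t := range n) fun p hp => ?_).trans (card_range n).le
          exact mem_range.mpr (mem_filter.mp hp).2
        · rw [← Nat.cast_prod]
          exact_mod_cast Nat.le_of_dvd hq (Nat.prod_primeFactors_dvd q)

end DyadicBlocks

section PrimeTail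

open Finset

variable {T T' : Finset ℕ} {α β : ℕ → ℂ} {K c c' d δ X : ℝ}

lemma log_two_block (hc : 0 < c) (hd : 0 < d) (hX : 1 ≤ X) (hcX : 3 ≤ c * X) :
    ∃ k₀ B : ℕ, 0 < k₀ ∧ c * X ≤ k₀ ∧ (B : ℝ) ≤ (2 * d + 1) * X ∧
      Real.exp (c * X) ≤ 2 ^ (k₀ + 1) ∧ ∀ p : ℕ, Real.exp (c * X) ≤ p → (p : ℝ) ≤ Real.exp (d * X) →
        Nat.log 2 p ∈ Ico k₀ (k₀ + B) := by
  have hl2 : 0 < Real.log 2 := Real.log_pos (by norm_num)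
  have hl2' := Real.log_two_lt_d9
  have hl2'' := Real.log_two_gt_d9
  have he : ∀ x : ℝ, Real.exp x = (2 : ℝ) ^ (x / Real.log 2) := fun x => by
    rw [Real.rpow_def_of_pos (by norm_num), mul_div_cancel₀ _ hl2.ne']
  have h1 : c * X + 1 ≤ c * X / Real.log 2 := by
    rw [le_div_iff₀ hl2]; nlinarith
  refine ⟨⌊c * X / Real.log 2⌋₊, ⌊d * X / Real.log 2⌋₊ + 1, Nat.floor_pos.mpr (by linarith), ?_, ?_,
    ?_, fun p hp1 hp2 => ?_⟩
  · have := Nat.lt_floor_add_one (c * X / Real.log 2); linarith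
  · have := Nat.floor_le (a := d * X / Real.log 2) (by positivity)
    push_cast
    have h2 : d * X / Real.log 2 ≤ 2 * (d * X) := by
      rw [div_le_iff₀ hl2]; nlinarith [mul_pos hd (by linarith : 0 < X)]
    nlinarith
  · rw [he, ← Real.rpow_natCast]
    refine Real.rpow_le_rpow_of_exponent_le (by norm_num) ?_
    push_cast
    exact (Nat.lt_floor_add_one _).le
  · have hp0 : p ≠ 0 := by
      rintro rfl
      have := Real.exp_pos (c * X)
      simp at hp1; linarith
    rw [mem_Ico]
    constructor
    · refine Nat.le_log_of_pow_le (by norm_num) ?_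
      have : ((2 : ℝ) ^ ⌊c * X / Real.log 2⌋₊) ≤ p := by
        refine le_trans ?_ hp1
        rw [he, ← Real.rpow_natCast]
        exact Real.rpow_le_rpow_of_exponent_le (by norm_num) (Nat.floor_le (by positivity))
      exact_mod_cast this
    · refine lt_of_lt_of_le ?_ (Nat.le_add_left _ _)
      refine Nat.log_lt_of_lt_pow hp0 ?_
      have : (p : ℝ) < (2 : ℝ) ^ (⌊d * X / Real.log 2⌋₊ + 1) := by
        refine lt_of_le_of_lt hp2 ?_
        rw [he, ← Real.rpow_natCast]
        refine Real.rpow_lt_rpow_of_exponent_lt (by norm_num) ?_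
        push_cast
        exact Nat.lt_floor_add_one _
      exact_mod_cast this

lemma large_sieve_primes_small (hc : 0 < c) (hd : 0 < d) (hX : 1 ≤ X) (hcX : 4 ≤ c * X)
    (hT : ∀ p ∈ T, p.Prime) (hTX : ∀ p ∈ T, Real.exp (c * X) ≤ p ∧ (p : ℝ) ≤ Real.exp (d * X))
    (hα : ∀ p ∈ T, ‖α p‖ ≤ K / p) :
    ∑ q ∈ (Icc 1 ⌊Real.exp (c * X / 4)⌋₊).filter Squarefree,
      (q : ℝ) / 2 ^ #q.primeFactors * primNorm q.primeFactors T α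
      ≤ 4992 * (2 * d + 1) ^ 2 * K ^ 2 / c ^ 2 := by
  obtain ⟨k₀, B, hk, hk', hB, h2, h3⟩ := log_two_block hc hd hX (by linarith)
  set z := ⌊Real.exp (c * X / 4)⌋₊
  have hz : 0 < z := Nat.floor_pos.mpr (Real.one_le_exp (by linarith))
  have hzk : z ^ 4 ≤ 2 ^ (k₀ + 1) := by
    have : (z : ℝ) ^ 4 ≤ 2 ^ (k₀ + 1) := by
      refine le_trans (pow_le_pow_left₀ (by positivity) (Nat.floor_le (Real.exp_pos _).le) 4) ?_
      rw [← Real.exp_nat_mul]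
      refine le_trans (le_of_eq ?_) h2
      congr 1; push_cast; ring
    exact_mod_cast this
  have h := large_sieve_blocks_small hk hz hzk hT (fun p hp => h3 p (hTX p hp).1 (hTX p hp).2) hα
  have hlog : c * X / 4 ≤ Real.log (z + 1) := by
    rw [Real.le_log_iff_exp_le (by positivity)]
    exact (Nat.lt_floor_add_one _).le
  set S := ∑ q ∈ (Icc 1 z).filter Squarefree,
      (q : ℝ) / 2 ^ #q.primeFactors * primNorm q.primeFactors T α
  have hS : 0 ≤ S := sum_nonneg fun q _ => mul_nonneg (by positivity) (primNorm_nonneg _ _)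
  have hX0 : 0 < X := by linarith
  have h5 : c * X / 4 * S ≤ 1248 * ((2 * d + 1) * X) ^ 2 * K ^ 2 / (c * X) := by
    calc c * X / 4 * S ≤ Real.log (z + 1) * S := by gcongr
      _ ≤ _ := h
      _ ≤ _ := by gcongr
  rw [le_div_iff₀ (by positivity)] at h5 ⊢
  have h6 : X ^ 2 * (S * c ^ 2) ≤ X ^ 2 * (4992 * (2 * d + 1) ^ 2 * K ^ 2) := by linarith
  exact le_of_mul_le_mul_left h6 (by positivity)

lemma large_sieve_primes (hc : 0 < c) (hd : 0 < d) (hX : 1 ≤ X) (hcX : 4 ≤ c * X)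
    (hT : ∀ p ∈ T, p.Prime) (hTX : ∀ p ∈ T, Real.exp (c * X) ≤ p ∧ (p : ℝ) ≤ Real.exp (d * X))
    (hα : ∀ p ∈ T, ‖α p‖ ≤ K / p) {R : ℕ} (hR : 0 < R) :
    ∑ q ∈ (Icc 1 R).filter Squarefree, (q : ℝ) * primNorm q.primeFactors T α
      ≤ 312 * ((2 * d + 1) * X) ^ 2 * K ^ 2 * (1 + 2 * (R * Real.exp (-(c * X / 2))) ^ 2) := by
  obtain ⟨k₀, B, hk, hk', hB, h2, h3⟩ := log_two_block hc hd hX (by linarith)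
  refine (large_sieve_blocks hk hR hT (fun p hp => h3 p (hTX p hp).1 (hTX p hp).2) hα).trans ?_
  have : (R : ℝ) ^ 2 / 2 ^ k₀ ≤ 2 * (R * Real.exp (-(c * X / 2))) ^ 2 := by
    rw [mul_pow, ← Real.exp_nat_mul, show ((2 : ℕ) : ℝ) * -(c * X / 2) = -(c * X) by push_cast; ring,
      Real.exp_neg, div_le_iff₀ (by positivity)]
    rw [pow_succ] at h2
    have h4 : 1 ≤ (Real.exp (c * X))⁻¹ * (2 ^ k₀ * 2) := by
      rw [← inv_mul_cancel₀ (Real.exp_pos (c * X)).ne']; gcongr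
    nlinarith [sq_nonneg (R : ℝ)]
  have hX0 : 0 < X := by linarith
  gcongr

lemma sqrt_one_add_mul_le {u v : ℝ} (hu : 0 ≤ u) (hv : 0 ≤ v) (hvu : v ≤ u) :
    √(1 + 2 * u ^ 2) * √(1 + 2 * v ^ 2) ≤ 1 + 4 * u + 4 * (u * v) := by
  have h : ∀ w : ℝ, 0 ≤ w → √(1 + 2 * w ^ 2) ≤ 1 + 2 * w := fun w hw => by
    rw [Real.sqrt_le_left (by positivity)]; nlinarith
  calc _ ≤ (1 + 2 * u) * (1 + 2 * v) := by gcongr <;> apply h <;> assumption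
    _ ≤ _ := by nlinarith

set_option maxHeartbeats 2000000 in
theorem exists_bilinear_tail_le (hc : 0 < c) (hcc : c ≤ c') (h1 : 1 ≤ c + c') (hd : 0 < d)
    (hδ : 0 < δ) (hδ' : δ ≤ 1 / 2) (K : ℝ) :
    ∃ C κ : ℝ, 0 < C ∧ 0 < κ ∧ ∀ X : ℝ, 1 ≤ X → 4 ≤ c * X → ∀ (T T' : Finset ℕ) (α β : ℕ → ℂ),
      (∀ p ∈ T, p.Prime) → (∀ p ∈ T', p.Prime) →
      (∀ p ∈ T, Real.exp (c * X) ≤ p ∧ (p : ℝ) ≤ Real.exp (d * X)) →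
      (∀ p ∈ T', Real.exp (c' * X) ≤ p ∧ (p : ℝ) ≤ Real.exp (d * X)) →
      (∀ p ∈ T, ‖α p‖ ≤ K / p) → (∀ p ∈ T', ‖β p‖ ≤ K / p) → ∀ q₀ : ℕ, 0 < q₀ →
      ∑ q ∈ (Ioc q₀ ⌊Real.exp ((1 / 2 - δ) * X)⌋₊).filter Squarefree,
        (12 : ℝ) ^ #q.primeFactors *
          (√(primNorm q.primeFactors T α) * √(primNorm q.primeFactors T' β))
        ≤ C * (1 / √q₀ + X ^ 3 * Real.exp (-(κ * X))) := by
  obtain ⟨C₁, hC₁, hC₁'⟩ := exists_pow_card_primeFactors_le 24 (τ := 1 / 2) (by norm_num)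
  set τ := min (1 / 2) (min (c / 2) δ) with hτ
  have hτ0 : 0 < τ := by simp [hτ, hc, hδ]
  have hτ1 : τ ≤ 1 / 2 := min_le_left _ _
  have hτ2 : τ ≤ c / 2 := (min_le_right _ _).trans (min_le_left _ _)
  have hτ3 : τ ≤ δ := (min_le_right _ _).trans (min_le_right _ _)
  obtain ⟨C₂, hC₂, hC₂'⟩ := exists_pow_card_primeFactors_le 12 hτ0
  set S := 4992 * (2 * d + 1) ^ 2 * K ^ 2 / c ^ 2 with hS
  set G := 312 * (2 * d + 1) ^ 2 * K ^ 2 with hG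
  have hS0 : 0 ≤ S := by positivity
  have hG0 : 0 ≤ G := by positivity
  refine ⟨C₁ * S + 100 * C₂ * G + 1, min (c / 8) (δ / 2), by positivity, by simp [hc, hδ], ?_⟩
  intro X hX hcX T T' α β hT hT' hTX hTX' hα hβ q₀ hq₀
  have hX0 : 0 < X := by linarith
  set κ := min (c / 8) (δ / 2) with hκ
  set z := ⌊Real.exp (c * X / 4)⌋₊ with hz
  set L := ⌊Real.exp ((1 / 2 - δ) * X)⌋₊ with hL
  set f : ℕ → ℝ := fun q => (12 : ℝ) ^ #q.primeFactors *
          (√(primNorm q.primeFactors T α) * √(primNorm q.primeFactors T' β)) with hf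
  have hf0 : ∀ q, 0 ≤ f q := fun q => by positivity
  have hNα : ∀ q : ℕ, 0 ≤ primNorm q.primeFactors T α := fun q => primNorm_nonneg _ _
  have hNβ : ∀ q : ℕ, 0 ≤ primNorm q.primeFactors T' β := fun q => primNorm_nonneg _ _
  have hsmall : ∑ q ∈ ((Ioc q₀ z).filter Squarefree), f q ≤ C₁ * S * (1 / √q₀) := by
    have h3 : ∀ q ∈ (Ioc q₀ z).filter Squarefree, f q ≤ C₁ * (1 / √q₀) *
        (1 / 2 * ((q : ℝ) / 2 ^ #q.primeFactors * primNorm q.primeFactors T α +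
          (q : ℝ) / 2 ^ #q.primeFactors * primNorm q.primeFactors T' β)) := by
      intro q hq
      have hq1 := (mem_Ioc.mp (mem_filter.mp hq).1).1
      have hq0 : 0 < q := by omega
      have hqr : (0 : ℝ) < q := by exact_mod_cast hq0
      have h4 := hC₁' q hq0
      have h5 : √(primNorm q.primeFactors T α) * √(primNorm q.primeFactors T' β) ≤
          1 / 2 * (primNorm q.primeFactors T α + primNorm q.primeFactors T' β) := by
        have := two_mul_le_add_sq (√(primNorm q.primeFactors T α)) (√(primNorm q.primeFactors T' β))
        rw [Real.sq_sqrt (hNα q), Real.sq_sqrt (hNβ q)] at this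
        linarith
      have h6 : (12 : ℝ) ^ #q.primeFactors ≤ C₁ * (1 / √q₀) * (q / 2 ^ #q.primeFactors) := by
        rw [← Real.sqrt_eq_rpow] at h4
        have h7 : √q ≤ 1 / √q₀ * q := by
          have h8 : √(q₀ : ℝ) ≤ √q := Real.sqrt_le_sqrt (by exact_mod_cast hq1.le)
          have h9 : 0 < √(q₀ : ℝ) := Real.sqrt_pos.mpr (by exact_mod_cast hq₀)
          rw [one_div, inv_mul_eq_div, le_div_iff₀ h9]
          calc √(q : ℝ) * √q₀ ≤ √q * √q := by gcongr
            _ = q := Real.mul_self_sqrt hqr.le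
        rw [← mul_div_assoc, le_div_iff₀ (by positivity), ← mul_pow]
        norm_num at h4 ⊢
        calc _ ≤ _ := h4
          _ ≤ C₁ * (1 / √q₀ * q) := by gcongr
          _ = _ := by rw [one_div]; ring
      calc f q ≤ C₁ * (1 / √q₀) * (q / 2 ^ #q.primeFactors) *
            (1 / 2 * (primNorm q.primeFactors T α + primNorm q.primeFactors T' β)) := by
            rw [hf]; exact mul_le_mul h6 h5 (by positivity) (by positivity)
        _ = _ := by ring
    refine (sum_le_sum h3).trans ?_
    rw [← mul_sum, ← mul_sum, sum_add_distrib]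
    have hsub : (Ioc q₀ z).filter Squarefree ⊆ (Icc 1 z).filter Squarefree := by
      intro q hq; simp only [mem_filter, mem_Ioc, mem_Icc] at hq ⊢; refine ⟨⟨?_, hq.1.2⟩, hq.2⟩; omega
    have hcX' : c * X ≤ c' * X := by gcongr
    have h4 := (sum_le_sum_of_subset_of_nonneg hsub fun q _ _ => mul_nonneg
      (by positivity) (hNα q)).trans (large_sieve_primes_small hc hd hX hcX hT hTX hα)
    have h5 := (sum_le_sum_of_subset_of_nonneg hsub fun q _ _ => mul_nonneg
      (by positivity) (hNβ q)).trans (large_sieve_primes_small hc hd hX hcX hT'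
        (fun p hp => ⟨(Real.exp_le_exp.mpr hcX').trans (hTX' p hp).1, (hTX' p hp).2⟩) hβ)
    rw [← hS] at h4 h5
    calc _ ≤ C₁ * (1 / √q₀) * (1 / 2 * (S + S)) := by gcongr
      _ = _ := by ring
  have hlarge : ∀ j, ∑ q ∈ ((Ioc z L).filter Squarefree).filter (Nat.log 2 · = j), f q ≤
      50 * C₂ * G * (X ^ 2 * Real.exp (-(κ * X))) := by
    intro j
    rcases (((Ioc z L).filter Squarefree).filter (Nat.log 2 · = j)).eq_empty_or_nonempty
      with h0 | ⟨q₁, hq₁⟩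
    · rw [h0, sum_empty]; positivity
    simp only [mem_filter, mem_Ioc] at hq₁
    obtain ⟨⟨⟨hzq, hqL⟩, -⟩, hqj⟩ := hq₁
    set R := 2 ^ (j + 1) with hR
    have hRq : q₁ < R := by rw [hR, ← hqj]; exact Nat.lt_pow_succ_log_self (by norm_num) q₁
    have hRq' : R ≤ 2 * q₁ := by
      rw [hR, ← hqj, pow_succ, mul_comm]
      exact Nat.mul_le_mul_left 2 (Nat.pow_log_le_self 2 (by omega))
    have hR0 : (0 : ℝ) < R := by rw [hR]; positivity
    have hRlow : Real.exp (c * X / 4) ≤ R := by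
      refine (Nat.lt_floor_add_one _).le.trans ?_
      exact_mod_cast (by omega : z + 1 ≤ R)
    have hRup : (R : ℝ) ≤ 2 * Real.exp ((1 / 2 - δ) * X) := by
      calc (R : ℝ) ≤ 2 * L := by exact_mod_cast (by omega : R ≤ 2 * L)
        _ ≤ _ := by gcongr; exact Nat.floor_le (Real.exp_pos _).le
    have h3 : ∀ q ∈ ((Ioc z L).filter Squarefree).filter (Nat.log 2 · = j),
        f q ≤ 2 * C₂ * (R : ℝ) ^ (τ - 1) *
          (√(q * primNorm q.primeFactors T α) * √(q * primNorm q.primeFactors T' β)) := by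
      intro q hq
      simp only [mem_filter, mem_Ioc] at hq
      have hq0 : 0 < q := by omega
      have hqr : (0 : ℝ) < q := by exact_mod_cast hq0
      have hRq2 : (R : ℝ) ≤ 2 * q := by
        have : R ≤ 2 * q := by
          rw [hR, ← hq.2, pow_succ, mul_comm]
          exact Nat.mul_le_mul_left 2 (Nat.pow_log_le_self 2 (by omega))
        exact_mod_cast this
      have hqR : (q : ℝ) ≤ R := by
        have : q < R := by rw [hR, ← hq.2]; exact Nat.lt_pow_succ_log_self (by norm_num) q
        exact_mod_cast this.le
      have h4 : (12 : ℝ) ^ #q.primeFactors ≤ 2 * C₂ * (R : ℝ) ^ (τ - 1) * q := by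
        refine (hC₂' q hq0).trans ?_
        rw [Real.rpow_sub_one hR0.ne']
        have h5 : (q : ℝ) ^ τ ≤ (R : ℝ) ^ τ := Real.rpow_le_rpow hqr.le hqR hτ0.le
        have h6 : 1 ≤ 2 * q / (R : ℝ) := by rw [le_div_iff₀ hR0]; linarith
        calc C₂ * (q : ℝ) ^ τ ≤ C₂ * (R : ℝ) ^ τ := by gcongr
          _ ≤ C₂ * (R : ℝ) ^ τ * (2 * q / (R : ℝ)) := le_mul_of_one_le_right (by positivity) h6
          _ = _ := by ring
      rw [Real.sqrt_mul hqr.le, Real.sqrt_mul hqr.le]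
      calc f q ≤ 2 * C₂ * (R : ℝ) ^ (τ - 1) * q *
            (√(primNorm q.primeFactors T α) * √(primNorm q.primeFactors T' β)) := by
            rw [hf]; exact mul_le_mul_of_nonneg_right h4 (by positivity)
        _ = 2 * C₂ * (R : ℝ) ^ (τ - 1) * (√q * √q) *
            (√(primNorm q.primeFactors T α) * √(primNorm q.primeFactors T' β)) := by
            rw [Real.mul_self_sqrt hqr.le]
        _ = _ := by ring
    refine (sum_le_sum h3).trans ?_
    rw [← mul_sum]
    have hsub : ((Ioc z L).filter Squarefree).filter (Nat.log 2 · = j) ⊆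
        (Icc 1 R).filter Squarefree := by
      intro q hq; simp only [mem_filter, mem_Ioc, mem_Icc] at hq ⊢
      have : q < R := by rw [hR, ← hq.2]; exact Nat.lt_pow_succ_log_self (by norm_num) q
      refine ⟨⟨?_, ?_⟩, hq.1.2⟩ <;> omega
    have hRn : 0 < R := by positivity
    set u := R * Real.exp (-(c * X / 2)) with hu
    set v := R * Real.exp (-(c' * X / 2)) with hv
    have hvu : v ≤ u := by
      rw [hu, hv]; gcongr
    have hc' : 0 < c' := hc.trans_le hcc
    have hcX' : c * X ≤ c' * X := by gcongr
    have h4 := (sum_le_sum_of_subset_of_nonneg hsub fun q _ _ => mul_nonneg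
      (by positivity) (hNα q)).trans (large_sieve_primes hc hd hX hcX hT hTX hα hRn)
    have h5 := (sum_le_sum_of_subset_of_nonneg hsub fun q _ _ => mul_nonneg
      (by positivity) (hNβ q)).trans (large_sieve_primes hc' hd hX (hcX.trans hcX') hT' hTX' hβ hRn)
    have h6 : ∑ q ∈ ((Ioc z L).filter Squarefree).filter (Nat.log 2 · = j),
        √(q * primNorm q.primeFactors T α) * √(q * primNorm q.primeFactors T' β) ≤
        G * X ^ 2 * (1 + 4 * u + 4 * (u * v)) := by
      refine (Real.sum_sqrt_mul_sqrt_le _ (fun q => mul_nonneg (by positivity) (hNα q))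
        (fun q => mul_nonneg (by positivity) (hNβ q))).trans ?_
      refine (mul_le_mul (Real.sqrt_le_sqrt h4) (Real.sqrt_le_sqrt h5) (Real.sqrt_nonneg _)
        (Real.sqrt_nonneg _)).trans ?_
      have e : 312 * ((2 * d + 1) * X) ^ 2 * K ^ 2 = G * X ^ 2 := by rw [hG]; ring
      rw [e, ← hu, ← hv, Real.sqrt_mul (by positivity : 0 ≤ G * X ^ 2) (1 + 2 * u ^ 2),
        Real.sqrt_mul (by positivity : 0 ≤ G * X ^ 2) (1 + 2 * v ^ 2)]
      calc _ = (√(G * X ^ 2) * √(G * X ^ 2)) * (√(1 + 2 * u ^ 2) * √(1 + 2 * v ^ 2)) := by ring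
        _ ≤ _ := by
          rw [Real.mul_self_sqrt (by positivity)]
          gcongr
          exact sqrt_one_add_mul_le (by positivity) (by positivity) hvu
    have hκ1 : Real.exp (-(c * X / 8)) ≤ Real.exp (-(κ * X)) := by
      have := mul_le_mul_of_nonneg_right (min_le_left (c / 8) (δ / 2)) hX0.le
      rw [Real.exp_le_exp]; linarith
    have hκ2 : Real.exp (-(δ * X / 2)) ≤ Real.exp (-(κ * X)) := by
      have := mul_le_mul_of_nonneg_right (min_le_right (c / 8) (δ / 2)) hX0.le
      rw [Real.exp_le_exp]; linarith
    have h7 : (R : ℝ) ^ (τ - 1) ≤ Real.exp (-(κ * X)) := by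
      refine le_trans (Real.rpow_le_rpow_of_nonpos (Real.exp_pos _) hRlow (by linarith)) ?_
      refine le_trans ?_ hκ1
      rw [← Real.exp_mul, Real.exp_le_exp]
      nlinarith [mul_pos hc hX0]
    have hR2 : ∀ s : ℝ, 0 ≤ s → (R : ℝ) ^ s ≤ 2 ^ s * Real.exp ((1 / 2 - δ) * X * s) :=
      fun s hs => by
        refine (Real.rpow_le_rpow hR0.le hRup hs).trans_eq ?_
        rw [Real.mul_rpow (by norm_num) (Real.exp_pos _).le, ← Real.exp_mul]
    have h8 : (R : ℝ) ^ (τ - 1) * u ≤ 2 * Real.exp (-(κ * X)) := by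
      calc (R : ℝ) ^ (τ - 1) * u = (R : ℝ) ^ τ * Real.exp (-(c * X / 2)) := by
            rw [hu, Real.rpow_sub_one hR0.ne']; field_simp
        _ ≤ 2 ^ τ * Real.exp ((1 / 2 - δ) * X * τ) * Real.exp (-(c * X / 2)) := by
            gcongr; exact hR2 τ hτ0.le
        _ ≤ 2 ^ (1 : ℝ) * Real.exp ((1 / 2 - δ) * X * τ) * Real.exp (-(c * X / 2)) := by
            gcongr
            · norm_num
            · linarith
        _ = 2 * Real.exp ((1 / 2 - δ) * X * τ - c * X / 2) := by
            rw [Real.rpow_one, mul_assoc, ← Real.exp_add]; rfl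
        _ ≤ 2 * Real.exp (-(c * X / 8)) := by
            gcongr
            have : (1 / 2 - δ) * X * τ ≤ 1 / 2 * X * (c / 2) := by
              have : (1 / 2 - δ) ≤ 1 / 2 := by linarith
              gcongr
            nlinarith [mul_pos hc hX0]
        _ ≤ _ := by gcongr
    have h9 : (R : ℝ) ^ (τ - 1) * (u * v) ≤ 4 * Real.exp (-(κ * X)) := by
      have hexp : Real.exp (-(c * X / 2)) * Real.exp (-(c' * X / 2)) ≤ Real.exp (-(X / 2)) := by
        rw [← Real.exp_add, Real.exp_le_exp]; nlinarith
      calc (R : ℝ) ^ (τ - 1) * (u * v)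
          = (R : ℝ) ^ (1 + τ) * (Real.exp (-(c * X / 2)) * Real.exp (-(c' * X / 2))) := by
            rw [hu, hv, Real.rpow_sub_one hR0.ne', Real.rpow_add hR0, Real.rpow_one]; field_simp
        _ ≤ 2 ^ (1 + τ) * Real.exp ((1 / 2 - δ) * X * (1 + τ)) * Real.exp (-(X / 2)) := by
            gcongr; exact hR2 _ (by linarith)
        _ ≤ 2 ^ (2 : ℝ) * Real.exp ((1 / 2 - δ) * X * (1 + τ)) * Real.exp (-(X / 2)) := by
            gcongr
            · norm_num
            · linarith
        _ = 4 * Real.exp ((1 / 2 - δ) * X * (1 + τ) - X / 2) := by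
            rw [mul_assoc, ← Real.exp_add]; norm_num; rfl
        _ ≤ 4 * Real.exp (-(δ * X / 2)) := by
            gcongr
            have : (1 / 2 - δ) * X * τ ≤ 1 / 2 * X * δ := by
              have : (1 / 2 - δ) ≤ 1 / 2 := by linarith
              gcongr
            nlinarith
        _ ≤ _ := by gcongr
    calc 2 * C₂ * (R : ℝ) ^ (τ - 1) * _ ≤
        2 * C₂ * (R : ℝ) ^ (τ - 1) * (G * X ^ 2 * (1 + 4 * u + 4 * (u * v))) := by gcongr
      _ = 2 * C₂ * G * X ^ 2 * ((R : ℝ) ^ (τ - 1) + 4 * ((R : ℝ) ^ (τ - 1) * u) +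
          4 * ((R : ℝ) ^ (τ - 1) * (u * v))) := by ring
      _ ≤ 2 * C₂ * G * X ^ 2 * (Real.exp (-(κ * X)) + 4 * (2 * Real.exp (-(κ * X))) +
          4 * (4 * Real.exp (-(κ * X)))) := by gcongr
      _ = _ := by ring
  have hJ : ∑ q ∈ (Ioc z L).filter Squarefree, f q ≤
      100 * C₂ * G * (X ^ 3 * Real.exp (-(κ * X))) := by
    have hL0 : (Nat.log 2 L : ℝ) + 1 ≤ 2 * X := by
      have h3 : (2 : ℝ) ^ Nat.log 2 L ≤ Real.exp (1 / 2 * X) := by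
        rcases Nat.eq_zero_or_pos L with h | h
        · rw [h]; simpa using Real.one_le_exp (by positivity)
        · calc (2 : ℝ) ^ Nat.log 2 L ≤ L := by exact_mod_cast Nat.pow_log_le_self 2 h.ne'
            _ ≤ Real.exp ((1 / 2 - δ) * X) := Nat.floor_le (Real.exp_pos _).le
            _ ≤ _ := by gcongr; linarith
      have h4 := Real.log_le_log (by positivity) h3
      rw [Real.log_exp, Real.log_pow] at h4
      have := Real.log_two_gt_d9
      nlinarith [(Nat.cast_nonneg (Nat.log 2 L) : (0 : ℝ) ≤ Nat.log 2 L)]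
    rw [← sum_fiberwise_of_maps_to (t := range (Nat.log 2 L + 1)) (g := Nat.log 2) fun q hq => ?_]
    · refine (sum_le_sum fun j _ => hlarge j).trans ?_
      rw [sum_const, card_range, nsmul_eq_mul]
      push_cast
      calc _ ≤ 2 * X * (50 * C₂ * G * (X ^ 2 * Real.exp (-(κ * X)))) := by gcongr
        _ = _ := by ring
    · rw [mem_range, Nat.lt_succ_iff]
      exact Nat.log_mono_right (mem_Ioc.mp (mem_filter.mp hq).1).2
  calc ∑ q ∈ (Ioc q₀ L).filter Squarefree, f q
      ≤ ∑ q ∈ (Ioc q₀ z).filter Squarefree ∪ (Ioc z L).filter Squarefree, f q := by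
        refine sum_le_sum_of_subset_of_nonneg (fun q hq => ?_) fun q _ _ => hf0 q
        simp only [mem_union, mem_filter, mem_Ioc] at hq ⊢
        by_cases h : q ≤ z
        · exact Or.inl ⟨⟨hq.1.1, h⟩, hq.2⟩
        · exact Or.inr ⟨⟨by omega, hq.1.2⟩, hq.2⟩
    _ ≤ ∑ q ∈ (Ioc q₀ z).filter Squarefree, f q + ∑ q ∈ (Ioc z L).filter Squarefree, f q := by
        rw [← sum_union_inter]
        exact le_add_of_nonneg_right (sum_nonneg fun q _ => hf0 q)
    _ ≤ C₁ * S * (1 / √q₀) + 100 * C₂ * G * (X ^ 3 * Real.exp (-(κ * X))) := add_le_add hsmall hJ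
    _ ≤ _ := by
        have h3 : 0 ≤ 1 / √(q₀ : ℝ) := by positivity
        have h4 : 0 ≤ X ^ 3 * Real.exp (-(κ * X)) := by positivity
        have h5 : 0 ≤ C₁ * S := by positivity
        have h6 : 0 ≤ 100 * C₂ * G := by positivity
        nlinarith [mul_nonneg h5 h4, mul_nonneg h6 h3]

end PrimeTail

section MertensAP

open Filter Topology MeasureTheory ArithmeticFunction ArithmeticFunction.vonMangoldt

/-- The exponentially weighted polynomial `exp (-u) * P (exp (-u))`. -/
noncomputable def expPoly (P : Polynomial ℝ) (u : ℝ) : ℝ := Real.exp (-u) * P.eval (Real.exp (-u))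

lemma expPoly_monomial (k : ℕ) (a u : ℝ) :
    expPoly (Polynomial.monomial k a) u = a * Real.exp (-((k + 1 : ℝ) * u)) := by
  rw [expPoly, Polynomial.eval_monomial, ← Real.exp_nat_mul, mul_left_comm, ← Real.exp_add]
  congr 2; ring

lemma expPoly_monomial_zero_one (u : ℝ) : expPoly (Polynomial.monomial 0 1) u = Real.exp (-u) := by
  simp [expPoly]

lemma expPoly_add (P Q : Polynomial ℝ) (u : ℝ) : expPoly (P + Q) u = expPoly P u + expPoly Q u := by
  simp [expPoly, mul_add]

lemma integrableOn_expPoly (P : Polynomial ℝ) : IntegrableOn (expPoly P) (Set.Ioi 0) := by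
  induction P using Polynomial.induction_on' with
  | add P Q hP hQ =>
    have : expPoly (P + Q) = fun u => expPoly P u + expPoly Q u := funext (expPoly_add P Q)
    rw [this]; exact hP.add hQ
  | monomial k a =>
    have : expPoly (Polynomial.monomial k a) = fun u => a * Real.exp (-(k + 1 : ℝ) * u) := by
      funext u; rw [expPoly_monomial]; ring_nf
    rw [this]
    exact (integrableOn_exp_mul_Ioi (by have : (0 : ℝ) ≤ k := by positivity
                                        linarith) 0).const_mul a

lemma exp_neg_mul_log_div {n : ℕ} (hn : n ≠ 0) (k X : ℝ) :
    Real.exp (-(k * (Real.log n / X))) = 1 / (n : ℝ) ^ (k / X) := by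
  have hn' : (0 : ℝ) < n := by positivity
  rw [one_div, ← Real.rpow_neg hn'.le, Real.rpow_def_of_pos hn']
  congr 1; ring

variable {c : ℕ → ℝ} {A : ℝ}

lemma tendsto_sum_expPoly (hc0 : c 0 = 0) (hs : ∀ s : ℝ, 0 < s → Summable fun n => c n / (n : ℝ) ^ s)
    (hlim : Tendsto (fun s : ℝ => s * ∑' n, c n / (n : ℝ) ^ s) (𝓝[>] 0) (𝓝 A)) (P : Polynomial ℝ) :
    (∀ X : ℝ, 0 < X → Summable fun n => c n * expPoly P (Real.log n / X)) ∧
    Tendsto (fun X : ℝ => X⁻¹ * ∑' n, c n * expPoly P (Real.log n / X)) atTop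
      (𝓝 (A * ∫ u in Set.Ioi 0, expPoly P u)) := by
  induction P using Polynomial.induction_on' with
  | add P Q hP hQ =>
    have e : ∀ X n, c n * expPoly (P + Q) (Real.log n / X)
        = c n * expPoly P (Real.log n / X) + c n * expPoly Q (Real.log n / X) := by
      intro X n; rw [expPoly_add, mul_add]
    refine ⟨fun X hX => ?_, ?_⟩
    · simp_rw [e]; exact (hP.1 X hX).add (hQ.1 X hX)
    · have : ∫ u in Set.Ioi 0, expPoly (P + Q) u =
          (∫ u in Set.Ioi 0, expPoly P u) + ∫ u in Set.Ioi 0, expPoly Q u := by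
        simp_rw [expPoly_add]
        exact integral_add (integrableOn_expPoly P) (integrableOn_expPoly Q)
      rw [this, mul_add]
      refine (hP.2.add hQ.2).congr' ?_
      filter_upwards [eventually_gt_atTop 0] with X hX
      simp_rw [e]
      rw [(hP.1 X hX).tsum_add (hQ.1 X hX), mul_add]
  | monomial k a =>
    have hk : (0 : ℝ) < k + 1 := by positivity
    have e : ∀ X n, c n * expPoly (Polynomial.monomial k a) (Real.log n / X)
        = a * (c n / (n : ℝ) ^ ((k + 1 : ℝ) / X)) := by
      intro X n
      rcases eq_or_ne n 0 with rfl | hn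
      · simp [hc0]
      · rw [expPoly_monomial, exp_neg_mul_log_div hn]; ring
    refine ⟨fun X hX => ?_, ?_⟩
    · simp_rw [e]; exact (hs _ (by positivity)).mul_left a
    · simp_rw [e, tsum_mul_left]
      have h1 : Tendsto (fun X : ℝ => (k + 1 : ℝ) / X) atTop (𝓝[>] 0) := by
        refine tendsto_nhdsWithin_iff.mpr ⟨tendsto_const_nhds.div_atTop tendsto_id, ?_⟩
        filter_upwards [eventually_gt_atTop 0] with X hX
        exact Set.mem_Ioi.mpr (by positivity)
      have h2 := ((hlim.comp h1).const_mul (a / (k + 1)))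
      have h3 : ∫ u in Set.Ioi 0, expPoly (Polynomial.monomial k a) u = a / (k + 1) := by
        have : expPoly (Polynomial.monomial k a) = fun u => a * Real.exp (-(k + 1 : ℝ) * u) := by
          funext u; rw [expPoly_monomial]; ring_nf
        rw [this, integral_const_mul, integral_exp_mul_Ioi (by linarith)]
        rw [mul_zero, Real.exp_zero]
        field_simp
      rw [h3, mul_comm A]
      refine h2.congr' ?_
      filter_upwards [eventually_gt_atTop 0] with X hX
      simp only [Function.comp]
      field_simp

/-- Karamata's theorem for a Dirichlet series with a simple pole at `0`. -/
theorem karamata (hc : ∀ n, 0 ≤ c n) (hc0 : c 0 = 0)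
    (hs : ∀ s : ℝ, 0 < s → Summable fun n => c n / (n : ℝ) ^ s)
    (hlim : Tendsto (fun s : ℝ => s * ∑' n, c n / (n : ℝ) ^ s) (𝓝[>] 0) (𝓝 A))
    {F : ℝ → ℝ} (hF : Continuous F) {d : ℝ} (hF0 : ∀ u ≤ 0, F u = 0) (hFd : ∀ u, d ≤ u → F u = 0) :
    Tendsto (fun X : ℝ => X⁻¹ * ∑' n, c n * F (Real.log n / X)) atTop (𝓝 (A * ∫ u, F u)) := by
  set G : ℝ → ℝ := fun t => F (- Real.log t) / t with hG
  have hGc : Continuous G := by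
    rw [continuous_iff_continuousAt]
    intro t
    rcases eq_or_ne t 0 with rfl | ht
    · have : G =ᶠ[𝓝 0] fun _ => 0 := by
        filter_upwards [Metric.ball_mem_nhds (0 : ℝ) (Real.exp_pos (-d))] with t ht
        rw [Metric.mem_ball, dist_zero_right, Real.norm_eq_abs] at ht
        rcases eq_or_ne t 0 with rfl | h0
        · simp [hG]
        have : Real.log t < -d := by
          rw [← Real.log_abs, Real.log_lt_iff_lt_exp (abs_pos.mpr h0)]; exact ht
        simp only [hG]
        rw [hFd _ (by linarith), zero_div]
      exact continuousAt_const.congr this.symm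
    · exact ((hF.continuousAt).comp (Real.continuousAt_log ht).neg).div continuousAt_id ht
  have hFG : ∀ u, F u = Real.exp (-u) * G (Real.exp (-u)) := by
    intro u
    simp only [hG, Real.log_exp, neg_neg]
    field_simp
  have hInt : IntegrableOn F (Set.Ioi 0) := by
    have : Integrable F := hF.integrable_of_hasCompactSupport
      (HasCompactSupport.of_support_subset_isCompact (isCompact_Icc (a := 0) (b := d)) (by
        intro u hu
        by_contra h
        rw [Set.mem_Icc, not_and_or, not_le, not_le] at h
        rcases h with h | h
        · exact hu (hF0 u h.le)
        · exact hu (hFd u h.le)))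
    exact this.integrableOn
  have hIntF : ∫ u, F u = ∫ u in Set.Ioi 0, F u := by
    refine (setIntegral_eq_integral_of_forall_compl_eq_zero fun u hu => hF0 u ?_).symm
    exact not_lt.mp hu
  have hone := tendsto_sum_expPoly hc0 hs hlim (Polynomial.monomial 0 1)
  have hA : A * ∫ u in Set.Ioi 0, expPoly (Polynomial.monomial 0 1) u = A := by
    have : ∫ u in Set.Ioi (0:ℝ), expPoly (Polynomial.monomial 0 1) u = 1 := by
      simp_rw [expPoly_monomial_zero_one, integral_exp_neg_Ioi, neg_zero, Real.exp_zero]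
    rw [this, mul_one]
  rw [hA] at hone
  have hA0 : 0 ≤ A := by
    refine ge_of_tendsto hone.2 ?_
    filter_upwards [eventually_gt_atTop 0] with X hX
    refine mul_nonneg (by positivity) (tsum_nonneg fun n => mul_nonneg (hc n) ?_)
    rw [expPoly_monomial]; positivity
  rw [Metric.tendsto_atTop']
  intro ε hε
  set δ := ε / (2 * A + 3) with hδ
  have hδ0 : 0 < δ := by positivity
  obtain ⟨P, hP⟩ := exists_polynomial_near_of_continuousOn 0 1 G hGc.continuousOn δ hδ0
  have hFP : ∀ u, 0 ≤ u → |expPoly P u - F u| ≤ δ * Real.exp (-u) := by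
    intro u hu
    rw [hFG u, expPoly, ← mul_sub, abs_mul, abs_of_pos (Real.exp_pos _), mul_comm]
    gcongr
    exact (hP _ ⟨(Real.exp_pos _).le, Real.exp_le_one_iff.mpr (by linarith)⟩).le
  have hPs := tendsto_sum_expPoly hc0 hs hlim P
  have hI : |(∫ u in Set.Ioi 0, expPoly P u) - ∫ u in Set.Ioi 0, F u| ≤ δ := by
    rw [← integral_sub (integrableOn_expPoly P) hInt, ← Real.norm_eq_abs]
    have h1 : ∫ u in Set.Ioi (0:ℝ), δ * Real.exp (-u) = δ := by
      rw [integral_const_mul, integral_exp_neg_Ioi]; simp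
    refine le_trans (norm_integral_le_of_norm_le (g := fun u => δ * Real.exp (-u)) ?_ ?_) h1.le
    · refine Integrable.const_mul ?_ δ
      have h2 := integrableOn_expPoly (Polynomial.monomial 0 1)
      rw [show expPoly (Polynomial.monomial 0 1) = fun u => Real.exp (-u) from
        funext expPoly_monomial_zero_one] at h2
      exact h2
    · filter_upwards [ae_restrict_mem measurableSet_Ioi] with u hu
      exact hFP u (le_of_lt hu)
  obtain ⟨X1, hX1⟩ := (Metric.tendsto_atTop'.mp hPs.2) δ hδ0
  obtain ⟨X2, hX2⟩ := (Metric.tendsto_atTop'.mp hone.2) 1 one_pos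
  refine ⟨max (max X1 X2) 0, fun X hX => ?_⟩
  have hX0 : 0 < X := (le_max_right _ _).trans_lt hX
  have h1 := hX1 X ((le_max_left _ _).trans_lt ((le_max_left _ _).trans_lt hX))
  have h2 := hX2 X ((le_max_right _ _).trans_lt ((le_max_left _ _).trans_lt hX))
  rw [Real.dist_eq] at h1 h2 ⊢
  have hbd : ∀ n : ℕ, |c n * expPoly P (Real.log n / X) - c n * F (Real.log n / X)|
      ≤ δ * (c n * expPoly (Polynomial.monomial 0 1) (Real.log n / X)) := by
    intro n
    rw [← mul_sub, abs_mul, abs_of_nonneg (hc n), expPoly_monomial]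
    have := hFP (Real.log n / X) (div_nonneg (Real.log_natCast_nonneg n) hX0.le)
    simp only [CharP.cast_eq_zero, zero_add, one_mul]
    calc _ ≤ c n * (δ * Real.exp (-(Real.log n / X))) := by gcongr; exact hc n
      _ = _ := by ring
  have hsd : Summable fun n : ℕ =>
      c n * expPoly P (Real.log n / X) - c n * F (Real.log n / X) :=
    Summable.of_norm_bounded ((hone.1 X hX0).mul_left δ) hbd
  have hsF : Summable fun n : ℕ => c n * F (Real.log n / X) := by
    simpa using (hPs.1 X hX0).sub hsd
  have h3 : |X⁻¹ * (∑' n, c n * expPoly P (Real.log n / X)) - X⁻¹ * ∑' n, c n * F (Real.log n / X)|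
      ≤ δ * (A + 1) := by
    rw [← mul_sub, ← (hPs.1 X hX0).tsum_sub hsF, abs_mul, abs_of_pos (inv_pos.mpr hX0)]
    have h4 := tsum_of_norm_bounded (f := fun n : ℕ =>
      c n * expPoly P (Real.log n / X) - c n * F (Real.log n / X))
      ((hone.1 X hX0).mul_left δ).hasSum hbd
    rw [tsum_mul_left, Real.norm_eq_abs] at h4
    have h5 := (abs_lt.mp h2).2
    calc _ ≤ X⁻¹ * (δ * ∑' n : ℕ, c n * expPoly (Polynomial.monomial 0 1) (Real.log n / X)) := by
          gcongr
      _ = δ * (X⁻¹ * ∑' n : ℕ, c n * expPoly (Polynomial.monomial 0 1) (Real.log n / X)) := by ring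
      _ ≤ δ * (A + 1) := by gcongr; linarith
  have h6 : |A * (∫ u in Set.Ioi 0, expPoly P u) - A * ∫ u, F u| ≤ A * δ := by
    rw [← mul_sub, abs_mul, abs_of_nonneg hA0, hIntF]; gcongr
  have h7 : δ * (2 * A + 3) = ε := by rw [hδ]; field_simp
  rw [abs_le] at h3 h6
  rw [abs_lt] at h1 ⊢
  constructor <;> nlinarith

lemma tendsto_mul_tsum_residueClass {q : ℕ} [NeZero q] {a : ZMod q} (ha : IsUnit a) :
    (∀ s : ℝ, 0 < s → Summable fun n : ℕ => (residueClass a n / n) / (n : ℝ) ^ s) ∧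
    Tendsto (fun s : ℝ => s * ∑' n : ℕ, (residueClass a n / n) / (n : ℝ) ^ s) (𝓝[>] 0)
      (𝓝 (q.totient : ℝ)⁻¹) := by
  have e : ∀ s : ℝ, 0 < s → ∀ n : ℕ,
      (residueClass a n / n) / (n : ℝ) ^ s = residueClass a n / (n : ℝ) ^ (1 + s) := by
    intro s hs n
    rcases eq_or_ne n 0 with rfl | hn
    · simp
    · rw [Real.rpow_add (by positivity), Real.rpow_one, div_div]
  have H {x : ℝ} (hx : 1 < x) :
      ∑' n, residueClass a n / (n : ℝ) ^ x =
        (LFunctionResidueClassAux a x).re + (q.totient : ℝ)⁻¹ / (x - 1) := by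
    refine Complex.ofReal_injective ?_
    simp only [Complex.ofReal_tsum, Complex.ofReal_div, Complex.ofReal_cpow (Nat.cast_nonneg _),
      Complex.ofReal_natCast, Complex.ofReal_add, Complex.ofReal_inv, Complex.ofReal_sub,
      Complex.ofReal_one]
    simp_rw [← LFunctionResidueClassAux_real ha hx,
      eqOn_LFunctionResidueClassAux ha <| Set.mem_ofPred.mpr (Complex.ofReal_re x ▸ hx),
      sub_add_cancel, LSeries, LSeries.term]
    refine tsum_congr fun n ↦ ?_
    split_ifs with hn
    · simp only [hn, residueClass_apply_zero, Complex.ofReal_zero, zero_div]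
    · rfl
  have hcont : ContinuousOn (fun x : ℝ ↦ (LFunctionResidueClassAux a x).re) (Set.Ici 1) :=
    Complex.continuous_re.continuousOn.comp (t := Set.univ) (continuousOn_LFunctionResidueClassAux a)
      (fun ⦃x⦄ a ↦ trivial) |>.comp Complex.continuous_ofReal.continuousOn fun x hx ↦ by
        simpa only [Set.mem_ofPred_eq, Complex.ofReal_re, Set.mem_Ici] using hx
  constructor
  · intro s hs
    simp_rw [e s hs]
    have hsum := LSeriesSummable_of_abscissaOfAbsConv_lt_re (s := ((1 + s : ℝ) : ℂ)) <|
      (abscissaOfAbsConv_residueClass_le_one a).trans_lt <| by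
        rw [Complex.ofReal_re]; norm_cast; linarith
    have := hsum.norm
    refine this.congr fun n => ?_
    rw [LSeries.norm_term_eq]
    rcases eq_or_ne n 0 with rfl | hn
    · simp
    · simp only [hn, if_false, Complex.ofReal_re, Complex.norm_real, Real.norm_eq_abs]
      rw [abs_of_nonneg (residueClass_nonneg a n)]
  · have h1 : Tendsto (fun s : ℝ => s * (LFunctionResidueClassAux a ((1 + s : ℝ) : ℂ)).re
        + (q.totient : ℝ)⁻¹) (𝓝[>] 0) (𝓝 (0 * (LFunctionResidueClassAux a ((1 : ℝ) : ℂ)).re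
        + (q.totient : ℝ)⁻¹)) := by
      refine (Tendsto.mul (tendsto_id.mono_left nhdsWithin_le_nhds) ?_).add tendsto_const_nhds
      refine (hcont 1 Set.self_mem_Ici).tendsto.comp (tendsto_nhdsWithin_iff.mpr ⟨?_, ?_⟩)
      · have : Tendsto (fun s : ℝ => 1 + s) (𝓝 0) (𝓝 (1 + 0)) := tendsto_id.const_add 1
        rw [add_zero] at this
        exact this.mono_left nhdsWithin_le_nhds
      · filter_upwards [self_mem_nhdsWithin] with s hs
        rw [Set.mem_Ioi] at hs
        rw [Set.mem_Ici]; linarith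
    rw [zero_mul, zero_add] at h1
    refine h1.congr' ?_
    filter_upwards [self_mem_nhdsWithin] with s hs
    rw [Set.mem_Ioi] at hs
    simp_rw [e s hs]
    rw [H (by linarith)]
    have : (1 + s - 1) = s := by ring
    rw [this]
    field_simp

/-- Mertens' theorem for primes in an arithmetic progression, in weighted form. -/
theorem mertens_residueClass {q : ℕ} [NeZero q] {a : ZMod q} (ha : IsUnit a)
    {f : ℝ → ℝ} (hf : Continuous f) {c d : ℝ} (hc : 0 < c) (hfc : ∀ u ≤ c, f u = 0)
    (hfd : ∀ u, d ≤ u → f u = 0) :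
    Tendsto (fun X : ℝ => ∑' n : ℕ, if n.Prime ∧ (n : ZMod q) = a then f (Real.log n / X) / n else 0)
      atTop (𝓝 ((q.totient : ℝ)⁻¹ * ∫ u, f u / u)) := by
  set F : ℝ → ℝ := fun u => f u / u with hF
  have hFc : Continuous F := by
    rw [continuous_iff_continuousAt]
    intro t
    rcases lt_or_ge t c with ht | ht
    · have : F =ᶠ[𝓝 t] fun _ => 0 := by
        filter_upwards [Iio_mem_nhds ht] with u hu
        simp [hF, hfc u (le_of_lt hu)]
      exact continuousAt_const.congr this.symm
    · exact hf.continuousAt.div continuousAt_id (hc.trans_le ht).ne'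
  obtain ⟨hs, hlim⟩ := tendsto_mul_tsum_residueClass ha
  have hF0 : ∀ u ≤ 0, F u = 0 := fun u hu => by simp [hF, hfc u (hu.trans hc.le)]
  have hFd : ∀ u, d ≤ u → F u = 0 := fun u hu => by simp [hF, hfd u hu]
  have key := karamata (c := fun n => residueClass a n / n)
    (fun n => div_nonneg (residueClass_nonneg a n) (Nat.cast_nonneg n)) (by simp) hs hlim hFc hF0 hFd
  have hcs : HasCompactSupport F :=
    HasCompactSupport.of_support_subset_isCompact (isCompact_Icc (a := 0) (b := d)) (by
        intro u hu
        by_contra h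
        rw [Set.mem_Icc, not_and_or, not_le, not_le] at h
        rcases h with h | h
        · exact hu (hF0 u h.le)
        · exact hu (hFd u h.le))
  obtain ⟨K, hK⟩ := hFc.bounded_above_of_compact_support hcs
  have hnp := summable_residueClass_non_primes_div (a := a)
  have hzero : Tendsto (fun X : ℝ => X⁻¹ * ∑' n : ℕ,
      (if n.Prime then 0 else residueClass a n) / n * F (Real.log n / X)) atTop (𝓝 0) := by
    refine squeeze_zero_norm' (a := fun X : ℝ =>
      X⁻¹ * (K * ∑' n : ℕ, (if n.Prime then 0 else residueClass a n) / n)) ?_ ?_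
    · filter_upwards [eventually_gt_atTop 0] with X hX
      rw [norm_mul, Real.norm_of_nonneg (inv_nonneg.mpr hX.le)]
      gcongr
      rw [← tsum_mul_left]
      refine tsum_of_norm_bounded (hnp.mul_left K).hasSum fun n => ?_
      have h0 : 0 ≤ (if n.Prime then 0 else residueClass a n) / n := by
        positivity [residueClass_nonneg a n]
      rw [norm_mul, Real.norm_of_nonneg h0, mul_comm]
      gcongr
      exact hK _
    · simpa using (tendsto_inv_atTop_zero (𝕜 := ℝ)).mul_const
        (K * ∑' n : ℕ, (if n.Prime then 0 else residueClass a n) / n)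
  have := key.sub hzero
  rw [sub_zero] at this
  refine this.congr' ?_
  filter_upwards [eventually_gt_atTop 0] with X hX
  have hfin : ∀ g : ℕ → ℝ, Summable fun n => g n * F (Real.log n / X) := by
    intro g
    refine summable_of_ne_finset_zero (s := Finset.range (⌈Real.exp (d * X)⌉₊ + 1)) fun n hn => ?_
    rw [Finset.mem_range, not_lt] at hn
    have h1 : Real.exp (d * X) ≤ n := (Nat.le_ceil _).trans (by exact_mod_cast (by omega))
    have h2 : d * X ≤ Real.log n := by
      rw [← Real.log_exp (d * X)]; exact Real.log_le_log (Real.exp_pos _) h1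
    rw [hFd _ (by rwa [le_div_iff₀ hX]), mul_zero]
  rw [← mul_sub, ← (hfin _).tsum_sub (hfin _), ← tsum_mul_left]
  refine tsum_congr fun n => ?_
  by_cases hp : n.Prime
  · simp only [hp, if_true, true_and, zero_div, zero_mul, sub_zero]
    by_cases hna : (n : ZMod q) = a
    · have hl : residueClass a n = Real.log n := by
        rw [residueClass, Set.indicator_of_mem (by exact hna), vonMangoldt_apply_prime hp]
      have hl0 : Real.log n ≠ 0 := (Real.log_pos (by exact_mod_cast hp.one_lt)).ne'
      have hn0 : (n : ℝ) ≠ 0 := by exact_mod_cast hp.ne_zero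
      rw [if_pos hna, hl]
      simp only [hF]
      field_simp
    · have hl : residueClass a n = 0 := Set.indicator_of_notMem (by exact hna) _
      rw [if_neg hna, hl]; simp
  · simp [hp]

end MertensAP

section LaplaceFourier

open Filter Topology MeasureTheory FourierTransform SchwartzMap
open scoped ContDiff

/-- The point `1 + 2πiξ` of the line of real part one. -/
noncomputable def vline (ξ : ℝ) : ℂ := 1 + 2 * Real.pi * Complex.I * ξ

/-- The exponential `exp (-(1 + 2πiξ) u)`. -/
noncomputable def lapExp (ξ u : ℝ) : ℂ := Complex.exp (-(vline ξ * u))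

lemma norm_lapExp (ξ u : ℝ) : ‖lapExp ξ u‖ = Real.exp (-u) := by
  rw [lapExp, Complex.norm_exp, vline]
  congr 1
  simp [Complex.mul_re, Complex.add_re, Complex.mul_im]

lemma vline_re (ξ : ℝ) : (vline ξ).re = 1 := by simp [vline]

lemma vline_im (ξ : ℝ) : (vline ξ).im = 2 * Real.pi * ξ := by simp [vline]

lemma norm_vline_le (ξ : ℝ) : ‖vline ξ‖ ≤ 7 * (1 + |ξ|) := by
  rw [vline]
  refine (norm_add_le _ _).trans ?_
  simp only [norm_one, Complex.norm_mul, Complex.norm_ofNat, Complex.norm_real, Real.norm_eq_abs,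
    Complex.norm_I, mul_one, abs_of_pos Real.pi_pos]
  nlinarith [Real.pi_lt_d2, abs_nonneg ξ, Real.pi_pos]

@[fun_prop]
lemma continuous_vline : Continuous vline := by unfold vline; fun_prop

lemma lapExp_add (ξ u v : ℝ) : lapExp ξ (u + v) = lapExp ξ u * lapExp ξ v := by
  rw [lapExp, lapExp, lapExp, ← Complex.exp_add]; congr 1; push_cast; ring

lemma lapExp_zero (ξ : ℝ) : lapExp ξ 0 = 1 := by simp [lapExp]

/-- `ψ` represents the function `g`, whose derivative is `-d`, as a Laplace–Fourier integral on the
half line. -/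
structure LaplacePair (g d : ℝ → ℝ) (ψ : ℝ → ℂ) : Prop where
  continuous : Continuous ψ
  integrable : ∀ n : ℕ, Integrable fun ξ : ℝ => (1 + |ξ|) ^ n * ‖ψ ξ‖
  integral_eq : ∀ u, 0 ≤ u → ∫ ξ, ψ ξ * lapExp ξ u = g u
  integral_vline_eq : ∀ u, 0 < u → ∫ ξ, ψ ξ * vline ξ * lapExp ξ u = d u

namespace LaplacePair

variable {g d g' d' : ℝ → ℝ} {ψ ψ' : ℝ → ℂ}

lemma integrable_mul (h : LaplacePair g d ψ) {φ : ℝ → ℂ} (hφ : Continuous φ) {C : ℝ} {n : ℕ}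
    (hb : ∀ ξ, ‖φ ξ‖ ≤ C * (1 + |ξ|) ^ n) : Integrable fun ξ => ψ ξ * φ ξ := by
  refine ((h.integrable n).const_mul C).mono' (h.continuous.mul hφ).aestronglyMeasurable
    (Eventually.of_forall fun ξ => ?_)
  rw [norm_mul]
  calc ‖ψ ξ‖ * ‖φ ξ‖ ≤ ‖ψ ξ‖ * (C * (1 + |ξ|) ^ n) := by gcongr; exact hb ξ
    _ = _ := by ring

lemma integrable_lapExp (h : LaplacePair g d ψ) (u : ℝ) :
    Integrable fun ξ => ψ ξ * lapExp ξ u :=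
  h.integrable_mul (C := Real.exp (-u)) (n := 0) (by unfold lapExp; fun_prop)
    fun ξ => by simp [norm_lapExp]

lemma integral_pair (h : LaplacePair g d ψ) (h' : LaplacePair g' d' ψ') :
    ∫ q : ℝ × ℝ, ψ q.1 * ψ' q.2 * (vline q.1 * vline q.2 / (vline q.1 + vline q.2))
      = ((∫ u in Set.Ioi 0, d u * d' u : ℝ) : ℂ) := by
  set μ := volume.restrict (Set.Ioi (0 : ℝ)) with hμ
  have hA : Integrable fun ξ => ψ ξ * vline ξ :=
    h.integrable_mul (by fun_prop) (n := 1) (C := 7) fun ξ => by simpa using norm_vline_le ξ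
  have hA' : Integrable fun ξ => ψ' ξ * vline ξ :=
    h'.integrable_mul (by fun_prop) (n := 1) (C := 7) fun ξ => by simpa using norm_vline_le ξ
  have hE : Integrable (fun u : ℝ => Real.exp (-2 * u)) μ :=
    integrableOn_exp_mul_Ioi (by norm_num) 0
  set F : (ℝ × ℝ) → ℝ → ℂ := fun q u =>
    (ψ q.1 * vline q.1) * (ψ' q.2 * vline q.2) * (lapExp q.1 u * lapExp q.2 u) with hF
  have hψ := h.continuous
  have hψ' := h'.continuous
  have hFint : Integrable (Function.uncurry F) ((volume : Measure (ℝ × ℝ)).prod μ) := by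
    have h1 : Integrable (fun q : (ℝ × ℝ) × ℝ =>
        ((ψ q.1.1 * vline q.1.1) * (ψ' q.1.2 * vline q.1.2)) * ((Real.exp (-2 * q.2) : ℝ) : ℂ))
        ((volume : Measure (ℝ × ℝ)).prod μ) := (hA.mul_prod hA').mul_prod hE.ofReal
    refine h1.mono (Continuous.aestronglyMeasurable ?_) (Eventually.of_forall fun q => le_of_eq ?_)
    · simp only [hF, Function.uncurry_def, lapExp]; fun_prop
    · simp only [hF, Function.uncurry_def, norm_mul, norm_lapExp, Complex.norm_real,
        Real.norm_eq_abs, Real.abs_exp]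
      rw [← Real.exp_add]; congr 2; ring
  have hleft : ∀ q : ℝ × ℝ, ∫ u, F q u ∂μ
      = ψ q.1 * ψ' q.2 * (vline q.1 * vline q.2 / (vline q.1 + vline q.2)) := by
    intro q
    have hre : 0 < (vline q.1 + vline q.2).re := by simp [vline_re]
    have e : ∀ u, F q u = (ψ q.1 * vline q.1) * (ψ' q.2 * vline q.2) *
        Complex.exp (-(vline q.1 + vline q.2) * u) := by
      intro u
      simp only [hF, lapExp]
      rw [← Complex.exp_add]; congr 2; ring
    simp_rw [e]
    rw [integral_const_mul, integral_exp_mul_complex_Ioi (by rw [Complex.neg_re]; linarith)]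
    have : vline q.1 + vline q.2 ≠ 0 := fun h0 => by rw [h0] at hre; simp at hre
    rw [Complex.ofReal_zero, mul_zero, Complex.exp_zero]
    field_simp
  simp_rw [← hleft]
  rw [integral_integral_swap hFint, ← integral_complex_ofReal]
  refine setIntegral_congr_fun measurableSet_Ioi fun u hu => ?_
  simp only [hF]
  have e : ∀ q : ℝ × ℝ, ψ q.1 * vline q.1 * (ψ' q.2 * vline q.2) * (lapExp q.1 u * lapExp q.2 u)
      = (ψ q.1 * vline q.1 * lapExp q.1 u) * (ψ' q.2 * vline q.2 * lapExp q.2 u) := by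
    intro q; ring
  simp_rw [e]
  rw [Measure.volume_eq_prod, integral_prod_mul (fun ξ => ψ ξ * vline ξ * lapExp ξ u)
    (fun ξ => ψ' ξ * vline ξ * lapExp ξ u), h.integral_vline_eq u hu, h'.integral_vline_eq u hu]
  push_cast; rfl

end LaplacePair

/-- Every smooth function on the half line with compact support has a rapidly decaying
Laplace–Fourier representation. -/
theorem exists_laplacePair {e : ℝ → ℝ} (he : ContDiff ℝ ∞ e) {b : ℝ} (hb : ∀ u, b ≤ u → e u = 0) :
    ∃ ψ, LaplacePair (fun u => ∫ t in u..b, e t) e ψ := by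
  set g : ℝ → ℝ := fun u => ∫ t in u..b, e t with hg
  have hgd : ∀ u, HasDerivAt g (- e u) u := fun u =>
    intervalIntegral.integral_hasDerivAt_left (he.continuous.intervalIntegrable _ _)
      he.continuous.stronglyMeasurable.stronglyMeasurableAtFilter he.continuous.continuousAt
  have hgs : ContDiff ℝ ∞ g := by
    rw [contDiff_infty_iff_deriv]
    refine ⟨fun u => (hgd u).differentiableAt, ?_⟩
    rw [show deriv g = fun u => - e u from funext fun u => (hgd u).deriv]
    exact he.neg
  have hg0 : ∀ u, b ≤ u → g u = 0 := by
    intro u hu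
    refine (intervalIntegral.integral_congr (g := fun _ => (0 : ℝ)) fun t ht => ?_).trans (by simp)
    rw [Set.uIcc_of_ge hu] at ht
    exact hb t ht.1
  set f : ℝ → ℂ := fun u => ((Real.exp u * (g u * Real.smoothTransition (u + 1)) : ℝ) : ℂ) with hf
  have hfs : ContDiff ℝ ∞ f := by
    refine Complex.ofRealCLM.contDiff.comp (Real.contDiff_exp.mul (hgs.mul ?_))
    exact Real.smoothTransition.contDiff.comp (contDiff_id.add contDiff_const)
  have hfc : HasCompactSupport f :=
    HasCompactSupport.of_support_subset_isCompact (isCompact_Icc (a := -1) (b := b)) (by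
      intro u hu
      by_contra h
      rw [Set.mem_Icc, not_and_or, not_le, not_le] at h
      refine hu ?_
      rcases h with h | h
      · simp [hf, Real.smoothTransition.zero_of_nonpos (x := u + 1) (by linarith)]
      · simp [hf, hg0 u h.le])
  set S : 𝓢(ℝ, ℂ) := hfc.toSchwartzMap hfs with hS
  have hSf : ∀ u, S u = f u := fun u => rfl
  set Ψ : 𝓢(ℝ, ℂ) := 𝓕⁻ S with hΨ
  have hFΨ : 𝓕 (Ψ : ℝ → ℂ) = f := by
    rw [← SchwartzMap.fourier_coe, hΨ, FourierTransform.fourier_fourierInv_eq]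
    exact funext hSf
  have hint : ∀ n : ℕ, Integrable fun ξ : ℝ => ‖ξ‖ ^ n * ‖Ψ ξ‖ :=
    fun n => Ψ.integrable_pow_mul volume n
  have hker : ∀ ξ u : ℝ, lapExp ξ u = (Real.exp (-u) : ℂ) * Complex.exp (((-2 * Real.pi * ξ * u : ℝ) : ℂ) * Complex.I) := by
    intro ξ u
    rw [lapExp, vline, Complex.ofReal_exp, ← Complex.exp_add]
    congr 1; push_cast; ring
  have hfour : ∀ (φ : ℝ → ℂ) (u : ℝ), 𝓕 φ u = ∫ ξ, Complex.exp (((-2 * Real.pi * ξ * u : ℝ) : ℂ) * Complex.I) * φ ξ := by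
    intro φ u
    rw [Real.fourier_eq']
    refine integral_congr_ae (Eventually.of_forall fun ξ => ?_)
    simp only [smul_eq_mul]
    congr 2
    simp; ring
  refine ⟨Ψ, Ψ.continuous, fun n => ?_, fun u hu => ?_, fun u hu => ?_⟩
  · have : (fun ξ : ℝ => (1 + |ξ|) ^ n * ‖Ψ ξ‖) = fun ξ => ∑ k ∈ Finset.range (n + 1),
        (n.choose k : ℝ) * (‖ξ‖ ^ k * ‖Ψ ξ‖) := by
      funext ξ
      rw [add_comm, add_pow, Finset.sum_mul]
      refine Finset.sum_congr rfl fun k _ => ?_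
      rw [one_pow, Real.norm_eq_abs]; ring
    rw [this]
    exact integrable_finsetSum _ fun k _ => (hint k).const_mul _
  · have h1 : ∫ ξ, Ψ ξ * lapExp ξ u = (Real.exp (-u) : ℂ) * 𝓕 (Ψ : ℝ → ℂ) u := by
      rw [hfour, ← integral_const_mul]
      refine integral_congr_ae (Eventually.of_forall fun ξ => ?_)
      simp only [hker]; ring
    rw [h1, hFΨ]
    simp only [hf]
    rw [Real.smoothTransition.one_of_one_le (by linarith), ← Complex.ofReal_mul, ← mul_assoc,
      ← Real.exp_add]
    simp
  · have hI : Integrable (Ψ : ℝ → ℂ) := Ψ.integrable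
    have hI' : Integrable (fun ξ : ℝ => ξ • Ψ ξ) := by
      refine (hint 1).mono' (by fun_prop) (Eventually.of_forall fun ξ => ?_)
      rw [norm_smul, pow_one]
    have hder := Real.hasDerivAt_fourier hI hI' u
    rw [hFΨ] at hder
    have hder2 : HasDerivAt f (((Real.exp u * g u + Real.exp u * (- e u) : ℝ) : ℂ)) u := by
      have h1 : HasDerivAt (fun u => Real.exp u * g u) (Real.exp u * g u + Real.exp u * (- e u)) u :=
        (Real.hasDerivAt_exp u).mul (hgd u)
      refine h1.ofReal_comp.congr_of_eventuallyEq ?_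
      filter_upwards [lt_mem_nhds hu] with v hv
      simp only [hf]
      rw [Real.smoothTransition.one_of_one_le (by linarith), mul_one]
    have huniq := hder.unique hder2
    rw [hfour] at huniq
    have hI2 : Integrable fun ξ : ℝ => Complex.exp (((-2 * Real.pi * ξ * u : ℝ) : ℂ) * Complex.I) * Ψ ξ :=
      hI.bdd_mul (c := 1) (Continuous.aestronglyMeasurable (by fun_prop)) (Eventually.of_forall fun ξ => by
        rw [Complex.norm_exp_ofReal_mul_I])
    have hI3 : Integrable fun ξ : ℝ => Complex.exp (((-2 * Real.pi * ξ * u : ℝ) : ℂ) * Complex.I) *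
        ((-2 * Real.pi * Complex.I * ξ) • Ψ ξ) := by
      refine Integrable.bdd_mul (c := 1) ?_ (Continuous.aestronglyMeasurable (by fun_prop)) (Eventually.of_forall fun ξ => by
        rw [Complex.norm_exp_ofReal_mul_I])
      refine (hI'.const_mul (-2 * Real.pi * Complex.I)).congr (Eventually.of_forall fun ξ => ?_)
      simp only [smul_eq_mul, Complex.real_smul]; ring
    have h0 := hfour Ψ u
    rw [hFΨ] at h0
    have h1 : ∫ ξ, Ψ ξ * vline ξ * lapExp ξ u = (Real.exp (-u) : ℂ) *
        ((∫ ξ : ℝ, Complex.exp (((-2 * Real.pi * ξ * u : ℝ) : ℂ) * Complex.I) * Ψ ξ) -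
          ∫ ξ : ℝ, Complex.exp (((-2 * Real.pi * ξ * u : ℝ) : ℂ) * Complex.I) *
        ((-2 * Real.pi * Complex.I * ξ) • Ψ ξ)) := by
      rw [← integral_sub hI2 hI3, ← integral_const_mul]
      refine integral_congr_ae (Eventually.of_forall fun ξ => ?_)
      simp only [hker, vline, smul_eq_mul]; ring
    rw [h1, huniq, ← h0]
    simp only [hf]
    rw [Real.smoothTransition.one_of_one_le (by linarith), mul_one, ← Complex.ofReal_sub,
      ← Complex.ofReal_mul]
    congr 1
    have : Real.exp (-u) * Real.exp u = 1 := by rw [← Real.exp_add]; simp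
    linear_combination e u * this

end LaplaceFourier

section ZetaNearOne

open Filter Topology

/-- The function `(s - 1) ζ(s)`, extended continuously to `s = 1`. -/
noncomputable def zetaResidue : ℂ → ℂ :=
  Function.update (fun s => (s - 1) * riemannZeta s) 1 1

lemma zetaResidue_of_ne {s : ℂ} (hs : s ≠ 1) : zetaResidue s = (s - 1) * riemannZeta s :=
  Function.update_of_ne hs _ _

lemma continuous_zetaResidue : Continuous zetaResidue := by
  rw [continuous_iff_continuousAt]
  intro s
  rcases eq_or_ne s 1 with rfl | hs
  · exact continuousAt_update_same.mpr riemannZeta_residue_one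
  · refine (ContinuousAt.congr (f := fun s => (s - 1) * riemannZeta s) ?_ ?_)
    · exact (continuousAt_id.sub continuousAt_const).mul
        (differentiableAt_riemannZeta hs).continuousAt
    · filter_upwards [isOpen_ne.mem_nhds hs] with t ht
      rw [zetaResidue_of_ne ht]

lemma exists_zetaResidue_bounds : ∃ C > 0, ∀ s : ℂ, 1 ≤ s.re → s.re ≤ 2 → |s.im| ≤ 7 →
    ‖zetaResidue s‖ ≤ C ∧ 1 ≤ C * ‖zetaResidue s‖ := by
  set K : Set ℂ := Set.Icc 1 2 ×ℂ Set.Icc (-7) 7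
  have hK : IsCompact K := isCompact_Icc.reProdIm isCompact_Icc
  have hne : ∀ s ∈ K, zetaResidue s ≠ 0 := by
    intro s hs
    rcases eq_or_ne s 1 with rfl | h1
    · simp [zetaResidue]
    · rw [zetaResidue_of_ne h1]
      exact mul_ne_zero (sub_ne_zero.mpr h1) (riemannZeta_ne_zero_of_one_le_re hs.1.1)
  obtain ⟨A, hA⟩ := hK.exists_bound_of_continuousOn continuous_zetaResidue.continuousOn
  obtain ⟨B, hB⟩ := hK.exists_bound_of_continuousOn
    (continuous_zetaResidue.continuousOn.inv₀ hne)
  refine ⟨max 1 (max A B), by positivity, fun s h1 h2 h3 => ?_⟩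
  have hs : s ∈ K := ⟨⟨h1, h2⟩, abs_le.mp h3⟩
  refine ⟨(hA s hs).trans ((le_max_left _ _).trans (le_max_right _ _)), ?_⟩
  have h4 := hB s hs
  have h5 : 0 < ‖zetaResidue s‖ := norm_pos_iff.mpr (hne s hs)
  rw [Pi.inv_apply, norm_inv, inv_le_iff_one_le_mul₀ h5] at h4
  exact h4.trans (by gcongr; exact (le_max_right _ _).trans (le_max_right _ _))

lemma norm_prime_cpow_neg {p : ℕ} (hp : p.Prime) (s : ℂ) :
    ‖(p : ℂ) ^ (-s)‖ = (p : ℝ) ^ (-s.re) := by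
  rw [Complex.norm_natCast_cpow_of_pos hp.pos, Complex.neg_re]

private lemma prime_rpow_neg_lt_one {p : ℕ} (hp : p.Prime) {σ : ℝ} (hσ : 1 < σ) :
    (p : ℝ) ^ (-σ) < 1 :=
  Real.rpow_lt_one_of_one_lt_of_neg (by exact_mod_cast hp.one_lt) (by linarith)

private lemma norm_eulerFactor_real {p : ℕ} (hp : p.Prime) {σ : ℝ} (hσ : 1 < σ) :
    ‖(1 - (p : ℂ) ^ (-(σ : ℂ)))⁻¹‖ = (1 - (p : ℝ) ^ (-σ))⁻¹ := by
  have h1 := prime_rpow_neg_lt_one hp hσ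
  rw [norm_inv, show (p : ℂ) ^ (-(σ : ℂ)) = (((p : ℝ) ^ (-σ) : ℝ) : ℂ) by
    rw [Complex.ofReal_cpow (by positivity)]; push_cast; rfl, ← Complex.ofReal_one,
    ← Complex.ofReal_sub, Complex.norm_real, Real.norm_of_nonneg (by linarith)]

lemma norm_riemannZeta_le {s : ℂ} (hs : 1 < s.re) : ‖riemannZeta s‖ ≤ ‖riemannZeta s.re‖ := by
  have h1 := (riemannZeta_eulerProduct hs).norm
  have h2 := (riemannZeta_eulerProduct (s := (s.re : ℂ)) (by simpa using hs)).norm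
  refine le_of_tendsto_of_tendsto' h1 h2 fun n => ?_
  rw [norm_prod, norm_prod]
  refine Finset.prod_le_prod (fun _ _ => norm_nonneg _) fun p hp => ?_
  have hp := Nat.prime_of_mem_primesBelow hp
  have h3 := prime_rpow_neg_lt_one hp hs
  rw [norm_eulerFactor_real hp hs, norm_inv]
  refine inv_anti₀ (by linarith) ?_
  have := norm_sub_norm_le (1 : ℂ) ((p : ℂ) ^ (-s))
  rwa [norm_one, norm_prime_cpow_neg hp] at this

lemma norm_inv_riemannZeta_le {s : ℂ} (hs : 1 < s.re) :
    ‖(riemannZeta s)⁻¹‖ ≤ ‖riemannZeta s.re‖ := by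
  have h1 := ((riemannZeta_eulerProduct hs).inv₀
    (riemannZeta_ne_zero_of_one_le_re hs.le)).norm
  have h2 := (riemannZeta_eulerProduct (s := (s.re : ℂ)) (by simpa using hs)).norm
  refine le_of_tendsto_of_tendsto' h1 h2 fun n => ?_
  rw [← Finset.prod_inv_distrib, norm_prod, norm_prod]
  refine Finset.prod_le_prod (fun _ _ => norm_nonneg _) fun p hp => ?_
  have hp := Nat.prime_of_mem_primesBelow hp
  have h3 := prime_rpow_neg_lt_one hp hs
  rw [norm_eulerFactor_real hp hs, inv_inv]
  refine (norm_sub_le _ _).trans ?_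
  rw [norm_one, norm_prime_cpow_neg hp]
  have h4 : 0 ≤ (p : ℝ) ^ (-s.re) := by positivity
  rw [← one_div, le_div_iff₀ (by linarith)]
  nlinarith

lemma exists_norm_riemannZeta_le : ∃ C > 0, ∀ s : ℂ, 1 < s.re → s.re ≤ 2 →
    ‖riemannZeta s‖ ≤ C / (s.re - 1) ∧
    ‖(riemannZeta s)⁻¹‖ ≤ C / (s.re - 1) ∧
    (|s.im| ≤ 7 → ‖(riemannZeta s)⁻¹‖ ≤ C * ‖s - 1‖) := by
  obtain ⟨C, hC, h⟩ := exists_zetaResidue_bounds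
  have key : ∀ σ : ℝ, 1 < σ → σ ≤ 2 → ‖riemannZeta σ‖ ≤ C / (σ - 1) := by
    intro σ h1 h2
    have h3 := (h σ (by simpa using h1.le) (by simpa using h2) (by simp)).1
    rw [zetaResidue_of_ne (by norm_cast; linarith), norm_mul,
      ← Complex.ofReal_one, ← Complex.ofReal_sub, Complex.norm_real,
      Real.norm_of_nonneg (by linarith)] at h3
    rw [le_div_iff₀ (by linarith)]
    linarith
  refine ⟨C, hC, fun s h1 h2 => ⟨(norm_riemannZeta_le h1).trans (key _ h1 h2),
    (norm_inv_riemannZeta_le h1).trans (key _ h1 h2), fun h3 => ?_⟩⟩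
  have h4 := (h s h1.le h2 h3).2
  have hs1 : s ≠ 1 := by rintro rfl; simp at h1
  rw [zetaResidue_of_ne hs1, norm_mul] at h4
  rw [norm_inv, inv_le_iff_one_le_mul₀ (norm_pos_iff.mpr
    (riemannZeta_ne_zero_of_one_le_re h1.le))]
  linarith

/-- The point `1 + (z₀ + ⋯) / X` at which zeta functions are evaluated. -/
lemma exists_norm_inv_riemannZeta_vline_le : ∃ C > 0, ∀ X : ℝ, 1 ≤ X → ∀ ξ : ℝ,
    ‖(riemannZeta (1 + vline ξ / X))⁻¹‖ ≤ C * (1 + |ξ|) ^ 2 / X := by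
  obtain ⟨C, hC, h⟩ := exists_norm_riemannZeta_le
  refine ⟨7 * C, by positivity, fun X hX ξ => ?_⟩
  have hX0 : 0 < X := by linarith
  have hre : (1 + vline ξ / X : ℂ).re = 1 + 1 / X := by
    simp [vline_re, Complex.div_ofReal_re]
  have him : (1 + vline ξ / X : ℂ).im = 2 * Real.pi * ξ / X := by
    simp [vline_im, Complex.div_ofReal_im]
  have h1 : 0 < 1 / X := by positivity
  have h2 : 1 / X ≤ 1 := by rw [div_le_one hX0]; exact hX
  obtain ⟨-, h4, h5⟩ := h (1 + vline ξ / X) (by rw [hre]; linarith) (by rw [hre]; linarith)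
  rw [hre, him] at *
  have ha := abs_nonneg ξ
  by_cases hξ : |ξ| ≤ X
  · have h6 := h5 (by
      rw [abs_div, abs_mul, abs_of_pos hX0, div_le_iff₀ hX0, abs_of_pos (by positivity)]
      nlinarith [Real.pi_lt_d2, Real.pi_pos])
    refine h6.trans ?_
    rw [add_sub_cancel_left, norm_div, Complex.norm_real, Real.norm_of_nonneg hX0.le,
      ← mul_div_assoc]
    refine div_le_div_of_nonneg_right ?_ hX0.le
    calc C * ‖vline ξ‖ ≤ C * (7 * (1 + |ξ|)) := by gcongr; exact norm_vline_le ξ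
      _ ≤ 7 * C * (1 + |ξ|) ^ 2 := by nlinarith [mul_nonneg hC.le ha, mul_nonneg (mul_nonneg hC.le ha) ha]
  · push Not at hξ
    refine h4.trans ?_
    rw [add_sub_cancel_left, div_div_eq_mul_div, div_one, le_div_iff₀ hX0]
    nlinarith [mul_pos hC hX0, mul_le_mul hξ.le hξ.le hX0.le ha]

lemma exists_norm_riemannZeta_add_vline_le : ∃ C > 0, ∀ X : ℝ, 2 ≤ X → ∀ ξ ξ' : ℝ,
    ‖riemannZeta (1 + (vline ξ + vline ξ') / X)‖ ≤ C * X := by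
  obtain ⟨C, hC, h⟩ := exists_norm_riemannZeta_le
  refine ⟨C, by positivity, fun X hX ξ ξ' => ?_⟩
  have hX0 : 0 < X := by linarith
  have hre : (1 + (vline ξ + vline ξ') / X : ℂ).re = 1 + 2 / X := by
    simp [vline_re, Complex.div_ofReal_re]; norm_num
  have h1 : 0 < 2 / X := by positivity
  have h2 : 2 / X ≤ 1 := by rw [div_le_one hX0]; exact hX
  refine (h _ (by rw [hre]; linarith) (by rw [hre]; linarith)).1.trans ?_
  rw [hre, add_sub_cancel_left, div_div_eq_mul_div]
  have := mul_pos hC hX0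
  linarith

lemma tendsto_riemannZeta_div {z : ℂ} (hz : z ≠ 0) :
    Tendsto (fun X : ℝ => (X : ℂ)⁻¹ * riemannZeta (1 + z / X)) atTop (𝓝 z⁻¹) := by
  have h1 : Tendsto (fun X : ℝ => 1 + z / (X : ℂ)) atTop (𝓝[≠] 1) := by
    refine tendsto_nhdsWithin_iff.mpr ⟨?_, ?_⟩
    · have : Tendsto (fun X : ℝ => ((X⁻¹ : ℝ) : ℂ)) atTop (𝓝 ((0 : ℝ) : ℂ)) :=
        (Complex.continuous_ofReal.tendsto 0).comp tendsto_inv_atTop_zero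
      have h2 := (this.const_mul z).const_add 1
      simpa [div_eq_mul_inv] using h2
    · filter_upwards [eventually_gt_atTop 0] with X hX
      simp [hz, hX.ne']
  have h2 := ((riemannZeta_residue_one.comp h1).const_mul z⁻¹)
  rw [mul_one] at h2
  refine h2.congr' ?_
  filter_upwards [eventually_gt_atTop 0] with X hX
  simp only [Function.comp, add_sub_cancel_left]
  field_simp

end ZetaNearOne

section EulerLocal

open Finset Filter Topology

/-- The local factor `(1 - p^{-z₀/X}) (1 - p^{-z₁/X}) - 1`. -/
noncomputable def eFac (X : ℝ) (q : ℝ × ℝ) (p : ℕ) : ℂ :=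
  (1 - lapExp q.1 (Real.log p / X)) * (1 - lapExp q.2 (Real.log p / X)) - 1

/-- The primes in `(D, P)`. -/
def sievePrimes (D P : ℕ) : Finset ℕ := (Nat.primesBelow P).filter (D < ·)

lemma mem_sievePrimes {D P p : ℕ} : p ∈ sievePrimes D P ↔ p.Prime ∧ D < p ∧ p < P := by
  simp [sievePrimes, Nat.mem_primesBelow]; tauto

lemma norm_lapExp_log {X : ℝ} (ξ : ℝ) {p : ℕ} (hp : 0 < p) :
    ‖lapExp ξ (Real.log p / X)‖ = (p : ℝ) ^ (-(1 / X)) := by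
  rw [norm_lapExp, Real.rpow_def_of_pos (by exact_mod_cast hp)]
  congr 1; ring

lemma norm_lapExp_log_le_one {X : ℝ} (hX : 0 < X) (ξ : ℝ) (p : ℕ) :
    ‖lapExp ξ (Real.log p / X)‖ ≤ 1 := by
  rw [norm_lapExp, Real.exp_le_one_iff, neg_nonpos]
  exact div_nonneg (Real.log_natCast_nonneg p) hX.le

lemma norm_eFac_le {X : ℝ} (hX : 0 < X) (q : ℝ × ℝ) (p : ℕ) : ‖eFac X q p‖ ≤ 3 := by
  have h0 := norm_lapExp_log_le_one hX q.1 p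
  have h1 := norm_lapExp_log_le_one hX q.2 p
  set x := lapExp q.1 (Real.log p / X)
  set y := lapExp q.2 (Real.log p / X)
  rw [eFac, show (1 - x) * (1 - y) - 1 = x * y - x - y by ring]
  calc ‖x * y - x - y‖ ≤ ‖x * y‖ + ‖x‖ + ‖y‖ :=
        (norm_sub_le _ _).trans (by gcongr; exact norm_sub_le _ _)
    _ ≤ 1 * 1 + 1 + 1 := by rw [norm_mul]; gcongr
    _ = 3 := by norm_num

lemma norm_eFac_le_rpow {X : ℝ} (hX : 0 < X) (q : ℝ × ℝ) {p : ℕ} (hp : 0 < p) :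
    ‖eFac X q p‖ ≤ 3 * (p : ℝ) ^ (-(1 / X)) := by
  have h0 := norm_lapExp_log (X := X) q.1 hp
  have h1 := norm_lapExp_log (X := X) q.2 hp
  have h2 := norm_lapExp_log_le_one hX q.2 p
  set x := lapExp q.1 (Real.log p / X)
  set y := lapExp q.2 (Real.log p / X)
  rw [eFac, show (1 - x) * (1 - y) - 1 = x * y - x - y by ring]
  calc ‖x * y - x - y‖ ≤ ‖x * y‖ + ‖x‖ + ‖y‖ :=
        (norm_sub_le _ _).trans (by gcongr; exact norm_sub_le _ _)
    _ ≤ ‖x‖ * 1 + ‖x‖ + ‖y‖ := by rw [norm_mul]; gcongr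
    _ = _ := by rw [h0, h1]; ring

lemma continuous_eFac (X : ℝ) (p : ℕ) : Continuous fun q : ℝ × ℝ => eFac X q p := by
  unfold eFac lapExp; fun_prop

lemma tendsto_lapExp_log_div (ξ : ℝ) (p : ℕ) :
    Tendsto (fun X : ℝ => lapExp ξ (Real.log p / X)) atTop (𝓝 1) := by
  have h1 : Tendsto (fun X : ℝ => Real.log p / X) atTop (𝓝 0) :=
    tendsto_const_nhds.div_atTop tendsto_id
  have h2 : Continuous (fun u => lapExp ξ u) := by unfold lapExp; fun_prop
  have h3 := (h2.tendsto 0).comp h1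
  rw [lapExp_zero] at h3
  exact h3

lemma tendsto_eFac (q : ℝ × ℝ) (p : ℕ) :
    Tendsto (fun X : ℝ => eFac X q p) atTop (𝓝 (-1)) := by
  have h := fun ξ => tendsto_lapExp_log_div ξ p
  simpa [eFac] using (((h q.1).const_sub 1).mul ((h q.2).const_sub 1)).sub_const 1

/-- The inverse of the zeta model of a local factor. -/
noncomputable def zetaModelInv (x y t : ℂ) : ℂ := (1 - x * y * t) / ((1 - x * t) * (1 - y * t))

lemma norm_one_sub_mul_ge {x : ℂ} (hx : ‖x‖ ≤ 1) {t : ℝ} (ht : 0 ≤ t) (ht' : t ≤ 1 / 2) :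
    1 / 2 ≤ ‖1 - x * (t : ℂ)‖ := by
  have := norm_sub_norm_le (1 : ℂ) (x * t)
  rw [norm_one, norm_mul, Complex.norm_real, Real.norm_of_nonneg ht] at this
  nlinarith [norm_nonneg x]

lemma norm_zetaModelInv_sub_le {x y : ℂ} (hx : ‖x‖ ≤ 1) (hy : ‖y‖ ≤ 1) {t : ℝ} (ht : 0 ≤ t)
    (ht' : t ≤ 1 / 2) :
    ‖zetaModelInv x y t - 1 - t * (-((1 - x) * (1 - y) - 1))‖ ≤ 34 * t ^ 2 := by
  have h1 := norm_one_sub_mul_ge hx ht ht'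
  have h2 := norm_one_sub_mul_ge hy ht ht'
  have h1' : (1 - x * (t : ℂ)) ≠ 0 := norm_pos_iff.mp (by linarith)
  have h2' : (1 - y * (t : ℂ)) ≠ 0 := norm_pos_iff.mp (by linarith)
  set e := (1 - x) * (1 - y) - 1 with he
  have hxy : ‖x * y‖ ≤ 1 := by rw [norm_mul]; exact mul_le_one₀ hx (norm_nonneg _) hy
  have hs : ‖x + y‖ ≤ 2 := (norm_add_le _ _).trans (by linarith)
  have hen : ‖e‖ ≤ 3 := by
    rw [he, show (1 - x) * (1 - y) - 1 = x * y - (x + y) by ring]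
    exact (norm_sub_le _ _).trans (by linarith)
  have key : zetaModelInv x y t - 1 - t * (-e)
      = (t : ℂ) ^ 2 * (-(x * y) - (x + y) * e + x * y * e * t) / ((1 - x * t) * (1 - y * t)) := by
    rw [zetaModelInv, he]
    field_simp
    ring
  have htn : ‖(t : ℂ)‖ = t := by rw [Complex.norm_real, Real.norm_of_nonneg ht]
  rw [key, norm_div, norm_mul, norm_pow, norm_mul (1 - x * (t : ℂ)), htn,
    div_le_iff₀ (by nlinarith)]
  have hnum : ‖-(x * y) - (x + y) * e + x * y * e * t‖ ≤ 8.5 := by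
    calc _ ≤ ‖-(x * y)‖ + ‖(x + y) * e‖ + ‖x * y * e * t‖ :=
          (norm_add_le _ _).trans (by gcongr; exact norm_sub_le _ _)
      _ ≤ 1 + 2 * 3 + 1 * 3 * (1 / 2) := by
          rw [norm_neg, norm_mul (x + y), norm_mul _ (t : ℂ), norm_mul (x * y), htn]
          gcongr
      _ = 8.5 := by norm_num
  have h3 : 1 / 4 ≤ ‖1 - x * (t : ℂ)‖ * ‖1 - y * (t : ℂ)‖ := by nlinarith
  nlinarith [sq_nonneg t, mul_le_mul_of_nonneg_left hnum (sq_nonneg t),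
    mul_le_mul_of_nonneg_left h3 (sq_nonneg t)]

lemma norm_zetaModelInv_le {x y : ℂ} (hx : ‖x‖ ≤ 1) (hy : ‖y‖ ≤ 1) {t : ℝ} (ht : 0 ≤ t)
    (ht' : t ≤ 1 / 2) : ‖zetaModelInv x y t‖ ≤ 11 := by
  have h := norm_zetaModelInv_sub_le hx hy ht ht'
  have hen : ‖-((1 - x) * (1 - y) - 1)‖ ≤ 3 := by
    rw [norm_neg, show (1 - x) * (1 - y) - 1 = x * y - x - y by ring]
    calc ‖x * y - x - y‖ ≤ ‖x * y‖ + ‖x‖ + ‖y‖ :=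
          (norm_sub_le _ _).trans (by gcongr; exact norm_sub_le _ _)
      _ ≤ 1 * 1 + 1 + 1 := by rw [norm_mul]; gcongr
      _ = 3 := by norm_num
  have htn : ‖(t : ℂ)‖ = t := by rw [Complex.norm_real, Real.norm_of_nonneg ht]
  set e := -((1 - x) * (1 - y) - 1)
  calc ‖zetaModelInv x y t‖ = ‖(zetaModelInv x y t - 1 - t * e) + (1 + t * e)‖ := by ring_nf
    _ ≤ 34 * t ^ 2 + (1 + t * 3) := by
        refine (norm_add_le _ _).trans (add_le_add h ((norm_add_le _ _).trans ?_))
        rw [norm_one, norm_mul, htn]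
        gcongr
    _ ≤ 11 := by nlinarith

lemma exists_norm_prod_sub_le {ι : Type*} (K B : ℝ) (hK : 0 ≤ K) (hB : 0 ≤ B) (s : Finset ι) :
    ∃ C, 0 ≤ C ∧ ∀ (a b : ι → ℂ) (t : ℝ), 0 ≤ t → t ≤ 1 →
      (∀ i ∈ s, ‖a i - 1 - t * b i‖ ≤ K * t ^ 2) → (∀ i ∈ s, ‖b i‖ ≤ B) →
      ‖∏ i ∈ s, a i - 1 - t * ∑ i ∈ s, b i‖ ≤ C * t ^ 2 := by
  classical
  induction s using Finset.induction with
  | empty => exact ⟨0, le_rfl, by simp⟩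
  | insert j s hj ih =>
    obtain ⟨C, hC, ih⟩ := ih
    refine ⟨K * (1 + #s * B + C) + (1 + B) * C + B * (#s * B), by positivity, ?_⟩
    intro a b t ht ht' ha hb
    have h1 := ih a b t ht ht' (fun i hi => ha i (mem_insert_of_mem hi))
      (fun i hi => hb i (mem_insert_of_mem hi))
    have haj := ha j (mem_insert_self _ _)
    have hbj := hb j (mem_insert_self _ _)
    rw [prod_insert hj, sum_insert hj]
    have hsum : ‖∑ i ∈ s, b i‖ ≤ #s * B := by
      refine (norm_sum_le_of_le s fun i hi => hb i (mem_insert_of_mem hi)).trans ?_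
      simp
    set Pr := ∏ i ∈ s, a i
    set σs := ∑ i ∈ s, b i
    have htn : ‖(t : ℂ)‖ = t := by rw [Complex.norm_real, Real.norm_of_nonneg ht]
    have hPr : ‖Pr‖ ≤ 1 + #s * B + C := by
      calc ‖Pr‖ = ‖(Pr - 1 - t * σs) + 1 + t * σs‖ := by ring_nf
        _ ≤ ‖Pr - 1 - t * σs‖ + 1 + t * ‖σs‖ := by
            refine (norm_add_le _ _).trans ?_
            rw [norm_mul, htn]
            gcongr
            exact (norm_add_le _ _).trans (by rw [norm_one])
        _ ≤ C * 1 ^ 2 + 1 + 1 * (#s * B) := by gcongr; exact h1.trans (by gcongr)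
        _ = _ := by ring
    calc ‖a j * Pr - 1 - t * (b j + σs)‖
        = ‖(a j - 1 - t * b j) * Pr + (1 + t * b j) * (Pr - 1 - t * σs) + t ^ 2 * (b j * σs)‖ := by
          ring_nf
      _ ≤ ‖(a j - 1 - t * b j) * Pr‖ + ‖(1 + t * b j) * (Pr - 1 - t * σs)‖
          + ‖(t : ℂ) ^ 2 * (b j * σs)‖ := norm_add₃_le
      _ ≤ K * t ^ 2 * (1 + #s * B + C) + (1 + 1 * B) * (C * t ^ 2) + t ^ 2 * (B * (#s * B)) := by
          rw [norm_mul, norm_mul, norm_mul, norm_mul, norm_pow, htn]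
          gcongr
          refine (norm_add_le _ _).trans ?_
          rw [norm_one, norm_mul, htn]
          gcongr
      _ = _ := by ring

variable {ι : Type*} [Fintype ι]

/-- The averaged local factor `1 + v(p) ∑ᵢ eᵢ(p)`. -/
noncomputable def locFac (v : ℕ → ℝ) (X : ℝ) (ξ : ι → ℝ × ℝ) (p : ℕ) : ℂ :=
  1 + v p * ∑ i, eFac X (ξ i) p

/-- The ratio of the local factor and its zeta model. -/
noncomputable def eulerRatio (v : ℕ → ℝ) (D : ℕ) (X : ℝ) (ξ : ι → ℝ × ℝ) (p : ℕ) : ℂ :=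
  (if D < p then locFac v X ξ p else 1) * ∏ i, zetaModelInv (lapExp (ξ i).1 (Real.log p / X))
    (lapExp (ξ i).2 (Real.log p / X)) ((p : ℝ)⁻¹ : ℝ)

lemma exists_norm_eulerRatio_sub_one_le {v : ℕ → ℝ}
    (hv : ∀ p : ℕ, p.Prime → |v p - (p : ℝ)⁻¹| ≤ 2 * ((p : ℝ)⁻¹) ^ 2) (D : ℕ) :
    ∃ C > 0, ∀ X : ℝ, 0 < X → ∀ ξ : ι → ℝ × ℝ, ∀ p : ℕ, p.Prime →
      ‖eulerRatio v D X ξ p - 1‖ ≤ C * ((p : ℝ)⁻¹) ^ 2 := by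
  obtain ⟨C₁, hC₁, h1⟩ := exists_norm_prod_sub_le (ι := ι) 34 3 (by norm_num) (by norm_num) univ
  set k := Fintype.card ι
  obtain ⟨C₂, hC₂, h2⟩ := exists_norm_prod_sub_le (ι := Bool) (C₁ + 6 * k) (3 * k)
    (by positivity) (by positivity) univ
  refine ⟨C₂ + (1 + 11 ^ k) * (D + 1) ^ 2, by positivity, fun X hX ξ p hp => ?_⟩
  have hp0 : (0 : ℝ) < p := by exact_mod_cast hp.pos
  have ht : 0 ≤ (p : ℝ)⁻¹ := by positivity
  have ht' : (p : ℝ)⁻¹ ≤ 1 / 2 := by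
    rw [one_div]; exact inv_anti₀ (by norm_num) (by exact_mod_cast hp.two_le)
  set t := (p : ℝ)⁻¹
  set M := ∏ i, zetaModelInv (lapExp (ξ i).1 (Real.log p / X))
    (lapExp (ξ i).2 (Real.log p / X)) (t : ℝ)
  have he : ∀ i, ‖eFac X (ξ i) p‖ ≤ 3 := fun i => norm_eFac_le hX _ p
  have hsum : ‖∑ i, eFac X (ξ i) p‖ ≤ 3 * k := by
    refine (norm_sum_le_of_le univ fun i _ => he i).trans ?_
    simp [k, mul_comm]
  rw [eulerRatio]
  split_ifs with hD
  · have hM : ‖M - 1 - t * (-∑ i, eFac X (ξ i) p)‖ ≤ C₁ * t ^ 2 := by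
      rw [← sum_neg_distrib]
      exact h1 _ _ t ht (by linarith) (fun i _ => norm_zetaModelInv_sub_le
        (norm_lapExp_log_le_one hX _ _) (norm_lapExp_log_le_one hX _ _) ht ht')
        (fun i _ => by rw [norm_neg]; exact he i)
    have h3 := h2 (fun b => if b then locFac v X ξ p else M)
      (fun b => if b then ∑ i, eFac X (ξ i) p else -∑ i, eFac X (ξ i) p) t ht (by linarith) ?_ ?_
    · simp only [Fintype.prod_bool, Fintype.sum_bool, if_true, add_neg_cancel,
        Bool.false_eq_true, if_false, mul_zero, sub_zero] at h3
      refine h3.trans ?_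
      gcongr
      have : (0 : ℝ) ≤ (1 + 11 ^ k) * (D + 1) ^ 2 := by positivity
      linarith
    · rintro (_ | _) -
      · simp only [Bool.false_eq_true, if_false]
        exact hM.trans (by gcongr; have : (0 : ℝ) ≤ 6 * k := by positivity
                           linarith)
      · simp only [if_true, locFac]
        rw [show (1 : ℂ) + v p * ∑ i, eFac X (ξ i) p - 1 - t * ∑ i, eFac X (ξ i) p
          = ((v p - t : ℝ) : ℂ) * ∑ i, eFac X (ξ i) p by push_cast; ring, norm_mul,
          Complex.norm_real, Real.norm_eq_abs]
        calc |v p - t| * ‖∑ i, eFac X (ξ i) p‖ ≤ (2 * t ^ 2) * (3 * k) := by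
              gcongr; exact hv p hp
          _ ≤ (C₁ + 6 * k) * t ^ 2 := by nlinarith [mul_nonneg hC₁ (sq_nonneg t)]
    · rintro (_ | _) - <;> simpa using hsum
  · have hM : ‖M‖ ≤ 11 ^ k := by
      rw [norm_prod]
      refine (prod_le_prod (fun _ _ => norm_nonneg _) fun i _ => norm_zetaModelInv_le
        (norm_lapExp_log_le_one hX _ _) (norm_lapExp_log_le_one hX _ _) ht ht').trans ?_
      simp [k]
    have h3 : 1 ≤ (D + 1) ^ 2 * t ^ 2 := by
      rw [← mul_pow]
      refine one_le_pow₀ ?_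
      rw [← div_eq_mul_inv, one_le_div hp0]
      have : p ≤ D := not_lt.mp hD
      have : (p : ℝ) ≤ D := by exact_mod_cast this
      linarith
    rw [one_mul]
    calc ‖M - 1‖ ≤ 11 ^ k + 1 := (norm_sub_le _ _).trans (by rw [norm_one]; gcongr)
      _ ≤ (1 + 11 ^ k) * ((D + 1) ^ 2 * t ^ 2) := by
          have : (0 : ℝ) ≤ 1 + 11 ^ k := by positivity
          nlinarith
      _ ≤ _ := by nlinarith [mul_nonneg hC₂ (sq_nonneg t)]

lemma tendsto_zetaModelInv (q : ℝ × ℝ) (p : ℕ) (hp : p.Prime) :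
    Tendsto (fun X : ℝ => zetaModelInv (lapExp q.1 (Real.log p / X)) (lapExp q.2 (Real.log p / X))
      ((p : ℝ)⁻¹ : ℝ)) atTop (𝓝 ((1 - (p : ℝ)⁻¹ : ℝ) : ℂ)⁻¹) := by
  have h := fun ξ => tendsto_lapExp_log_div ξ p
  have hne : (1 - ((p : ℝ)⁻¹ : ℝ) : ℂ) ≠ 0 := by
    rw [← Complex.ofReal_one, ← Complex.ofReal_sub, Complex.ofReal_ne_zero, sub_ne_zero]
    exact (inv_lt_one_of_one_lt₀ (by exact_mod_cast hp.one_lt)).ne'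
  have h3 := ((((h q.1).mul (h q.2)).mul_const (((p : ℝ)⁻¹ : ℝ) : ℂ)).const_sub 1).div
    ((((h q.1).mul_const (((p : ℝ)⁻¹ : ℝ) : ℂ)).const_sub 1).mul
    (((h q.2).mul_const (((p : ℝ)⁻¹ : ℝ) : ℂ)).const_sub 1)) (by simpa only [one_mul] using mul_ne_zero hne hne)
  unfold zetaModelInv
  refine h3.trans (le_of_eq ?_)
  congr 1
  rw [one_mul, one_mul, Complex.ofReal_sub, Complex.ofReal_one,
    div_mul_cancel_left₀ hne]

end EulerLocal

section EulerGlobal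

open Finset Filter Topology

variable {ι : Type*} [Fintype ι]

noncomputable def eulerError (v : ℕ → ℝ) (D : ℕ) (X : ℝ) (ξ : ι → ℝ × ℝ) (p : ℕ) : ℂ :=
  if p.Prime then eulerRatio v D X ξ p - 1 else 0

/-- The limit of the truncated Euler products. -/
noncomputable def eulerLim (v : ℕ → ℝ) (D : ℕ) (X : ℝ) (ξ : ι → ℝ × ℝ) : ℂ :=
  (∏' p, (1 + eulerError v D X ξ p)) * ∏ i, (riemannZeta (1 + (vline (ξ i).1 + vline (ξ i).2) / X)
    * ((riemannZeta (1 + vline (ξ i).1 / X))⁻¹ * (riemannZeta (1 + vline (ξ i).2 / X))⁻¹))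

lemma exists_norm_eulerError_le {v : ℕ → ℝ}
    (hv : ∀ p : ℕ, p.Prime → |v p - (p : ℝ)⁻¹| ≤ 2 * ((p : ℝ)⁻¹) ^ 2) (D : ℕ) :
    ∃ C > 0, ∀ X : ℝ, 0 < X → ∀ ξ : ι → ℝ × ℝ, ∀ p : ℕ,
      ‖eulerError v D X ξ p‖ ≤ C * ((p : ℝ)⁻¹) ^ 2 := by
  obtain ⟨C, hC, h⟩ := exists_norm_eulerRatio_sub_one_le (ι := ι) hv D
  refine ⟨C, hC, fun X hX ξ p => ?_⟩
  rw [eulerError]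
  split_ifs with hp
  · exact h X hX ξ p hp
  · simp; positivity

lemma summable_const_mul_inv_sq (C : ℝ) : Summable fun p : ℕ => C * ((p : ℝ)⁻¹) ^ 2 := by
  simpa using (Real.summable_nat_pow_inv.mpr one_lt_two).mul_left C

lemma lapExp_mul_inv {p : ℕ} (hp : p.Prime) (ξ X : ℝ) :
    lapExp ξ (Real.log p / X) * (((p : ℝ)⁻¹ : ℝ) : ℂ) = (p : ℂ) ^ (-(1 + vline ξ / X)) := by
  have hp0 : (p : ℂ) ≠ 0 := by exact_mod_cast hp.ne_zero
  rw [neg_add, Complex.cpow_add _ _ hp0, Complex.cpow_neg_one, mul_comm, lapExp,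
    Complex.cpow_def_of_ne_zero hp0, Complex.ofReal_inv, Complex.ofReal_natCast]
  congr 2
  rw [← Complex.natCast_log]
  push_cast
  ring

lemma lapExp_mul_lapExp_mul_inv {p : ℕ} (hp : p.Prime) (ξ ξ' X : ℝ) :
    lapExp ξ (Real.log p / X) * lapExp ξ' (Real.log p / X) * (((p : ℝ)⁻¹ : ℝ) : ℂ)
      = (p : ℂ) ^ (-(1 + (vline ξ + vline ξ') / X)) := by
  have hp0 : (p : ℂ) ≠ 0 := by exact_mod_cast hp.ne_zero
  rw [neg_add, Complex.cpow_add _ _ hp0, Complex.cpow_neg_one, mul_comm, lapExp, lapExp,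
    Complex.cpow_def_of_ne_zero hp0, Complex.ofReal_inv, Complex.ofReal_natCast, ← Complex.exp_add]
  congr 2
  rw [← Complex.natCast_log]
  push_cast
  ring

lemma prod_locFac_eq (v : ℕ → ℝ) (D P : ℕ) {X : ℝ} (hX : 0 < X) (ξ : ι → ℝ × ℝ) :
    ∏ p ∈ sievePrimes D P, locFac v X ξ p
      = (∏ p ∈ range P, (1 + eulerError v D X ξ p)) *
        ∏ i, ((∏ p ∈ Nat.primesBelow P, (1 - (p : ℂ) ^ (-(1 + (vline (ξ i).1 + vline (ξ i).2) / X)))⁻¹)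
          * ((∏ p ∈ Nat.primesBelow P, (1 - (p : ℂ) ^ (-(1 + vline (ξ i).1 / X)))⁻¹)⁻¹ *
            (∏ p ∈ Nat.primesBelow P, (1 - (p : ℂ) ^ (-(1 + vline (ξ i).2 / X)))⁻¹)⁻¹)) := by
  have h1 : ∏ p ∈ range P, (1 + eulerError v D X ξ p)
      = ∏ p ∈ Nat.primesBelow P, eulerRatio v D X ξ p := by
    rw [Nat.primesBelow, prod_filter]
    refine prod_congr rfl fun p _ => ?_
    rw [eulerError]; split_ifs <;> ring
  rw [h1]
  simp only [← prod_inv_distrib, ← prod_mul_distrib]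
  rw [Finset.prod_comm, ← prod_mul_distrib, sievePrimes, prod_filter]
  refine prod_congr rfl fun p hp => ?_
  have hp := Nat.prime_of_mem_primesBelow hp
  have ht : (0 : ℝ) ≤ (p : ℝ)⁻¹ := by positivity
  have ht' : (p : ℝ)⁻¹ ≤ 1 / 2 := by
    rw [one_div]; exact inv_anti₀ (by norm_num) (by exact_mod_cast hp.two_le)
  rw [eulerRatio, mul_assoc, ← prod_mul_distrib, prod_eq_one, mul_one]
  intro i _
  have hx := norm_lapExp_log_le_one hX (ξ i).1 p
  have hy := norm_lapExp_log_le_one hX (ξ i).2 p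
  have e1 := norm_one_sub_mul_ge hx ht ht'
  have e2 := norm_one_sub_mul_ge hy ht ht'
  have e3 := norm_one_sub_mul_ge (x := lapExp (ξ i).1 (Real.log p / X) *
    lapExp (ξ i).2 (Real.log p / X))
    (by rw [norm_mul]; exact mul_le_one₀ hx (norm_nonneg _) hy) ht ht'
  rw [zetaModelInv]
  rw [lapExp_mul_inv hp] at e1 e2 ⊢
  rw [lapExp_mul_lapExp_mul_inv hp] at e3 ⊢
  rw [lapExp_mul_inv hp]
  have e1' := norm_pos_iff.mp (lt_of_lt_of_le (by norm_num) e1)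
  have e2' := norm_pos_iff.mp (lt_of_lt_of_le (by norm_num) e2)
  have e3' := norm_pos_iff.mp (lt_of_lt_of_le (by norm_num) e3)
  rw [inv_inv, inv_inv, div_mul_eq_mul_div, mul_inv_cancel_left₀ e3',
    div_self (mul_ne_zero e1' e2')]

lemma one_lt_re_one_add_vline_div {X : ℝ} (hX : 0 < X) (ξ : ℝ) :
    1 < (1 + vline ξ / X : ℂ).re := by
  simp [vline_re, Complex.div_ofReal_re, hX]

lemma one_lt_re_one_add_vline_add_div {X : ℝ} (hX : 0 < X) (ξ ξ' : ℝ) :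
    1 < (1 + (vline ξ + vline ξ') / X : ℂ).re := by
  simp [vline_re, Complex.div_ofReal_re, hX]

lemma tendsto_prod_locFac {v : ℕ → ℝ}
    (hv : ∀ p : ℕ, p.Prime → |v p - (p : ℝ)⁻¹| ≤ 2 * ((p : ℝ)⁻¹) ^ 2) (D : ℕ) {X : ℝ}
    (hX : 0 < X) (ξ : ι → ℝ × ℝ) :
    Tendsto (fun P => ∏ p ∈ sievePrimes D P, locFac v X ξ p) atTop (𝓝 (eulerLim v D X ξ)) := by
  simp_rw [prod_locFac_eq v D _ hX ξ]
  obtain ⟨C, hC, h⟩ := exists_norm_eulerError_le (ι := ι) hv D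
  refine Tendsto.mul ?_ (tendsto_finsetProd _ fun i _ => ?_)
  · refine (multipliable_one_add_of_summable ?_).hasProd.tendsto_prod_nat
    exact (summable_const_mul_inv_sq C).of_nonneg_of_le (fun _ => norm_nonneg _) (h X hX ξ)
  · have h1 := one_lt_re_one_add_vline_div hX (ξ i).1
    have h2 := one_lt_re_one_add_vline_div hX (ξ i).2
    exact (riemannZeta_eulerProduct (one_lt_re_one_add_vline_add_div hX _ _)).mul
      (((riemannZeta_eulerProduct h1).inv₀ (riemannZeta_ne_zero_of_one_le_re h1.le)).mul
        ((riemannZeta_eulerProduct h2).inv₀ (riemannZeta_ne_zero_of_one_le_re h2.le)))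

/-- The polynomial weight dominating the Euler products. -/
noncomputable def polyWeight (ξ : ι → ℝ × ℝ) : ℝ :=
  ∏ i, ((1 + |(ξ i).1|) ^ 2 * (1 + |(ξ i).2|) ^ 2)

lemma exists_norm_eulerLim_le {v : ℕ → ℝ}
    (hv : ∀ p : ℕ, p.Prime → |v p - (p : ℝ)⁻¹| ≤ 2 * ((p : ℝ)⁻¹) ^ 2) (D : ℕ) :
    ∃ C > 0, ∀ X : ℝ, 2 ≤ X → ∀ ξ : ι → ℝ × ℝ,
      X ^ Fintype.card ι * ‖eulerLim v D X ξ‖ ≤ C * polyWeight ξ := by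
  obtain ⟨C, hC, h⟩ := exists_norm_eulerError_le (ι := ι) hv D
  obtain ⟨C₁, hC₁, h1⟩ := exists_norm_inv_riemannZeta_vline_le
  obtain ⟨C₂, hC₂, h2⟩ := exists_norm_riemannZeta_add_vline_le
  set W := ∑' p : ℕ, C * ((p : ℝ)⁻¹) ^ 2
  refine ⟨Real.exp W * (C₂ * C₁ ^ 2) ^ Fintype.card ι, by positivity, fun X hX ξ => ?_⟩
  have hX0 : 0 < X := by linarith
  have hR : ‖∏' p, (1 + eulerError v D X ξ p)‖ ≤ Real.exp W := by
    have hm := (multipliable_one_add_of_summable ((summable_const_mul_inv_sq C).of_nonneg_of_le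
      (fun _ => norm_nonneg _) (h X hX0 ξ))).hasProd.tendsto_prod_nat.norm
    refine le_of_tendsto' hm fun n => ?_
    rw [norm_prod]
    calc _ ≤ ∏ p ∈ range n, Real.exp (C * ((p : ℝ)⁻¹) ^ 2) := by
          refine prod_le_prod (fun _ _ => norm_nonneg _) fun p _ => ?_
          refine (norm_add_le _ _).trans ?_
          rw [norm_one]
          have := Real.add_one_le_exp (C * ((p : ℝ)⁻¹) ^ 2)
          linarith [h X hX0 ξ p]
      _ ≤ _ := by
          rw [← Real.exp_sum]
          exact Real.exp_le_exp.mpr ((summable_const_mul_inv_sq C).sum_le_tsum _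
            fun _ _ => by positivity)
  rw [eulerLim, norm_mul, norm_prod, polyWeight]
  calc _ = ‖∏' p, (1 + eulerError v D X ξ p)‖ * ∏ i, (X *
        ‖riemannZeta (1 + (vline (ξ i).1 + vline (ξ i).2) / X)
        * ((riemannZeta (1 + vline (ξ i).1 / X))⁻¹ * (riemannZeta (1 + vline (ξ i).2 / X))⁻¹)‖) := by
        rw [prod_mul_distrib, prod_const, card_univ]; ring
    _ ≤ Real.exp W * ∏ i, (C₂ * C₁ ^ 2 * ((1 + |(ξ i).1|) ^ 2 * (1 + |(ξ i).2|) ^ 2)) := by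
        refine mul_le_mul hR (prod_le_prod (fun i _ => by positivity) fun i _ => ?_)
          (by positivity) (by positivity)
        rw [norm_mul, norm_mul]
        have e0 := h2 X hX (ξ i).1 (ξ i).2
        have e1 := h1 X (by linarith) (ξ i).1
        have e2 := h1 X (by linarith) (ξ i).2
        calc _ ≤ X * (C₂ * X * (C₁ * (1 + |(ξ i).1|) ^ 2 / X * (C₁ * (1 + |(ξ i).2|) ^ 2 / X))) :=
              mul_le_mul_of_nonneg_left (mul_le_mul e0 (mul_le_mul e1 e2 (norm_nonneg _)
                (by positivity)) (by positivity) (by positivity)) hX0.le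
          _ = _ := by field_simp
    _ = _ := by rw [prod_mul_distrib, prod_const, card_univ]; ring

/-- The Euler factors of the singular series. -/
noncomputable def eulerConstFac (v : ℕ → ℝ) (D k p : ℕ) : ℝ :=
  if p.Prime then (if D < p then 1 - k * v p else 1) * ((1 - (p : ℝ)⁻¹)⁻¹) ^ k else 1

/-- The singular series. -/
noncomputable def eulerConst (v : ℕ → ℝ) (D k : ℕ) : ℝ := ∏' p, eulerConstFac v D k p

lemma tendsto_eulerError (v : ℕ → ℝ) (D : ℕ) (ξ : ι → ℝ × ℝ) (p : ℕ) :
    Tendsto (fun X => eulerError v D X ξ p) atTop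
      (𝓝 ((eulerConstFac v D (Fintype.card ι) p : ℂ) - 1)) := by
  unfold eulerError eulerConstFac
  split_ifs with hp hD
  · refine Tendsto.sub_const ?_ 1
    unfold eulerRatio locFac
    simp only [if_pos hD]
    push_cast
    refine Tendsto.mul ?_ ?_
    · have := ((tendsto_finsetSum univ fun i _ => tendsto_eFac (ξ i) p).const_mul
        (v p : ℂ)).const_add 1
      simpa [mul_comm, sub_eq_add_neg] using this
    · have := tendsto_finsetProd univ fun i _ => tendsto_zetaModelInv (ξ i) p hp
      simpa using this
  · refine Tendsto.sub_const ?_ 1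
    unfold eulerRatio
    simp only [if_neg hD, one_mul]
    have := tendsto_finsetProd univ fun i _ => tendsto_zetaModelInv (ξ i) p hp
    simpa using this
  · simp

lemma summable_eulerConstFac_sub_one {v : ℕ → ℝ}
    (hv : ∀ p : ℕ, p.Prime → |v p - (p : ℝ)⁻¹| ≤ 2 * ((p : ℝ)⁻¹) ^ 2) (D k : ℕ) :
    Summable fun p => ‖eulerConstFac v D k p - 1‖ := by
  obtain ⟨C, hC, h⟩ := exists_norm_eulerError_le (ι := Fin k) hv D
  refine (summable_const_mul_inv_sq C).of_nonneg_of_le (fun _ => norm_nonneg _) fun p => ?_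
  have h1 := (tendsto_eulerError v D (0 : Fin k → ℝ × ℝ) p).norm
  rw [Fintype.card_fin, ← Complex.ofReal_one, ← Complex.ofReal_sub, Complex.norm_real] at h1
  exact le_of_tendsto h1 ((eventually_gt_atTop 0).mono fun X hX => h X hX 0 p)

lemma multipliable_eulerConstFac {v : ℕ → ℝ}
    (hv : ∀ p : ℕ, p.Prime → |v p - (p : ℝ)⁻¹| ≤ 2 * ((p : ℝ)⁻¹) ^ 2) (D k : ℕ) :
    Multipliable (eulerConstFac v D k) := by
  simpa using multipliable_one_add_of_summable (summable_eulerConstFac_sub_one hv D k)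

lemma vline_ne_zero (ξ : ℝ) : vline ξ ≠ 0 := fun h => by
  have := vline_re ξ; rw [h] at this; simp at this

lemma vline_add_ne_zero (ξ ξ' : ℝ) : vline ξ + vline ξ' ≠ 0 := fun h => by
  have : (vline ξ + vline ξ').re = 2 := by rw [Complex.add_re, vline_re, vline_re]; norm_num
  rw [h] at this; simp at this

lemma tendsto_eulerLim {v : ℕ → ℝ}
    (hv : ∀ p : ℕ, p.Prime → |v p - (p : ℝ)⁻¹| ≤ 2 * ((p : ℝ)⁻¹) ^ 2) (D : ℕ) (ξ : ι → ℝ × ℝ) :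
    Tendsto (fun X : ℝ => (X : ℂ) ^ Fintype.card ι * eulerLim v D X ξ) atTop
      (𝓝 (eulerConst v D (Fintype.card ι) * ∏ i, (vline (ξ i).1 * vline (ξ i).2 /
        (vline (ξ i).1 + vline (ξ i).2)))) := by
  obtain ⟨C, hC, h⟩ := exists_norm_eulerError_le (ι := ι) hv D
  have h1 := tendsto_tprod_one_add_of_dominated_convergence (summable_const_mul_inv_sq C)
    (tendsto_eulerError v D ξ) ((eventually_gt_atTop 0).mono fun X hX => h X hX ξ)
  have h2 : ∏' p, (1 + ((eulerConstFac v D (Fintype.card ι) p : ℂ) - 1))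
      = (eulerConst v D (Fintype.card ι) : ℂ) := by
    simp only [add_sub_cancel]
    exact ((multipliable_eulerConstFac hv D _).map_tprod Complex.ofRealHom
      Complex.continuous_ofReal).symm
  rw [h2] at h1
  have h3 : Tendsto (fun X : ℝ => ∏ i, ((X : ℂ) * (riemannZeta (1 + (vline (ξ i).1 +
      vline (ξ i).2) / X) * ((riemannZeta (1 + vline (ξ i).1 / X))⁻¹ *
      (riemannZeta (1 + vline (ξ i).2 / X))⁻¹)))) atTop (𝓝 (∏ i, (vline (ξ i).1 * vline (ξ i).2 /
        (vline (ξ i).1 + vline (ξ i).2)))) := by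
    refine tendsto_finsetProd _ fun i _ => ?_
    have e0 := tendsto_riemannZeta_div (vline_add_ne_zero (ξ i).1 (ξ i).2)
    have e1 := (tendsto_riemannZeta_div (vline_ne_zero (ξ i).1)).inv₀
      (inv_ne_zero (vline_ne_zero _))
    have e2 := (tendsto_riemannZeta_div (vline_ne_zero (ξ i).2)).inv₀
      (inv_ne_zero (vline_ne_zero _))
    have e3 := e0.mul (e1.mul e2)
    rw [inv_inv, inv_inv, mul_comm, ← div_eq_mul_inv] at e3
    refine e3.congr' ?_
    filter_upwards [eventually_gt_atTop 0] with X hX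
    have : (X : ℂ) ≠ 0 := by exact_mod_cast hX.ne'
    simp only [mul_inv, inv_inv]
    field_simp
  refine (h1.mul h3).congr fun X => ?_
  rw [eulerLim, prod_mul_distrib, prod_const, card_univ]
  ring

lemma exists_norm_prod_locFac_le {v : ℕ → ℝ}
    (hv : ∀ p : ℕ, p.Prime → |v p - (p : ℝ)⁻¹| ≤ 2 * ((p : ℝ)⁻¹) ^ 2) (D : ℕ) {X : ℝ}
    (hX : 0 < X) :
    ∃ B, ∀ (P : ℕ) (ξ : ι → ℝ × ℝ), ‖∏ p ∈ sievePrimes D P, locFac v X ξ p‖ ≤ B := by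
  have hs : Summable fun p : ℕ => 9 * Fintype.card ι * (p : ℝ) ^ (-(1 + 1 / X)) := by
    refine Summable.mul_left _ (Real.summable_nat_rpow.mpr ?_)
    have : 0 < 1 / X := by positivity
    linarith
  refine ⟨Real.exp (∑' p : ℕ, 9 * Fintype.card ι * (p : ℝ) ^ (-(1 + 1 / X))), fun P ξ => ?_⟩
  rw [norm_prod]
  calc _ ≤ ∏ p ∈ sievePrimes D P, Real.exp (9 * Fintype.card ι * (p : ℝ) ^ (-(1 + 1 / X))) := by
        refine prod_le_prod (fun _ _ => norm_nonneg _) fun p hp => ?_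
        have hp := (mem_sievePrimes.mp hp).1
        have hp0 : (0 : ℝ) < p := by exact_mod_cast hp.pos
        have hp1 : (p : ℝ)⁻¹ ≤ 1 := inv_le_one_of_one_le₀ (by exact_mod_cast hp.one_le)
        have hip : 0 ≤ (p : ℝ)⁻¹ := by positivity
        refine (norm_add_le _ _).trans ?_
        rw [norm_one, norm_mul, Complex.norm_real, Real.norm_eq_abs]
        have h1 : |v p| ≤ 3 * (p : ℝ)⁻¹ := by
          have := hv p hp
          have h2 := abs_sub_abs_le_abs_sub (v p) (p : ℝ)⁻¹
          rw [abs_of_nonneg hip] at h2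
          nlinarith
        have h2 : ‖∑ i, eFac X (ξ i) p‖ ≤ Fintype.card ι * (3 * (p : ℝ) ^ (-(1 / X))) := by
          refine (norm_sum_le_of_le univ fun i _ => norm_eFac_le_rpow hX _ hp.pos).trans ?_
          simp
        have h3 : (p : ℝ) ^ (-(1 + 1 / X)) = (p : ℝ)⁻¹ * (p : ℝ) ^ (-(1 / X)) := by
          rw [neg_add, Real.rpow_add hp0, Real.rpow_neg_one]
        refine le_trans ?_ ((add_comm _ _).trans_le (Real.add_one_le_exp _))
        refine (add_le_add_iff_left 1).mpr ?_
        calc |v p| * ‖∑ i, eFac X (ξ i) p‖ ≤ (3 * (p : ℝ)⁻¹) *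
              (Fintype.card ι * (3 * (p : ℝ) ^ (-(1 / X)))) := by gcongr
          _ = _ := by rw [h3]; ring
    _ ≤ _ := by
        rw [← Real.exp_sum]
        exact Real.exp_le_exp.mpr (hs.sum_le_tsum _ fun _ _ => by positivity)

end EulerGlobal

section EulerIntegral

open Finset Filter Topology MeasureTheory

variable {ι : Type*} [Fintype ι]

/-- The product of Fourier densities over all variables. -/
noncomputable def pairWeight (ψ ψ' : ι → ℝ → ℂ) (ξ : ι → ℝ × ℝ) : ℂ :=
  ∏ i, (ψ i (ξ i).1 * ψ' i (ξ i).2)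

variable {g d g' d' : ι → ℝ → ℝ} {ψ ψ' : ι → ℝ → ℂ}

lemma continuous_pairWeight (h : ∀ i, LaplacePair (g i) (d i) (ψ i))
    (h' : ∀ i, LaplacePair (g' i) (d' i) (ψ' i)) : Continuous (pairWeight ψ ψ') := by
  have h1 := fun i => (h i).continuous
  have h2 := fun i => (h' i).continuous
  unfold pairWeight
  fun_prop

lemma integrable_polyWeight_mul (h : ∀ i, LaplacePair (g i) (d i) (ψ i))
    (h' : ∀ i, LaplacePair (g' i) (d' i) (ψ' i)) :
    Integrable fun ξ : ι → ℝ × ℝ => polyWeight ξ * ‖pairWeight ψ ψ' ξ‖ := by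
  have h1 : Integrable fun ξ : ι → ℝ × ℝ => ∏ i, ((1 + |(ξ i).1|) ^ 2 * ‖ψ i (ξ i).1‖ *
      ((1 + |(ξ i).2|) ^ 2 * ‖ψ' i (ξ i).2‖)) :=
    Integrable.fintype_prod (f := fun i (q : ℝ × ℝ) => (1 + |q.1|) ^ 2 * ‖ψ i q.1‖ *
      ((1 + |q.2|) ^ 2 * ‖ψ' i q.2‖)) fun i => ((h i).integrable 2).mul_prod ((h' i).integrable 2)
  refine h1.congr (Eventually.of_forall fun ξ => ?_)
  simp only [polyWeight, pairWeight, norm_prod, norm_mul, ← prod_mul_distrib]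
  exact prod_congr rfl fun i _ => by ring

lemma one_le_polyWeight (ξ : ι → ℝ × ℝ) : 1 ≤ polyWeight ξ := by
  unfold polyWeight
  rw [← Finset.prod_const_one (s := (univ : Finset ι))]
  refine prod_le_prod (fun _ _ => zero_le_one) fun i _ => ?_
  exact one_le_mul_of_one_le_of_one_le (one_le_pow₀ (by simp)) (one_le_pow₀ (by simp))

lemma integrable_pairWeight (h : ∀ i, LaplacePair (g i) (d i) (ψ i))
    (h' : ∀ i, LaplacePair (g' i) (d' i) (ψ' i)) : Integrable (pairWeight ψ ψ') := by
  refine (integrable_polyWeight_mul h h').mono' (continuous_pairWeight h h').aestronglyMeasurable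
    (Eventually.of_forall fun ξ => ?_)
  nlinarith [one_le_polyWeight ξ, norm_nonneg (pairWeight ψ ψ' ξ)]

lemma continuous_locFac (v : ℕ → ℝ) (X : ℝ) (p : ℕ) :
    Continuous fun ξ : ι → ℝ × ℝ => locFac v X ξ p := by
  have := fun i : ι => (continuous_eFac X p).comp (continuous_apply (A := fun _ => ℝ × ℝ) i)
  unfold locFac
  exact continuous_const.add (continuous_const.mul (continuous_finsetSum _ fun i _ => this i))

lemma continuous_prod_locFac (v : ℕ → ℝ) (X : ℝ) (S : Finset ℕ) :
    Continuous fun ξ : ι → ℝ × ℝ => ∏ p ∈ S, locFac v X ξ p :=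
  continuous_finsetProd _ fun p _ => continuous_locFac v X p

lemma aestronglyMeasurable_eulerLim {v : ℕ → ℝ}
    (hv : ∀ p : ℕ, p.Prime → |v p - (p : ℝ)⁻¹| ≤ 2 * ((p : ℝ)⁻¹) ^ 2) (D : ℕ) {X : ℝ}
    (hX : 0 < X) : AEStronglyMeasurable (fun ξ : ι → ℝ × ℝ => eulerLim v D X ξ) :=
  aestronglyMeasurable_of_tendsto_ae atTop
    (fun P => (continuous_prod_locFac v X (sievePrimes D P)).aestronglyMeasurable)
    (Eventually.of_forall fun ξ => tendsto_prod_locFac hv D hX ξ)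

lemma tendsto_integral_prod_locFac (h : ∀ i, LaplacePair (g i) (d i) (ψ i))
    (h' : ∀ i, LaplacePair (g' i) (d' i) (ψ' i)) {v : ℕ → ℝ}
    (hv : ∀ p : ℕ, p.Prime → |v p - (p : ℝ)⁻¹| ≤ 2 * ((p : ℝ)⁻¹) ^ 2) (D : ℕ) {X : ℝ}
    (hX : 0 < X) :
    Tendsto (fun P => ∫ ξ, pairWeight ψ ψ' ξ * ∏ p ∈ sievePrimes D P, locFac v X ξ p) atTop
        (𝓝 (∫ ξ, pairWeight ψ ψ' ξ * eulerLim v D X ξ)) ∧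
    Tendsto (fun P => ∫ ξ, ‖pairWeight ψ ψ' ξ‖ * ‖∏ p ∈ sievePrimes D P, locFac v X ξ p‖) atTop
        (𝓝 (∫ ξ, ‖pairWeight ψ ψ' ξ‖ * ‖eulerLim v D X ξ‖)) := by
  obtain ⟨B, hB⟩ := exists_norm_prod_locFac_le (ι := ι) hv D hX
  have hc := continuous_pairWeight h h'
  have hi := (integrable_pairWeight h h').norm.mul_const B
  constructor
  · refine tendsto_integral_of_dominated_convergence _
      (fun P => (hc.mul (continuous_prod_locFac v X _)).aestronglyMeasurable) hi
      (fun P => Eventually.of_forall fun ξ => ?_) (Eventually.of_forall fun ξ =>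
        (tendsto_prod_locFac hv D hX ξ).const_mul _)
    rw [norm_mul]
    gcongr
    exact hB P ξ
  · refine tendsto_integral_of_dominated_convergence _
      (fun P => (hc.norm.mul (continuous_prod_locFac v X _).norm).aestronglyMeasurable) hi
      (fun P => Eventually.of_forall fun ξ => ?_) (Eventually.of_forall fun ξ =>
        (tendsto_prod_locFac hv D hX ξ).norm.const_mul _)
    rw [Real.norm_of_nonneg (by positivity)]
    gcongr
    exact hB P ξ

lemma integral_prod_vline_eq (h : ∀ i, LaplacePair (g i) (d i) (ψ i))
    (h' : ∀ i, LaplacePair (g' i) (d' i) (ψ' i)) :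
    ∫ ξ : ι → ℝ × ℝ, pairWeight ψ ψ' ξ * ∏ i, (vline (ξ i).1 * vline (ξ i).2 /
        (vline (ξ i).1 + vline (ξ i).2))
      = ((∏ i, ∫ u in Set.Ioi 0, d i u * d' i u : ℝ) : ℂ) := by
  simp only [pairWeight, ← prod_mul_distrib]
  rw [integral_fintype_prod_volume_eq_prod (f := fun i (q : ℝ × ℝ) => ψ i q.1 * ψ' i q.2 *
    (vline q.1 * vline q.2 / (vline q.1 + vline q.2))), Complex.ofReal_prod]
  exact prod_congr rfl fun i _ => (h i).integral_pair (h' i)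

theorem eventually_integral_prod_locFac (h : ∀ i, LaplacePair (g i) (d i) (ψ i))
    (h' : ∀ i, LaplacePair (g' i) (d' i) (ψ' i)) {v : ℕ → ℝ}
    (hv : ∀ p : ℕ, p.Prime → |v p - (p : ℝ)⁻¹| ≤ 2 * ((p : ℝ)⁻¹) ^ 2) (D : ℕ) {ε : ℝ}
    (hε : 0 < ε) :
    ∀ᶠ X : ℝ in atTop, ∀ᶠ P in atTop,
      ‖(X : ℂ) ^ Fintype.card ι *
          (∫ ξ, pairWeight ψ ψ' ξ * ∏ p ∈ sievePrimes D P, locFac v X ξ p) - ((eulerConst v D (Fintype.card ι) * ∏ i, ∫ u in Set.Ioi 0, d i u * d' i u : ℝ) : ℂ)‖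
        ≤ ε := by
  obtain ⟨C, hC, hb⟩ := exists_norm_eulerLim_le (ι := ι) hv D
  have h1 : Tendsto (fun X : ℝ => ∫ ξ, pairWeight ψ ψ' ξ *
      ((X : ℂ) ^ Fintype.card ι * eulerLim v D X ξ)) atTop (𝓝 (∫ ξ, pairWeight ψ ψ' ξ *
      (eulerConst v D (Fintype.card ι) * ∏ i, (vline (ξ i).1 * vline (ξ i).2 /
        (vline (ξ i).1 + vline (ξ i).2))))) := by
    refine tendsto_integral_filter_of_dominated_convergence _ ?_ ?_
      ((integrable_polyWeight_mul h h').const_mul C)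
      (Eventually.of_forall fun ξ => (tendsto_eulerLim hv D ξ).const_mul _)
    · filter_upwards [eventually_gt_atTop 0] with X hX
      exact (continuous_pairWeight h h').aestronglyMeasurable.mul
        ((aestronglyMeasurable_eulerLim hv D hX).const_mul _)
    · filter_upwards [eventually_ge_atTop 2] with X hX
      refine Eventually.of_forall fun ξ => ?_
      rw [norm_mul, norm_mul, norm_pow, Complex.norm_real, Real.norm_of_nonneg (by linarith)]
      calc _ ≤ ‖pairWeight ψ ψ' ξ‖ * (C * polyWeight ξ) := mul_le_mul_of_nonneg_left (hb X hX ξ) (norm_nonneg _)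
        _ = _ := by ring
  simp only [mul_left_comm _ ((eulerConst v D _ : ℝ) : ℂ), integral_const_mul,
    mul_left_comm _ (_ ^ _), integral_prod_vline_eq h h'] at h1
  have h2 := Metric.tendsto_atTop.mp h1 (ε / 2) (by positivity)
  obtain ⟨X₀, hX₀⟩ := h2
  filter_upwards [eventually_ge_atTop X₀, eventually_gt_atTop 0] with X hX hX0
  have h3 := ((tendsto_integral_prod_locFac h h' hv D hX0).1.const_mul
    ((X : ℂ) ^ Fintype.card ι))
  have h4 := (Metric.tendsto_nhds.mp h3) (ε / 2) (by positivity)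
  filter_upwards [h4] with P hP
  have h5 := dist_triangle _ _ _ |>.trans (add_le_add hP.le (hX₀ X hX).le)
  rw [dist_eq_norm, add_halves] at h5
  push_cast at h5 ⊢
  exact h5

theorem exists_integral_norm_prod_locFac_le (h : ∀ i, LaplacePair (g i) (d i) (ψ i))
    (h' : ∀ i, LaplacePair (g' i) (d' i) (ψ' i)) {v : ℕ → ℝ}
    (hv : ∀ p : ℕ, p.Prime → |v p - (p : ℝ)⁻¹| ≤ 2 * ((p : ℝ)⁻¹) ^ 2) (D : ℕ) :
    ∃ C > 0, ∀ X : ℝ, 2 ≤ X → ∀ᶠ P in atTop,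
      X ^ Fintype.card ι * ∫ ξ, ‖pairWeight ψ ψ' ξ‖ * ‖∏ p ∈ sievePrimes D P, locFac v X ξ p‖
        ≤ C := by
  obtain ⟨C, hC, hb⟩ := exists_norm_eulerLim_le (ι := ι) hv D
  set I := ∫ ξ : ι → ℝ × ℝ, polyWeight ξ * ‖pairWeight ψ ψ' ξ‖
  have hI : 0 ≤ I := integral_nonneg fun ξ =>
    mul_nonneg (zero_le_one.trans (one_le_polyWeight ξ)) (norm_nonneg _)
  refine ⟨C * I + 1, by positivity, fun X hX => ?_⟩
  have hX0 : 0 < X := by linarith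
  have h1 : X ^ Fintype.card ι * ∫ ξ, ‖pairWeight ψ ψ' ξ‖ * ‖eulerLim v D X ξ‖ ≤ C * I := by
    rw [← integral_const_mul, ← integral_const_mul]
    refine integral_mono_of_nonneg (Eventually.of_forall fun ξ => by positivity)
      ((integrable_polyWeight_mul h h').const_mul C) (Eventually.of_forall fun ξ => ?_)
    calc _ = ‖pairWeight ψ ψ' ξ‖ * (X ^ Fintype.card ι * ‖eulerLim v D X ξ‖) := by ring
      _ ≤ ‖pairWeight ψ ψ' ξ‖ * (C * polyWeight ξ) := mul_le_mul_of_nonneg_left (hb X hX ξ) (norm_nonneg _)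
      _ = _ := by ring
  have h2 := ((tendsto_integral_prod_locFac h h' hv D hX0).2.const_mul (X ^ Fintype.card ι))
  filter_upwards [h2.eventually_le_const (lt_of_le_of_lt h1 (lt_add_one _))] with P hP using hP

end EulerIntegral

section EulerConst

open Finset Filter Topology

lemma abs_inv_sub_one_sub_inv_le {p : ℕ} (hp : p.Prime) :
    |((p : ℝ) - 1)⁻¹ - (p : ℝ)⁻¹| ≤ 2 * ((p : ℝ)⁻¹) ^ 2 := by
  have h2 : (2 : ℝ) ≤ p := by exact_mod_cast hp.two_le
  have h1 : (p : ℝ) - 1 ≠ 0 := by linarith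
  have h0 : (p : ℝ) ≠ 0 := by linarith
  have e : ((p : ℝ) - 1)⁻¹ - (p : ℝ)⁻¹ = ((p : ℝ) - 1)⁻¹ * (p : ℝ)⁻¹ := by field_simp; ring
  rw [e, abs_of_nonneg (mul_nonneg (inv_nonneg.mpr (by linarith)) (by positivity)), pow_two,
    ← mul_assoc]
  refine mul_le_mul_of_nonneg_right ?_ (by positivity)
  rw [inv_le_iff_one_le_mul₀ (by linarith)]
  field_simp
  linarith

lemma abs_inv_sub_inv_le {p : ℕ} : |(p : ℝ)⁻¹ - (p : ℝ)⁻¹| ≤ 2 * ((p : ℝ)⁻¹) ^ 2 := by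
  rw [sub_self, abs_zero]; positivity

theorem eulerConst_three_eq (D : ℕ) :
    eulerConst (fun p => (p : ℝ)⁻¹) D 3 =
      eulerConst (fun p => ((p : ℝ) - 1)⁻¹) D 2 *
        ∏ p ∈ Nat.primesBelow (D + 1), (1 - (p : ℝ)⁻¹)⁻¹ := by
  set G : ℕ → ℝ := fun p => if p ∈ Nat.primesBelow (D + 1) then (1 - (p : ℝ)⁻¹)⁻¹ else 1
  have hG : ∀ p ∉ Nat.primesBelow (D + 1), G p = 1 := fun p hp => if_neg hp
  have h1 : ∏' p, G p = ∏ p ∈ Nat.primesBelow (D + 1), (1 - (p : ℝ)⁻¹)⁻¹ := by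
    rw [tprod_eq_prod hG]
    exact prod_congr rfl fun p hp => if_pos hp
  have h2 : Multipliable G := multipliable_of_ne_finset_one hG
  rw [← h1, eulerConst, eulerConst, ← (multipliable_eulerConstFac
    (fun p hp => abs_inv_sub_one_sub_inv_le hp) D 2).tprod_mul h2]
  refine tprod_congr fun p => ?_
  simp only [eulerConstFac, G, Nat.mem_primesBelow, Nat.lt_succ_iff]
  by_cases hp : p.Prime
  · have hp2 : (2 : ℝ) ≤ p := by exact_mod_cast hp.two_le
    by_cases hD : D < p
    · simp only [hp, hD, if_true, not_le.mpr hD, false_and, if_false, mul_one]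
      have h1 : (p : ℝ) - 1 ≠ 0 := by linarith
      have h0 : (p : ℝ) ≠ 0 := by linarith
      have h3 : (1 - (p : ℝ)⁻¹)⁻¹ = p / (p - 1) := by field_simp
      rw [h3]
      push_cast
      field_simp
      ring
    · simp only [hp, hD, if_true, if_false, not_lt.mp hD, true_and, one_mul]
      ring
  · simp [hp]

theorem eulerConst_three_pos {D : ℕ} (hD : 3 ≤ D) :
    0 < eulerConst (fun p => (p : ℝ)⁻¹) D 3 := by
  have hv : ∀ p : ℕ, p.Prime → |(p : ℝ)⁻¹ - (p : ℝ)⁻¹| ≤ 2 * ((p : ℝ)⁻¹) ^ 2 :=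
    fun p _ => abs_inv_sub_inv_le
  have hpos : ∀ p, 0 < eulerConstFac (fun p => (p : ℝ)⁻¹) D 3 p := by
    intro p
    unfold eulerConstFac
    split_ifs with hp hDp
    · have h3 : (3 : ℝ) < p := by exact_mod_cast hD.trans_lt hDp
      have h4 : (3 : ℝ) * (p : ℝ)⁻¹ < 1 := by
        rw [← div_eq_mul_inv, div_lt_one (by linarith)]; exact h3
      have h5 : 0 < (p : ℝ)⁻¹ := by positivity
      refine mul_pos (by push_cast; linarith) (pow_pos (inv_pos.mpr (by linarith)) _)
    · rw [one_mul]
      refine pow_pos (inv_pos.mpr (sub_pos.mpr (inv_lt_one_of_one_lt₀ ?_))) _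
      exact_mod_cast hp.one_lt
    · exact one_pos
  have hs := Real.summable_log_one_add_of_summable (summable_eulerConstFac_sub_one hv D 3).of_norm
  simp only [add_sub_cancel] at hs
  rw [eulerConst, ← Real.rexp_tsum_eq_tprod hpos hs]
  exact Real.exp_pos _

end EulerConst

section Vanishing

open Finset Filter Topology MeasureTheory

variable {ι : Type*} [Fintype ι]

/-- The product of shifted exponentials. -/
noncomputable def shiftFac (s s' : ι → ℝ) (ξ : ι → ℝ × ℝ) : ℂ :=
  ∏ i, (lapExp (ξ i).1 (s i) * lapExp (ξ i).2 (s' i))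

variable {g d g' d' : ι → ℝ → ℝ} {ψ ψ' : ι → ℝ → ℂ}

lemma shiftFac_add (s t s' t' : ι → ℝ) (ξ : ι → ℝ × ℝ) :
    shiftFac (s + t) (s' + t') ξ = shiftFac s s' ξ * shiftFac t t' ξ := by
  rw [shiftFac, shiftFac, shiftFac, ← prod_mul_distrib]
  refine prod_congr rfl fun i _ => ?_
  rw [Pi.add_apply, Pi.add_apply, lapExp_add, lapExp_add]; ring

lemma shiftFac_single [DecidableEq ι] (i : ι) (t t' : ℝ) (ξ : ι → ℝ × ℝ) :
    shiftFac (Pi.single i t) (Pi.single i t') ξ = lapExp (ξ i).1 t * lapExp (ξ i).2 t' := by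
  rw [shiftFac, prod_eq_single i]
  · simp
  · intro j _ hj
    simp [Pi.single_eq_of_ne hj, lapExp_zero]
  · simp

lemma continuous_shiftFac (s s' : ι → ℝ) : Continuous (shiftFac s s') := by
  unfold shiftFac lapExp; fun_prop

lemma norm_shiftFac_le {s s' : ι → ℝ} (hs : ∀ i, 0 ≤ s i) (hs' : ∀ i, 0 ≤ s' i)
    (ξ : ι → ℝ × ℝ) : ‖shiftFac s s' ξ‖ ≤ 1 := by
  rw [shiftFac, norm_prod]
  refine prod_le_one (fun _ _ => norm_nonneg _) fun i _ => ?_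
  rw [norm_mul, norm_lapExp, norm_lapExp, ← Real.exp_add, Real.exp_le_one_iff]
  linarith [hs i, hs' i]

lemma integrable_pairWeight_mul (h : ∀ i, LaplacePair (g i) (d i) (ψ i))
    (h' : ∀ i, LaplacePair (g' i) (d' i) (ψ' i)) {F : (ι → ℝ × ℝ) → ℂ} (hF : Continuous F) {B : ℝ}
    (hB : ∀ ξ, ‖F ξ‖ ≤ B) : Integrable fun ξ => pairWeight ψ ψ' ξ * F ξ :=
  (integrable_pairWeight h h').mul_bdd hF.aestronglyMeasurable (Eventually.of_forall hB)

lemma integral_pairWeight_mul_shiftFac (h : ∀ i, LaplacePair (g i) (d i) (ψ i))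
    (h' : ∀ i, LaplacePair (g' i) (d' i) (ψ' i)) {s s' : ι → ℝ} (hs : ∀ i, 0 ≤ s i)
    (hs' : ∀ i, 0 ≤ s' i) :
    ∫ ξ, pairWeight ψ ψ' ξ * shiftFac s s' ξ = ∏ i, ((g i (s i) : ℂ) * g' i (s' i)) := by
  simp only [pairWeight, shiftFac, ← prod_mul_distrib]
  rw [integral_fintype_prod_volume_eq_prod (f := fun i (q : ℝ × ℝ) => ψ i q.1 * ψ' i q.2 *
    (lapExp q.1 (s i) * lapExp q.2 (s' i)))]
  refine prod_congr rfl fun i _ => ?_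
  rw [← (h i).integral_eq _ (hs i), ← (h' i).integral_eq _ (hs' i), ← integral_prod_mul]
  exact integral_congr_ae (Eventually.of_forall fun q => by ring)

/-- A local polynomial in the variables. -/
noncomputable def locPoly (X : ℝ) (u : ℕ → ℂ) (c : ℕ → ι → ℂ) (ξ : ι → ℝ × ℝ) (p : ℕ) : ℂ :=
  u p + ∑ i, c p i * eFac X (ξ i) p

lemma continuous_locPoly (X : ℝ) (u : ℕ → ℂ) (c : ℕ → ι → ℂ) (p : ℕ) :
    Continuous fun ξ : ι → ℝ × ℝ => locPoly X u c ξ p := by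
  have := fun i : ι => (continuous_eFac X p).comp (continuous_apply (A := fun _ => ℝ × ℝ) i)
  unfold locPoly
  exact continuous_const.add (continuous_finsetSum _ fun i _ => continuous_const.mul (this i))

lemma norm_locPoly_le {X : ℝ} (hX : 0 < X) (u : ℕ → ℂ) (c : ℕ → ι → ℂ) (ξ : ι → ℝ × ℝ) (p : ℕ) :
    ‖locPoly X u c ξ p‖ ≤ ‖u p‖ + ∑ i, ‖c p i‖ * 3 := by
  refine (norm_add_le _ _).trans (add_le_add le_rfl (norm_sum_le_of_le _ fun i _ => ?_))
  rw [norm_mul]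
  gcongr
  exact norm_eFac_le hX _ _

lemma continuous_prod_locPoly (X : ℝ) (u : ℕ → ℂ) (c : ℕ → ι → ℂ) (S : Finset ℕ) :
    Continuous fun ξ : ι → ℝ × ℝ => ∏ p ∈ S, locPoly X u c ξ p :=
  continuous_finsetProd _ fun p _ => continuous_locPoly X u c p

lemma norm_prod_locPoly_le {X : ℝ} (hX : 0 < X) (u : ℕ → ℂ) (c : ℕ → ι → ℂ) (S : Finset ℕ)
    (ξ : ι → ℝ × ℝ) :
    ‖∏ p ∈ S, locPoly X u c ξ p‖ ≤ ∏ p ∈ S, (‖u p‖ + ∑ i, ‖c p i‖ * 3) := by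
  rw [norm_prod]
  exact prod_le_prod (fun _ _ => norm_nonneg _) fun p _ => norm_locPoly_le hX u c ξ p

lemma integrable_shift_locPoly (h : ∀ i, LaplacePair (g i) (d i) (ψ i))
    (h' : ∀ i, LaplacePair (g' i) (d' i) (ψ' i)) {X : ℝ} (hX : 0 < X) (u : ℕ → ℂ) (c : ℕ → ι → ℂ)
    (S : Finset ℕ) {s s' : ι → ℝ} (hs : ∀ i, 0 ≤ s i) (hs' : ∀ i, 0 ≤ s' i) :
    Integrable fun ξ => pairWeight ψ ψ' ξ * (shiftFac s s' ξ * ∏ p ∈ S, locPoly X u c ξ p) := by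
  refine integrable_pairWeight_mul h h'
    ((continuous_shiftFac s s').mul (continuous_prod_locPoly X u c S))
    (B := 1 * ∏ p ∈ S, (‖u p‖ + ∑ i, ‖c p i‖ * 3)) fun ξ => ?_
  rw [norm_mul]
  exact mul_le_mul (norm_shiftFac_le hs hs' ξ) (norm_prod_locPoly_le hX u c S ξ) (norm_nonneg _)
    zero_le_one

lemma integral_shift_locPoly_eq_zero (h : ∀ i, LaplacePair (g i) (d i) (ψ i))
    (h' : ∀ i, LaplacePair (g' i) (d' i) (ψ' i)) {a a' : ι → ℝ}
    (ha : ∀ i u, a i ≤ u → g i u = 0) (ha' : ∀ i u, a' i ≤ u → g' i u = 0)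
    {X : ℝ} (hX : 0 < X) (u : ℕ → ℂ) (c : ℕ → ι → ℂ) (Q : Finset ℕ) (hQ : ∀ p ∈ Q, u p = 0)
    (S : Finset ℕ) :
    ∀ s s' : ι → ℝ, (∀ i, 0 ≤ s i) → (∀ i, 0 ≤ s' i) →
      ∑ i, (a i + a' i) < ∑ i, (s i + s' i) + ∑ p ∈ Q ∩ S, Real.log p / X →
      ∫ ξ, pairWeight ψ ψ' ξ * (shiftFac s s' ξ * ∏ p ∈ S, locPoly X u c ξ p) = 0 := by
  classical
  induction S using Finset.induction with
  | empty =>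
    intro s s' hs hs' hlt
    simp only [inter_empty, sum_empty, add_zero, prod_empty, mul_one] at hlt ⊢
    rw [integral_pairWeight_mul_shiftFac h h' hs hs']
    obtain ⟨i, -, hi⟩ := exists_lt_of_sum_lt hlt
    refine prod_eq_zero (mem_univ i) ?_
    by_cases h1 : a i ≤ s i
    · rw [ha i _ h1]; simp
    · rw [ha' i (s' i) (by linarith [not_le.mp h1])]; simp
  | insert p S hp ih =>
    intro s s' hs hs' hlt
    set t := Real.log p / X with ht
    have ht0 : 0 ≤ t := div_nonneg (Real.log_natCast_nonneg p) hX.le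
    have hsub : ∑ q ∈ Q ∩ insert p S, Real.log q / X ≤ t + ∑ q ∈ Q ∩ S, Real.log q / X := by
      by_cases hpQ : p ∈ Q
      · rw [inter_insert_of_mem hpQ, sum_insert (by simp [hp])]
      · rw [inter_insert_of_notMem hpQ]; linarith
    have hsum : ∀ (i : ι) (x : ℝ), ∑ j, (Pi.single i x : ι → ℝ) j = x := fun i x => by simp
    have hnn : ∀ (i : ι) (x : ℝ), 0 ≤ x → ∀ j, 0 ≤ (Pi.single i x : ι → ℝ) j := by
      intro i x hx j
      by_cases hj : j = i
      · subst hj; simpa using hx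
      · simp [Pi.single_eq_of_ne hj]
    have hshift : ∀ (i : ι) (b b' : ℝ), 0 ≤ b → 0 ≤ b' → t ≤ b + b' →
        ∫ ξ, pairWeight ψ ψ' ξ * (shiftFac (s + Pi.single i b) (s' + Pi.single i b') ξ *
          ∏ p ∈ S, locPoly X u c ξ p) = 0 := by
      intro i b b' hb hb' hbt
      refine ih _ _ (fun j => add_nonneg (hs j) (hnn i b hb j))
        (fun j => add_nonneg (hs' j) (hnn i b' hb' j)) ?_
      simp only [Pi.add_apply, sum_add_distrib, hsum] at hlt ⊢
      linarith
    have hint : ∀ (i : ι) (b b' : ℝ), 0 ≤ b → 0 ≤ b' →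
        Integrable fun ξ => pairWeight ψ ψ' ξ * (shiftFac (s + Pi.single i b)
          (s' + Pi.single i b') ξ * ∏ p ∈ S, locPoly X u c ξ p) := fun i b b' hb hb' =>
      integrable_shift_locPoly h h' hX u c S (fun j => add_nonneg (hs j) (hnn i b hb j))
        (fun j => add_nonneg (hs' j) (hnn i b' hb' j))
    have hexp : ∀ ξ, pairWeight ψ ψ' ξ * (shiftFac s s' ξ * ∏ p ∈ insert p S, locPoly X u c ξ p)
        = u p * (pairWeight ψ ψ' ξ * (shiftFac s s' ξ * ∏ p ∈ S, locPoly X u c ξ p)) +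
          ∑ i, c p i * (pairWeight ψ ψ' ξ * (shiftFac (s + Pi.single i t) (s' + Pi.single i t) ξ *
            ∏ p ∈ S, locPoly X u c ξ p) -
            pairWeight ψ ψ' ξ * (shiftFac (s + Pi.single i t) (s' + Pi.single i 0) ξ *
            ∏ p ∈ S, locPoly X u c ξ p) -
            pairWeight ψ ψ' ξ * (shiftFac (s + Pi.single i 0) (s' + Pi.single i t) ξ *
            ∏ p ∈ S, locPoly X u c ξ p)) := by
      intro ξ
      rw [prod_insert hp]
      conv_lhs => rw [locPoly]
      rw [show ∀ x y z w v : ℂ, x * (y * ((z + w) * v)) = z * (x * (y * v)) + w * (x * (y * v)) by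
        intros; ring, sum_mul]
      congr 1
      refine sum_congr rfl fun i _ => ?_
      simp only [shiftFac_add, shiftFac_single, lapExp_zero, eFac, ← ht]
      ring
    simp_rw [hexp]
    have hi3 : ∀ i, Integrable fun ξ => c p i * (pairWeight ψ ψ' ξ * (shiftFac (s + Pi.single i t)
          (s' + Pi.single i t) ξ * ∏ p ∈ S, locPoly X u c ξ p) -
            pairWeight ψ ψ' ξ * (shiftFac (s + Pi.single i t) (s' + Pi.single i 0) ξ *
            ∏ p ∈ S, locPoly X u c ξ p) -
            pairWeight ψ ψ' ξ * (shiftFac (s + Pi.single i 0) (s' + Pi.single i t) ξ *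
            ∏ p ∈ S, locPoly X u c ξ p)) := fun i =>
      (((hint i t t ht0 ht0).sub (hint i t 0 ht0 le_rfl)).sub
        (hint i 0 t le_rfl ht0)).const_mul _
    rw [integral_add ((integrable_shift_locPoly h h' hX u c S hs hs').const_mul _)
      (integrable_finsetSum _ fun i _ => hi3 i), integral_const_mul,
      integral_finsetSum _ fun i _ => hi3 i]
    have h1 : u p * ∫ ξ, pairWeight ψ ψ' ξ * (shiftFac s s' ξ * ∏ p ∈ S, locPoly X u c ξ p) = 0 := by
      by_cases hpQ : p ∈ Q
      · rw [hQ p hpQ, zero_mul]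
      · rw [ih s s' hs hs' (by rwa [inter_insert_of_notMem hpQ] at hlt), mul_zero]
    rw [h1, zero_add]
    refine sum_eq_zero fun i _ => ?_
    rw [integral_const_mul]
    refine mul_eq_zero_of_right _ ((integral_sub ((hint i t t ht0 ht0).sub (hint i t 0 ht0 le_rfl))
      (hint i 0 t le_rfl ht0)).trans ?_)
    rw [hshift i 0 t le_rfl ht0 (by linarith), sub_zero]
    refine (integral_sub (hint i t t ht0 ht0) (hint i t 0 ht0 le_rfl)).trans ?_
    rw [hshift i t t ht0 ht0 (by linarith), hshift i t 0 ht0 le_rfl (by linarith), sub_zero]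

theorem integral_prod_locPoly_eq_zero (h : ∀ i, LaplacePair (g i) (d i) (ψ i))
    (h' : ∀ i, LaplacePair (g' i) (d' i) (ψ' i)) {a a' : ι → ℝ}
    (ha : ∀ i u, a i ≤ u → g i u = 0) (ha' : ∀ i u, a' i ≤ u → g' i u = 0)
    {X : ℝ} (hX : 0 < X) (u : ℕ → ℂ) (c : ℕ → ι → ℂ) {Q S : Finset ℕ} (hQS : Q ⊆ S)
    (hQ : ∀ p ∈ Q, u p = 0) (hlt : X * ∑ i, (a i + a' i) < ∑ p ∈ Q, Real.log p) :
    ∫ ξ, pairWeight ψ ψ' ξ * ∏ p ∈ S, locPoly X u c ξ p = 0 := by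
  have := integral_shift_locPoly_eq_zero h h' ha ha' hX u c Q hQ S 0 0 (fun _ => le_rfl)
    (fun _ => le_rfl) (by
      rw [inter_eq_left.mpr hQS, ← sum_div]
      simpa [lt_div_iff₀ hX, mul_comm] using hlt)
  simpa [shiftFac, lapExp_zero] using this

end Vanishing

section ResidueSums

open Finset

/-- The sum of `1 / m` over a residue class. -/
lemma abs_sum_inv_modEq_sub_le {r : ℕ} (hr : 0 < r) (b N : ℕ) {n : ℕ} (hn : N ≤ n) :
    |(∑ m ∈ Ioc N n with m ≡ b [MOD r], (m : ℝ)⁻¹) - (∑ m ∈ Ioc N n, (m : ℝ)⁻¹) / r|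
      ≤ ((N : ℝ) + 1)⁻¹ := by
  have hr' : (0 : ℝ) < r := by exact_mod_cast hr
  have hrz : (0 : ℤ) < r := by exact_mod_cast hr
  set f : ℕ → ℝ := fun m => (((m : ℤ) - b) % r : ℤ) / r with hf
  have hf0 : ∀ m, 0 ≤ f m := fun m =>
    div_nonneg (by exact_mod_cast Int.emod_nonneg _ hrz.ne') hr'.le
  have hf1 : ∀ m, f m ≤ 1 := fun m => by
    rw [hf, div_le_one hr']
    exact_mod_cast (Int.emod_lt_of_pos _ hrz).le
  have hstep : ∀ m : ℕ, (if m + 1 ≡ b [MOD r] then (1 : ℝ) else 0) - 1 / r = f m - f (m + 1) := by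
    intro m
    set x : ℤ := (m : ℤ) + 1 - b with hx
    have hmod : m + 1 ≡ b [MOD r] ↔ x % r = 0 := by
      rw [← Int.natCast_modEq_iff, Int.modEq_iff_dvd, ← Int.dvd_iff_emod_eq_zero, hx, ← dvd_neg]
      push_cast
      rw [neg_sub]
    have e1 : f (m + 1) = ((x % r : ℤ) : ℝ) / r := by simp [hf, hx]
    have e2 : f m = (((x - 1) % r : ℤ) : ℝ) / r := by
      simp only [hf, hx]; congr 3; ring
    rw [e1, e2]
    by_cases h0 : x % r = 0
    · rw [if_pos (hmod.mpr h0), h0]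
      have : (x - 1) % r = r - 1 := by
        rw [Int.sub_emod, h0, zero_sub, ← Int.add_emod_right]
        rcases eq_or_lt_of_le (show (1 : ℤ) ≤ r by omega) with h | h
        · rw [← h]; simp
        · rw [Int.emod_eq_of_lt (by omega : (0:ℤ) ≤ 1) h]
          exact Int.emod_eq_of_lt (by omega) (by omega) |>.trans (by ring)
      rw [this]; push_cast; field_simp; ring
    · rw [if_neg (mt hmod.mp h0)]
      have h2 := Int.emod_nonneg x hrz.ne'
      have h3 := Int.emod_lt_of_pos x hrz
      have : (x - 1) % r = x % r - 1 := by
        conv_lhs => rw [← Int.emod_add_mul_ediv x r]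
        rw [show x % r + r * (x / r) - 1 = (x % r - 1) + r * (x / r) by ring,
          Int.add_mul_emod_self_left]
        exact Int.emod_eq_of_lt (by omega) (by omega)
      rw [this]; push_cast; ring
  have key : ∀ n, N ≤ n → (∑ m ∈ Ioc N n, ((if m ≡ b [MOD r] then (1 : ℝ) else 0) - 1 / r) * (m : ℝ)⁻¹)
      + f n * ((n : ℝ) + 1)⁻¹ ≤ ((N : ℝ) + 1)⁻¹ ∧ -((N : ℝ) + 1)⁻¹ + ((n : ℝ) + 1)⁻¹ ≤
      (∑ m ∈ Ioc N n, ((if m ≡ b [MOD r] then (1 : ℝ) else 0) - 1 / r) * (m : ℝ)⁻¹)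
      + f n * ((n : ℝ) + 1)⁻¹ := by
    intro n hn
    induction n, hn using Nat.le_induction with
    | base =>
      have : (0 : ℝ) < ((N : ℝ) + 1)⁻¹ := by positivity
      simp only [Ioc_self, sum_empty, zero_add]
      constructor
      · nlinarith [hf1 N]
      · nlinarith [hf0 N]
    | succ n hn ih =>
      rw [show Ioc N (n + 1) = insert (n + 1) (Ioc N n) by ext; simp; omega, sum_insert (by simp), hstep]
      have h1 : ((n : ℝ) + 1 + 1)⁻¹ ≤ ((n : ℝ) + 1)⁻¹ := by gcongr; linarith
      push_cast
      set S := ∑ m ∈ Ioc N n, ((if m ≡ b [MOD r] then (1 : ℝ) else 0) - 1 / r) * (m : ℝ)⁻¹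
      constructor
      · nlinarith [hf0 (n + 1)]
      · nlinarith [hf1 (n + 1)]
  have e : (∑ m ∈ Ioc N n with m ≡ b [MOD r], (m : ℝ)⁻¹) - (∑ m ∈ Ioc N n, (m : ℝ)⁻¹) / r =
      ∑ m ∈ Ioc N n, ((if m ≡ b [MOD r] then (1 : ℝ) else 0) - 1 / r) * (m : ℝ)⁻¹ := by
    rw [sum_filter, sum_div, ← sum_sub_distrib]
    refine sum_congr rfl fun m _ => ?_
    split_ifs <;> ring
  obtain ⟨h1, h2⟩ := key n hn
  have h3 : (0 : ℝ) < ((n : ℝ) + 1)⁻¹ := by positivity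
  rw [e, abs_le]
  constructor
  · nlinarith [hf1 n]
  · nlinarith [hf0 n]

lemma norm_sum_prod_residues_sub_le {ι : Type*} [Fintype ι] {N n : ℕ} (hn : N ≤ n)
    (ρ : ℕ → ι → ℕ) (e : ℕ → ι → ℂ) {B : ℝ} (hB : 0 ≤ B) (he : ∀ p, ∑ i, ‖e p i‖ ≤ B)
    (Q : Finset ℕ) (hQ : ∀ p ∈ Q, p.Prime) :
    ∀ r b : ℕ, 0 < r → (∀ p ∈ Q, r.Coprime p) →
      ‖(∑ m ∈ Ioc N n with m ≡ b [MOD r], ((m : ℂ)⁻¹ *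
          ∏ p ∈ Q, ∑ i, if m ≡ ρ p i [MOD p] then e p i else 0)) -
        (∑ m ∈ Ioc N n, (m : ℂ)⁻¹) / r * ∏ p ∈ Q, ((p : ℂ)⁻¹ * ∑ i, e p i)‖
      ≤ B ^ #Q * ((N : ℝ) + 1)⁻¹ := by
  classical
  induction Q using Finset.induction with
  | empty =>
    intro r b hr _
    have := abs_sum_inv_modEq_sub_le hr b N hn
    rw [← Real.norm_eq_abs, ← Complex.norm_real] at this
    push_cast at this
    simpa using this
  | insert p Q hp ih =>
    intro r b hr hcop
    have hpp := hQ p (mem_insert_self p Q)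
    have hrp := hcop p (mem_insert_self p Q)
    obtain ⟨t, ht⟩ : ∃ t : ι → ℕ, ∀ i, t i ≡ b [MOD r] ∧ t i ≡ ρ p i [MOD p] :=
      ⟨fun i => (Nat.chineseRemainder hrp b (ρ p i)).1,
        fun i => (Nat.chineseRemainder hrp b (ρ p i)).2⟩
    have hiff : ∀ i m, (m ≡ b [MOD r] ∧ m ≡ ρ p i [MOD p]) ↔ m ≡ t i [MOD r * p] := fun i m => by
      rw [← Nat.modEq_and_modEq_iff_modEq_mul hrp]
      exact ⟨fun h => ⟨h.1.trans (ht i).1.symm, h.2.trans (ht i).2.symm⟩,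
        fun h => ⟨h.1.trans (ht i).1, h.2.trans (ht i).2⟩⟩
    have ih' := fun i => ih (fun q hq => hQ q (mem_insert_of_mem hq)) (r * p) (t i)
      (Nat.mul_pos hr hpp.pos) fun q hq => Nat.Coprime.mul_left
        (hcop q (mem_insert_of_mem hq)) ((Nat.coprime_primes hpp (hQ q (mem_insert_of_mem hq))).mpr
          (fun h => hp (h ▸ hq)))
    have hE : (∑ m ∈ Ioc N n with m ≡ b [MOD r], ((m : ℂ)⁻¹ *
          ∏ p ∈ insert p Q, ∑ i, if m ≡ ρ p i [MOD p] then e p i else 0)) -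
        (∑ m ∈ Ioc N n, (m : ℂ)⁻¹) / r * ∏ p ∈ insert p Q, ((p : ℂ)⁻¹ * ∑ i, e p i) =
        ∑ i, e p i * ((∑ m ∈ Ioc N n with m ≡ t i [MOD r * p], ((m : ℂ)⁻¹ *
          ∏ p ∈ Q, ∑ i, if m ≡ ρ p i [MOD p] then e p i else 0)) -
        (∑ m ∈ Ioc N n, (m : ℂ)⁻¹) / (r * p : ℕ) * ∏ p ∈ Q, ((p : ℂ)⁻¹ * ∑ i, e p i)) := by
      simp_rw [mul_sub, sum_sub_distrib]
      congr 1
      · simp_rw [mul_sum, sum_filter]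
        rw [sum_comm]
        refine sum_congr rfl fun m _ => ?_
        by_cases hm : m ≡ b [MOD r]
        · rw [if_pos hm, prod_insert hp, sum_mul, mul_sum]
          refine sum_congr rfl fun i _ => ?_
          simp only [← hiff i m, hm, true_and]
          split_ifs <;> ring
        · rw [if_neg hm]
          refine (sum_eq_zero fun i _ => ?_).symm
          rw [if_neg fun h => hm ((hiff i m).mpr h).1]
      · rw [prod_insert hp, ← sum_mul]
        push_cast
        rw [div_eq_mul_inv, div_eq_mul_inv, mul_inv]
        ring
    rw [hE, card_insert_of_notMem hp, pow_succ']
    calc _ ≤ ∑ i, ‖e p i‖ * (B ^ #Q * ((N : ℝ) + 1)⁻¹) := norm_sum_le_of_le _ fun i _ => by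
          rw [norm_mul]
          exact mul_le_mul_of_nonneg_left (ih' i) (norm_nonneg _)
      _ = (∑ i, ‖e p i‖) * (B ^ #Q * ((N : ℝ) + 1)⁻¹) := by rw [sum_mul]
      _ ≤ B * (B ^ #Q * ((N : ℝ) + 1)⁻¹) := mul_le_mul_of_nonneg_right (he p) (by positivity)
      _ = _ := by ring

/-- Harmonic sums over exponential ranges. -/
lemma abs_sum_inv_Ioc_floor_exp_sub_le {X Y : ℝ} (hX : 0 ≤ X) (hXY : X ≤ Y) :
    |(∑ m ∈ Ioc ⌊Real.exp X⌋₊ ⌊Real.exp Y⌋₊, (m : ℝ)⁻¹) - (Y - X)| ≤ 4 := by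
  have key : ∀ Z : ℝ, 0 ≤ Z → Z - 1 ≤ (harmonic ⌊Real.exp Z⌋₊ : ℝ) ∧
      (harmonic ⌊Real.exp Z⌋₊ : ℝ) ≤ Z + 1 := by
    intro Z hZ
    have h1 : (1 : ℝ) ≤ Real.exp Z := Real.one_le_exp hZ
    constructor
    · refine le_trans ?_ (log_add_one_le_harmonic _)
      have : Z ≤ Real.log (⌊Real.exp Z⌋₊ + 1 : ℕ) := by
        rw [Real.le_log_iff_exp_le (by positivity)]
        push_cast
        exact (Nat.lt_floor_add_one _).le
      linarith
    · refine (harmonic_le_one_add_log _).trans ?_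
      have : Real.log (⌊Real.exp Z⌋₊ : ℕ) ≤ Z := by
        rw [Real.log_le_iff_le_exp (by exact_mod_cast Nat.floor_pos.mpr h1)]
        exact Nat.floor_le (by positivity)
      linarith
  have hle : ⌊Real.exp X⌋₊ ≤ ⌊Real.exp Y⌋₊ := Nat.floor_le_floor (Real.exp_le_exp.mpr hXY)
  have hH : ∀ n : ℕ, (harmonic n : ℝ) = ∑ m ∈ Ioc 0 n, (m : ℝ)⁻¹ := fun n => by
    rw [harmonic_eq_sum_Icc]; push_cast; rfl
  have := sum_Ioc_consecutive (fun m : ℕ => (m : ℝ)⁻¹) (Nat.zero_le _) hle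
  rw [← hH, ← hH] at this
  obtain ⟨a1, a2⟩ := key X hX
  obtain ⟨b1, b2⟩ := key Y (hX.trans hXY)
  rw [abs_le]
  constructor <;> linarith

end ResidueSums

section SieveWeight

open Finset Filter Topology MeasureTheory

/-- The Selberg type sieve weight attached to a smooth function and a set of primes. -/
noncomputable def sieveWeight (g : ℝ → ℝ) (X : ℝ) (T : Finset ℕ) : ℝ :=
  ∑ U ∈ T.powerset, (-1) ^ #U * g ((∑ p ∈ U, Real.log p) / X)

lemma prod_lapExp (X ξ : ℝ) (U : Finset ℕ) :
    ∏ p ∈ U, lapExp ξ (Real.log p / X) = lapExp ξ ((∑ p ∈ U, Real.log p) / X) := by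
  classical
  induction U using Finset.induction with
  | empty => simp [lapExp_zero]
  | insert p U hp ih => rw [prod_insert hp, sum_insert hp, ih, add_div, lapExp_add]

lemma prod_one_sub_lapExp (X ξ : ℝ) (T : Finset ℕ) :
    ∏ p ∈ T, (1 - lapExp ξ (Real.log p / X)) =
      ∑ U ∈ T.powerset, (-1) ^ #U * lapExp ξ ((∑ p ∈ U, Real.log p) / X) := by
  classical
  rw [prod_sub]
  exact sum_congr rfl fun U _ => by rw [prod_lapExp]; simp

lemma LaplacePair.integral_prod_one_sub {g d : ℝ → ℝ} {ψ : ℝ → ℂ} (h : LaplacePair g d ψ) {X : ℝ}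
    (hX : 0 < X) (T : Finset ℕ) :
    ∫ ξ, ψ ξ * ∏ p ∈ T, (1 - lapExp ξ (Real.log p / X)) = (sieveWeight g X T : ℂ) := by
  simp_rw [prod_one_sub_lapExp, mul_sum, sieveWeight]
  rw [integral_finsetSum]
  · push_cast
    refine sum_congr rfl fun U _ => ?_
    rw [← h.integral_eq _ (div_nonneg (sum_nonneg fun p _ => Real.log_natCast_nonneg p) hX.le),
      ← integral_const_mul]
    exact integral_congr_ae (Eventually.of_forall fun ξ => by ring)
  · intro U _
    exact ((h.integrable_lapExp _).const_mul ((-1) ^ #U)).congr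
      (Eventually.of_forall fun ξ => by ring)

variable {ι : Type*} [Fintype ι] {g d g' d' : ι → ℝ → ℝ} {ψ ψ' : ι → ℝ → ℂ}

lemma prod_locPoly_indicator [DecidableEq ι] (X : ℝ) {S : Finset ℕ} {R : ι → Finset ℕ}
    (hR : ∀ i, R i ⊆ S) (hdisj : ∀ i j p, p ∈ R i → p ∈ R j → i = j) (ξ : ι → ℝ × ℝ) :
    ∏ p ∈ S, locPoly X (fun _ => 1) (fun p i => if p ∈ R i then 1 else 0) ξ p =
      ∏ i, ((∏ p ∈ R i, (1 - lapExp (ξ i).1 (Real.log p / X))) *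
        ∏ p ∈ R i, (1 - lapExp (ξ i).2 (Real.log p / X))) := by
  have h1 : ∀ i, (∏ p ∈ R i, (1 - lapExp (ξ i).1 (Real.log p / X))) *
        ∏ p ∈ R i, (1 - lapExp (ξ i).2 (Real.log p / X)) =
        ∏ p ∈ S, if p ∈ R i then 1 + eFac X (ξ i) p else 1 := fun i => by
    rw [← prod_mul_distrib, ← prod_filter, filter_mem_eq_inter, inter_eq_right.mpr (hR i)]
    exact prod_congr rfl fun p _ => by rw [eFac]; ring
  simp_rw [h1]
  rw [Finset.prod_comm]
  refine prod_congr rfl fun p _ => ?_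
  rw [locPoly]
  by_cases hp : ∃ i, p ∈ R i
  · obtain ⟨i, hi⟩ := hp
    have hne : ∀ j, j ≠ i → p ∉ R j := fun j hj hpj => hj (hdisj j i p hpj hi)
    rw [prod_eq_single i (fun j _ hj => if_neg (hne j hj)) (by simp), if_pos hi,
      sum_eq_single i (fun j _ hj => by rw [if_neg (hne j hj), zero_mul]) (by simp), if_pos hi,
      one_mul]
  · push Not at hp
    rw [prod_eq_one fun i _ => if_neg (hp i), sum_eq_zero fun i _ => by rw [if_neg (hp i), zero_mul],
      add_zero]

lemma integral_prod_locPoly_indicator (h : ∀ i, LaplacePair (g i) (d i) (ψ i))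
    (h' : ∀ i, LaplacePair (g' i) (d' i) (ψ' i)) {X : ℝ} (hX : 0 < X) {S : Finset ℕ}
    {R : ι → Finset ℕ} (hR : ∀ i, R i ⊆ S) (hdisj : ∀ i j p, p ∈ R i → p ∈ R j → i = j) :
    ∫ ξ, pairWeight ψ ψ' ξ *
        ∏ p ∈ S, locPoly X (fun _ => 1) (fun p i => if p ∈ R i then 1 else 0) ξ p =
      ((∏ i, (sieveWeight (g i) X (R i) * sieveWeight (g' i) X (R i)) : ℝ) : ℂ) := by
  classical
  simp_rw [prod_locPoly_indicator X hR hdisj, pairWeight, ← prod_mul_distrib (s := univ)]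
  rw [integral_fintype_prod_volume_eq_prod (f := fun i (q : ℝ × ℝ) => ψ i q.1 * ψ' i q.2 *
    ((∏ p ∈ R i, (1 - lapExp q.1 (Real.log p / X))) *
        ∏ p ∈ R i, (1 - lapExp q.2 (Real.log p / X))))]
  push_cast
  refine prod_congr rfl fun i _ => ?_
  rw [← (h i).integral_prod_one_sub hX, ← (h' i).integral_prod_one_sub hX, ← integral_prod_mul]
  exact integral_congr_ae (Eventually.of_forall fun q => by ring)

lemma integrable_prod_locPoly (h : ∀ i, LaplacePair (g i) (d i) (ψ i))
    (h' : ∀ i, LaplacePair (g' i) (d' i) (ψ' i)) {X : ℝ} (hX : 0 < X) (u : ℕ → ℂ) (c : ℕ → ι → ℂ)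
    (S : Finset ℕ) : Integrable fun ξ => pairWeight ψ ψ' ξ * ∏ p ∈ S, locPoly X u c ξ p :=
  integrable_pairWeight_mul h h' (continuous_prod_locPoly X u c S) (norm_prod_locPoly_le hX u c S)

lemma integral_prod_locPoly_one_eq_sum (h : ∀ i, LaplacePair (g i) (d i) (ψ i))
    (h' : ∀ i, LaplacePair (g' i) (d' i) (ψ' i)) {X : ℝ} (hX : 0 < X) (c : ℕ → ι → ℂ)
    (S : Finset ℕ) :
    ∫ ξ, pairWeight ψ ψ' ξ * ∏ p ∈ S, locPoly X (fun _ => 1) c ξ p =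
      ∑ Q ∈ S.powerset, ∫ ξ, pairWeight ψ ψ' ξ * ∏ p ∈ Q, locPoly X (fun _ => 0) c ξ p := by
  rw [← integral_finsetSum _ fun Q _ => integrable_prod_locPoly h h' hX _ c Q]
  refine integral_congr_ae (Eventually.of_forall fun ξ => ?_)
  simp only [locPoly, zero_add]
  rw [prod_one_add, mul_sum]

lemma sum_powerset_prod_le_eq {S : Finset ℕ} (hS : ∀ p ∈ S, p.Prime) (n : ℕ)
    (F : Finset ℕ → ℝ) :
    ∑ Q ∈ S.powerset with ∏ p ∈ Q, p ≤ n, F Q =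
      ∑ q ∈ Icc 1 n with Squarefree q ∧ q.primeFactors ⊆ S, F q.primeFactors := by
  refine sum_nbij' (fun Q => ∏ p ∈ Q, p) (fun q => q.primeFactors) ?_ ?_ ?_ ?_ ?_
  · intro Q hQ
    simp only [mem_filter, mem_powerset, mem_Icc] at hQ ⊢
    have hQ' := fun p hp => hS p (hQ.1 hp)
    have hpf := Nat.primeFactors_prod hQ'
    refine ⟨⟨Nat.one_le_iff_ne_zero.mpr (prod_ne_zero_iff.mpr fun p hp => (hQ' p hp).ne_zero),
      hQ.2⟩, ?_, by rw [hpf]; exact hQ.1⟩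
    exact Finset.squarefree_prod_of_pairwise_isCoprime (fun p hp q hq hpq =>
      Nat.coprime_iff_isRelPrime.mp ((Nat.coprime_primes (hQ' p hp) (hQ' q hq)).mpr hpq))
      fun p hp => (hQ' p hp).squarefree
  · intro q hq
    simp only [mem_filter, mem_powerset, mem_Icc] at hq ⊢
    exact ⟨hq.2.2, by rw [Nat.prod_primeFactors_of_squarefree hq.2.1]; exact hq.1.2⟩
  · intro Q hQ
    simp only [mem_filter, mem_powerset] at hQ
    exact Nat.primeFactors_prod fun p hp => hS p (hQ.1 hp)
  · intro q hq
    simp only [mem_filter, mem_Icc] at hq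
    exact Nat.prod_primeFactors_of_squarefree hq.2.1
  · intro Q hQ
    simp only [mem_filter, mem_powerset] at hQ
    rw [Nat.primeFactors_prod fun p hp => hS p (hQ.1 hp)]

lemma exp_lt_prod_iff {Q : Finset ℕ} (hQ : ∀ p ∈ Q, p.Prime) (y : ℝ) :
    ¬ ∏ p ∈ Q, p ≤ ⌊Real.exp y⌋₊ ↔ y < ∑ p ∈ Q, Real.log p := by
  rw [Nat.le_floor_iff (Real.exp_pos _).le, not_le, ← Real.log_prod
    fun p hp => Nat.cast_ne_zero.mpr (hQ p hp).ne_zero, Real.lt_log_iff_exp_lt]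
  · push_cast; rfl
  · exact prod_pos fun p hp => Nat.cast_pos.mpr (hQ p hp).pos

end SieveWeight

section SieveSecondMoment

open Finset Filter Topology MeasureTheory

variable {ι : Type*} [Fintype ι] {g d g' d' : ι → ℝ → ℝ} {ψ ψ' : ι → ℝ → ℂ}

lemma norm_sum_prod_locPoly_sub_le {N n : ℕ} (hn : N ≤ n) {X : ℝ} (hX : 0 < X) (ξ : ι → ℝ × ℝ)
    {M : ι → ℕ → ℕ} {Q : Finset ℕ} (hQ : ∀ p ∈ Q, p.Prime)
    (hM : ∀ p ∈ Q, ∀ i, ∃ ρ, ∀ m, p ∣ M i m ↔ m ≡ ρ [MOD p]) :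
    ‖(∑ m ∈ Ioc N n, (m : ℂ)⁻¹ *
        ∏ p ∈ Q, locPoly X (fun _ => 0) (fun p i => if p ∣ M i m then 1 else 0) ξ p) -
      (∑ m ∈ Ioc N n, (m : ℂ)⁻¹) *
        ∏ p ∈ Q, locPoly X (fun _ => 0) (fun p _ => (p : ℂ)⁻¹) ξ p‖ ≤
      ((3 * Fintype.card ι : ℕ) : ℝ) ^ #Q * ((N : ℝ) + 1)⁻¹ := by
  classical
  have hex : ∀ p i, ∃ ρ, p ∈ Q → ∀ m, p ∣ M i m ↔ m ≡ ρ [MOD p] := fun p i => by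
    by_cases hp : p ∈ Q
    · obtain ⟨ρ, h⟩ := hM p hp i
      exact ⟨ρ, fun _ => h⟩
    · exact ⟨0, fun h => absurd h hp⟩
  choose ρ hρ using hex
  have := norm_sum_prod_residues_sub_le hn ρ (fun p i => eFac X (ξ i) p)
    (B := (3 * Fintype.card ι : ℕ)) (Nat.cast_nonneg _) (fun p => by
      refine (sum_le_sum fun i _ => norm_eFac_le hX (ξ i) p).trans (le_of_eq ?_)
      simp [mul_comm]) Q hQ 1 0 one_pos (fun p _ => Nat.coprime_one_left p)
  simp only [Nat.modEq_one, filter_true, Nat.cast_one, div_one] at this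
  convert this using 3
  · refine sum_congr rfl fun m _ => ?_
    congr 1
    refine prod_congr rfl fun p hp => ?_
    simp only [locPoly, zero_add, ite_mul, one_mul, zero_mul, hρ p _ hp]
  · congr 1
    refine prod_congr rfl fun p hp => ?_
    simp only [locPoly, zero_add, mul_sum]

lemma norm_sum_integral_sub_le (h : ∀ i, LaplacePair (g i) (d i) (ψ i))
    (h' : ∀ i, LaplacePair (g' i) (d' i) (ψ' i)) {a a' : ι → ℝ}
    (ha : ∀ i u, a i ≤ u → g i u = 0) (ha' : ∀ i u, a' i ≤ u → g' i u = 0) {X : ℝ} (hX : 0 < X)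
    {N n : ℕ} (hn : N ≤ n) {M : ι → ℕ → ℕ} {S : Finset ℕ} (hS : ∀ p ∈ S, p.Prime)
    (hM : ∀ p ∈ S, ∀ i, ∃ ρ, ∀ m, p ∣ M i m ↔ m ≡ ρ [MOD p]) :
    ‖(∑ m ∈ Ioc N n, (m : ℂ)⁻¹ * ∫ ξ, pairWeight ψ ψ' ξ *
        ∏ p ∈ S, locPoly X (fun _ => 1) (fun p i => if p ∣ M i m then 1 else 0) ξ p) -
      (∑ m ∈ Ioc N n, (m : ℂ)⁻¹) * ∫ ξ, pairWeight ψ ψ' ξ *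
        ∏ p ∈ S, locPoly X (fun _ => 1) (fun p _ => (p : ℂ)⁻¹) ξ p‖ ≤
      (∫ ξ, ‖pairWeight ψ ψ' ξ‖) * ((∑ q ∈ Icc 1 ⌊Real.exp (X * ∑ i, (a i + a' i))⌋₊,
        ((3 * Fintype.card ι : ℕ) : ℝ) ^ #q.primeFactors) * ((N : ℝ) + 1)⁻¹) := by
  classical
  set K : ℝ := ((3 * Fintype.card ι : ℕ) : ℝ) with hK
  set Y := ⌊Real.exp (X * ∑ i, (a i + a' i))⌋₊
  have hH : Integrable fun ξ => ‖pairWeight ψ ψ' ξ‖ := (integrable_pairWeight h h').norm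
  set Δ : Finset ℕ → ℂ := fun Q => (∑ m ∈ Ioc N n, (m : ℂ)⁻¹ * ∫ ξ, pairWeight ψ ψ' ξ *
        ∏ p ∈ Q, locPoly X (fun _ => 0) (fun p i => if p ∣ M i m then 1 else 0) ξ p) -
      (∑ m ∈ Ioc N n, (m : ℂ)⁻¹) * ∫ ξ, pairWeight ψ ψ' ξ *
        ∏ p ∈ Q, locPoly X (fun _ => 0) (fun p _ => (p : ℂ)⁻¹) ξ p with hΔ
  have hsum : (∑ m ∈ Ioc N n, (m : ℂ)⁻¹ * ∫ ξ, pairWeight ψ ψ' ξ *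
        ∏ p ∈ S, locPoly X (fun _ => 1) (fun p i => if p ∣ M i m then 1 else 0) ξ p) -
      (∑ m ∈ Ioc N n, (m : ℂ)⁻¹) * ∫ ξ, pairWeight ψ ψ' ξ *
        ∏ p ∈ S, locPoly X (fun _ => 1) (fun p _ => (p : ℂ)⁻¹) ξ p = ∑ Q ∈ S.powerset, Δ Q := by
    simp only [hΔ, integral_prod_locPoly_one_eq_sum h h' hX, sum_sub_distrib, mul_sum (s := S.powerset)]
    rw [sum_comm]
  have hbig : ∀ Q ∈ S.powerset, Q ∉ S.powerset.filter (fun Q => ∏ p ∈ Q, p ≤ Y) → Δ Q = 0 := by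
    intro Q hQ hQY
    have hQ' : ∀ p ∈ Q, p.Prime := fun p hp => hS p (mem_powerset.mp hQ hp)
    have hlt : X * ∑ i, (a i + a' i) < ∑ p ∈ Q, Real.log p :=
      (exp_lt_prod_iff hQ' _).mp fun hc => hQY (mem_filter.mpr ⟨hQ, hc⟩)
    simp only [hΔ]
    rw [integral_prod_locPoly_eq_zero h h' ha ha' hX _ _ subset_rfl (fun _ _ => rfl) hlt, mul_zero,
      sub_zero]
    refine sum_eq_zero fun m _ => ?_
    rw [integral_prod_locPoly_eq_zero h h' ha ha' hX _ _ subset_rfl (fun _ _ => rfl) hlt, mul_zero]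
  have hterm : ∀ Q ∈ S.powerset, ‖Δ Q‖ ≤
      (∫ ξ, ‖pairWeight ψ ψ' ξ‖) * (K ^ #Q * ((N : ℝ) + 1)⁻¹) := by
    intro Q hQ
    have hQS := mem_powerset.mp hQ
    have e : Δ Q = ∫ ξ, pairWeight ψ ψ' ξ * ((∑ m ∈ Ioc N n, (m : ℂ)⁻¹ *
        ∏ p ∈ Q, locPoly X (fun _ => 0) (fun p i => if p ∣ M i m then 1 else 0) ξ p) -
      (∑ m ∈ Ioc N n, (m : ℂ)⁻¹) *
        ∏ p ∈ Q, locPoly X (fun _ => 0) (fun p _ => (p : ℂ)⁻¹) ξ p) := by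
      simp only [hΔ, ← integral_const_mul]
      rw [← integral_finsetSum, ← integral_sub]
      · refine integral_congr_ae (Eventually.of_forall fun ξ => ?_)
        simp only [mul_sub, mul_sum, sum_mul]
        congr 1 <;> exact sum_congr rfl fun m _ => by ring
      · exact integrable_finsetSum _ fun m _ => (integrable_prod_locPoly h h' hX _ _ Q).const_mul _
      · exact (integrable_prod_locPoly h h' hX _ _ Q).const_mul _
      · exact fun m _ => (integrable_prod_locPoly h h' hX _ _ Q).const_mul _
    rw [e, ← integral_mul_const]
    refine norm_integral_le_of_norm_le (hH.mul_const _) (Eventually.of_forall fun ξ => ?_)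
    rw [norm_mul]
    exact mul_le_mul_of_nonneg_left (norm_sum_prod_locPoly_sub_le hn hX ξ
      (fun p hp => hS p (hQS hp)) fun p hp => hM p (hQS hp)) (norm_nonneg _)
  rw [hsum, ← sum_subset (filter_subset (fun Q => ∏ p ∈ Q, p ≤ Y) _) hbig]
  refine (norm_sum_le_of_le _ fun Q hQ => hterm Q (mem_of_mem_filter Q hQ)).trans ?_
  rw [← mul_sum, ← sum_mul]
  refine mul_le_mul_of_nonneg_left (mul_le_mul_of_nonneg_right ?_ (by positivity))
    (integral_nonneg fun _ => norm_nonneg _)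
  rw [sum_powerset_prod_le_eq hS]
  exact sum_le_sum_of_subset_of_nonneg (filter_subset _ _) fun _ _ _ => by positivity

lemma tendsto_pow_mul_sum_pow_card_primeFactors (K k : ℕ) {s : ℝ} (hs : s < 1) :
    Tendsto (fun X : ℝ => X ^ k * ((∑ q ∈ Icc 1 ⌊Real.exp (X * s)⌋₊,
      (K : ℝ) ^ #q.primeFactors) * ((⌊Real.exp X⌋₊ : ℝ) + 1)⁻¹)) atTop (𝓝 0) := by
  set s' := max s 0 with hs'
  have hs1 : s' < 1 := max_lt hs one_pos
  have hs0 : 0 ≤ s' := le_max_right _ _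
  set τ := (1 - s') / 2 with hτ
  have hτ0 : 0 < τ := by rw [hτ]; linarith
  obtain ⟨C, hC, hb⟩ := exists_pow_card_primeFactors_le K hτ0
  have hlim : Tendsto (fun X : ℝ => C * (X ^ k * Real.exp (-τ * X))) atTop (𝓝 0) := by
    have h1 := (Real.tendsto_pow_mul_exp_neg_atTop_nhds_zero k).comp
      (tendsto_id.const_mul_atTop hτ0)
    have h2 := (h1.const_mul (C * (τ ^ k)⁻¹))
    rw [mul_zero] at h2
    refine h2.congr fun X => ?_
    simp only [Function.comp_apply, id, mul_pow, neg_mul]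
    field_simp
  refine squeeze_zero' ?_ ?_ hlim
  · filter_upwards [eventually_ge_atTop 0] with X hX
    positivity
  · filter_upwards [eventually_ge_atTop 0] with X hX
    have hfl : (⌊Real.exp (X * s)⌋₊ : ℝ) ≤ Real.exp (s' * X) :=
      (Nat.floor_le (Real.exp_pos _).le).trans (Real.exp_le_exp.mpr (by
        rw [mul_comm]; exact mul_le_mul_of_nonneg_right (le_max_left _ _) hX))
    have h1 : ∑ q ∈ Icc 1 ⌊Real.exp (X * s)⌋₊, (K : ℝ) ^ #q.primeFactors ≤
        Real.exp (s' * X) * (C * Real.exp (s' * X * τ)) := by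
      refine (sum_le_card_nsmul _ _ (C * Real.exp (s' * X * τ)) fun q hq => ?_).trans ?_
      · rw [mem_Icc] at hq
        refine (hb q hq.1).trans (mul_le_mul_of_nonneg_left ?_ hC.le)
        rw [Real.exp_mul]
        exact Real.rpow_le_rpow (by positivity) ((Nat.cast_le.mpr hq.2).trans hfl) hτ0.le
      · rw [nsmul_eq_mul]
        refine mul_le_mul_of_nonneg_right ?_ (by positivity)
        simpa using hfl
    have h2 : ((⌊Real.exp X⌋₊ : ℝ) + 1)⁻¹ ≤ Real.exp (-X) := by
      rw [Real.exp_neg]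
      exact inv_anti₀ (Real.exp_pos _) (Nat.lt_floor_add_one _).le
    have h3 : s' * X + s' * X * τ + -X ≤ -τ * X := by
      have : s' * τ ≤ τ := by nlinarith
      have h4 : s' + τ + τ = 1 := by rw [hτ]; ring
      nlinarith
    calc _ ≤ X ^ k * ((Real.exp (s' * X) * (C * Real.exp (s' * X * τ))) * Real.exp (-X)) :=
          mul_le_mul_of_nonneg_left (mul_le_mul h1 h2 (by positivity) (by positivity))
            (by positivity)
      _ = C * (X ^ k * Real.exp (s' * X + s' * X * τ + -X)) := by
          rw [Real.exp_add, Real.exp_add]; ring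
      _ ≤ _ := by gcongr

theorem eventually_sum_sieveWeight (h : ∀ i, LaplacePair (g i) (d i) (ψ i))
    (h' : ∀ i, LaplacePair (g' i) (d' i) (ψ' i)) {a a' : ι → ℝ}
    (ha : ∀ i u, a i ≤ u → g i u = 0) (ha' : ∀ i u, a' i ≤ u → g' i u = 0)
    (hsum : ∑ i, (a i + a' i) < 1) {η : ℝ} (hη : 0 ≤ η) {D : ℕ} {M : ι → ℕ → ℕ}
    (hM : ∀ p, p.Prime → D < p → ∀ i, ∃ ρ, ∀ m, p ∣ M i m ↔ m ≡ ρ [MOD p])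
    (hdisj : ∀ p, p.Prime → D < p → ∀ i j m, p ∣ M i m → p ∣ M j m → i = j) {ε : ℝ} (hε : 0 < ε) :
    ∀ᶠ X : ℝ in atTop, ∀ᶠ P in atTop,
      |X ^ Fintype.card ι / X * (∑ m ∈ Ioc ⌊Real.exp X⌋₊ ⌊Real.exp ((1 + η) * X)⌋₊, (m : ℝ)⁻¹ *
        ∏ i, (sieveWeight (g i) X {p ∈ sievePrimes D P | p ∣ M i m} *
          sieveWeight (g' i) X {p ∈ sievePrimes D P | p ∣ M i m})) -
        η * (eulerConst (fun p => (p : ℝ)⁻¹) D (Fintype.card ι) *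
          ∏ i, ∫ u in Set.Ioi 0, d i u * d' i u)| ≤ ε := by
  set k := Fintype.card ι with hk
  set G : ℝ := eulerConst (fun p => (p : ℝ)⁻¹) D k * ∏ i, ∫ u in Set.Ioi 0, d i u * d' i u with hG
  set W : ℝ := ∫ ξ, ‖pairWeight ψ ψ' ξ‖
  have hv : ∀ p : ℕ, p.Prime → |(p : ℝ)⁻¹ - (p : ℝ)⁻¹| ≤ 2 * ((p : ℝ)⁻¹) ^ 2 := fun p _ => by
    rw [sub_self, abs_zero]; positivity
  have hmain := eventually_integral_prod_locFac h h' hv D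
    (show (0 : ℝ) < ε / (4 * (η + 4)) by positivity)
  have herr := ((tendsto_pow_mul_sum_pow_card_primeFactors (3 * k) k hsum).const_mul W).eventually
    (gt_mem_nhds (show W * 0 < ε / 4 by simpa using by positivity))
  filter_upwards [hmain, herr, eventually_ge_atTop 1, eventually_ge_atTop (16 * |G| / ε)]
    with X hm he hX1 hXG
  have hX : 0 < X := by linarith
  filter_upwards [hm] with P hmP
  set N := ⌊Real.exp X⌋₊
  set n := ⌊Real.exp ((1 + η) * X)⌋₊
  have hNn : N ≤ n := Nat.floor_le_floor (Real.exp_le_exp.mpr (by nlinarith))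
  set T : ℝ := ∑ m ∈ Ioc N n, (m : ℝ)⁻¹ *
        ∏ i, (sieveWeight (g i) X {p ∈ sievePrimes D P | p ∣ M i m} *
          sieveWeight (g' i) X {p ∈ sievePrimes D P | p ∣ M i m}) with hT
  set I : ℂ := ∫ ξ, pairWeight ψ ψ' ξ * ∏ p ∈ sievePrimes D P, locFac (fun p => (p : ℝ)⁻¹) X ξ p
  set H : ℝ := ∑ m ∈ Ioc N n, (m : ℝ)⁻¹ with hH
  have hHb : |H - η * X| ≤ 4 := by
    have := abs_sum_inv_Ioc_floor_exp_sub_le hX.le (show X ≤ (1 + η) * X by nlinarith)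
    rwa [show (1 + η) * X - X = η * X by ring] at this
  have hTI : ‖(T : ℂ) - H * I‖ ≤ W * ((∑ q ∈ Icc 1 ⌊Real.exp (X * ∑ i, (a i + a' i))⌋₊,
        ((3 * k : ℕ) : ℝ) ^ #q.primeFactors) * ((N : ℝ) + 1)⁻¹) := by
    have := norm_sum_integral_sub_le h h' ha ha' hX hNn (S := sievePrimes D P) (M := M)
      (fun p hp => (mem_sievePrimes.mp hp).1)
      fun p hp => hM p (mem_sievePrimes.mp hp).1 (mem_sievePrimes.mp hp).2.1
    refine le_trans (le_of_eq ?_) this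
    congr 2
    · rw [hT]
      push_cast
      refine sum_congr rfl fun m _ => ?_
      congr 1
      have h3 := integral_prod_locPoly_indicator h h' hX (S := sievePrimes D P)
        (R := fun i => {p ∈ sievePrimes D P | p ∣ M i m}) (fun i => filter_subset _ _)
        (fun i j p hi hj => by
          rw [mem_filter, mem_sievePrimes] at hi hj
          exact hdisj p hi.1.1 hi.1.2.1 i j m hi.2 hj.2)
      push_cast at h3
      rw [← h3]
      refine integral_congr_ae (Eventually.of_forall fun ξ => ?_)
      simp only
      congr 1
      refine prod_congr rfl fun p hp => ?_
      simp only [locPoly, mem_filter, hp, true_and]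
    · rw [hH]
      push_cast
      congr 1
      refine integral_congr_ae (Eventually.of_forall fun ξ => ?_)
      simp only [locPoly, locFac, mul_sum]
      push_cast
      rfl
  have hX0 : (X : ℂ) ≠ 0 := by exact_mod_cast hX.ne'
  rw [← Real.norm_eq_abs, ← Complex.norm_real]
  push_cast
  have hsplit : (X : ℂ) ^ k / X * T - η * G = (X : ℂ) ^ k / X * (T - H * I) +
      (H / X) * ((X : ℂ) ^ k * I - G) + ((H - η * X) / X) * G := by
    field_simp; ring
  have hHX : |H / X| ≤ η + 4 := by
    rw [abs_div, abs_of_pos hX, div_le_iff₀ hX]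
    have := abs_le.mp hHb
    rw [abs_le]; constructor <;> nlinarith
  have b1 : ‖(X : ℂ) ^ k / X * (T - H * I)‖ ≤ ε / 4 := by
    rw [norm_mul, norm_div, norm_pow, Complex.norm_real, Real.norm_eq_abs, abs_of_pos hX]
    calc X ^ k / X * ‖(T : ℂ) - H * I‖ ≤ X ^ k * ‖(T : ℂ) - H * I‖ :=
          mul_le_mul_of_nonneg_right (div_le_self (by positivity) hX1) (norm_nonneg _)
      _ ≤ X ^ k * _ := mul_le_mul_of_nonneg_left hTI (by positivity)
      _ ≤ ε / 4 := by rw [← mul_assoc, mul_comm (X ^ k), mul_assoc]; exact he.le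
  have b2 : ‖(H / X : ℂ) * ((X : ℂ) ^ k * I - G)‖ ≤ ε / 4 := by
    rw [norm_mul]
    calc _ ≤ (η + 4) * (ε / (4 * (η + 4))) := by
          refine mul_le_mul ?_ (by simpa [hG] using hmP) (norm_nonneg _) (by positivity)
          rw [← Complex.ofReal_div, Complex.norm_real]
          exact hHX
      _ = ε / 4 := by field_simp
  have b3 : ‖((H - η * X) / X : ℂ) * G‖ ≤ ε / 4 := by
    have e : ((H - η * X) / X : ℂ) * G = (((H - η * X) / X * G : ℝ) : ℂ) := by push_cast; ring
    rw [e, Complex.norm_real, Real.norm_eq_abs, abs_mul, abs_div, abs_of_pos hX]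
    rw [div_le_iff₀ hε] at hXG
    calc _ ≤ 4 / X * |G| := by gcongr
      _ ≤ ε / 4 := by rw [div_mul_eq_mul_div, div_le_iff₀ hX]; linarith
  have hfin := norm_add_le_of_le (norm_add_le_of_le b1 b2) b3
  rw [← hsplit] at hfin
  have e2 : (η : ℂ) * (eulerConst (fun p => (p : ℝ)⁻¹) D k *
      ∏ i, ((∫ u in Set.Ioi 0, d i u * d' i u : ℝ) : ℂ)) = η * G := by rw [hG]; push_cast; rfl
  refine le_trans (le_of_eq ?_) (hfin.trans (by linarith))
  rw [← e2]

end SieveSecondMoment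

section PrimeWindow

open Finset Filter Topology

/-- The primes `p` with `exp (c X) ≤ p ≤ exp (d X)`. -/
noncomputable def primeWindow (c d X : ℝ) : Finset ℕ :=
  (Iic ⌊Real.exp (d * X)⌋₊).filter fun p => p.Prime ∧ Real.exp (c * X) ≤ p

lemma mem_primeWindow {c d X : ℝ} {p : ℕ} : p ∈ primeWindow c d X ↔
    p.Prime ∧ Real.exp (c * X) ≤ p ∧ (p : ℝ) ≤ Real.exp (d * X) := by
  simp only [primeWindow, mem_filter, mem_Iic, Nat.le_floor_iff (Real.exp_pos _).le]
  tauto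

variable {f : ℝ → ℝ} {c d : ℝ}

lemma weight_eq_zero_of_notMem (hfc : ∀ u ≤ c, f u = 0) (hfd : ∀ u, d ≤ u → f u = 0) {X : ℝ}
    (hX : 0 < X) {p : ℕ} (hp : p.Prime) (h : p ∉ primeWindow c d X) : f (Real.log p / X) = 0 := by
  have hp0 : (0 : ℝ) < p := by exact_mod_cast hp.pos
  rw [mem_primeWindow] at h
  by_cases h1 : Real.exp (c * X) ≤ p
  · apply hfd
    have h2 : Real.exp (d * X) < p := by
      by_contra! h2; exact h ⟨hp, h1, h2⟩
    rw [le_div_iff₀ hX, Real.le_log_iff_exp_le hp0]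
    exact h2.le
  · apply hfc
    rw [div_le_iff₀ hX, Real.log_le_iff_le_exp hp0]
    exact (not_le.mp h1).le

lemma tendsto_sum_primeWindow {q : ℕ} [NeZero q] {a : ZMod q} (ha : IsUnit a)
    (hf : Continuous f) (hc : 0 < c) (hfc : ∀ u ≤ c, f u = 0) (hfd : ∀ u, d ≤ u → f u = 0) :
    Tendsto (fun X : ℝ => ∑ p ∈ primeWindow c d X,
        if (p : ZMod q) = a then f (Real.log p / X) / p else 0)
      atTop (𝓝 ((q.totient : ℝ)⁻¹ * ∫ u, f u / u)) := by
  refine (mertens_residueClass ha hf hc hfc hfd).congr' ?_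
  filter_upwards [eventually_gt_atTop 0] with X hX
  rw [tsum_eq_sum (s := primeWindow c d X) fun n hn => ?_]
  · refine sum_congr rfl fun p hp => ?_
    simp [(mem_primeWindow.mp hp).1]
  · split_ifs with h
    · rw [weight_eq_zero_of_notMem hfc hfd hX h.1 hn, zero_div]
    · rfl

lemma eventually_sum_primeWindow_eq_zero {q : ℕ} [NeZero q] {a : ZMod q} (ha : ¬ IsUnit a)
    (hc : 0 < c) (f : ℝ → ℝ) (d : ℝ) :
    ∀ᶠ X : ℝ in atTop, ∑ p ∈ primeWindow c d X,
        (if (p : ZMod q) = a then f (Real.log p / X) / p else 0) = 0 := by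
  have h : Tendsto (fun X : ℝ => Real.exp (c * X)) atTop atTop :=
    Real.tendsto_exp_atTop.comp (tendsto_id.const_mul_atTop hc)
  filter_upwards [h.eventually_gt_atTop (q : ℝ)] with X hX
  refine sum_eq_zero fun p hp => if_neg ?_
  rintro rfl
  obtain ⟨hp1, hp2, -⟩ := mem_primeWindow.mp hp
  apply ha
  rw [ZMod.isUnit_iff_coprime, Nat.Prime.coprime_iff_not_dvd hp1]
  intro hdvd
  have := Nat.le_of_dvd (NeZero.pos q) hdvd
  have : (p : ℝ) ≤ q := by exact_mod_cast this
  linarith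

lemma sum_balInd (p : ℕ) [Fact p.Prime] (u : (ZMod p)ˣ) : ∑ v : ZMod p, balInd p v u = 0 := by
  have hp : (1 : ℝ) < p := by exact_mod_cast (Fact.out : p.Prime).one_lt
  have h : ∀ v : ZMod p, balInd p v u =
      (if v = (u : ZMod p) then 1 else 0) - (if v = 0 then 0 else 1 / ((p : ℝ) - 1)) := by
    intro v
    rw [balInd]
    by_cases hv : v = 0
    · simp [hv, u.ne_zero.symm]
    · simp [hv]
  simp_rw [h, sum_sub_distrib, sum_ite_eq', mem_univ, if_true]
  have : ∑ v : ZMod p, (if v = 0 then 0 else 1 / ((p : ℝ) - 1)) = 1 := by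
    have h1 : ∀ v : ZMod p, (if v = 0 then 0 else 1 / ((p : ℝ) - 1))
        = 1 / ((p : ℝ) - 1) - if v = 0 then 1 / ((p : ℝ) - 1) else 0 := fun v => by
      split_ifs <;> simp
    simp_rw [h1, sum_sub_distrib, sum_ite_eq', mem_univ, if_true]
    rw [sum_const, card_univ, ZMod.card, nsmul_eq_mul]
    have : (p : ℝ) - 1 ≠ 0 := by linarith
    field_simp
  rw [this, sub_self]

lemma abs_balInd_le_one (p : ℕ) (hp : p.Prime) (x u : ZMod p) : |balInd p x u| ≤ 1 := by
  have h2 : (2 : ℝ) ≤ p := by exact_mod_cast hp.two_le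
  have h3 : 0 < 1 / ((p : ℝ) - 1) := by apply div_pos <;> linarith
  have h4 : 1 / ((p : ℝ) - 1) ≤ 1 := by rw [div_le_one] <;> linarith
  rw [balInd, abs_le]
  split_ifs <;> constructor <;> linarith

lemma tendsto_sum_mul_balInd {m p' : ℕ} [NeZero m] [Fact p'.Prime] (hm : m.Coprime p')
    (φ : ZMod m → ℝ) (u : (ZMod p')ˣ) (hf : Continuous f) (hc : 0 < c) (hfc : ∀ u ≤ c, f u = 0)
    (hfd : ∀ u, d ≤ u → f u = 0) :
    Tendsto (fun X : ℝ => ∑ p ∈ primeWindow c d X,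
        f (Real.log p / X) / p * (φ p * balInd p' p u)) atTop (𝓝 0) := by
  have : NeZero (m * p') := ⟨mul_ne_zero (NeZero.ne m) (Fact.out : p'.Prime).ne_zero⟩
  set I := ((m * p').totient : ℝ)⁻¹ * ∫ u, f u / u
  set S : ℝ → ZMod m × ZMod p' → ℝ := fun X v => ∑ p ∈ primeWindow c d X,
    if (p : ZMod (m * p')) = (ZMod.chineseRemainder hm).symm v then f (Real.log p / X) / p else 0
  have hS : ∀ v, Tendsto (fun X => S X v) atTop
      (𝓝 (if IsUnit v.1 ∧ IsUnit v.2 then I else 0)) := by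
    intro v
    have hv : IsUnit ((ZMod.chineseRemainder hm).symm v) ↔ IsUnit v.1 ∧ IsUnit v.2 := by
      rw [MulEquiv.isUnit_map, Prod.isUnit_iff]
    split_ifs with h
    · exact tendsto_sum_primeWindow (hv.mpr h) hf hc hfc hfd
    · exact tendsto_const_nhds.congr' (EventuallyEq.symm
        (eventually_sum_primeWindow_eq_zero (mt hv.mp h) hc f d))
  have h1 : ∀ X, ∑ p ∈ primeWindow c d X, f (Real.log p / X) / p * (φ p * balInd p' p u)
      = ∑ v : ZMod m × ZMod p', φ v.1 * balInd p' v.2 u * S X v := by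
    intro X
    simp only [S, mul_sum]
    rw [sum_comm]
    refine sum_congr rfl fun p _ => ?_
    have h2 : ∀ v : ZMod m × ZMod p',
        ((p : ZMod (m * p')) = (ZMod.chineseRemainder hm).symm v) ↔ v = ((p : ZMod m), (p : ZMod p')) := by
      intro v
      rw [RingEquiv.eq_symm_apply, map_natCast, eq_comm]
      rfl
    simp_rw [h2, mul_ite, mul_zero, sum_ite_eq', mem_univ, if_true]
    ring
  simp_rw [h1]
  have h3 := tendsto_finsetSum (univ : Finset (ZMod m × ZMod p')) fun v _ =>
    (hS v).const_mul (φ v.1 * balInd p' v.2 u)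
  convert h3 using 2
  rw [Fintype.sum_prod_type]
  symm
  refine sum_eq_zero fun v₁ _ => ?_
  by_cases hv₁ : IsUnit v₁
  · have h4 : ∀ v₂ : ZMod p', φ v₁ * balInd p' v₂ u * (if IsUnit v₁ ∧ IsUnit v₂ then I else 0)
        = φ v₁ * I * balInd p' v₂ u := by
      intro v₂
      by_cases hv₂ : v₂ = 0
      · simp [balInd, hv₂]
      · rw [if_pos ⟨hv₁, isUnit_iff_ne_zero.mpr hv₂⟩]; ring
    rw [sum_congr rfl fun v₂ _ => h4 v₂, ← mul_sum, sum_balInd, mul_zero]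
  · simp [hv₁]

lemma sum_primeWindow_inv_sq_le {X : ℝ} :
    ∑ p ∈ primeWindow c d X, 1 / (p : ℝ) ^ 2 ≤ 2 * Real.exp (-(c * X)) := by
  set k := ⌈Real.exp (c * X)⌉₊ with hk
  have hk0 : 0 < k := Nat.ceil_pos.mpr (Real.exp_pos _)
  have hsub : primeWindow c d X ⊆ Ioo (k - 1) (⌊Real.exp (d * X)⌋₊ + 1) := by
    intro p hp
    obtain ⟨-, h1, h2⟩ := mem_primeWindow.mp hp
    have h3 : k ≤ p := Nat.ceil_le.mpr h1
    have h4 : p ≤ ⌊Real.exp (d * X)⌋₊ := Nat.le_floor h2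
    rw [mem_Ioo]; omega
  refine (sum_le_sum_of_subset_of_nonneg hsub fun _ _ _ => by positivity).trans ?_
  have h := sum_Ioo_inv_sq_le (α := ℝ) (k - 1) (⌊Real.exp (d * X)⌋₊ + 1)
  simp_rw [one_div]
  refine h.trans ?_
  rw [Nat.cast_sub hk0, Nat.cast_one, sub_add_cancel, Real.exp_neg, div_eq_mul_inv]
  gcongr
  exact Nat.le_ceil _

lemma tendsto_sum_mul_prod_balInd {A : ℕ} [NeZero A] {Q : Finset ℕ}
    [hQ : ∀ p : Q, Fact (p : ℕ).Prime] (hQA : ∀ p ∈ Q, A.Coprime p) (hQ0 : Q.Nonempty)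
    (a : ZMod A) (u : (p : Q) → (ZMod p)ˣ)
    (hf : Continuous f) (hc : 0 < c) (hfc : ∀ u ≤ c, f u = 0) (hfd : ∀ u, d ≤ u → f u = 0) :
    Tendsto (fun X : ℝ => ∑ p ∈ primeWindow c d X,
        (if (p : ZMod A) = a then f (Real.log p / X) / p else 0) * ∏ r : Q, balInd r p (u r))
      atTop (𝓝 0) := by
  classical
  obtain ⟨p', hp'⟩ := hQ0
  have hprime : ∀ p ∈ Q, p.Prime := fun p hp => (hQ ⟨p, hp⟩).out
  have : Fact p'.Prime := ⟨hprime p' hp'⟩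
  set m := A * ∏ p ∈ Q.erase p', p with hm
  have : NeZero m := ⟨mul_ne_zero (NeZero.ne A)
    (prod_ne_zero_iff.mpr fun p hp => (hprime p (mem_of_mem_erase hp)).ne_zero)⟩
  have hcop : m.Coprime p' := by
    refine Nat.Coprime.mul_left (hQA p' hp') (Nat.Coprime.prod_left fun p hp => ?_)
    exact (Nat.coprime_primes (hprime p (mem_of_mem_erase hp)) (hprime p' hp')).mpr
      (ne_of_mem_erase hp)
  set φ : ZMod m → ℝ := fun v => (if (v.cast : ZMod A) = a then 1 else 0) *
    ∏ r ∈ univ.erase (⟨p', hp'⟩ : Q), balInd r (v.cast : ZMod r) (u r) with hφ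
  refine (tendsto_sum_mul_balInd hcop φ (u ⟨p', hp'⟩) hf hc hfc hfd).congr fun X => ?_
  refine sum_congr rfl fun p _ => ?_
  have h1 : ((p : ZMod m).cast : ZMod A) = p := ZMod.cast_natCast (Dvd.intro _ rfl) p
  have h2 : ∀ r ∈ univ.erase (⟨p', hp'⟩ : Q), ((p : ZMod m).cast : ZMod r) = p := fun r hr =>
    ZMod.cast_natCast ((dvd_prod_of_mem (fun p => p) (mem_erase.mpr
      ⟨fun h => ne_of_mem_erase hr (Subtype.ext h), r.2⟩)).trans (Dvd.intro_left A rfl)) p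
  rw [hφ]
  simp only [h1]
  rw [prod_congr rfl fun r hr => by rw [h2 r hr],
    ← mul_prod_erase univ _ (mem_univ (⟨p', hp'⟩ : Q))]
  split_ifs <;> ring

lemma exists_bound_of_support (hf : Continuous f) (hfc : ∀ u ≤ c, f u = 0)
    (hfd : ∀ u, d ≤ u → f u = 0) : ∃ M, 0 ≤ M ∧ ∀ u, |f u| ≤ M := by
  obtain ⟨M, hM⟩ := (isCompact_Icc (a := c) (b := d)).exists_bound_of_continuousOn hf.continuousOn
  refine ⟨max M 0, le_max_right _ _, fun u => ?_⟩
  by_cases h : u ∈ Set.Icc c d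
  · exact (hM u h).trans (le_max_left _ _)
  · rw [Set.mem_Icc, not_and_or, not_le, not_le] at h
    rcases h with h | h
    · simp [hfc u h.le]
    · simp [hfd u h.le]

/-- The weight `f (log p / X) / p` on the primes congruent to `a` modulo `A`. -/
noncomputable def classWeight (A : ℕ) (f : ℝ → ℝ) (X : ℝ) (a : ZMod A) (p : ℕ) : ℝ :=
  if (p : ZMod A) = a then f (Real.log p / X) / p else 0

lemma abs_classWeight_le {A : ℕ} {M : ℝ} (hM : ∀ u, |f u| ≤ M) (X : ℝ) (a : ZMod A) (p : ℕ) :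
    |classWeight A f X a p| ≤ M / p := by
  have hM0 : 0 ≤ M := (abs_nonneg _).trans (hM 0)
  rw [classWeight]
  split_ifs
  · rw [abs_div, Nat.abs_cast]; gcongr; exact hM _
  · rw [abs_zero]; positivity

lemma eventually_primNorm_le {A : ℕ} [NeZero A] {Q : Finset ℕ}
    [hQ : ∀ p : Q, Fact (p : ℕ).Prime] (hQA : ∀ p ∈ Q, A.Coprime p) (hQ0 : Q.Nonempty)
    (a : ZMod A) (hf : Continuous f) (hc : 0 < c) (hfc : ∀ u ≤ c, f u = 0)
    (hfd : ∀ u, d ≤ u → f u = 0) (K : ℝ) {ε : ℝ} (hε : 0 < ε) :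
    ∀ᶠ X : ℝ in atTop, ∀ α : ℕ → ℂ,
      (∀ p ∈ primeWindow c d X, ‖α p - classWeight A f X a p‖ ≤ K / (p : ℝ) ^ 2) →
      primNorm Q (primeWindow c d X) α ≤ ε := by
  set U := (p : Q) → (ZMod p)ˣ
  set n : ℝ := (Fintype.card U : ℝ)
  obtain ⟨ε', hε', hεn⟩ : ∃ ε' > 0, n * (2 * ε') ^ 2 ≤ ε := by
    have hn : 0 ≤ n := by positivity
    refine ⟨√(ε / (n + 1)) / 2, by positivity, ?_⟩
    rw [mul_div_cancel₀ _ two_ne_zero, Real.sq_sqrt (by positivity), ← mul_div_assoc,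
      div_le_iff₀ (by positivity)]
    nlinarith
  have h1 : ∀ᶠ X : ℝ in atTop, ∀ u : U, |∑ p ∈ primeWindow c d X,
        classWeight A f X a p * ∏ r : Q, balInd r p (u r)| ≤ ε' := by
    rw [eventually_all]
    intro u
    have := (tendsto_sum_mul_prod_balInd hQA hQ0 a u hf hc hfc hfd).abs
    rw [abs_zero] at this
    filter_upwards [this.eventually (eventually_le_nhds hε')] with X hX using hX
  have h2 : Tendsto (fun X : ℝ => |K| * (2 * Real.exp (-(c * X)))) atTop (𝓝 (|K| * (2 * 0))) := by
    refine Tendsto.const_mul _ (Tendsto.const_mul _ ?_)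
    exact Real.tendsto_exp_neg_atTop_nhds_zero.comp (tendsto_id.const_mul_atTop hc)
  rw [mul_zero, mul_zero] at h2
  filter_upwards [h1, h2.eventually (eventually_le_nhds hε')] with X hX1 hX2 α hα
  rw [← sum_normSq_balInd]
  have hb : ∀ u : U, ∀ p : ℕ, ‖∏ r : Q, ((balInd r p (u r) : ℝ) : ℂ)‖ ≤ 1 := by
    intro u p
    rw [norm_prod]
    refine prod_le_one (fun _ _ => norm_nonneg _) fun r _ => ?_
    rw [Complex.norm_real]
    exact abs_balInd_le_one r (hQ r).out _ _
  have h3 : ∀ u : U, ‖∑ x ∈ primeWindow c d X, α x * ∏ r : Q, ((balInd r x (u r) : ℝ) : ℂ)‖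
      ≤ 2 * ε' := by
    intro u
    have e : ∑ x ∈ primeWindow c d X, α x * ∏ r : Q, ((balInd r x (u r) : ℝ) : ℂ)
        = ((∑ p ∈ primeWindow c d X, classWeight A f X a p * ∏ r : Q, balInd r p (u r) : ℝ) : ℂ)
        + ∑ x ∈ primeWindow c d X,
          (α x - classWeight A f X a x) * ∏ r : Q, ((balInd r x (u r) : ℝ) : ℂ) := by
      push_cast
      rw [← sum_add_distrib]
      refine sum_congr rfl fun x _ => by ring
    rw [e, two_mul]
    refine (norm_add_le _ _).trans (add_le_add ?_ ?_)
    · rw [Complex.norm_real]; exact hX1 u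
    · refine (norm_sum_le _ _).trans (le_trans ?_ hX2)
      calc _ ≤ ∑ p ∈ primeWindow c d X, |K| * (1 / (p : ℝ) ^ 2) := by
            refine sum_le_sum fun p hp => ?_
            rw [norm_mul]
            refine (mul_le_of_le_one_right (norm_nonneg _) (hb u p)).trans ((hα p hp).trans ?_)
            rw [mul_one_div]; gcongr; exact le_abs_self K
        _ ≤ _ := by rw [← mul_sum]; gcongr; exact sum_primeWindow_inv_sq_le
  calc _ ≤ ∑ _u : U, (2 * ε') ^ 2 := sum_le_sum fun u _ => by gcongr; exact h3 u
    _ = n * (2 * ε') ^ 2 := by rw [sum_const, card_univ, nsmul_eq_mul]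
    _ ≤ ε := hεn

end PrimeWindow

section BilinearSmall

open Finset Filter Topology

variable {f h : ℝ → ℝ} {c c' d δ : ℝ}

theorem eventually_bilinear_sum_le {A : ℕ} [NeZero A] (hf : Continuous f)
    (hfc : ∀ u ≤ c, f u = 0) (hfd : ∀ u, d ≤ u → f u = 0) (hh : Continuous h)
    (hhc : ∀ u ≤ c', h u = 0) (hhd : ∀ u, d ≤ u → h u = 0)
    (hc : 0 < c) (hcc : c ≤ c') (h1 : 1 ≤ c + c') (hd : 0 < d) (hδ : 0 < δ) (hδ' : δ ≤ 1 / 2)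
    (K : ℝ) {ε : ℝ} (hε : 0 < ε) :
    ∀ᶠ X : ℝ in atTop, ∀ (a b : ZMod A) (α β : ℕ → ℂ),
      (∀ p ∈ primeWindow c d X, ‖α p - classWeight A f X a p‖ ≤ K / (p : ℝ) ^ 2) →
      (∀ p ∈ primeWindow c' d X, ‖β p - classWeight A h X b p‖ ≤ K / (p : ℝ) ^ 2) →
      ∑ q ∈ (Icc 2 ⌊Real.exp ((1 / 2 - δ) * X)⌋₊).filter (fun q => Squarefree q ∧ A.Coprime q),
        (12 : ℝ) ^ #q.primeFactors * (√(primNorm q.primeFactors (primeWindow c d X) α) *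
          √(primNorm q.primeFactors (primeWindow c' d X) β)) ≤ ε := by
  have hc' : 0 < c' := hc.trans_le hcc
  obtain ⟨M, hM0, hM⟩ := exists_bound_of_support hf hfc hfd
  obtain ⟨M', hM0', hM'⟩ := exists_bound_of_support hh hhc hhd
  set K' := max M M' + |K| with hK'
  obtain ⟨C, κ, hC, hκ, htail⟩ := exists_bilinear_tail_le hc hcc h1 hd hδ hδ' K'
  obtain ⟨q₀, hq₀, hq₀'⟩ : ∃ q₀ : ℕ, 0 < q₀ ∧ C * (1 / √q₀) ≤ ε / 3 := by
    obtain ⟨n, hn⟩ := exists_nat_gt ((3 * C / ε) ^ 2)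
    have hn0 : (0 : ℝ) < n := lt_of_le_of_lt (sq_nonneg _) hn
    refine ⟨n, by exact_mod_cast hn0, ?_⟩
    have h2 : 3 * C / ε ≤ √n := Real.le_sqrt_of_sq_le hn.le
    rw [mul_one_div, div_le_iff₀ (Real.sqrt_pos.mpr hn0)]
    rw [div_le_iff₀ hε] at h2
    linarith
  have ht1 : Tendsto (fun X : ℝ => C * (X ^ 3 * Real.exp (-(κ * X)))) atTop (𝓝 0) := by
    have h2 := (Real.tendsto_pow_mul_exp_neg_atTop_nhds_zero 3).comp
      (tendsto_id.const_mul_atTop hκ)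
    have h3 := h2.const_mul (C / κ ^ 3)
    rw [mul_zero] at h3
    refine h3.congr fun X => ?_
    simp only [Function.comp, id]
    field_simp
  obtain ⟨ε', hε', hεq⟩ : ∃ ε' > 0, ∑ q ∈ Icc 2 q₀, (12 : ℝ) ^ #q.primeFactors * ε' ≤ ε / 3 := by
    set W := ∑ q ∈ Icc 2 q₀, (12 : ℝ) ^ #q.primeFactors
    have hW : 0 ≤ W := by positivity
    refine ⟨ε / 3 / (W + 1), by positivity, ?_⟩
    rw [← sum_mul, ← mul_div_assoc, div_le_iff₀ (by positivity)]
    nlinarith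
  have hsmall : ∀ᶠ X : ℝ in atTop, ∀ q ∈ (Icc 2 q₀).filter (fun q => Squarefree q ∧ A.Coprime q),
      ∀ (a b : ZMod A), (∀ α : ℕ → ℂ,
        (∀ p ∈ primeWindow c d X, ‖α p - classWeight A f X a p‖ ≤ K / (p : ℝ) ^ 2) →
        primNorm q.primeFactors (primeWindow c d X) α ≤ ε') ∧ (∀ β : ℕ → ℂ,
        (∀ p ∈ primeWindow c' d X, ‖β p - classWeight A h X b p‖ ≤ K / (p : ℝ) ^ 2) →
        primNorm q.primeFactors (primeWindow c' d X) β ≤ ε') := by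
    rw [eventually_all_finset]
    intro q hq
    simp only [mem_filter, mem_Icc] at hq
    have hA : ∀ p ∈ q.primeFactors, A.Coprime p := fun p hp =>
      hq.2.2.coprime_dvd_right (Nat.dvd_of_mem_primeFactors hp)
    have h0 : q.primeFactors.Nonempty := Nat.nonempty_primeFactors.mpr (by omega)
    simp only [eventually_all, eventually_and]
    exact fun a b => ⟨eventually_primNorm_le hA h0 a hf hc hfc hfd K hε',
      eventually_primNorm_le hA h0 b hh hc' hhc hhd K hε'⟩
  filter_upwards [hsmall, ht1.eventually (eventually_le_nhds (by positivity : 0 < ε / 3)),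
    eventually_ge_atTop 1, eventually_ge_atTop (4 / c)] with X hX1 hX2 hX3 hX4 a b α β hα hβ
  have hbd : ∀ {g : ℝ → ℝ} {a' : ZMod A} {γ : ℕ → ℂ} {M₁ : ℝ} (s : Finset ℕ), (∀ p ∈ s, p.Prime) →
      M₁ ≤ max M M' →
      (∀ u, |g u| ≤ M₁) → (∀ p ∈ s, ‖γ p - classWeight A g X a' p‖ ≤ K / (p : ℝ) ^ 2) →
      ∀ p ∈ s, ‖γ p‖ ≤ K' / p := by
    intro g a' γ M₁ s hs hM₁ hg hγ p hp
    have hp1 : (1 : ℝ) ≤ p := by exact_mod_cast (hs p hp).one_le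
    calc ‖γ p‖ = ‖(γ p - classWeight A g X a' p) + classWeight A g X a' p‖ := by rw [sub_add_cancel]
      _ ≤ K / (p : ℝ) ^ 2 + M₁ / p := by
          refine (norm_add_le _ _).trans (add_le_add (hγ p hp) ?_)
          rw [Complex.norm_real]; exact abs_classWeight_le hg X a' p
      _ ≤ |K| / (p : ℝ) ^ 1 + max M M' / p := by
          gcongr
          · exact le_abs_self K
          · norm_num
      _ = _ := by rw [hK', pow_one]; ring
  have hw : ∀ c₁, ∀ p ∈ primeWindow c₁ d X, p.Prime := fun _ p hp => (mem_primeWindow.mp hp).1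
  have hlarge := htail X hX3 (by rw [div_le_iff₀ hc] at hX4; linarith)
    (primeWindow c d X) (primeWindow c' d X) α β (hw c) (hw c')
    (fun p hp => (mem_primeWindow.mp hp).2) (fun p hp => (mem_primeWindow.mp hp).2)
    (hbd _ (hw c) (le_max_left _ _) hM hα) (hbd _ (hw c') (le_max_right _ _) hM' hβ) q₀ hq₀
  set F : ℕ → ℝ := fun q => (12 : ℝ) ^ #q.primeFactors *
    (√(primNorm q.primeFactors (primeWindow c d X) α) *
      √(primNorm q.primeFactors (primeWindow c' d X) β))
  have hF0 : ∀ q, 0 ≤ F q := fun q => by positivity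
  set L := ⌊Real.exp ((1 / 2 - δ) * X)⌋₊
  have hs : ∑ q ∈ (Icc 2 q₀).filter (fun q => Squarefree q ∧ A.Coprime q), F q ≤ ε / 3 := by
    refine le_trans ?_ hεq
    refine le_trans (sum_le_sum (g := fun q => (12 : ℝ) ^ #q.primeFactors * ε') fun q hq => ?_)
      (sum_le_sum_of_subset_of_nonneg (filter_subset _ _) fun _ _ _ => by positivity)
    obtain ⟨h2, h3⟩ := hX1 q hq a b
    refine mul_le_mul_of_nonneg_left ?_ (by positivity)
    calc _ ≤ √ε' * √ε' := by
          gcongr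
          · exact h2 α hα
          · exact h3 β hβ
      _ = ε' := Real.mul_self_sqrt hε'.le
  calc ∑ q ∈ (Icc 2 L).filter (fun q => Squarefree q ∧ A.Coprime q), F q
      ≤ ∑ q ∈ (Icc 2 q₀).filter (fun q => Squarefree q ∧ A.Coprime q) ∪
          (Ioc q₀ L).filter Squarefree, F q := by
        refine sum_le_sum_of_subset_of_nonneg (fun q hq => ?_) fun q _ _ => hF0 q
        simp only [mem_union, mem_filter, mem_Ioc, mem_Icc] at hq ⊢
        by_cases h : q ≤ q₀
        · exact Or.inl ⟨⟨hq.1.1, h⟩, hq.2⟩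
        · exact Or.inr ⟨⟨by omega, hq.1.2⟩, hq.2.1⟩
    _ ≤ ∑ q ∈ (Icc 2 q₀).filter (fun q => Squarefree q ∧ A.Coprime q), F q +
          ∑ q ∈ (Ioc q₀ L).filter Squarefree, F q := by
        rw [← sum_union_inter]
        exact le_add_of_nonneg_right (sum_nonneg fun q _ => hF0 q)
    _ ≤ ε / 3 + C * (1 / √q₀ + X ^ 3 * Real.exp (-(κ * X))) := add_le_add hs hlarge
    _ ≤ ε := by rw [mul_add]; linarith

end BilinearSmall

section BilinearLocal

open Finset Filter Topology MeasureTheory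

variable {ι : Type*} [Fintype ι]

/-- The weight `1 / (p - 1)`. -/
noncomputable def unitDensity (p : ℕ) : ℝ := ((p : ℝ) - 1)⁻¹

/-- The average of the local factor over the units modulo `p`. -/
noncomputable abbrev avgFac (X : ℝ) (ξ : ι → ℝ × ℝ) (p : ℕ) : ℂ := locFac unitDensity X ξ p

lemma norm_avgFac_sub_one_le {X : ℝ} (hX : 0 < X) (ξ : ι → ℝ × ℝ) {p : ℕ} (hp : p.Prime) :
    ‖avgFac X ξ p - 1‖ ≤ 6 * Fintype.card ι / p := by
  have h2 : (2 : ℝ) ≤ p := by exact_mod_cast hp.two_le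
  rw [avgFac, locFac, add_sub_cancel_left, norm_mul, Complex.norm_real, Real.norm_eq_abs,
    unitDensity, abs_of_pos (inv_pos.mpr (by linarith))]
  have h1 : ‖∑ i, eFac X (ξ i) p‖ ≤ 3 * Fintype.card ι :=
    (norm_sum_le_of_le _ fun i _ => norm_eFac_le hX (ξ i) p).trans (le_of_eq (by simp [mul_comm]))
  have h3 : ((p : ℝ) - 1)⁻¹ ≤ 2 / p := by
    rw [inv_eq_one_div, div_le_div_iff₀ (by linarith) (by linarith)]; linarith
  calc _ ≤ 2 / (p : ℝ) * (3 * Fintype.card ι) :=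
        mul_le_mul h3 h1 (norm_nonneg _) (by positivity)
    _ = _ := by ring

lemma half_le_norm_avgFac {X : ℝ} (hX : 0 < X) (ξ : ι → ℝ × ℝ) {p : ℕ} (hp : p.Prime)
    (hcard : 12 * Fintype.card ι ≤ p) : 1 / 2 ≤ ‖avgFac X ξ p‖ := by
  have h0 : (0 : ℝ) < p := by exact_mod_cast hp.pos
  have h1 : ‖avgFac X ξ p - 1‖ ≤ 1 / 2 := by
    refine (norm_avgFac_sub_one_le hX ξ hp).trans ?_
    rw [div_le_div_iff₀ h0 two_pos]
    have : (12 : ℝ) * Fintype.card ι ≤ p := by exact_mod_cast hcard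
    linarith
  have h2 := norm_sub_norm_le (1 : ℂ) (1 - avgFac X ξ p)
  rw [sub_sub_cancel, norm_one, ← norm_neg (1 - _), neg_sub] at h2
  linarith

lemma norm_inv_avgFac_sub_one_le {X : ℝ} (hX : 0 < X) (ξ : ι → ℝ × ℝ) {p : ℕ} (hp : p.Prime)
    (hcard : 12 * Fintype.card ι ≤ p) : ‖(avgFac X ξ p)⁻¹ - 1‖ ≤ 12 * Fintype.card ι / p := by
  have h := half_le_norm_avgFac hX ξ hp hcard
  have h0 : avgFac X ξ p ≠ 0 := fun h0 => by rw [h0, norm_zero] at h; linarith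
  have e : (avgFac X ξ p)⁻¹ - 1 = -((avgFac X ξ p)⁻¹ * (avgFac X ξ p - 1)) := by
    field_simp; ring
  rw [e, norm_neg, norm_mul, norm_inv]
  calc _ ≤ 2 * (6 * Fintype.card ι / (p : ℝ)) := by
        refine mul_le_mul ?_ (norm_avgFac_sub_one_le hX ξ hp) (norm_nonneg _) two_pos.le
        rw [inv_le_comm₀ (by linarith) two_pos]
        linarith
    _ = _ := by ring

/-- The part of the local factor at `p` of mean zero over the units. -/
noncomputable def balFac (r : (p : ℕ) → ι → ZMod p) (X : ℝ) (ξ : ι → ℝ × ℝ) (n p : ℕ) : ℂ :=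
  ∑ i, ((balInd p n (r p i) : ℝ) : ℂ) * eFac X (ξ i) p

/-- The part of the local factor at `p` which is constant on the units. -/
noncomputable def mainFac (X : ℝ) (ξ : ι → ℝ × ℝ) (n p : ℕ) : ℂ :=
  if p ∣ n then 1 else avgFac X ξ p

/-- The coefficients of the term of the expansion with mean-zero part at the primes in `Q`. -/
noncomputable def splitCoeff (r : (p : ℕ) → ι → ZMod p) (Q : Finset ℕ) (n p : ℕ) (i : ι) : ℂ :=
  if p ∈ Q then ((balInd p n (r p i) : ℝ) : ℂ) else if p ∣ n then 0 else unitDensity p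

/-- The constant coefficients of the term with mean-zero part at the primes in `Q`. -/
noncomputable def splitConst (Q : Finset ℕ) (p : ℕ) : ℂ := if p ∈ Q then 0 else 1

lemma prod_split (r : (p : ℕ) → ι → ZMod p) (X : ℝ) (ξ : ι → ℝ × ℝ) (n : ℕ) {Q S : Finset ℕ}
    (hQS : Q ⊆ S) :
    ∏ p ∈ S, locPoly X (splitConst Q) (splitCoeff r Q n) ξ p =
      (∏ p ∈ Q, balFac r X ξ n p) * ∏ p ∈ S \ Q, mainFac X ξ n p := by
  rw [← prod_sdiff hQS, mul_comm]
  congr 1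
  · refine prod_congr rfl fun p hp => ?_
    simp [locPoly, splitConst, splitCoeff, hp, balFac]
  · refine prod_congr rfl fun p hp => ?_
    have hpQ := (mem_sdiff.mp hp).2
    simp only [locPoly, splitConst, splitCoeff, hpQ, if_false, mainFac, avgFac, locFac]
    split_ifs
    · simp
    · rw [mul_sum]

lemma locPoly_indicator_eq (r : (p : ℕ) → ι → ZMod p) (X : ℝ) (ξ : ι → ℝ × ℝ) (n : ℕ) {p : ℕ}
    (hr : ∀ i, r p i ≠ 0) :
    locPoly X (fun _ => 1) (fun p i => if (n : ZMod p) = r p i then 1 else 0) ξ p =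
      balFac r X ξ n p + mainFac X ξ n p := by
  have hz : ((n : ZMod p) = 0) ↔ p ∣ n := ZMod.natCast_eq_zero_iff n p
  simp only [locPoly, balFac, mainFac, balInd, hz]
  split_ifs with h
  · have : ∀ i, (n : ZMod p) ≠ r p i := fun i hi => hr i (by rw [← hi, hz]; exact h)
    simp [this]
  · rw [avgFac, locFac, unitDensity, mul_sum, add_left_comm, ← sum_add_distrib]
    congr 1
    refine sum_congr rfl fun i _ => ?_
    split_ifs <;> push_cast <;> ring

lemma prod_locPoly_indicator_eq_sum (r : (p : ℕ) → ι → ZMod p) (X : ℝ) (ξ : ι → ℝ × ℝ) (n : ℕ)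
    {S : Finset ℕ} (hr : ∀ p ∈ S, ∀ i, r p i ≠ 0) :
    ∏ p ∈ S, locPoly X (fun _ => 1) (fun p i => if (n : ZMod p) = r p i then 1 else 0) ξ p =
      ∑ Q ∈ S.powerset, ∏ p ∈ S, locPoly X (splitConst Q) (splitCoeff r Q n) ξ p := by
  classical
  rw [prod_congr rfl fun p hp => locPoly_indicator_eq r X ξ n (hr p hp), prod_add]
  exact sum_congr rfl fun Q hQ => (prod_split r X ξ n (mem_powerset.mp hQ)).symm

/-- At products of two distinct primes the constant parts multiply to twists of the Euler
product. -/
lemma prod_split_mul_eq (r : (p : ℕ) → ι → ZMod p) (X : ℝ) (ξ : ι → ℝ × ℝ) {Q S : Finset ℕ}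
    (hQS : Q ⊆ S) (hS : ∀ p ∈ S, p.Prime) (hE : ∀ p ∈ S, avgFac X ξ p ≠ 0) {x y : ℕ} (hx : x ∈ S)
    (hy : y ∈ S) (hxy : x ≠ y) :
    ∏ p ∈ S, locPoly X (splitConst Q) (splitCoeff r Q (x * y)) ξ p =
      (∏ p ∈ S, avgFac X ξ p) * ((avgFac X ξ x)⁻¹ * (avgFac X ξ y)⁻¹ *
        ∏ p ∈ Q, (balFac r X ξ (x * y) p / avgFac X ξ p)) := by
  classical
  have hdvd : ∀ p ∈ S, p ∣ x * y ↔ p = x ∨ p = y := fun p hp => by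
    rw [(hS p hp).dvd_mul, Nat.prime_dvd_prime_iff_eq (hS p hp) (hS x hx),
      Nat.prime_dvd_prime_iff_eq (hS p hp) (hS y hy)]
  rw [prod_split r X ξ _ hQS]
  by_cases hQ : ∃ p ∈ Q, p ∣ x * y
  · obtain ⟨p, hp, hpd⟩ := hQ
    have : balFac r X ξ (x * y) p = 0 := by
      have h0 : ((x * y : ℕ) : ZMod p) = 0 := (ZMod.natCast_eq_zero_iff _ _).mpr hpd
      simp only [balFac, balInd, h0, if_true]
      simp
    rw [prod_eq_zero hp this, prod_eq_zero hp (by rw [this, zero_div])]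
    simp
  · push Not at hQ
    have hxQ : x ∈ S \ Q := mem_sdiff.mpr ⟨hx, fun h => hQ x h (dvd_mul_right x y)⟩
    have hyQ : y ∈ S \ Q := mem_sdiff.mpr ⟨hy, fun h => hQ y h (dvd_mul_left y x)⟩
    have h1 : ∀ p ∈ S \ Q, mainFac X ξ (x * y) p = avgFac X ξ p *
        ((if p = x then (avgFac X ξ x)⁻¹ else 1) * (if p = y then (avgFac X ξ y)⁻¹ else 1)) := by
      intro p hp
      have hpS := (mem_sdiff.mp hp).1
      rw [mainFac]
      by_cases h2 : p = x
      · subst h2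
        rw [if_pos (dvd_mul_right _ _), if_pos rfl, if_neg hxy, mul_one, mul_inv_cancel₀ (hE p hpS)]
      · by_cases h3 : p = y
        · subst h3
          rw [if_pos (dvd_mul_left _ _), if_neg h2, if_pos rfl, one_mul, mul_inv_cancel₀ (hE p hpS)]
        · rw [if_neg (by rw [hdvd p hpS]; tauto), if_neg h2, if_neg h3, mul_one, mul_one]
    rw [prod_congr rfl h1, prod_mul_distrib, prod_mul_distrib, prod_ite_eq' (S \ Q),
      prod_ite_eq' (S \ Q), if_pos hxQ, if_pos hyQ, prod_div_distrib, ← prod_sdiff hQS]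
    have hne : ∏ p ∈ Q, avgFac X ξ p ≠ 0 := prod_ne_zero_iff.mpr fun p hp => hE p (hQS hp)
    field_simp

lemma norm_sum_prod_balFac_le {X : ℝ} (hX : 0 < X) (ξ : ι → ℝ × ℝ) (r : (p : ℕ) → ι → ZMod p)
    {Q T T' : Finset ℕ} (hQ : ∀ p ∈ Q, p.Prime) (hcard : ∀ p ∈ Q, 12 * Fintype.card ι ≤ p)
    (hr : ∀ p ∈ Q, ∀ i, r p i ≠ 0) (α β : ℕ → ℂ) :
    ‖∑ x ∈ T, ∑ y ∈ T', α x * β y * ∏ p ∈ Q, (balFac r X ξ (x * y) p / avgFac X ξ p)‖ ≤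
      ((6 * Fintype.card ι : ℕ) : ℝ) ^ #Q * (√(primNorm Q T α) * √(primNorm Q T' β)) := by
  classical
  have hF : ∀ p : Q, Fact (p : ℕ).Prime := fun p => ⟨hQ p p.2⟩
  have hexp : ∀ n : ℕ, ∏ p ∈ Q, (balFac r X ξ n p / avgFac X ξ p) =
      ∑ s : Q → ι, (∏ p : Q, eFac X (ξ (s p)) p / avgFac X ξ p) *
        ∏ p : Q, ((balInd p n (r p (s p)) : ℝ) : ℂ) := fun n => by
    rw [← prod_coe_sort Q]
    simp only [balFac, sum_div]
    rw [prod_univ_sum, Fintype.piFinset_univ]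
    refine sum_congr rfl fun s _ => ?_
    rw [← prod_mul_distrib]
    exact prod_congr rfl fun p _ => by ring
  have hswap : ∑ x ∈ T, ∑ y ∈ T', α x * β y * ∏ p ∈ Q, (balFac r X ξ (x * y) p / avgFac X ξ p) =
      ∑ s : Q → ι, (∏ p : Q, eFac X (ξ (s p)) p / avgFac X ξ p) *
        ∑ x ∈ T, ∑ y ∈ T', α x * β y * ∏ p : Q, ((balInd p (x * y) (r p (s p)) : ℝ) : ℂ) := by
    calc _ = ∑ x ∈ T, ∑ y ∈ T', ∑ s : Q → ι, (∏ p : Q, eFac X (ξ (s p)) p / avgFac X ξ p) *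
          (α x * β y * ∏ p : Q, ((balInd p (x * y) (r p (s p)) : ℝ) : ℂ)) := by
          refine sum_congr rfl fun x _ => sum_congr rfl fun y _ => ?_
          rw [hexp, mul_sum]
          refine sum_congr rfl fun s _ => ?_
          push_cast
          ring
      _ = ∑ s : Q → ι, ∑ x ∈ T, ∑ y ∈ T', (∏ p : Q, eFac X (ξ (s p)) p / avgFac X ξ p) *
          (α x * β y * ∏ p : Q, ((balInd p (x * y) (r p (s p)) : ℝ) : ℂ)) :=
          (sum_congr rfl fun x _ => sum_comm).trans sum_comm
      _ = _ := sum_congr rfl fun s _ => by rw [mul_sum]; simp only [mul_sum]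
  rw [hswap]
  calc _ ≤ ∑ s : Q → ι, (6 : ℝ) ^ #Q * (√(primNorm Q T α) * √(primNorm Q T' β)) := by
        refine norm_sum_le_of_le _ fun s _ => ?_
        rw [norm_mul]
        refine mul_le_mul ?_ ?_ (norm_nonneg _) (by positivity)
        · rw [norm_prod, ← Fintype.card_coe Q, ← card_univ, ← prod_const]
          refine prod_le_prod (fun _ _ => norm_nonneg _) fun p _ => ?_
          have h := half_le_norm_avgFac hX ξ (hQ p p.2) (hcard p p.2)
          rw [norm_div, div_le_iff₀ (by linarith)]
          linarith [norm_eFac_le hX (ξ (s p)) p]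
        · rw [← Real.sqrt_mul (primNorm_nonneg T α)]
          refine Real.le_sqrt_of_sq_le ?_
          have := norm_bilinear_sq_le (Q := Q) T α β T' fun p => Units.mk0 _ (hr p p.2 (s p))
          simpa using this
    _ = _ := by
        rw [sum_const, card_univ, Fintype.card_fun, Fintype.card_coe, nsmul_eq_mul]
        push_cast
        rw [← mul_assoc, ← mul_pow, mul_comm (6 : ℝ)]

end BilinearLocal

section BilinearMain

open Finset Filter Topology MeasureTheory

variable {ι : Type*} [Fintype ι]

/-- Division of a weight by the averaged local factors. -/
noncomputable def divAvg (X : ℝ) (ξ : ι → ℝ × ℝ) (α : ℕ → ℂ) (p : ℕ) : ℂ :=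
  α p * (avgFac X ξ p)⁻¹

lemma norm_sum_split_sub_le {X : ℝ} (hX : 0 < X) (ξ : ι → ℝ × ℝ) {r : (p : ℕ) → ι → ZMod p}
    {S T T' : Finset ℕ} (hS : ∀ p ∈ S, p.Prime) (hcard : ∀ p ∈ S, 12 * Fintype.card ι ≤ p)
    (hι : 6 * Fintype.card ι ≤ 12) (hr : ∀ p ∈ S, ∀ i, r p i ≠ 0) (hT : T ⊆ S) (hT' : T' ⊆ S)
    {α : ℕ → ℂ} (β : ℕ → ℂ) (hne : ∀ x ∈ T, x ∈ T' → α x = 0) {n : ℕ} (hn : 1 ≤ n) :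
    ‖∑ x ∈ T, ∑ y ∈ T', α x * β y * ∑ Q ∈ S.powerset with ∏ p ∈ Q, p ≤ n,
        ∏ p ∈ S, locPoly X (splitConst Q) (splitCoeff r Q (x * y)) ξ p -
      (∏ p ∈ S, avgFac X ξ p) * ((∑ x ∈ T, divAvg X ξ α x) * ∑ y ∈ T', divAvg X ξ β y)‖ ≤
    (∑ q ∈ Icc 2 n with Squarefree q ∧ q.primeFactors ⊆ S, (12 : ℝ) ^ #q.primeFactors *
      (√(primNorm q.primeFactors T (divAvg X ξ α)) *
        √(primNorm q.primeFactors T' (divAvg X ξ β)))) * ‖∏ p ∈ S, avgFac X ξ p‖ := by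
  classical
  have hE : ∀ p ∈ S, avgFac X ξ p ≠ 0 := fun p hp h0 => by
    have := half_le_norm_avgFac hX ξ (hS p hp) (hcard p hp)
    rw [h0, norm_zero] at this; linarith
  set G : Finset ℕ → ℂ := fun Q => ∑ x ∈ T, ∑ y ∈ T', divAvg X ξ α x * divAvg X ξ β y *
    ∏ p ∈ Q, (balFac r X ξ (x * y) p / avgFac X ξ p) with hG
  have hmain : ∑ x ∈ T, ∑ y ∈ T', α x * β y * ∑ Q ∈ S.powerset with ∏ p ∈ Q, p ≤ n,
        ∏ p ∈ S, locPoly X (splitConst Q) (splitCoeff r Q (x * y)) ξ p =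
      (∏ p ∈ S, avgFac X ξ p) * ∑ Q ∈ S.powerset with ∏ p ∈ Q, p ≤ n, G Q := by
    calc _ = ∑ x ∈ T, ∑ y ∈ T', ∑ Q ∈ S.powerset with ∏ p ∈ Q, p ≤ n,
          (∏ p ∈ S, avgFac X ξ p) * (divAvg X ξ α x * divAvg X ξ β y *
            ∏ p ∈ Q, (balFac r X ξ (x * y) p / avgFac X ξ p)) := by
          refine sum_congr rfl fun x hx => sum_congr rfl fun y hy => ?_
          rw [mul_sum]
          refine sum_congr rfl fun Q hQ => ?_
          by_cases hxy : x = y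
          · subst hxy
            rw [divAvg, hne x hx hy]; ring
          · rw [prod_split_mul_eq r X ξ (mem_powerset.mp (mem_filter.mp hQ).1) hS hE (hT hx)
              (hT' hy) hxy, divAvg, divAvg]
            ring
      _ = ∑ Q ∈ S.powerset with ∏ p ∈ Q, p ≤ n, ∑ x ∈ T, ∑ y ∈ T',
          (∏ p ∈ S, avgFac X ξ p) * (divAvg X ξ α x * divAvg X ξ β y *
            ∏ p ∈ Q, (balFac r X ξ (x * y) p / avgFac X ξ p)) :=
          (sum_congr rfl fun x _ => sum_comm).trans sum_comm
      _ = _ := by simp only [hG, mul_sum]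
  have hempty : (∅ : Finset ℕ) ∈ S.powerset.filter fun Q => ∏ p ∈ Q, p ≤ n := by simpa using hn
  have hG0 : G ∅ = (∑ x ∈ T, divAvg X ξ α x) * ∑ y ∈ T', divAvg X ξ β y := by
    simp only [hG, prod_empty, mul_one, sum_mul_sum]
  rw [hmain, ← add_sum_erase _ _ hempty, hG0, mul_add, add_sub_cancel_left, norm_mul, mul_comm]
  refine mul_le_mul_of_nonneg_right ?_ (norm_nonneg _)
  set H : Finset ℕ → ℝ := fun Q => (12 : ℝ) ^ #Q *
    (√(primNorm Q T (divAvg X ξ α)) * √(primNorm Q T' (divAvg X ξ β))) with hH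
  have hGH : ∀ Q ∈ S.powerset, ‖G Q‖ ≤ H Q := fun Q hQ => by
    have hQS := mem_powerset.mp hQ
    refine (norm_sum_prod_balFac_le hX ξ r (fun p hp => hS p (hQS hp))
      (fun p hp => hcard p (hQS hp)) (fun p hp => hr p (hQS hp)) _ _).trans ?_
    refine mul_le_mul_of_nonneg_right ?_ (by positivity)
    exact pow_le_pow_left₀ (by positivity) (by exact_mod_cast hι) _
  refine (norm_sum_le_of_le _ fun Q hQ => hGH Q (mem_filter.mp (mem_of_mem_erase hQ)).1).trans ?_
  have h1 := sum_powerset_prod_le_eq hS n H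
  rw [← add_sum_erase _ _ hempty] at h1
  have h2 : ∑ q ∈ Icc 1 n with Squarefree q ∧ q.primeFactors ⊆ S, H q.primeFactors =
      H ∅ + ∑ q ∈ Icc 2 n with Squarefree q ∧ q.primeFactors ⊆ S, H q.primeFactors := by
    have : (Icc 1 n).filter (fun q => Squarefree q ∧ q.primeFactors ⊆ S) =
        insert 1 ((Icc 2 n).filter fun q => Squarefree q ∧ q.primeFactors ⊆ S) := by
      ext q
      simp only [mem_filter, mem_Icc, mem_insert]
      constructor
      · rintro ⟨h, h'⟩
        rcases eq_or_ne q 1 with h1 | h1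
        · exact Or.inl h1
        · exact Or.inr ⟨by omega, h'⟩
      · rintro (rfl | h)
        · simpa using hn
        · exact ⟨by omega, h.2⟩
    rw [this, sum_insert (by simp), Nat.primeFactors_one]
  exact (add_left_cancel (h1.trans h2)).le

/-- A pair of weights supported on complementary ranges. -/
structure TilePair (f h : ℝ → ℝ) (c c' d : ℝ) : Prop where
  continuous_left : Continuous f
  continuous_right : Continuous h
  left_low : ∀ u ≤ c, f u = 0
  left_high : ∀ u, c' ≤ u → f u = 0
  right_low : ∀ u ≤ c', h u = 0
  right_high : ∀ u, d ≤ u → h u = 0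
  pos : 0 < c
  le_mid : c ≤ c'
  one_le : 1 ≤ c + c'
  mid_le : c' ≤ d

variable {f h : ℝ → ℝ} {c c' d : ℝ}

lemma TilePair.left_high' (t : TilePair f h c c' d) (u : ℝ) (hu : d ≤ u) : f u = 0 :=
  t.left_high u (t.mid_le.trans hu)

lemma norm_divAvg_sub_le {X : ℝ} (hX : 0 < X) (ξ : ι → ℝ × ℝ) {A : ℕ} {M : ℝ}
    (hM : ∀ u, |f u| ≤ M) (a : ZMod A) {p : ℕ} (hp : p.Prime) (hcard : 12 * Fintype.card ι ≤ p) :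
    ‖divAvg X ξ (fun p => (classWeight A f X a p : ℂ)) p - classWeight A f X a p‖ ≤
      M * (12 * Fintype.card ι) / (p : ℝ) ^ 2 := by
  have h1 : divAvg X ξ (fun p => (classWeight A f X a p : ℂ)) p - classWeight A f X a p =
      (classWeight A f X a p : ℂ) * ((avgFac X ξ p)⁻¹ - 1) := by rw [divAvg]; ring
  rw [h1, norm_mul, Complex.norm_real, Real.norm_eq_abs]
  have hM0 : 0 ≤ M := (abs_nonneg _).trans (hM 0)
  calc _ ≤ M / p * (12 * Fintype.card ι / p) :=
        mul_le_mul (abs_classWeight_le hM X a p) (norm_inv_avgFac_sub_one_le hX ξ hp hcard)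
          (norm_nonneg _) (by positivity)
    _ = _ := by rw [div_mul_div_comm, sq]

lemma norm_sum_divAvg_sub_le {X : ℝ} (hX : 0 < X) (ξ : ι → ℝ × ℝ) {A : ℕ} {M : ℝ}
    (hM : ∀ u, |f u| ≤ M) (a : ZMod A)
    (hcard : ∀ p ∈ primeWindow c d X, 12 * Fintype.card ι ≤ p) :
    ‖∑ p ∈ primeWindow c d X, divAvg X ξ (fun p => (classWeight A f X a p : ℂ)) p -
        ((∑ p ∈ primeWindow c d X, classWeight A f X a p : ℝ) : ℂ)‖ ≤
      M * (12 * Fintype.card ι) * (2 * Real.exp (-(c * X))) := by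
  have hM0 : 0 ≤ M := (abs_nonneg _).trans (hM 0)
  push_cast
  rw [← sum_sub_distrib]
  refine (norm_sum_le_of_le _ fun p hp => norm_divAvg_sub_le hX ξ hM a (mem_primeWindow.mp hp).1
    (hcard p hp)).trans ?_
  simp_rw [div_eq_mul_one_div (_ * _), ← mul_sum]
  exact mul_le_mul_of_nonneg_left sum_primeWindow_inv_sq_le (by positivity)

lemma primeWindow_subset_sievePrimes {D P : ℕ} {X : ℝ} (h1 : (D : ℝ) < Real.exp (c * X))
    (h2 : ⌊Real.exp (d * X)⌋₊ < P) : primeWindow c d X ⊆ sievePrimes D P := by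
  intro p hp
  obtain ⟨h3, h4, h5⟩ := mem_primeWindow.mp hp
  rw [mem_sievePrimes]
  exact ⟨h3, by exact_mod_cast h1.trans_le h4, (Nat.le_floor h5).trans_lt h2⟩

end BilinearMain

section BilinearLimit

open Finset Filter Topology MeasureTheory

variable {ι : Type*} [Fintype ι] {f h : ℝ → ℝ} {c c' d : ℝ}

lemma norm_mul_sub_mul_le {s t : ℂ} {I J η : ℝ} (hs : ‖s - I‖ ≤ η) (ht : ‖t - J‖ ≤ η)
    (hη : η ≤ 1) : ‖s * t - ((I * J : ℝ) : ℂ)‖ ≤ η * (|I| + |J| + 1) := by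
  have hη0 : 0 ≤ η := (norm_nonneg _).trans hs
  have e : s * t - ((I * J : ℝ) : ℂ) = (s - I) * (t - J) + (s - I) * J + I * (t - J) := by
    push_cast; ring
  rw [e]
  refine (norm_add₃_le).trans ?_
  simp only [norm_mul, Complex.norm_real, Real.norm_eq_abs]
  have h1 : ‖s - I‖ * ‖t - J‖ ≤ η * 1 := mul_le_mul hs (ht.trans hη) (norm_nonneg _) hη0
  have h2 : ‖s - I‖ * |J| ≤ η * |J| := mul_le_mul_of_nonneg_right hs (abs_nonneg _)
  have h3 : |I| * ‖t - J‖ ≤ |I| * η := mul_le_mul_of_nonneg_left ht (abs_nonneg _)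
  linarith

lemma tendsto_exp_mul_atTop (hc : 0 < c) : Tendsto (fun X : ℝ => Real.exp (c * X)) atTop atTop :=
  Real.tendsto_exp_atTop.comp (tendsto_id.const_mul_atTop hc)

lemma eventually_norm_sum_divAvg_sub_le {A : ℕ} [NeZero A] {a : ZMod A} (ha : IsUnit a)
    (hf : Continuous f) (hc : 0 < c) (hfc : ∀ u ≤ c, f u = 0) (hfd : ∀ u, d ≤ u → f u = 0)
    {ε : ℝ} (hε : 0 < ε) :
    ∀ᶠ X : ℝ in atTop, ∀ ξ : ι → ℝ × ℝ,
      ‖∑ p ∈ primeWindow c d X, divAvg X ξ (fun p => (classWeight A f X a p : ℂ)) p -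
        (((A.totient : ℝ)⁻¹ * ∫ u, f u / u : ℝ) : ℂ)‖ ≤ ε := by
  obtain ⟨M, hM0, hM⟩ := exists_bound_of_support hf hfc hfd
  have h1 := Metric.tendsto_nhds.mp (tendsto_sum_primeWindow ha hf hc hfc hfd) (ε / 2) (by positivity)
  have h2 : Tendsto (fun X : ℝ => M * (12 * Fintype.card ι) * (2 * Real.exp (-(c * X)))) atTop
      (𝓝 0) := by
    have := ((Real.tendsto_exp_neg_atTop_nhds_zero.comp
      (tendsto_id.const_mul_atTop hc)).const_mul 2).const_mul (M * (12 * Fintype.card ι))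
    simpa [Function.comp_def] using this
  filter_upwards [h1, h2.eventually (eventually_le_nhds (half_pos hε)), eventually_gt_atTop 0,
    (tendsto_exp_mul_atTop hc).eventually_ge_atTop (12 * Fintype.card ι : ℝ)] with X hX1 hX2 hX3 hX4 ξ
  have hX5 := norm_sum_divAvg_sub_le (c := c) (d := d) hX3 ξ hM a fun p hp => by
    have := hX4.trans (mem_primeWindow.mp hp).2.1
    exact_mod_cast this
  rw [dist_eq_norm, ← Complex.norm_real, Complex.ofReal_sub] at hX1
  have h5 := norm_add_le_of_le hX5 hX1.le
  simp only [classWeight] at h5 ⊢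
  rw [sub_add_sub_cancel] at h5
  linarith

theorem TilePair.eventually_norm_sum_split_sub_le (t : TilePair f h c c' d) {A : ℕ} [NeZero A]
    {a b : ZMod A} (ha : IsUnit a) (hb : IsUnit b) {D : ℕ}
    (hA : ∀ p : ℕ, p.Prime → D < p → A.Coprime p) (hcard : 12 * Fintype.card ι ≤ D)
    (hι : 6 * Fintype.card ι ≤ 12) {r : (p : ℕ) → ι → ZMod p}
    (hr : ∀ p : ℕ, p.Prime → D < p → ∀ i, r p i ≠ 0) {δ : ℝ} (hδ : 0 < δ) (hδ' : δ ≤ 1 / 2)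
    {ε : ℝ} (hε : 0 < ε) :
    ∀ᶠ X : ℝ in atTop, ∀ᶠ P in atTop, ∀ ξ : ι → ℝ × ℝ,
      ‖∑ x ∈ primeWindow c d X, ∑ y ∈ primeWindow c' d X,
          ((classWeight A f X a x : ℂ) * (classWeight A h X b y : ℂ)) *
          ∑ Q ∈ (sievePrimes D P).powerset with ∏ p ∈ Q, p ≤ ⌊Real.exp ((1 / 2 - δ) * X)⌋₊,
            ∏ p ∈ sievePrimes D P, locPoly X (splitConst Q) (splitCoeff r Q (x * y)) ξ p -
        (∏ p ∈ sievePrimes D P, avgFac X ξ p) *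
          (((A.totient : ℝ)⁻¹ * (∫ u, f u / u) * ((A.totient : ℝ)⁻¹ * ∫ u, h u / u) : ℝ) : ℂ)‖
      ≤ ε * ‖∏ p ∈ sievePrimes D P, avgFac X ξ p‖ := by
  have hc' : 0 < c' := t.pos.trans_le t.le_mid
  have hd : 0 < d := hc'.trans_le t.mid_le
  set I := (A.totient : ℝ)⁻¹ * ∫ u, f u / u with hI
  set J := (A.totient : ℝ)⁻¹ * ∫ u, h u / u with hJ
  obtain ⟨M, hM0, hM⟩ := exists_bound_of_support t.continuous_left t.left_low t.left_high'
  obtain ⟨M', hM0', hM'⟩ := exists_bound_of_support t.continuous_right t.right_low t.right_high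
  set η := min 1 (ε / 2 / (|I| + |J| + 1)) with hη
  have hη0 : 0 < η := lt_min one_pos (by positivity)
  have hη1 : η * (|I| + |J| + 1) ≤ ε / 2 := by
    rw [← le_div_iff₀ (by positivity)]; exact min_le_right _ _
  filter_upwards [eventually_norm_sum_divAvg_sub_le (ι := ι) ha t.continuous_left t.pos t.left_low
      t.left_high' hη0,
    eventually_norm_sum_divAvg_sub_le (ι := ι) hb t.continuous_right hc' t.right_low
      t.right_high hη0,
    eventually_bilinear_sum_le (A := A) t.continuous_left t.left_low t.left_high'
      t.continuous_right t.right_low t.right_high t.pos t.le_mid t.one_le hd hδ hδ'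
      (max M M' * (12 * Fintype.card ι)) (half_pos hε),
    (tendsto_exp_mul_atTop t.pos).eventually_gt_atTop (D : ℝ), eventually_gt_atTop 0]
    with X h1 h2 h3 h4 hX
  filter_upwards [eventually_gt_atTop ⌊Real.exp (d * X)⌋₊] with P hP ξ
  have h4' : (D : ℝ) < Real.exp (c' * X) :=
    h4.trans_le (Real.exp_le_exp.mpr (mul_le_mul_of_nonneg_right t.le_mid hX.le))
  have hW := primeWindow_subset_sievePrimes h4 hP
  have hW' := primeWindow_subset_sievePrimes h4' hP
  set S := sievePrimes D P with hS
  have hSp : ∀ p ∈ S, p.Prime := fun p hp => (mem_sievePrimes.mp hp).1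
  have hSD : ∀ p ∈ S, D < p := fun p hp => (mem_sievePrimes.mp hp).2.1
  have hSc : ∀ p ∈ S, 12 * Fintype.card ι ≤ p := fun p hp => hcard.trans (hSD p hp).le
  have hn : 1 ≤ ⌊Real.exp ((1 / 2 - δ) * X)⌋₊ := by
    rw [Nat.one_le_floor_iff, Real.one_le_exp_iff]
    exact mul_nonneg (by linarith) hX.le
  have key := norm_sum_split_sub_le hX ξ hSp hSc hι
    (fun p hp => hr p (hSp p hp) (hSD p hp)) hW hW'
    (α := fun p => (classWeight A f X a p : ℂ)) (fun p => (classWeight A h X b p : ℂ)) (by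
      intro x _ hx'
      have hx0 : (0 : ℝ) < x := by exact_mod_cast (mem_primeWindow.mp hx').1.pos
      have : c' ≤ Real.log x / X := by
        rw [le_div_iff₀ hX, Real.le_log_iff_exp_le hx0]; exact (mem_primeWindow.mp hx').2.1
      simp [classWeight, t.left_high _ this]) hn
  have h5 := h3 a b (divAvg X ξ fun p => (classWeight A f X a p : ℂ))
    (divAvg X ξ fun p => (classWeight A h X b p : ℂ))
    (fun p hp => (norm_divAvg_sub_le hX ξ hM a (mem_primeWindow.mp hp).1 (hSc p (hW hp))).trans
      (by gcongr; exact le_max_left _ _))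
    (fun p hp => (norm_divAvg_sub_le hX ξ hM' b (mem_primeWindow.mp hp).1 (hSc p (hW' hp))).trans
      (by gcongr; exact le_max_right _ _))
  have h6 : ∑ q ∈ Icc 2 ⌊Real.exp ((1 / 2 - δ) * X)⌋₊ with Squarefree q ∧ q.primeFactors ⊆ S,
      (12 : ℝ) ^ #q.primeFactors *
      (√(primNorm q.primeFactors (primeWindow c d X) (divAvg X ξ fun p => classWeight A f X a p)) *
        √(primNorm q.primeFactors (primeWindow c' d X) (divAvg X ξ fun p => classWeight A h X b p)))
      ≤ ε / 2 := by
    refine le_trans (sum_le_sum_of_subset_of_nonneg (fun q hq => ?_) fun _ _ _ => by positivity) h5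
    simp only [mem_filter] at hq ⊢
    refine ⟨hq.1, hq.2.1, Nat.Coprime.symm ?_⟩
    refine Nat.Coprime.symm (Nat.coprime_of_dvd fun p hp hpA hpq => ?_)
    have hpS := hq.2.2 (Nat.mem_primeFactors.mpr ⟨hp, hpq, by
      have := (mem_Icc.mp hq.1).1; omega⟩)
    exact (Nat.Prime.coprime_iff_not_dvd hp).mp (hA p hp (hSD p hpS)).symm hpA
  have h7 := norm_mul_sub_mul_le (h1 ξ) (h2 ξ) (min_le_left _ _)
  have h8 := key.trans (mul_le_mul_of_nonneg_right h6 (norm_nonneg _))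
  have h9 := mul_le_mul_of_nonneg_right (h7.trans hη1) (norm_nonneg (∏ p ∈ S, avgFac X ξ p))
  rw [← norm_mul, sub_mul, mul_comm _ (∏ p ∈ S, avgFac X ξ p),
    mul_comm (((I * J : ℝ)) : ℂ)] at h9
  have h10 := norm_add_le_of_le h8 h9
  rw [sub_add_sub_cancel] at h10
  refine h10.trans (le_of_eq (by ring))

end BilinearLimit

section BilinearIntegral

open Finset Filter Topology MeasureTheory

variable {ι : Type*} [Fintype ι] {f h : ℝ → ℝ} {c c' d : ℝ}
variable {g e g' e' : ι → ℝ → ℝ} {ψ ψ' : ι → ℝ → ℂ}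

lemma integral_prod_locPoly_eq_sum_small (hL : ∀ i, LaplacePair (g i) (e i) (ψ i))
    (hL' : ∀ i, LaplacePair (g' i) (e' i) (ψ' i)) {s s' : ι → ℝ}
    (hs : ∀ i u, s i ≤ u → g i u = 0) (hs' : ∀ i u, s' i ≤ u → g' i u = 0) {θ : ℝ}
    (hsum : ∑ i, (s i + s' i) ≤ θ) {X : ℝ} (hX : 0 < X) {S : Finset ℕ} (hS : ∀ p ∈ S, p.Prime)
    {r : (p : ℕ) → ι → ZMod p} (hr : ∀ p ∈ S, ∀ i, r p i ≠ 0) (n : ℕ) :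
    ∫ ξ, pairWeight ψ ψ' ξ * ∏ p ∈ S, locPoly X (fun _ => 1)
        (fun p i => if (n : ZMod p) = r p i then 1 else 0) ξ p =
      ∫ ξ, pairWeight ψ ψ' ξ * ∑ Q ∈ S.powerset with ∏ p ∈ Q, p ≤ ⌊Real.exp (θ * X)⌋₊,
        ∏ p ∈ S, locPoly X (splitConst Q) (splitCoeff r Q n) ξ p := by
  simp_rw [fun ξ => prod_locPoly_indicator_eq_sum r X ξ n hr, mul_sum]
  rw [integral_finsetSum _ fun Q _ => integrable_prod_locPoly hL hL' hX _ _ S,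
    integral_finsetSum _ fun Q _ => integrable_prod_locPoly hL hL' hX _ _ S]
  refine (sum_subset (filter_subset _ _) fun Q hQ hQ' => ?_).symm
  have hQS := mem_powerset.mp hQ
  refine integral_prod_locPoly_eq_zero hL hL' hs hs' hX _ _ hQS (fun p hp => by
    simp [splitConst, hp]) ?_
  have h1 : ¬ ∏ p ∈ Q, p ≤ ⌊Real.exp (θ * X)⌋₊ := fun h => hQ' (mem_filter.mpr ⟨hQ, h⟩)
  rw [exp_lt_prod_iff fun p hp => hS p (hQS hp)] at h1
  refine lt_of_le_of_lt ?_ h1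
  rw [mul_comm]
  exact mul_le_mul_of_nonneg_right hsum hX.le

theorem TilePair.eventually_sum_integral (t : TilePair f h c c' d) {A : ℕ} [NeZero A]
    {a b : ZMod A} (ha : IsUnit a) (hb : IsUnit b) {D : ℕ}
    (hA : ∀ p : ℕ, p.Prime → D < p → A.Coprime p) (hcard : 12 * Fintype.card ι ≤ D)
    (hι : 6 * Fintype.card ι ≤ 12) {r : (p : ℕ) → ι → ZMod p}
    (hr : ∀ p : ℕ, p.Prime → D < p → ∀ i, r p i ≠ 0)
    (hL : ∀ i, LaplacePair (g i) (e i) (ψ i)) (hL' : ∀ i, LaplacePair (g' i) (e' i) (ψ' i))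
    {s s' : ι → ℝ} (hs : ∀ i u, s i ≤ u → g i u = 0) (hs' : ∀ i u, s' i ≤ u → g' i u = 0)
    {δ : ℝ} (hδ : 0 < δ) (hδ' : δ ≤ 1 / 2) (hsum : ∑ i, (s i + s' i) ≤ 1 / 2 - δ)
    {ε : ℝ} (hε : 0 < ε) :
    ∀ᶠ X : ℝ in atTop, ∀ᶠ P in atTop,
      ‖(X : ℂ) ^ Fintype.card ι * ∑ x ∈ primeWindow c d X, ∑ y ∈ primeWindow c' d X,
          ((classWeight A f X a x : ℂ) * (classWeight A h X b y : ℂ)) *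
          (∫ ξ, pairWeight ψ ψ' ξ * ∏ p ∈ sievePrimes D P, locPoly X (fun _ => 1)
            (fun p i => if ((x * y : ℕ) : ZMod p) = r p i then 1 else 0) ξ p) -
        (((A.totient : ℝ)⁻¹ * (∫ u, f u / u) * ((A.totient : ℝ)⁻¹ * ∫ u, h u / u) *
          (eulerConst unitDensity D (Fintype.card ι) * ∏ i, ∫ u in Set.Ioi 0, e i u * e' i u) :
            ℝ) : ℂ)‖ ≤ ε := by
  have hv : ∀ p : ℕ, p.Prime → |unitDensity p - (p : ℝ)⁻¹| ≤ 2 * ((p : ℝ)⁻¹) ^ 2 :=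
    fun p hp => abs_inv_sub_one_sub_inv_le hp
  obtain ⟨C, hC, hC'⟩ := exists_integral_norm_prod_locFac_le hL hL' hv D
  set B : ℝ := (A.totient : ℝ)⁻¹ * (∫ u, f u / u) * ((A.totient : ℝ)⁻¹ * ∫ u, h u / u) with hB
  filter_upwards [t.eventually_norm_sum_split_sub_le ha hb hA hcard hι hr hδ hδ'
      (ε := ε / 2 / C) (by positivity),
    eventually_integral_prod_locFac hL hL' hv D (ε := ε / 2 / (|B| + 1)) (by positivity),
    eventually_ge_atTop 2] with X h1 h2 hX2
  have hX : 0 < X := by linarith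
  filter_upwards [h1, h2, hC' X hX2] with P h3 h4 h5
  set S := sievePrimes D P with hS
  have hSp : ∀ p ∈ S, p.Prime := fun p hp => (mem_sievePrimes.mp hp).1
  have hSr : ∀ p ∈ S, ∀ i, r p i ≠ 0 := fun p hp => hr p (hSp p hp) (mem_sievePrimes.mp hp).2.1
  set F : (ι → ℝ × ℝ) → ℂ := fun ξ => ∑ x ∈ primeWindow c d X, ∑ y ∈ primeWindow c' d X,
    ((classWeight A f X a x : ℂ) * (classWeight A h X b y : ℂ)) *
      ∑ Q ∈ S.powerset with ∏ p ∈ Q, p ≤ ⌊Real.exp ((1 / 2 - δ) * X)⌋₊,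
        ∏ p ∈ S, locPoly X (splitConst Q) (splitCoeff r Q (x * y)) ξ p with hF
  have hint : ∀ n : ℕ, Integrable fun ξ => pairWeight ψ ψ' ξ *
      ∑ Q ∈ S.powerset with ∏ p ∈ Q, p ≤ ⌊Real.exp ((1 / 2 - δ) * X)⌋₊,
        ∏ p ∈ S, locPoly X (splitConst Q) (splitCoeff r Q n) ξ p := fun n => by
    simp_rw [mul_sum]
    exact integrable_finsetSum _ fun Q _ => integrable_prod_locPoly hL hL' hX _ _ S
  have hFeq : ∀ ξ, pairWeight ψ ψ' ξ * F ξ =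
      ∑ x ∈ primeWindow c d X, ∑ y ∈ primeWindow c' d X,
        ((classWeight A f X a x : ℂ) * (classWeight A h X b y : ℂ)) * (pairWeight ψ ψ' ξ *
          ∑ Q ∈ S.powerset with ∏ p ∈ Q, p ≤ ⌊Real.exp ((1 / 2 - δ) * X)⌋₊,
            ∏ p ∈ S, locPoly X (splitConst Q) (splitCoeff r Q (x * y)) ξ p) := fun ξ => by
    rw [hF, mul_sum]
    refine sum_congr rfl fun x _ => ?_
    rw [mul_sum]
    exact sum_congr rfl fun y _ => by ring
  have hFint : Integrable fun ξ => pairWeight ψ ψ' ξ * F ξ := by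
    simp_rw [hFeq]
    exact integrable_finsetSum _ fun x _ => integrable_finsetSum _ fun y _ => (hint _).const_mul _
  have hsumF : ∑ x ∈ primeWindow c d X, ∑ y ∈ primeWindow c' d X,
      ((classWeight A f X a x : ℂ) * (classWeight A h X b y : ℂ)) *
      (∫ ξ, pairWeight ψ ψ' ξ * ∏ p ∈ S, locPoly X (fun _ => 1)
        (fun p i => if ((x * y : ℕ) : ZMod p) = r p i then 1 else 0) ξ p) =
      ∫ ξ, pairWeight ψ ψ' ξ * F ξ := by
    simp_rw [hFeq]
    rw [integral_finsetSum _ fun x _ => integrable_finsetSum _ fun y _ => (hint _).const_mul _]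
    refine sum_congr rfl fun x _ => ?_
    rw [integral_finsetSum _ fun y _ => (hint _).const_mul _]
    refine sum_congr rfl fun y _ => ?_
    rw [integral_const_mul,
      integral_prod_locPoly_eq_sum_small hL hL' hs hs' hsum hX hSp hSr (x * y)]
  have hEc : Continuous fun ξ : ι → ℝ × ℝ => ∏ p ∈ S, avgFac X ξ p := continuous_prod_locFac _ X S
  have hEint : Integrable fun ξ => pairWeight ψ ψ' ξ * ∏ p ∈ S, avgFac X ξ p := by
    have := integrable_prod_locPoly hL hL' hX (fun _ => 1) (fun p _ => (unitDensity p : ℂ)) S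
    simpa only [locPoly, ← mul_sum, avgFac, locFac] using this
  have h6 : ‖(∫ ξ, pairWeight ψ ψ' ξ * F ξ) -
      (B : ℂ) * ∫ ξ, pairWeight ψ ψ' ξ * ∏ p ∈ S, avgFac X ξ p‖ ≤
      ε / 2 / C * ∫ ξ, ‖pairWeight ψ ψ' ξ‖ * ‖∏ p ∈ S, locFac unitDensity X ξ p‖ := by
    rw [← integral_const_mul, ← integral_const_mul]
    refine (le_of_eq (congrArg norm (integral_sub hFint (hEint.const_mul _)).symm)).trans ?_
    refine norm_integral_le_of_norm_le ?_ (Eventually.of_forall fun ξ => ?_)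
    · refine Integrable.const_mul ?_ _
      simpa only [norm_mul] using hEint.norm
    · have := h3 ξ
      rw [show pairWeight ψ ψ' ξ * F ξ - (B : ℂ) * (pairWeight ψ ψ' ξ * ∏ p ∈ S, avgFac X ξ p) =
        pairWeight ψ ψ' ξ * (F ξ - (∏ p ∈ S, avgFac X ξ p) * (B : ℂ)) by ring, norm_mul]
      calc _ ≤ ‖pairWeight ψ ψ' ξ‖ * (ε / 2 / C * ‖∏ p ∈ S, avgFac X ξ p‖) :=
            mul_le_mul_of_nonneg_left this (norm_nonneg _)
        _ = _ := by ring
  have h7 : ‖(X : ℂ) ^ Fintype.card ι * (∫ ξ, pairWeight ψ ψ' ξ * F ξ) - (X : ℂ) ^ Fintype.card ι *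
      ((B : ℂ) * ∫ ξ, pairWeight ψ ψ' ξ * ∏ p ∈ S, avgFac X ξ p)‖ ≤ ε / 2 := by
    rw [← mul_sub, norm_mul, norm_pow, Complex.norm_real, Real.norm_of_nonneg hX.le]
    calc _ ≤ X ^ Fintype.card ι * (ε / 2 / C * ∫ ξ, ‖pairWeight ψ ψ' ξ‖ *
            ‖∏ p ∈ S, locFac unitDensity X ξ p‖) := mul_le_mul_of_nonneg_left h6 (by positivity)
      _ = ε / 2 / C * (X ^ Fintype.card ι * ∫ ξ, ‖pairWeight ψ ψ' ξ‖ *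
            ‖∏ p ∈ S, locFac unitDensity X ξ p‖) := by ring
      _ ≤ ε / 2 / C * C := mul_le_mul_of_nonneg_left h5 (by positivity)
      _ = _ := by field_simp
  have h8 := mul_le_mul_of_nonneg_left h4 (abs_nonneg B)
  rw [← Real.norm_eq_abs, ← Complex.norm_real, ← norm_mul, mul_sub, Complex.norm_real,
    Real.norm_eq_abs] at h8
  have h9 : |B| * (ε / 2 / (|B| + 1)) ≤ ε / 2 := by
    rw [mul_div_assoc', div_le_iff₀ (by positivity)]
    nlinarith [abs_nonneg B]
  have h10 := norm_add_le_of_le h7 (h8.trans h9)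
  rw [hsumF]
  rw [mul_left_comm (B : ℂ), sub_add_sub_cancel, add_halves] at h10
  rw [Complex.ofReal_mul B]
  exact h10

end BilinearIntegral

section BilinearSieve

open Finset Filter Topology MeasureTheory

variable {ι : Type*} [Fintype ι] {f h : ℝ → ℝ} {c c' d : ℝ}
variable {g e g' e' : ι → ℝ → ℝ} {ψ ψ' : ι → ℝ → ℂ}

lemma sum_units_classWeight_mul {A : ℕ} [NeZero A] {B : ZMod A} (hB : IsUnit B) (f h : ℝ → ℝ)
    (X : ℝ) (x y : ℕ) :
    ∑ a : (ZMod A)ˣ, classWeight A f X a x * classWeight A h X ((a⁻¹ : (ZMod A)ˣ) * B) y =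
      if ((x * y : ℕ) : ZMod A) = B then f (Real.log x / X) / x * (h (Real.log y / X) / y)
      else 0 := by
  split_ifs with hxy
  · rw [Nat.cast_mul] at hxy
    have hx : IsUnit (x : ZMod A) := isUnit_of_mul_isUnit_left (hxy ▸ hB)
    rw [sum_eq_single hx.unit]
    · have hy : (y : ZMod A) = ((hx.unit)⁻¹ : (ZMod A)ˣ) * B := by
        rw [← hxy, ← mul_assoc, IsUnit.val_inv_mul, one_mul]
      rw [classWeight, classWeight, if_pos hx.unit_spec.symm, if_pos hy]
    · intro a _ ha
      rw [classWeight, if_neg, zero_mul]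
      exact fun h => ha (Units.ext h.symm)
    · simp
  · refine sum_eq_zero fun a _ => ?_
    rw [classWeight, classWeight]
    split_ifs with h1 h2
    · refine absurd ?_ hxy
      rw [Nat.cast_mul, h1, h2, Units.mul_inv_cancel_left]
    all_goals simp

/-- The sum of a pair of sieve weights over products of two primes in a residue class. -/
noncomputable def semiprimeSum (g g' : ι → ℝ → ℝ) (f h : ℝ → ℝ) (c c' d : ℝ) (A : ℕ) (B : ZMod A)
    (r : (p : ℕ) → ι → ZMod p) (D P : ℕ) (X : ℝ) : ℝ :=
  ∑ x ∈ primeWindow c d X, ∑ y ∈ primeWindow c' d X,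
    (if ((x * y : ℕ) : ZMod A) = B then f (Real.log x / X) / x * (h (Real.log y / X) / y) else 0) *
      ∏ i, (sieveWeight (g i) X ((sievePrimes D P).filter fun p => ((x * y : ℕ) : ZMod p) = r p i) *
        sieveWeight (g' i) X ((sievePrimes D P).filter fun p => ((x * y : ℕ) : ZMod p) = r p i))

theorem TilePair.eventually_semiprimeSum (t : TilePair f h c c' d) {A : ℕ} [NeZero A]
    {B : ZMod A} (hB : IsUnit B) {D : ℕ}
    (hA : ∀ p : ℕ, p.Prime → D < p → A.Coprime p) (hcard : 12 * Fintype.card ι ≤ D)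
    (hι : 6 * Fintype.card ι ≤ 12) {r : (p : ℕ) → ι → ZMod p}
    (hr : ∀ p : ℕ, p.Prime → D < p → ∀ i, r p i ≠ 0)
    (hr' : ∀ p : ℕ, p.Prime → D < p → ∀ i j, r p i = r p j → i = j)
    (hL : ∀ i, LaplacePair (g i) (e i) (ψ i)) (hL' : ∀ i, LaplacePair (g' i) (e' i) (ψ' i))
    {s s' : ι → ℝ} (hs : ∀ i u, s i ≤ u → g i u = 0) (hs' : ∀ i u, s' i ≤ u → g' i u = 0)
    {δ : ℝ} (hδ : 0 < δ) (hδ' : δ ≤ 1 / 2) (hsum : ∑ i, (s i + s' i) ≤ 1 / 2 - δ)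
    {ε : ℝ} (hε : 0 < ε) :
    ∀ᶠ X : ℝ in atTop, ∀ᶠ P in atTop,
      |X ^ Fintype.card ι * semiprimeSum g g' f h c c' d A B r D P X -
        (A.totient : ℝ)⁻¹ * ((∫ u, f u / u) * ∫ u, h u / u) *
          (eulerConst unitDensity D (Fintype.card ι) * ∏ i, ∫ u in Set.Ioi 0, e i u * e' i u)|
        ≤ ε := by
  have hφ : (0 : ℝ) < A.totient := by exact_mod_cast Nat.totient_pos.mpr (NeZero.pos A)
  have hev := fun a : (ZMod A)ˣ => t.eventually_sum_integral a.isUnit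
    ((a⁻¹).isUnit.mul hB) hA hcard hι hr hL hL' hs hs' hδ hδ' hsum
    (ε := ε / A.totient) (by positivity)
  filter_upwards [eventually_all.mpr hev, eventually_gt_atTop 0] with X hX hX0
  filter_upwards [eventually_all.mpr hX] with P hP
  set S := sievePrimes D P with hS
  have hSp : ∀ p ∈ S, p.Prime := fun p hp => (mem_sievePrimes.mp hp).1
  set K : ℝ := (∫ u, f u / u) * ∫ u, h u / u
  set V : ℝ := eulerConst unitDensity D (Fintype.card ι) * ∏ i, ∫ u in Set.Ioi 0, e i u * e' i u
  set Z : ℕ → ℝ := fun n => ∏ i, (sieveWeight (g i) X (S.filter fun p => (n : ZMod p) = r p i) *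
        sieveWeight (g' i) X (S.filter fun p => (n : ZMod p) = r p i)) with hZ
  have hint : ∀ n : ℕ, ∫ ξ, pairWeight ψ ψ' ξ * ∏ p ∈ S, locPoly X (fun _ => 1)
        (fun p i => if (n : ZMod p) = r p i then 1 else 0) ξ p = (Z n : ℂ) := fun n => by
    rw [hZ, ← integral_prod_locPoly_indicator hL hL' hX0
      (R := fun i => S.filter fun p => (n : ZMod p) = r p i) (fun i => filter_subset _ _)
      fun i j p hi hj => hr' p (hSp p (mem_filter.mp hi).1)
        (mem_sievePrimes.mp (mem_filter.mp hi).1).2.1 i j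
        ((mem_filter.mp hi).2.symm.trans (mem_filter.mp hj).2)]
    refine integral_congr_ae (Eventually.of_forall fun ξ => ?_)
    refine congrArg _ (prod_congr rfl fun p hp => ?_)
    simp [locPoly, mem_filter, hp]
  have h1 : ∀ a : (ZMod A)ˣ, |X ^ Fintype.card ι * (∑ x ∈ primeWindow c d X,
      ∑ y ∈ primeWindow c' d X, classWeight A f X a x *
        classWeight A h X ((a⁻¹ : (ZMod A)ˣ) * B) y * Z (x * y)) -
      (A.totient : ℝ)⁻¹ * ((A.totient : ℝ)⁻¹ * K * V)| ≤ ε / A.totient := fun a => by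
    have h2 := hP a
    simp_rw [hint] at h2
    rw [← Real.norm_eq_abs, ← Complex.norm_real]
    refine le_trans (le_of_eq (congrArg norm ?_)) h2
    simp only [K]
    push_cast
    ring
  have h3 := (abs_sum_le_sum_abs _ _).trans (sum_le_sum fun a (_ : a ∈ univ) => h1 a)
  rw [sum_sub_distrib, sum_const, sum_const, card_univ, ZMod.card_units_eq_totient, nsmul_eq_mul,
    nsmul_eq_mul, mul_inv_cancel_left₀ hφ.ne', mul_div_cancel₀ _ hφ.ne', ← mul_sum] at h3
  refine le_trans (le_of_eq ?_) h3
  congr 3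
  rw [semiprimeSum]
  refine Eq.trans (sum_congr rfl fun x _ => ?_) sum_comm
  refine Eq.trans (sum_congr rfl fun y _ => ?_) sum_comm
  rw [← sum_units_classWeight_mul hB, sum_mul]

end BilinearSieve

section Plateau

open Set MeasureTheory
open scoped ContDiff

/-- A smooth function equal to `1` on `[p, q]` and vanishing outside `(P, Q)`. -/
noncomputable def plateau (P p q Q u : ℝ) : ℝ :=
  Real.smoothTransition ((u - P) / (p - P)) * Real.smoothTransition ((Q - u) / (Q - q))

variable {P p q Q u : ℝ}

lemma contDiff_plateau : ContDiff ℝ ∞ (plateau P p q Q) := by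
  unfold plateau
  exact (Real.smoothTransition.contDiff.comp ((contDiff_id.sub contDiff_const).div_const _)).mul
    (Real.smoothTransition.contDiff.comp ((contDiff_const.sub contDiff_id).div_const _))

lemma plateau_nonneg : 0 ≤ plateau P p q Q u :=
  mul_nonneg (Real.smoothTransition.nonneg _) (Real.smoothTransition.nonneg _)

lemma plateau_le_one : plateau P p q Q u ≤ 1 :=
  mul_le_one₀ (Real.smoothTransition.le_one _) (Real.smoothTransition.nonneg _)
    (Real.smoothTransition.le_one _)

lemma plateau_eq_zero_of_le (hp : P < p) (hu : u ≤ P) : plateau P p q Q u = 0 := by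
  rw [plateau, Real.smoothTransition.zero_of_nonpos, zero_mul]
  exact div_nonpos_of_nonpos_of_nonneg (by linarith) (by linarith)

lemma plateau_eq_zero_of_ge (hq : q < Q) (hu : Q ≤ u) : plateau P p q Q u = 0 := by
  rw [plateau, Real.smoothTransition.zero_of_nonpos (x := (Q - u) / (Q - q)), mul_zero]
  exact div_nonpos_of_nonpos_of_nonneg (by linarith) (by linarith)

lemma plateau_eq_one (hp : P < p) (hq : q < Q) (hu : u ∈ Icc p q) : plateau P p q Q u = 1 := by
  rw [plateau, Real.smoothTransition.one_of_one_le, Real.smoothTransition.one_of_one_le, one_mul]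
  · rw [one_le_div (by linarith)]; linarith [hu.2]
  · rw [one_le_div (by linarith)]; linarith [hu.1]

lemma continuous_plateau : Continuous (plateau P p q Q) := contDiff_plateau.continuous

/-- A function bounded below by the constant `v` on `[p, q]` and vanishing outside `[P, Q]` has
integral at least `(q - p) v`. -/
lemma mul_le_integral_of_plateau {F : ℝ → ℝ} (hF : IntegrableOn F (Icc p q)) (hint : Integrable F)
    (h0 : ∀ u, 0 ≤ F u) {v : ℝ} (hpq : p ≤ q) (hv : ∀ u ∈ Icc p q, v ≤ F u) :
    (q - p) * v ≤ ∫ u, F u := by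
  calc (q - p) * v = ∫ _ in Icc p q, v := by
        rw [setIntegral_const, smul_eq_mul, Real.volume_real_Icc_of_le hpq]
    _ ≤ ∫ u in Icc p q, F u :=
        setIntegral_mono_on (integrableOn_const (by simp)) hF measurableSet_Icc hv
    _ ≤ ∫ u, F u := setIntegral_le_integral hint (Filter.Eventually.of_forall h0)

lemma setIntegral_sq_plateau_ge (hp : P < p) (hq : q < Q) (hpq : p ≤ q) (hP : 0 ≤ P) :
    q - p ≤ ∫ u in Ioi (0 : ℝ), plateau P p q Q u * plateau P p q Q u := by
  have hc : Continuous fun u => plateau P p q Q u * plateau P p q Q u :=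
    continuous_plateau.mul continuous_plateau
  have hi : Integrable fun u => plateau P p q Q u * plateau P p q Q u := by
    refine hc.integrable_of_hasCompactSupport (HasCompactSupport.of_support_subset_isCompact
      (isCompact_Icc (a := P) (b := Q)) fun u hu => ?_)
    by_contra h
    rw [mem_Icc, not_and_or, not_le, not_le] at h
    rcases h with h | h
    · exact hu (by simp only [plateau_eq_zero_of_le hp h.le, mul_zero])
    · exact hu (by simp only [plateau_eq_zero_of_ge hq h.le, mul_zero])
  rw [setIntegral_eq_integral_of_forall_compl_eq_zero]
  · have := mul_le_integral_of_plateau (p := p) (q := q) (v := 1) hi.integrableOn hi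
      (fun u => mul_self_nonneg _) hpq fun u hu => by rw [plateau_eq_one hp hq hu, one_mul]
    linarith
  · intro u hu
    rw [plateau_eq_zero_of_le hp (by simp at hu; linarith), mul_zero]

lemma setIntegral_sq_plateau_le (hp : P < p) (hq : q < Q) (hPQ : P ≤ Q) (hP : 0 ≤ P) :
    ∫ u in Ioi (0 : ℝ), plateau P p q Q u * plateau P p q Q u ≤ Q - P := by
  have hc : Continuous fun u => plateau P p q Q u * plateau P p q Q u :=
    continuous_plateau.mul continuous_plateau
  calc ∫ u in Ioi (0 : ℝ), plateau P p q Q u * plateau P p q Q u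
      = ∫ u in Ioc P Q, plateau P p q Q u * plateau P p q Q u := by
        rw [setIntegral_eq_of_subset_of_forall_sdiff_eq_zero measurableSet_Ioi]
        · exact fun u hu => lt_of_le_of_lt hP hu.1
        · rintro u ⟨_, hu⟩
          rw [mem_Ioc, not_and_or, not_lt, not_le] at hu
          rcases hu with h | h
          · rw [plateau_eq_zero_of_le hp h, mul_zero]
          · rw [plateau_eq_zero_of_ge hq h.le, mul_zero]
    _ ≤ ∫ _ in Ioc P Q, (1 : ℝ) := by
        refine setIntegral_mono_on (hc.integrableOn_Icc.mono_set Ioc_subset_Icc_self)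
          (integrableOn_const (by simp)) measurableSet_Ioc fun u _ => ?_
        exact mul_le_one₀ plateau_le_one plateau_nonneg plateau_le_one
    _ = Q - P := by rw [setIntegral_const, smul_eq_mul, Real.volume_real_Ioc_of_le hPQ, mul_one]

lemma min_max_le_integral_plateau (hp : P < p) (hq : q < Q) (hpq : p ≤ q) (hP : 0 ≤ P) {y : ℝ}
    (hy : 0 ≤ y) : max 0 (min (y - p) (q - p)) ≤
      (∫ t in (0 : ℝ)..Q, plateau P p q Q t) - ∫ t in y..Q, plateau P p q Q t := by
  have hint : ∀ a b : ℝ, IntervalIntegrable (plateau P p q Q) volume a b :=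
    fun a b => continuous_plateau.intervalIntegrable _ _
  rw [← intervalIntegral.integral_add_adjacent_intervals (hint 0 y) (hint y Q), add_sub_cancel_right]
  have h0 : 0 ≤ ∫ t in (0 : ℝ)..y, plateau P p q Q t :=
    intervalIntegral.integral_nonneg hy fun _ _ => plateau_nonneg
  refine max_le h0 ?_
  rcases le_total y p with hyp | hyp
  · exact (min_le_left _ _).trans (by linarith)
  have hm : p ≤ min y q := le_min hyp hpq
  calc min (y - p) (q - p) = min y q - p := (min_sub_sub_right y q p).symm ▸ rfl
    _ = ∫ _ in p..min y q, (1 : ℝ) := by simp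
    _ = ∫ t in p..min y q, plateau P p q Q t := by
        refine intervalIntegral.integral_congr fun t ht => ?_
        rw [uIcc_of_le hm] at ht
        exact (plateau_eq_one hp hq ⟨ht.1, ht.2.trans (min_le_right _ _)⟩).symm
    _ ≤ ∫ t in (0 : ℝ)..y, plateau P p q Q t :=
        intervalIntegral.integral_mono_interval (by linarith) hm (min_le_left _ _)
          (Filter.Eventually.of_forall fun _ => plateau_nonneg) (hint _ _)

end Plateau

section PolySieve

open Finset Filter Topology MeasureTheory
open scoped ContDiff

/-- Three linear forms `A i * m + B i` that avoid the primes up to `D` and are pairwise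
independent modulo every larger prime. -/
structure AdmissibleForms (D : ℕ) (A B : Fin 3 → ℕ) : Prop where
  pos : ∀ i, 0 < A i
  dvd_iff : ∀ i p, p.Prime → (p ∣ A i ↔ p ≤ D)
  coprime : ∀ i, (A i).Coprime (B i)
  det_ne : ∀ i j, i ≠ j → ∀ p, p.Prime → D < p → (A i * B j : ZMod p) ≠ A j * B i

namespace AdmissibleForms

variable {D : ℕ} {A B : Fin 3 → ℕ}

lemma cast_ne_zero (h : AdmissibleForms D A B) {p : ℕ} (hp : p.Prime) (hD : D < p) (i : Fin 3) :
    (A i : ZMod p) ≠ 0 := fun h0 =>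
  hD.not_ge ((h.dvd_iff i p hp).mp ((ZMod.natCast_eq_zero_iff _ _).mp h0))

lemma exists_dvd_iff_modEq (h : AdmissibleForms D A B) {p : ℕ} (hp : p.Prime) (hD : D < p)
    (i : Fin 3) : ∃ ρ, ∀ m, p ∣ A i * m + B i ↔ m ≡ ρ [MOD p] := by
  have := Fact.mk hp
  have hA := h.cast_ne_zero hp hD i
  refine ⟨(-(B i : ZMod p) / A i).val, fun m => ?_⟩
  rw [← ZMod.natCast_eq_zero_iff, ← ZMod.natCast_eq_natCast_iff, ZMod.natCast_val, ZMod.cast_id,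
    eq_div_iff hA, eq_neg_iff_add_eq_zero]
  push_cast
  rw [mul_comm]

lemma eq_of_dvd (h : AdmissibleForms D A B) {p : ℕ} (hp : p.Prime) (hD : D < p) {i j : Fin 3}
    {m : ℕ} (hi : p ∣ A i * m + B i) (hj : p ∣ A j * m + B j) : i = j := by
  have := Fact.mk hp
  by_contra hij
  refine h.det_ne i j hij p hp hD ?_
  rw [← ZMod.natCast_eq_zero_iff] at hi hj
  push_cast at hi hj
  linear_combination (A i : ZMod p) * hj - (A j : ZMod p) * hi

/-- The residue class of `A j * m + B j` modulo `p` forced by `p ∣ A i * m + B i`. -/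
noncomputable def residue (A B : Fin 3 → ℕ) (j : Fin 3) (p : ℕ) (i : Fin 2) : ZMod p :=
  (A (j.succAbove i) * B j - A j * B (j.succAbove i)) * (A (j.succAbove i) : ZMod p)⁻¹

lemma residue_ne_zero (h : AdmissibleForms D A B) {p : ℕ} (hp : p.Prime) (hD : D < p) (j : Fin 3)
    (i : Fin 2) : residue A B j p i ≠ 0 := by
  have := Fact.mk hp
  exact mul_ne_zero (sub_ne_zero.mpr (h.det_ne _ _ (Fin.succAbove_ne j i) p hp hD))
    (inv_ne_zero (h.cast_ne_zero hp hD _))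

lemma dvd_iff_eq_residue (h : AdmissibleForms D A B) {p : ℕ} (hp : p.Prime) (hD : D < p)
    (j : Fin 3) (i : Fin 2) (m : ℕ) : p ∣ A (j.succAbove i) * m + B (j.succAbove i) ↔
      ((A j * m + B j : ℕ) : ZMod p) = residue A B j p i := by
  have := Fact.mk hp
  have hi := h.cast_ne_zero hp hD (j.succAbove i)
  have hj := h.cast_ne_zero hp hD j
  rw [residue, ← div_eq_mul_inv, eq_div_iff hi, ← ZMod.natCast_eq_zero_iff]
  push_cast
  constructor
  · intro h0
    linear_combination (A j : ZMod p) * h0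
  · intro h0
    refine (mul_eq_zero.mp (?_ : (A j : ZMod p) * _ = 0)).resolve_left hj
    linear_combination h0

lemma residue_injective (h : AdmissibleForms D A B) {p : ℕ} (hp : p.Prime) (hD : D < p)
    (j : Fin 3) {i i' : Fin 2} (hii : residue A B j p i = residue A B j p i') : i = i' := by
  have := Fact.mk hp
  by_contra hne
  refine h.det_ne _ _ (fun h0 => hne (Fin.succAbove_right_injective h0)) p hp hD
    (?_ : (A (j.succAbove i) * B (j.succAbove i') : ZMod p) = _)
  have hi := h.cast_ne_zero hp hD (j.succAbove i)
  have hi' := h.cast_ne_zero hp hD (j.succAbove i')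
  have hj := h.cast_ne_zero hp hD j
  rw [residue, residue, ← div_eq_mul_inv, ← div_eq_mul_inv, div_eq_div_iff hi hi'] at hii
  refine mul_left_cancel₀ hj ?_
  linear_combination hii

lemma coprime_of_lt (h : AdmissibleForms D A B) {p : ℕ} (hp : p.Prime) (hD : D < p)
    (j : Fin 3) : (A j).Coprime p :=
  ((Nat.Prime.coprime_iff_not_dvd hp).mpr fun h0 => hD.not_ge ((h.dvd_iff j p hp).mp h0)).symm

lemma isUnit_cast (h : AdmissibleForms D A B) (j : Fin 3) : IsUnit (B j : ZMod (A j)) :=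
  (ZMod.isUnit_iff_coprime _ _).mpr (h.coprime j).symm

lemma totient_inv_mul (h : AdmissibleForms D A B) (j : Fin 3) :
    (A j : ℝ) * ((A j).totient : ℝ)⁻¹ = ∏ p ∈ Nat.primesBelow (D + 1), (1 - (p : ℝ)⁻¹)⁻¹ := by
  have hA : (A j : ℝ) ≠ 0 := by exact_mod_cast (h.pos j).ne'
  have h1 : ((A j).totient : ℝ) = A j * ∏ p ∈ (A j).primeFactors, (1 - (p : ℝ)⁻¹) := by
    have := congrArg (fun q : ℚ => (q : ℝ)) (Nat.totient_eq_mul_prod_factors (A j))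
    push_cast at this
    exact this
  have h2 : (A j).primeFactors = Nat.primesBelow (D + 1) := by
    ext p
    rw [Nat.mem_primeFactors, Nat.mem_primesBelow, Nat.lt_succ_iff]
    constructor
    · rintro ⟨hp, hd, _⟩
      exact ⟨(h.dvd_iff j p hp).mp hd, hp⟩
    · rintro ⟨hd, hp⟩
      exact ⟨hp, (h.dvd_iff j p hp).mpr hd, (h.pos j).ne'⟩
  rw [h1, h2, Finset.prod_inv_distrib, mul_inv, mul_inv_cancel_left₀ hA]

end AdmissibleForms

/-- A linear combination of products of smooth one-dimensional sieve weights. -/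
structure PolySieve (κ : Type*) where
  /-- the densities of the cutoffs -/
  dens : κ → ℝ → ℝ
  /-- the end points of the cutoffs -/
  top : κ → ℝ
  /-- the coefficients -/
  coef : (Fin 3 → κ) → ℝ
  /-- the slack in the support conditions -/
  slack : ℝ
  contDiff : ∀ k, ContDiff ℝ ∞ (dens k)
  dens_eq_zero : ∀ k u, top k ≤ u → dens k u = 0
  slack_pos : 0 < slack
  slack_le : slack ≤ 1 / 2
  pair_le : ∀ l, coef l ≠ 0 → ∀ i j, i ≠ j → top (l i) + top (l j) ≤ 1 / 4 - slack / 2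

namespace PolySieve

variable {κ : Type*} (W : PolySieve κ)

/-- The cutoff with density `-W.dens k`. -/
noncomputable def prim (k : κ) (u : ℝ) : ℝ := ∫ t in u..W.top k, W.dens k t

/-- The increment of the cutoff from `0`. -/
noncomputable def rise (k : κ) (u : ℝ) : ℝ := W.prim k 0 - W.prim k u

/-- The inner product of two densities. -/
noncomputable def gram (k k' : κ) : ℝ := ∫ u in Set.Ioi 0, W.dens k u * W.dens k' u

lemma exists_laplacePair (k : κ) : ∃ ψ, LaplacePair (W.prim k) (W.dens k) ψ :=
  _root_.exists_laplacePair (W.contDiff k) (W.dens_eq_zero k)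

lemma prim_eq_zero (k : κ) (u : ℝ) (hu : W.top k ≤ u) : W.prim k u = 0 := by
  rw [prim, intervalIntegral.integral_symm, intervalIntegral.integral_zero_ae, neg_zero]
  refine Eventually.of_forall fun t ht => W.dens_eq_zero k t ?_
  rw [Set.uIoc_of_le hu] at ht
  exact ht.1.le

lemma continuous_rise (k : κ) : Continuous (W.rise k) := by
  have hc := (W.contDiff k).continuous
  have : W.rise k = fun u => ∫ t in (0 : ℝ)..u, W.dens k t := by
    funext u
    rw [rise, prim, prim, sub_eq_iff_eq_add, intervalIntegral.integral_add_adjacent_intervals] <;>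
      exact hc.intervalIntegrable _ _
  rw [this]
  exact intervalIntegral.continuous_primitive (fun a b => hc.intervalIntegrable a b) 0

variable [Fintype κ]

/-- The sieve weight attached to the sets of primes dividing the three forms. -/
noncomputable def weight (X : ℝ) (S : Fin 3 → Finset ℕ) : ℝ :=
  ∑ l : Fin 3 → κ, W.coef l * ∏ i, sieveWeight (W.prim (l i)) X (S i)

/-- The quadratic form giving the second moment of the weight. -/
noncomputable def energy : ℝ :=
  ∑ l : Fin 3 → κ, ∑ l' : Fin 3 → κ, W.coef l * W.coef l' * ∏ i, W.gram (l i) (l' i)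

theorem eventually_secondMoment_le {D : ℕ} {A B : Fin 3 → ℕ} (hAB : AdmissibleForms D A B)
    {η : ℝ} (hη : 0 ≤ η) {ε : ℝ} (hε : 0 < ε) :
    ∀ᶠ X : ℝ in atTop, ∀ᶠ P in atTop,
      X ^ 2 * ∑ m ∈ Ioc ⌊Real.exp X⌋₊ ⌊Real.exp ((1 + η) * X)⌋₊, (m : ℝ)⁻¹ *
        W.weight X (fun i => {p ∈ sievePrimes D P | p ∣ A i * m + B i}) ^ 2 ≤
      η * (eulerConst (fun p => (p : ℝ)⁻¹) D 3 * W.energy) + ε := by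
  choose ψ hψ using W.exists_laplacePair
  set N : ℝ := ∑ l : Fin 3 → κ, ∑ l' : Fin 3 → κ, |W.coef l * W.coef l'| + 1 with hN
  have hN0 : 0 < N := by positivity
  have hterm : ∀ q : (Fin 3 → κ) × (Fin 3 → κ), ∀ᶠ X : ℝ in atTop, ∀ᶠ P in atTop,
      |W.coef q.1 * W.coef q.2 * (X ^ 3 / X * (∑ m ∈ Ioc ⌊Real.exp X⌋₊ ⌊Real.exp ((1 + η) * X)⌋₊,
        (m : ℝ)⁻¹ * ∏ i,
          (sieveWeight (W.prim (q.1 i)) X {p ∈ sievePrimes D P | p ∣ A i * m + B i} *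
            sieveWeight (W.prim (q.2 i)) X {p ∈ sievePrimes D P | p ∣ A i * m + B i})) -
        η * (eulerConst (fun p => (p : ℝ)⁻¹) D 3 * ∏ i, W.gram (q.1 i) (q.2 i)))| ≤
      |W.coef q.1 * W.coef q.2| * (ε / N) := by
    rintro ⟨l, l'⟩
    by_cases h0 : W.coef l * W.coef l' = 0
    · filter_upwards with X
      filter_upwards with P
      simp [h0]
    have hl := W.pair_le l (left_ne_zero_of_mul h0)
    have hl' := W.pair_le l' (right_ne_zero_of_mul h0)
    have := eventually_sum_sieveWeight (fun i => hψ (l i)) (fun i => hψ (l' i))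
      (a := fun i => W.top (l i)) (a' := fun i => W.top (l' i))
      (fun i => W.prim_eq_zero (l i)) (fun i => W.prim_eq_zero (l' i))
      (by
        rw [Fin.sum_univ_three]
        have h1 := hl 0 1 (by decide)
        have h2 := hl 0 2 (by decide)
        have h3 := hl 1 2 (by decide)
        have h4 := hl' 0 1 (by decide)
        have h5 := hl' 0 2 (by decide)
        have h6 := hl' 1 2 (by decide)
        have := W.slack_pos
        linarith) hη (D := D) (M := fun i m => A i * m + B i)
      (fun p hp hD i => hAB.exists_dvd_iff_modEq hp hD i)
      (fun p hp hD i j m => hAB.eq_of_dvd hp hD) (ε := ε / N) (by positivity)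
    filter_upwards [this] with X hX
    filter_upwards [hX] with P hP
    rw [abs_mul]
    refine mul_le_mul_of_nonneg_left ?_ (abs_nonneg _)
    simpa only [Fintype.card_fin, gram] using hP
  filter_upwards [eventually_all.mpr hterm, eventually_gt_atTop 0] with X hX hX0
  filter_upwards [eventually_all.mpr hX] with P hP
  have hexp : ∀ m : ℕ, W.weight X (fun i => {p ∈ sievePrimes D P | p ∣ A i * m + B i}) ^ 2 =
      ∑ q : (Fin 3 → κ) × (Fin 3 → κ), W.coef q.1 * W.coef q.2 * ∏ i,
          (sieveWeight (W.prim (q.1 i)) X {p ∈ sievePrimes D P | p ∣ A i * m + B i} *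
            sieveWeight (W.prim (q.2 i)) X {p ∈ sievePrimes D P | p ∣ A i * m + B i}) := by
    intro m
    rw [weight, sq, sum_mul_sum, ← Fintype.sum_prod_type']
    refine sum_congr rfl fun q _ => ?_
    rw [prod_mul_distrib]; ring
  have hfin := sum_le_sum fun q (_ : q ∈ (univ : Finset ((Fin 3 → κ) × (Fin 3 → κ)))) =>
    (le_abs_self _).trans (hP q)
  have hR : ∑ q : (Fin 3 → κ) × (Fin 3 → κ), |W.coef q.1 * W.coef q.2| * (ε / N) ≤ ε := by
    rw [← sum_mul, Fintype.sum_prod_type, mul_div_assoc', div_le_iff₀ hN0]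
    nlinarith
  have hE : ∑ q : (Fin 3 → κ) × (Fin 3 → κ), W.coef q.1 * W.coef q.2 *
      (η * (eulerConst (fun p => (p : ℝ)⁻¹) D 3 * ∏ i, W.gram (q.1 i) (q.2 i))) =
      η * (eulerConst (fun p => (p : ℝ)⁻¹) D 3 * W.energy) := by
    rw [energy, ← Fintype.sum_prod_type', mul_sum, mul_sum]
    exact sum_congr rfl fun q _ => by ring
  simp_rw [mul_sub] at hfin
  rw [sum_sub_distrib, hE] at hfin
  have hL : ∑ q : (Fin 3 → κ) × (Fin 3 → κ), W.coef q.1 * W.coef q.2 *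
      (X ^ 3 / X * (∑ m ∈ Ioc ⌊Real.exp X⌋₊ ⌊Real.exp ((1 + η) * X)⌋₊,
        (m : ℝ)⁻¹ * ∏ i,
          (sieveWeight (W.prim (q.1 i)) X {p ∈ sievePrimes D P | p ∣ A i * m + B i} *
            sieveWeight (W.prim (q.2 i)) X {p ∈ sievePrimes D P | p ∣ A i * m + B i}))) =
      X ^ 2 * ∑ m ∈ Ioc ⌊Real.exp X⌋₊ ⌊Real.exp ((1 + η) * X)⌋₊, (m : ℝ)⁻¹ *
        W.weight X (fun i => {p ∈ sievePrimes D P | p ∣ A i * m + B i}) ^ 2 := by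
    simp_rw [hexp, mul_sum]
    rw [sum_comm]
    refine sum_congr rfl fun m _ => sum_congr rfl fun q _ => ?_
    rw [show X ^ 3 / X = X ^ 2 by field_simp]
    ring
  rw [hL] at hfin
  linarith
end PolySieve

end PolySieve

section PolySieveTile

open Finset Filter Topology MeasureTheory

namespace PolySieve

variable {κ : Type*} (W : PolySieve κ) [Fintype κ]

/-- The value of the weight when the form of index `j` is a product of two primes, the smaller one
of logarithmic size `u`. -/
noncomputable def partialWeight (X u : ℝ) (j : Fin 3) (S : Fin 2 → Finset ℕ) : ℝ :=
  ∑ l : Fin 3 → κ, W.coef l * (W.rise (l j) u *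
    ∏ i, sieveWeight (W.prim (l (j.succAbove i))) X (S i))

/-- The second moment of the partial weight over products of two primes. -/
noncomputable def tileSum (f h : ℝ → ℝ) (c c' d : ℝ) (A B : Fin 3 → ℕ) (j : Fin 3) (D P : ℕ)
    (X : ℝ) : ℝ :=
  ∑ x ∈ primeWindow c d X, ∑ y ∈ primeWindow c' d X,
    (if ((x * y : ℕ) : ZMod (A j)) = B j then f (Real.log x / X) / x * (h (Real.log y / X) / y)
      else 0) *
      W.partialWeight X (Real.log x / X) j (fun i => (sievePrimes D P).filter fun p =>
        ((x * y : ℕ) : ZMod p) = AdmissibleForms.residue A B j p i) ^ 2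

/-- The quadratic form giving the size of `tileSum`. -/
noncomputable def tileForm (f : ℝ → ℝ) (j : Fin 3) : ℝ :=
  ∑ l : Fin 3 → κ, ∑ l' : Fin 3 → κ, W.coef l * W.coef l' *
    ((∏ i : Fin 2, W.gram (l (j.succAbove i)) (l' (j.succAbove i))) *
      ∫ u, f u * (W.rise (l j) u * W.rise (l' j) u) / u)

theorem eventually_tileSum_ge {D : ℕ} (hD : 24 ≤ D) {A B : Fin 3 → ℕ}
    (hAB : AdmissibleForms D A B) {f h : ℝ → ℝ} {c c' d : ℝ} (t : TilePair f h c c' d) (j : Fin 3)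
    {ε : ℝ} (hε : 0 < ε) :
    ∀ᶠ X : ℝ in atTop, ∀ᶠ P in atTop,
      eulerConst (fun p => (p : ℝ)⁻¹) D 3 * ((∫ u, h u / u) * W.tileForm f j) - ε ≤
        A j * (X ^ 2 * W.tileSum f h c c' d A B j D P X) := by
  have : NeZero (A j) := ⟨(hAB.pos j).ne'⟩
  have hA0 : (0 : ℝ) < A j := by exact_mod_cast hAB.pos j
  choose ψ hψ using W.exists_laplacePair
  set N : ℝ := ∑ l : Fin 3 → κ, ∑ l' : Fin 3 → κ, |W.coef l * W.coef l'| + 1 with hN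
  have hN0 : 0 < N := by positivity
  set F : (Fin 3 → κ) × (Fin 3 → κ) → ℝ → ℝ :=
    fun q u => f u * (W.rise (q.1 j) u * W.rise (q.2 j) u) with hF
  set E : ℝ := eulerConst unitDensity D 2 with hE
  have htile : ∀ q, TilePair (F q) h c c' d := fun q =>
    { continuous_left := t.continuous_left.mul ((W.continuous_rise _).mul (W.continuous_rise _))
      continuous_right := t.continuous_right
      left_low := fun u hu => by simp only [hF, t.left_low u hu, zero_mul]
      left_high := fun u hu => by simp only [hF, t.left_high u hu, zero_mul]
      right_low := t.right_low
      right_high := t.right_high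
      pos := t.pos
      le_mid := t.le_mid
      one_le := t.one_le
      mid_le := t.mid_le }
  have hterm : ∀ q : (Fin 3 → κ) × (Fin 3 → κ), ∀ᶠ X : ℝ in atTop, ∀ᶠ P in atTop,
      |W.coef q.1 * W.coef q.2 * (X ^ 2 * semiprimeSum (fun i => W.prim (q.1 (j.succAbove i)))
          (fun i => W.prim (q.2 (j.succAbove i))) (F q) h c c' d (A j) (B j)
          (AdmissibleForms.residue A B j) D P X -
        ((A j).totient : ℝ)⁻¹ * ((∫ u, F q u / u) * ∫ u, h u / u) *
          (E * ∏ i, W.gram (q.1 (j.succAbove i)) (q.2 (j.succAbove i))))| ≤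
      |W.coef q.1 * W.coef q.2| * (ε / (A j * N)) := by
    rintro ⟨l, l'⟩
    by_cases h0 : W.coef l * W.coef l' = 0
    · filter_upwards with X
      filter_upwards with P
      simp [h0]
    have h01 : j.succAbove 0 ≠ j.succAbove 1 := fun h => by
      simpa using Fin.succAbove_right_injective h
    have hl := W.pair_le l (left_ne_zero_of_mul h0) _ _ h01
    have hl' := W.pair_le l' (right_ne_zero_of_mul h0) _ _ h01
    have := (htile (l, l')).eventually_semiprimeSum (hAB.isUnit_cast j) (D := D)
      (fun p hp hDp => hAB.coprime_of_lt hp hDp j) (by simpa using hD) (by simp)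
      (fun p hp hDp i => hAB.residue_ne_zero hp hDp j i)
      (fun p hp hDp i i' => hAB.residue_injective hp hDp j)
      (fun i => hψ (l (j.succAbove i))) (fun i => hψ (l' (j.succAbove i)))
      (s := fun i => W.top (l (j.succAbove i))) (s' := fun i => W.top (l' (j.succAbove i)))
      (fun i => W.prim_eq_zero _) (fun i => W.prim_eq_zero _) W.slack_pos W.slack_le
      (by rw [Fin.sum_univ_two]; linarith) (ε := ε / (A j * N)) (by positivity)
    filter_upwards [this] with X hX
    filter_upwards [hX] with P hP
    rw [abs_mul]
    refine mul_le_mul_of_nonneg_left ?_ (abs_nonneg _)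
    simpa only [Fintype.card_fin, gram] using hP
  filter_upwards [eventually_all.mpr hterm] with X hX
  filter_upwards [eventually_all.mpr hX] with P hP
  have hfin := sum_le_sum fun q (_ : q ∈ (univ : Finset ((Fin 3 → κ) × (Fin 3 → κ)))) =>
    (neg_le_abs _).trans (hP q)
  have hR : ∑ q : (Fin 3 → κ) × (Fin 3 → κ), |W.coef q.1 * W.coef q.2| * (ε / (A j * N)) ≤
      ε / A j := by
    rw [← sum_mul, Fintype.sum_prod_type, mul_div_assoc', div_le_div_iff₀ (by positivity) hA0]
    have : 0 < ε * A j := by positivity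
    nlinarith
  have hmain : ∑ q : (Fin 3 → κ) × (Fin 3 → κ), W.coef q.1 * W.coef q.2 *
      (((A j).totient : ℝ)⁻¹ * ((∫ u, F q u / u) * ∫ u, h u / u) *
          (E * ∏ i, W.gram (q.1 (j.succAbove i)) (q.2 (j.succAbove i)))) =
      ((A j).totient : ℝ)⁻¹ * E * ((∫ u, h u / u) * W.tileForm f j) := by
    rw [tileForm, ← Fintype.sum_prod_type', mul_sum, mul_sum]
    exact sum_congr rfl fun q _ => by ring
  have hL : ∑ q : (Fin 3 → κ) × (Fin 3 → κ), W.coef q.1 * W.coef q.2 *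
      (X ^ 2 * semiprimeSum (fun i => W.prim (q.1 (j.succAbove i)))
          (fun i => W.prim (q.2 (j.succAbove i))) (F q) h c c' d (A j) (B j)
          (AdmissibleForms.residue A B j) D P X) =
      X ^ 2 * W.tileSum f h c c' d A B j D P X := by
    simp_rw [semiprimeSum, tileSum, mul_sum]
    rw [sum_comm]
    refine sum_congr rfl fun x _ => ?_
    rw [sum_comm]
    refine sum_congr rfl fun y _ => ?_
    rw [partialWeight, sq (∑ l : Fin 3 → κ, _), sum_mul_sum, ← Fintype.sum_prod_type', mul_sum,
      mul_sum]
    refine sum_congr rfl fun q _ => ?_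
    rw [prod_mul_distrib, hF]
    split_ifs <;> ring
  have hK : eulerConst (fun p => (p : ℝ)⁻¹) D 3 = A j * (((A j).totient : ℝ)⁻¹ * E) := by
    rw [eulerConst_three_eq, ← hAB.totient_inv_mul j, hE]
    change E * _ = _
    ring
  simp_rw [mul_sub, neg_sub] at hfin
  rw [sum_sub_distrib, hmain, hL] at hfin
  have h2 := mul_le_mul_of_nonneg_left (hfin.trans hR) hA0.le
  rw [mul_div_cancel₀ _ hA0.ne', mul_sub] at h2
  rw [hK]
  linarith

end PolySieve

end PolySieveTile

section PolySieveCount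

open Finset Filter Topology

lemma sieveWeight_pair (g : ℝ → ℝ) (X : ℝ) {x y : ℕ} (hxy : x ≠ y) :
    sieveWeight g X {x, y} = g 0 - g (Real.log x / X) - g (Real.log y / X) +
      g ((Real.log x + Real.log y) / X) := by
  have hx : x ∉ ({y} : Finset ℕ) := by simpa using hxy
  have hp : ({y} : Finset ℕ).powerset = {∅, {y}} := rfl
  have hne : (∅ : Finset ℕ) ≠ {y} := (singleton_ne_empty y).symm
  rw [sieveWeight, show ({x, y} : Finset ℕ) = insert x {y} from rfl, sum_powerset_insert hx, hp,
    sum_pair hne, sum_pair hne, card_insert_of_notMem hx, sum_insert hx]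
  simp
  ring

lemma eq_of_mul_eq_mul_of_lt {x y x' y' : ℕ} (hx : x.Prime) (hx' : x'.Prime) (hy' : y'.Prime)
    (hlt : x < y) (hlt' : x' < y') (h : x * y = x' * y') : x = x' ∧ y = y' := by
  have h1 : x ∣ x' * y' := h ▸ dvd_mul_right x y
  rcases (Nat.Prime.dvd_mul hx).mp h1 with h2 | h2
  · have hxx := (Nat.prime_dvd_prime_iff_eq hx hx').mp h2
    subst hxx
    exact ⟨rfl, Nat.eq_of_mul_eq_mul_left hx.pos h⟩
  · have hxy := (Nat.prime_dvd_prime_iff_eq hx hy').mp h2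
    subst hxy
    have : y = x' := Nat.eq_of_mul_eq_mul_left hx.pos (h.trans (mul_comm _ _))
    omega

namespace PolySieve

variable {κ : Type*} (W : PolySieve κ) [Fintype κ]

lemma partialWeight_eq_weight {D : ℕ} {A B : Fin 3 → ℕ} (hAB : AdmissibleForms D A B) {X : ℝ}
    {P m x y : ℕ} {j : Fin 3} (hx : x ∈ sievePrimes D P) (hy : y ∈ sievePrimes D P) (hxy : x ≠ y)
    (hm : A j * m + B j = x * y) (h1 : ∀ k, W.prim k (Real.log y / X) = 0)
    (h2 : ∀ k, W.prim k ((Real.log x + Real.log y) / X) = 0) :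
    W.partialWeight X (Real.log x / X) j (fun i => (sievePrimes D P).filter fun p =>
        ((x * y : ℕ) : ZMod p) = AdmissibleForms.residue A B j p i) =
      W.weight X fun i => {p ∈ sievePrimes D P | p ∣ A i * m + B i} := by
  have hS : {p ∈ sievePrimes D P | p ∣ A j * m + B j} = {x, y} := by
    ext p
    rw [mem_filter, hm, mem_insert, mem_singleton]
    constructor
    · rintro ⟨hp, hd⟩
      have hp' := (mem_sievePrimes.mp hp).1
      exact ((Nat.Prime.dvd_mul hp').mp hd).imp
        (Nat.prime_dvd_prime_iff_eq hp' (mem_sievePrimes.mp hx).1).mp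
        (Nat.prime_dvd_prime_iff_eq hp' (mem_sievePrimes.mp hy).1).mp
    · rintro (rfl | rfl)
      · exact ⟨hx, dvd_mul_right _ _⟩
      · exact ⟨hy, dvd_mul_left _ _⟩
  have hS' : ∀ i : Fin 2, ((sievePrimes D P).filter fun p =>
        ((x * y : ℕ) : ZMod p) = AdmissibleForms.residue A B j p i) =
      {p ∈ sievePrimes D P | p ∣ A (j.succAbove i) * m + B (j.succAbove i)} := fun i => by
    refine filter_congr fun p hp => ?_
    obtain ⟨hp, hD, _⟩ := mem_sievePrimes.mp hp
    rw [hAB.dvd_iff_eq_residue hp hD j i m, hm]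
  rw [partialWeight, weight]
  refine sum_congr rfl fun l _ => ?_
  rw [Fin.prod_univ_succAbove _ j, hS, sieveWeight_pair _ _ hxy, h1, h2, rise, sub_zero, add_zero]
  simp_rw [hS']

variable {Ω : Type*} [Fintype Ω] {f h : Ω → ℝ → ℝ} {c c' d b : Ω → ℝ}

theorem eventually_sum_tileSum_le {D : ℕ} {A B : Fin 3 → ℕ} (hAB : AdmissibleForms D A B)
    (ht : ∀ τ, TilePair (f τ) (h τ) (c τ) (c' τ) (d τ)) (hb : ∀ τ u, b τ ≤ u → f τ u = 0)
    (hf1 : ∀ τ u, f τ u ≤ 1) (hh0 : ∀ τ u, 0 ≤ h τ u)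
    (hh1 : ∀ τ u, h τ u ≤ 1) (hdisj : ∀ τ τ' u, f τ u ≠ 0 → f τ' u ≠ 0 → τ = τ')
    (htop : ∀ τ k, W.top k ≤ c' τ) {ρ η : ℝ} (hρ : 0 < ρ) (hlow : ∀ τ, 1 + ρ ≤ c τ + c' τ)
    (hhigh : ∀ τ, b τ + d τ ≤ 1 + η) {C m₀ : ℕ}
    (hno : ∀ m, m₀ < m → ∀ i j, A i * m + B i ∈ E2 C → A j * m + B j ∈ E2 C → i = j) :
    ∀ᶠ X : ℝ in atTop, ∀ᶠ P in atTop,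
      ∑ j, ∑ τ, A j * W.tileSum (f τ) (h τ) (c τ) (c' τ) (d τ) A B j D P X ≤
        ∑ m ∈ Ioc ⌊Real.exp X⌋₊ ⌊Real.exp ((1 + η) * X)⌋₊, (m : ℝ)⁻¹ *
          W.weight X (fun i => {p ∈ sievePrimes D P | p ∣ A i * m + B i}) ^ 2 := by
  classical
  have e1 : ∀ᶠ X : ℝ in atTop, ∀ τ, max (C : ℝ) D < Real.exp (c τ * X) :=
    eventually_all.mpr fun τ => (tendsto_exp_mul_atTop (ht τ).pos).eventually_gt_atTop _
  have e2 : ∀ᶠ X : ℝ in atTop, ∀ j, (A j : ℝ) + B j ≤ Real.exp (ρ * X) :=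
    eventually_all.mpr fun j => (tendsto_exp_mul_atTop hρ).eventually_ge_atTop _
  have e3 : ∀ᶠ X : ℝ in atTop, (m₀ : ℝ) ≤ Real.exp X :=
    Real.tendsto_exp_atTop.eventually_ge_atTop _
  filter_upwards [e1, e2, e3, eventually_gt_atTop 0] with X h1 h2 h3 hX
  have e4 : ∀ᶠ P : ℕ in atTop, ∀ τ, ⌊Real.exp (d τ * X)⌋₊ < P :=
    eventually_all.mpr fun τ => eventually_gt_atTop _
  filter_upwards [e4] with P hP
  set J := Ioc ⌊Real.exp X⌋₊ ⌊Real.exp ((1 + η) * X)⌋₊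
  set w : ℕ → ℝ := fun m => (m : ℝ)⁻¹ *
    W.weight X (fun i => {p ∈ sievePrimes D P | p ∣ A i * m + B i}) ^ 2
  have hw : ∀ m, 0 ≤ w m := fun m => by positivity
  set I : Finset ((_ : Fin 3 × Ω) × ℕ × ℕ) := (univ : Finset (Fin 3 × Ω)).sigma fun q =>
    primeWindow (c q.2) (d q.2) X ×ˢ primeWindow (c' q.2) (d q.2) X with hI
  set act : ((_ : Fin 3 × Ω) × ℕ × ℕ) → Prop := fun s =>
    f s.1.2 (Real.log s.2.1 / X) ≠ 0 ∧ h s.1.2 (Real.log s.2.2 / X) ≠ 0 with hact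
  have hlt : ∀ s ∈ I, act s → s.2.1 < s.2.2 := fun s hs ha => by
    obtain ⟨⟨j, τ⟩, x, y⟩ := s
    simp only [hI, mem_sigma, mem_univ, true_and, mem_product, mem_primeWindow] at hs
    simp only [hact] at ha ⊢
    have hx : Real.log x / X < c' τ := not_le.mp fun h => ha.1 ((ht τ).left_high _ h)
    have hy : c' τ < Real.log y / X := not_le.mp fun h => ha.2 ((ht τ).right_low _ h)
    have := (div_lt_div_iff_of_pos_right hX).mp (hx.trans hy)
    exact_mod_cast (Real.log_lt_log_iff (by exact_mod_cast hs.1.1.pos)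
      (by exact_mod_cast hs.2.1.pos)).mp this
  have hgt : ∀ s ∈ I, C < s.2.1 ∧ D < s.2.1 := fun s hs => by
    obtain ⟨⟨j, τ⟩, x, y⟩ := s
    simp only [hI, mem_sigma, mem_univ, true_and, mem_product, mem_primeWindow] at hs
    have := (h1 τ).trans_le hs.1.2.1
    rw [max_lt_iff] at this
    exact_mod_cast this
  have hprime : ∀ s ∈ I, s.2.1.Prime ∧ s.2.2.Prime := fun s hs => by
    obtain ⟨⟨j, τ⟩, x, y⟩ := s
    simp only [hI, mem_sigma, mem_univ, true_and, mem_product, mem_primeWindow] at hs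
    exact ⟨hs.1.1, hs.2.1⟩
  calc ∑ j, ∑ τ, A j * W.tileSum (f τ) (h τ) (c τ) (c' τ) (d τ) A B j D P X
      = ∑ s ∈ I, A s.1.1 * ((if ((s.2.1 * s.2.2 : ℕ) : ZMod (A s.1.1)) = B s.1.1 then
          f s.1.2 (Real.log s.2.1 / X) / s.2.1 * (h s.1.2 (Real.log s.2.2 / X) / s.2.2) else 0) *
          W.partialWeight X (Real.log s.2.1 / X) s.1.1 (fun i => (sievePrimes D P).filter fun p =>
          ((s.2.1 * s.2.2 : ℕ) : ZMod p) = AdmissibleForms.residue A B s.1.1 p i) ^ 2) := by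
        rw [hI, sum_sigma, Fintype.sum_prod_type]
        refine sum_congr rfl fun j _ => sum_congr rfl fun τ _ => ?_
        rw [sum_product, tileSum, mul_sum]
        exact sum_congr rfl fun x _ => mul_sum _ _ _
    _ ≤ ∑ s ∈ I, ∑ m ∈ J, if act s ∧ A s.1.1 * m + B s.1.1 = s.2.1 * s.2.2 then w m else 0 := by
        refine sum_le_sum fun s hs => ?_
        have hlts := hlt s hs
        have hgts := hgt s hs
        obtain ⟨hpx, hpy⟩ := hprime s hs
        obtain ⟨⟨j, τ⟩, x, y⟩ := s
        simp only [hI, mem_sigma, mem_univ, true_and, mem_product, mem_primeWindow] at hs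
        simp only [hact] at hlts ⊢
        have hnn : 0 ≤ ∑ m ∈ J, if (f τ (Real.log x / X) ≠ 0 ∧ h τ (Real.log y / X) ≠ 0) ∧
            A j * m + B j = x * y then w m else 0 :=
          sum_nonneg fun m _ => by split_ifs <;> simp [hw]
        by_cases hz : f τ (Real.log x / X) ≠ 0 ∧ h τ (Real.log y / X) ≠ 0
        swap
        · rw [not_and_or, not_not, not_not] at hz
          refine le_trans (le_of_eq ?_) hnn
          rcases hz with hz | hz <;> simp [hz]
        by_cases hmod : ((x * y : ℕ) : ZMod (A j)) = B j
        swap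
        · rw [if_neg hmod, zero_mul, mul_zero]
          exact hnn
        have hx0 : (0 : ℝ) < x := by exact_mod_cast hpx.pos
        have hy0 : (0 : ℝ) < y := by exact_mod_cast hpy.pos
        have hA0 : (0 : ℝ) < A j := by exact_mod_cast hAB.pos j
        have hxc : c τ * X < Real.log x :=
          (lt_div_iff₀ hX).mp (not_le.mp fun h => hz.1 ((ht τ).left_low _ h))
        have hxb : Real.log x < b τ * X :=
          (div_lt_iff₀ hX).mp (not_le.mp fun h => hz.1 (hb τ _ h))
        have hyc' : c' τ < Real.log y / X := not_le.mp fun h => hz.2 ((ht τ).right_low _ h)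
        have hyc : c' τ * X < Real.log y := (lt_div_iff₀ hX).mp hyc'
        have hyd : Real.log y < d τ * X :=
          (div_lt_iff₀ hX).mp (not_le.mp fun h => hz.2 ((ht τ).right_high _ h))
        have hxye : ((x * y : ℕ) : ℝ) = Real.exp (Real.log x + Real.log y) := by
          rw [Real.exp_add, Real.exp_log hx0, Real.exp_log hy0, Nat.cast_mul]
        have hlo : Real.exp (ρ * X) * Real.exp X < (x * y : ℕ) := by
          rw [hxye, ← Real.exp_add, Real.exp_lt_exp]
          nlinarith [hlow τ]
        have hhi : ((x * y : ℕ) : ℝ) ≤ Real.exp ((1 + η) * X) := by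
          rw [hxye, Real.exp_le_exp]
          nlinarith [hhigh τ]
        have hlo' : A j * Real.exp X + B j < (x * y : ℕ) := by
          refine lt_of_le_of_lt ?_ hlo
          have := mul_le_mul_of_nonneg_right (h2 j) (Real.exp_pos X).le
          have h4 : (B j : ℝ) ≤ B j * Real.exp X :=
            le_mul_of_one_le_right (by positivity) (Real.one_le_exp hX.le)
          linarith
        have hBle : B j ≤ x * y := by
          have : (B j : ℝ) ≤ (x * y : ℕ) := by
            have := mul_pos hA0 (Real.exp_pos X)
            linarith
          exact_mod_cast this
        obtain ⟨m, hm⟩ := (Nat.modEq_iff_dvd' hBle).mp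
          ((ZMod.natCast_eq_natCast_iff _ _ _).mp hmod).symm
        have hm' : A j * m + B j = x * y := by omega
        have hmr : (A j * m + B j : ℝ) = (x * y : ℕ) := by exact_mod_cast hm'
        have hmlo : Real.exp X < m := by
          rw [← hmr] at hlo'
          exact lt_of_mul_lt_mul_left (by linarith) hA0.le
        have hm0 : (0 : ℝ) < m := (Real.exp_pos X).trans hmlo
        have hAm : (A j : ℝ) * m ≤ x * y := by
          have : (0 : ℝ) ≤ B j := by positivity
          push_cast at hmr
          linarith
        have hmhi : (m : ℝ) ≤ Real.exp ((1 + η) * X) := by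
          refine le_trans ?_ hhi
          have : (1 : ℝ) ≤ A j := by exact_mod_cast hAB.pos j
          push_cast
          nlinarith
        have hmJ : m ∈ J := mem_Ioc.mpr
          ⟨(Nat.floor_lt (Real.exp_pos X).le).mpr hmlo, Nat.le_floor hmhi⟩
        have hxS : x ∈ sievePrimes D P := by
          refine mem_sievePrimes.mpr ⟨hpx, hgts.2, ?_⟩
          exact (Nat.le_floor hs.1.2.2).trans_lt (hP τ)
        have hyS : y ∈ sievePrimes D P := by
          refine mem_sievePrimes.mpr ⟨hpy, hgts.2.trans (hlts hz), ?_⟩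
          exact (Nat.le_floor hs.2.2.2).trans_lt (hP τ)
        have hpw := W.partialWeight_eq_weight hAB (X := X) hxS hyS (hlts hz).ne hm'
          (fun k => W.prim_eq_zero k _ ((htop τ k).trans hyc'.le))
          (fun k => W.prim_eq_zero k _ ((htop τ k).trans (hyc'.le.trans (by
            rw [add_div]
            exact le_add_of_nonneg_left (div_nonneg (Real.log_natCast_nonneg x) hX.le)))))
        refine le_trans ?_ (single_le_sum (f := fun m => if (f τ (Real.log x / X) ≠ 0 ∧
          h τ (Real.log y / X) ≠ 0) ∧ A j * m + B j = x * y then w m else 0)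
          (fun m _ => by split_ifs <;> simp [hw]) hmJ)
        rw [if_pos hmod, if_pos ⟨hz, hm'⟩, hpw, ← mul_assoc]
        refine mul_le_mul_of_nonneg_right ?_ (sq_nonneg _)
        rw [div_mul_div_comm, mul_div_assoc', div_le_iff₀ (by positivity), inv_mul_eq_div,
          le_div_iff₀ hm0]
        have hfh : f τ (Real.log x / X) * h τ (Real.log y / X) ≤ 1 :=
          mul_le_one₀ (hf1 _ _) (hh0 _ _) (hh1 _ _)
        calc A j * (f τ (Real.log x / X) * h τ (Real.log y / X)) * m
            = (f τ (Real.log x / X) * h τ (Real.log y / X)) * (A j * m) := by ring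
          _ ≤ 1 * (A j * m) := mul_le_mul_of_nonneg_right hfh (by positivity)
          _ ≤ x * y := by linarith
    _ = ∑ m ∈ J, #{s ∈ I | act s ∧ A s.1.1 * m + B s.1.1 = s.2.1 * s.2.2} * w m := by
        rw [sum_comm]
        refine sum_congr rfl fun m _ => ?_
        rw [← sum_filter, sum_const, nsmul_eq_mul]
    _ ≤ ∑ m ∈ J, w m := by
        refine sum_le_sum fun m hm => mul_le_of_le_one_left (hw m) ?_
        have hm0 : m₀ < m := by
          have := (mem_Ioc.mp hm).1
          exact (Nat.le_floor h3).trans_lt this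
        rw [Nat.cast_le_one, card_le_one]
        intro s hs s' hs'
        rw [mem_filter] at hs hs'
        obtain ⟨hsI, hsa, hsm⟩ := hs
        obtain ⟨hsI', hsa', hsm'⟩ := hs'
        have hl := hlt s hsI hsa
        have hl' := hlt s' hsI' hsa'
        have hg := (hgt s hsI).1
        have hg' := (hgt s' hsI').1
        obtain ⟨hp1, hp2⟩ := hprime s hsI
        obtain ⟨hp1', hp2'⟩ := hprime s' hsI'
        have hj := hno m hm0 s.1.1 s'.1.1
          ⟨_, _, hp1, hp2, hl.ne, hg, hg.trans hl, hsm⟩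
          ⟨_, _, hp1', hp2', hl'.ne, hg', hg'.trans hl', hsm'⟩
        obtain ⟨⟨j, τ⟩, x, y⟩ := s
        obtain ⟨⟨j', τ'⟩, x', y'⟩ := s'
        dsimp only at hj hsm hsm' hl hl' hsa hsa' hp1 hp2 hp1' hp2'
        subst hj
        obtain ⟨rfl, rfl⟩ := eq_of_mul_eq_mul_of_lt hp1 hp1' hp2' hl hl' (hsm.symm.trans hsm')
        rw [hdisj τ τ' _ hsa.1 hsa'.1]

end PolySieve

end PolySieveCount

section PolySieveMain

open Finset Filter Topology MeasureTheory

namespace PolySieve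

variable {κ : Type*} (W : PolySieve κ) [Fintype κ]

theorem exists_pair_mem_E2 {Ω : Type*} [Fintype Ω] {f h : Ω → ℝ → ℝ} {c c' d b : Ω → ℝ}
    (ht : ∀ τ, TilePair (f τ) (h τ) (c τ) (c' τ) (d τ)) (hb : ∀ τ u, b τ ≤ u → f τ u = 0)
    (hf1 : ∀ τ u, f τ u ≤ 1) (hh0 : ∀ τ u, 0 ≤ h τ u)
    (hh1 : ∀ τ u, h τ u ≤ 1) (hdisj : ∀ τ τ' u, f τ u ≠ 0 → f τ' u ≠ 0 → τ = τ')
    (htop : ∀ τ k, W.top k ≤ c' τ) {ρ η : ℝ} (hρ : 0 < ρ) (hη : 0 ≤ η)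
    (hlow : ∀ τ, 1 + ρ ≤ c τ + c' τ) (hhigh : ∀ τ, b τ + d τ ≤ 1 + η)
    (hgap : η * W.energy < ∑ j, ∑ τ, (∫ u, h τ u / u) * W.tileForm (f τ) j)
    {D : ℕ} (hD : 24 ≤ D) {A B : Fin 3 → ℕ} (hAB : AdmissibleForms D A B) (C m₀ : ℕ) :
    ∃ m, m₀ < m ∧ ∃ i j, i ≠ j ∧ A i * m + B i ∈ E2 C ∧ A j * m + B j ∈ E2 C := by
  by_contra hcon
  push Not at hcon
  have hno : ∀ m, m₀ < m → ∀ i j, A i * m + B i ∈ E2 C → A j * m + B j ∈ E2 C → i = j := by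
    intro m hm i j hi hj
    by_contra hij
    exact hcon m hm i j hij hi hj
  set K := eulerConst (fun p => (p : ℝ)⁻¹) D 3 with hK
  have hK0 : 0 < K := eulerConst_three_pos (by omega)
  set V : Fin 3 → Ω → ℝ := fun j τ => (∫ u, h τ u / u) * W.tileForm (f τ) j with hV
  set G := ∑ j, ∑ τ, V j τ - η * W.energy with hG
  have hG0 : 0 < G := sub_pos.mpr hgap
  set n : ℝ := 3 * Fintype.card Ω with hn
  have hn0 : 0 ≤ n := by positivity
  have hε : 0 < K * G / (4 * (n + 1)) := by positivity
  have e1 := W.eventually_secondMoment_le hAB hη hε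
  have e2 := eventually_all.mpr fun j => eventually_all.mpr fun τ =>
    W.eventually_tileSum_ge hD hAB (ht τ) j hε
  have e3 := W.eventually_sum_tileSum_le hAB ht hb hf1 hh0 hh1 hdisj htop hρ hlow hhigh hno
  obtain ⟨X, h1, h2, h3⟩ := (e1.and (e2.and e3)).exists
  have h2' := eventually_all.mpr fun j => eventually_all.mpr fun τ => h2 j τ
  obtain ⟨P, p1, p2, p3⟩ := (h1.and (h2'.and h3)).exists
  have h4 := sum_le_sum fun j (_ : j ∈ (univ : Finset (Fin 3))) =>
    sum_le_sum fun τ (_ : τ ∈ (univ : Finset Ω)) => p2 j τ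
  have h5 : ∑ j : Fin 3, ∑ τ, (K * V j τ - K * G / (4 * (n + 1))) =
      K * ∑ j, ∑ τ, V j τ - n * (K * G / (4 * (n + 1))) := by
    simp only [sum_sub_distrib, ← mul_sum, sum_const, card_univ, Fintype.card_fin, nsmul_eq_mul]
    rw [hn]; push_cast; ring
  have h6 : ∑ j, ∑ τ, A j * (X ^ 2 * W.tileSum (f τ) (h τ) (c τ) (c' τ) (d τ) A B j D P X) =
      X ^ 2 * ∑ j, ∑ τ, A j * W.tileSum (f τ) (h τ) (c τ) (c' τ) (d τ) A B j D P X := by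
    simp only [mul_sum]
    exact sum_congr rfl fun j _ => sum_congr rfl fun τ _ => by ring
  rw [h5, h6] at h4
  have h7 := (h4.trans (mul_le_mul_of_nonneg_left p3 (sq_nonneg X))).trans p1
  have h8 : (n + 1) * (K * G / (4 * (n + 1))) = K * G / 4 := by field_simp
  have h9 : K * G = K * ∑ j, ∑ τ, V j τ - η * (K * W.energy) := by rw [hG]; ring
  have : 0 < K * G := by positivity
  nlinarith

variable {N : κ → ℝ}

lemma energy_le (hcoef : ∀ l, 0 ≤ W.coef l) (hnonneg : ∀ k k', 0 ≤ W.gram k k')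
    (hdiag : ∀ k, W.gram k k ≤ N k) (hoff : ∀ k k', k ≠ k' → W.gram k k' = 0) :
    W.energy ≤ ∑ l : Fin 3 → κ, W.coef l ^ 2 * ∏ i, N (l i) := by
  refine sum_le_sum fun l _ => ?_
  rw [sum_eq_single l, sq]
  · exact mul_le_mul_of_nonneg_left (prod_le_prod (fun i _ => hnonneg _ _) fun i _ => hdiag _)
      (mul_nonneg (hcoef l) (hcoef l))
  · intro l' _ hl
    obtain ⟨i, hi⟩ := Function.ne_iff.mp hl
    rw [prod_eq_zero (mem_univ i) (hoff _ _ hi.symm), mul_zero]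
  · simp

lemma tileForm_ge (hcoef : ∀ l, 0 ≤ W.coef l) (hnonneg : ∀ k k', 0 ≤ W.gram k k')
    (hN : ∀ k, 0 ≤ N k) (hdiag : ∀ k, N k ≤ W.gram k k) {f : ℝ → ℝ} (hf : Continuous f)
    {a b : ℝ} (ha : 0 < a) (hfa : ∀ u ≤ a, f u = 0) (hfb : ∀ u, b ≤ u → f u = 0)
    (hf0 : ∀ u, 0 ≤ f u) {θ : κ → ℝ} (hθ : ∀ k, 0 ≤ θ k) (hrise : ∀ k, ∀ u ≥ a, θ k ≤ W.rise k u)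
    (j : Fin 3) :
    (∫ u, f u / u) * ∑ v : Fin 2 → κ, (∏ i, N (v i)) *
      (∑ k, W.coef (j.insertNth k v) * θ k) ^ 2 ≤ W.tileForm f j := by
  have hint : ∀ g : ℝ → ℝ, Continuous g → Integrable fun u => f u * g u / u := by
    intro g hg
    have hsupp : Function.support (fun u => f u * g u / u) ⊆ Set.Icc a b := fun u hu => by
      by_contra h
      rw [Set.mem_Icc, not_and_or, not_le, not_le] at h
      rcases h with h | h
      · exact hu (by simp only [hfa u h.le, zero_mul, zero_div])
      · exact hu (by simp only [hfb u h.le, zero_mul, zero_div])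
    rw [← integrableOn_iff_integrable_of_support_subset hsupp]
    exact (ContinuousOn.div (hf.mul hg).continuousOn continuousOn_id
      fun u hu => (ha.trans_le hu.1).ne').integrableOn_Icc
  have hI : ∀ k k', θ k * θ k' * ∫ u, f u / u ≤ ∫ u, f u * (W.rise k u * W.rise k' u) / u := by
    intro k k'
    rw [← integral_const_mul]
    have h1 := (hint (fun _ => 1) continuous_const).const_mul (θ k * θ k')
    simp only [mul_one] at h1
    refine integral_mono h1
      (hint _ ((W.continuous_rise k).mul (W.continuous_rise k'))) fun u => ?_
    dsimp only
    rcases le_or_gt u a with hu | hu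
    · simp [hfa u hu]
    · have hu0 : 0 < u := ha.trans hu
      rw [mul_div_assoc', div_le_div_iff_of_pos_right hu0, mul_comm]
      exact mul_le_mul_of_nonneg_left (mul_le_mul (hrise k u hu.le) (hrise k' u hu.le) (hθ k')
        ((hθ k).trans (hrise k u hu.le))) (hf0 u)
  have hF : 0 ≤ ∫ u, f u / u := integral_nonneg fun u => by
    rcases le_or_gt u a with hu | hu
    · simp [hfa u hu]
    · exact div_nonneg (hf0 u) (ha.trans hu).le
  have hpos : ∀ k k', 0 ≤ ∫ u, f u * (W.rise k u * W.rise k' u) / u := fun k k' =>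
    (mul_nonneg (mul_nonneg (hθ k) (hθ k')) hF).trans (hI k k')
  have hre : ∀ F : (Fin 3 → κ) → ℝ, ∑ l, F l = ∑ v : Fin 2 → κ, ∑ k, F (j.insertNth k v) := by
    intro F
    rw [← (Fin.insertNthEquiv (fun _ => κ) j).sum_comp, Fintype.sum_prod_type_right]
    rfl
  rw [tileForm, hre, mul_sum]
  refine sum_le_sum fun v _ => ?_
  simp_rw [hre, Fin.insertNth_apply_same, Fin.insertNth_apply_succAbove]
  calc (∫ u, f u / u) * ((∏ i, N (v i)) * (∑ k, W.coef (j.insertNth k v) * θ k) ^ 2)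
      = ∑ k, ∑ k', W.coef (j.insertNth k v) * W.coef (j.insertNth k' v) * ((∏ i, N (v i)) *
          (θ k * θ k' * ∫ u, f u / u)) := by
        rw [sq, sum_mul_sum, mul_sum, mul_sum]
        refine sum_congr rfl fun k _ => ?_
        rw [mul_sum, mul_sum]
        exact sum_congr rfl fun k' _ => by ring
    _ ≤ _ := by
        refine sum_le_sum fun k _ => ?_
        refine le_trans ?_ (single_le_sum (fun v' _ => sum_nonneg fun k' _ => mul_nonneg
          (mul_nonneg (hcoef _) (hcoef _)) (mul_nonneg (prod_nonneg fun i _ => hnonneg _ _)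
            (hpos _ _))) (mem_univ v))
        refine sum_le_sum fun k' _ => mul_le_mul_of_nonneg_left ?_ (mul_nonneg (hcoef _) (hcoef _))
        exact mul_le_mul (prod_le_prod (fun i _ => hN _) fun i _ => hdiag _) (hI k k')
          (mul_nonneg (mul_nonneg (hθ k) (hθ k')) hF) (prod_nonneg fun i _ => hnonneg _ _)

end PolySieve

end PolySieveMain

section Cells

open Finset

/-- The left end point, in millionths, of the `k`-th cell. -/
def cellBot (k : Fin 7) : ℕ := if k = 0 then 0 else 25000 * (k + 1)

/-- The right end point, in millionths, of the `k`-th cell. -/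
def cellTop (k : Fin 7) : ℕ := 25000 * (k + 2) - 10

/-- The weight of the product of three cells. -/
def cellCoef (a b d : Fin 7) : ℕ :=
  if (a : ℕ) + b ≤ 6 ∧ (a : ℕ) + d ≤ 6 ∧ (b : ℕ) + d ≤ 6 then
    2 * (a + b + d) ^ 2 + 280 - 43 * (a + b + d) else 0

/-- The length, in millionths, of the inner part of a cell. -/
def cellLen (k : Fin 7) : ℕ := cellTop k - cellBot k - 2

/-- The length, in millionths, of the inner part of a cell to the left of `s`. -/
def cellRise (s : ℕ) (k : Fin 7) : ℕ := min (s - (cellBot k + 1)) (cellLen k)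

/-- A lower bound for the one-variable form of the cell weights at `s`. -/
def cellForm (s : ℕ) : ℕ :=
  ∑ a, ∑ b, cellLen a * cellLen b * (∑ k, cellCoef k a b * cellRise s k) ^ 2

/-- An upper bound for the energy of the cell weights. -/
def cellEnergy : ℕ :=
  ∑ a, ∑ b, ∑ d, cellCoef a b d ^ 2 * ((cellLen a + 2) * (cellLen b + 2) * (cellLen d + 2))

lemma cellRise_eq {s : ℕ} (hs : 200000 ≤ s) (k : Fin 7) : cellRise s k = cellRise 200000 k := by
  have h : cellLen k ≤ 200000 - (cellBot k + 1) := by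
    revert k; decide
  rw [cellRise, cellRise, min_eq_right h, min_eq_right (h.trans (by omega))]

lemma cellForm_eq {s : ℕ} (hs : 200000 ≤ s) : cellForm s = 10234431692468037600553472 := by
  have h : cellForm 200000 = 10234431692468037600553472 := by decide +kernel
  rw [← h]
  simp only [cellForm, cellRise_eq hs]

lemma cellEnergy_eq : cellEnergy = 70866388262279134000 := by decide +kernel

lemma sum_cellForm_left : ∑ i ∈ range 97, cellForm (2000 * (i + 3)) / ((i + 4) * (498 - i)) =
    20273324689026443551149 := by decide +kernel

lemma sum_cellForm_right : ∑ i ∈ range 150,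
    10234431692468037600553472 / ((97 + i + 4) * (498 - (97 + i))) =
    28156142284117412734417 := by
  decide +kernel

lemma cellForm_div_eq (i : ℕ) :
    cellForm (2000 * (97 + i + 3)) / ((97 + i + 4) * (498 - (97 + i))) =
      10234431692468037600553472 / ((97 + i + 4) * (498 - (97 + i))) := by
  rw [cellForm_eq (by omega)]

lemma sum_cellForm :
    ∑ i ∈ range 247, cellForm (2000 * (i + 3)) / ((i + 4) * (498 - i)) =
      20273324689026443551149 + 28156142284117412734417 := by
  have h (F : ℕ → ℕ) {a b : ℕ} (h1 : ∑ i ∈ range 97, F i = a)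
      (h2 : ∑ i ∈ range 150, F (97 + i) = b) : ∑ i ∈ range 247, F i = a + b := by
    rw [show 247 = 97 + 150 from rfl, sum_range_add, h1, h2]
  exact h (fun i => cellForm (2000 * (i + 3)) / ((i + 4) * (498 - i))) sum_cellForm_left
    ((sum_congr rfl fun i _ => cellForm_div_eq i).trans sum_cellForm_right)

lemma cellEnergy_lt : 4000000 * cellEnergy <
    5982 * ∑ i ∈ range 247, cellForm (2000 * (i + 3)) / ((i + 4) * (498 - i)) := by
  rw [cellEnergy_eq, sum_cellForm]
  norm_num

end Cells

section CellSieve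

open Finset MeasureTheory

lemma le_integral_plateau_div {P p q Q M : ℝ} (hP : 0 < P) (hp : P < p) (hpq : p ≤ q) (hq : q < Q)
    (hM : q ≤ M) : (q - p) / M ≤ ∫ u, plateau P p q Q u / u := by
  have hc : ∀ x, ∀ y, 0 < x → IntegrableOn (fun u => plateau P p q Q u / u) (Set.Icc x y) :=
    fun x y hx => (ContinuousOn.div continuous_plateau.continuousOn continuousOn_id
      fun u hu => (hx.trans_le hu.1).ne').integrableOn_Icc
  have hsupp : Function.support (fun u => plateau P p q Q u / u) ⊆ Set.Icc P Q := fun u hu => by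
    by_contra h
    rw [Set.mem_Icc, not_and_or, not_le, not_le] at h
    rcases h with h | h
    · exact hu (by simp only [plateau_eq_zero_of_le hp h.le, zero_div])
    · exact hu (by simp only [plateau_eq_zero_of_ge hq h.le, zero_div])
  rw [div_eq_mul_inv]
  refine mul_le_integral_of_plateau (hc p q (hP.trans hp))
    ((integrableOn_iff_integrable_of_support_subset hsupp).mp (hc P Q hP)) (fun u => ?_) hpq
    fun u hu => ?_
  · rcases le_or_gt u P with hu | hu
    · rw [plateau_eq_zero_of_le hp hu, zero_div]
    · exact div_nonneg plateau_nonneg (hP.trans hu).le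
  · have hu0 : 0 < u := (hP.trans hp).trans_le hu.1
    rw [plateau_eq_one hp hq hu, one_div]
    exact inv_anti₀ hu0 (hu.2.trans hM)

lemma cellBot_lt_cellTop (k : Fin 7) : cellBot k + 3 ≤ cellTop k := by
  revert k; decide

lemma cellTop_le_cellBot {k k' : Fin 7} (h : k < k') : cellTop k ≤ cellBot k' := by
  revert k k'; decide

lemma cellTop_le (k : Fin 7) : cellTop k ≤ 199990 := by
  revert k; decide

lemma cellTop_add_le {k k' : Fin 7} (h : (k : ℕ) + k' ≤ 6) : cellTop k + cellTop k' ≤ 249980 := by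
  revert k k'; decide

lemma cellCoef_swap_left (a b d : Fin 7) : cellCoef b a d = cellCoef a b d := by
  unfold cellCoef
  simp only [add_comm (b : ℕ) a, and_comm]

lemma cellCoef_swap_right (a b d : Fin 7) : cellCoef a d b = cellCoef a b d := by
  revert a b d; decide +kernel

lemma cellCoef_insertNth (j : Fin 3) (k : Fin 7) (v : Fin 2 → Fin 7) :
    cellCoef ((j.insertNth k v : Fin 3 → Fin 7) 0) ((j.insertNth k v : Fin 3 → Fin 7) 1)
      ((j.insertNth k v : Fin 3 → Fin 7) 2) = cellCoef k (v 0) (v 1) := by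
  fin_cases j
  · rfl
  · exact cellCoef_swap_left k (v 0) (v 1)
  · exact (cellCoef_swap_right (v 0) k (v 1)).trans (cellCoef_swap_left k (v 0) (v 1))

lemma cast_cellLen (k : Fin 7) : (cellLen k : ℝ) = cellTop k - 1 - (cellBot k + 1) := by
  have h := cellBot_lt_cellTop k
  rw [cellLen, Nat.cast_sub (by omega), Nat.cast_sub (by omega)]
  push_cast; ring

lemma cast_cellRise_le (s : ℕ) (k : Fin 7) : (cellRise s k : ℝ) ≤
    max 0 (min ((s : ℝ) - (cellBot k + 1)) (cellTop k - 1 - (cellBot k + 1))) := by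
  rw [← cast_cellLen, cellRise, Nat.cast_min]
  rcases le_total s (cellBot k + 1) with h | h
  · rw [Nat.sub_eq_zero_of_le h]
    simp
  · rw [Nat.cast_sub h]
    push_cast
    exact le_max_right _ _

/-- The density of the `k`-th cell. -/
noncomputable def cellDens (k : Fin 7) : ℝ → ℝ :=
  plateau (cellBot k / 10 ^ 6) ((cellBot k + 1) / 10 ^ 6) ((cellTop k - 1) / 10 ^ 6)
    (cellTop k / 10 ^ 6)

lemma cast_cellBot_lt (k : Fin 7) : (cellBot k : ℝ) + 3 ≤ cellTop k := by
  exact_mod_cast cellBot_lt_cellTop k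

/-- The sieve with the cell weights. -/
noncomputable def cellSieve : PolySieve (Fin 7) where
  dens := cellDens
  top k := cellTop k / 10 ^ 6
  coef l := cellCoef (l 0) (l 1) (l 2)
  slack := 4 / 10 ^ 5
  contDiff _ := contDiff_plateau
  dens_eq_zero k u hu := plateau_eq_zero_of_ge (by gcongr; linarith) hu
  slack_pos := by norm_num
  slack_le := by norm_num
  pair_le l hl i j hij := by
    have h : (l 0 : ℕ) + l 1 ≤ 6 ∧ (l 0 : ℕ) + l 2 ≤ 6 ∧ (l 1 : ℕ) + l 2 ≤ 6 := by
      by_contra h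
      exact hl (by rw [cellCoef, if_neg h, Nat.cast_zero])
    have h' : cellTop (l i) + cellTop (l j) ≤ 249980 := by
      obtain ⟨h1, h2, h3⟩ := h
      apply cellTop_add_le
      fin_cases i <;> fin_cases j <;> simp at hij ⊢ <;> omega
    have h'' : (cellTop (l i) : ℝ) + cellTop (l j) ≤ 249980 := by exact_mod_cast h'
    linarith

lemma cellSieve_coef_nonneg (l : Fin 3 → Fin 7) : 0 ≤ cellSieve.coef l := Nat.cast_nonneg _

lemma cellSieve_gram_nonneg (k k' : Fin 7) : 0 ≤ cellSieve.gram k k' :=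
  setIntegral_nonneg measurableSet_Ioi fun _ _ => mul_nonneg plateau_nonneg plateau_nonneg

lemma cellDens_mul_eq_zero {k k' : Fin 7} (h : k < k') (u : ℝ) :
    cellDens k u * cellDens k' u = 0 := by
  have h1 : (cellTop k : ℝ) ≤ cellBot k' := by exact_mod_cast cellTop_le_cellBot h
  rcases le_total u (cellTop k / 10 ^ 6) with hu | hu
  · rw [cellDens, cellDens, plateau_eq_zero_of_le (P := cellBot k' / 10 ^ 6)
      (by gcongr; linarith) (hu.trans (by gcongr)), mul_zero]
  · rw [cellDens, plateau_eq_zero_of_ge (by gcongr; linarith) hu, zero_mul]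

lemma cellSieve_gram_eq_zero (k k' : Fin 7) (h : k ≠ k') : cellSieve.gram k k' = 0 := by
  have : ∀ u, cellDens k u * cellDens k' u = 0 := by
    rcases h.lt_or_gt with h | h
    · exact cellDens_mul_eq_zero h
    · exact fun u => (mul_comm _ _).trans (cellDens_mul_eq_zero h u)
  simp [PolySieve.gram, cellSieve, this]

lemma le_cellSieve_gram (k : Fin 7) : (cellLen k : ℝ) / 10 ^ 6 ≤ cellSieve.gram k k := by
  have h := cast_cellBot_lt k
  refine le_trans (le_of_eq ?_) (setIntegral_sq_plateau_ge (P := cellBot k / 10 ^ 6)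
    (p := (cellBot k + 1) / 10 ^ 6) (q := (cellTop k - 1) / 10 ^ 6) (Q := cellTop k / 10 ^ 6)
    (by gcongr; linarith) (by gcongr; linarith) (by gcongr; linarith) (by positivity))
  rw [cast_cellLen]; ring

lemma cellSieve_gram_le (k : Fin 7) : cellSieve.gram k k ≤ ((cellLen k + 2 : ℕ) : ℝ) / 10 ^ 6 := by
  have h := cast_cellBot_lt k
  refine (setIntegral_sq_plateau_le (P := cellBot k / 10 ^ 6)
    (p := (cellBot k + 1) / 10 ^ 6) (q := (cellTop k - 1) / 10 ^ 6) (Q := cellTop k / 10 ^ 6)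
    (by gcongr; linarith) (by gcongr; linarith) (div_le_div_of_nonneg_right (by linarith) (by norm_num)) (by positivity)).trans
    (le_of_eq ?_)
  push_cast
  rw [cast_cellLen]; ring

lemma le_cellSieve_rise (s : ℕ) (k : Fin 7) {u : ℝ} (hu : (s : ℝ) / 10 ^ 6 ≤ u) :
    (cellRise s k : ℝ) / 10 ^ 6 ≤ cellSieve.rise k u := by
  have h := cast_cellBot_lt k
  refine le_trans ?_ (min_max_le_integral_plateau (P := cellBot k / 10 ^ 6)
    (p := (cellBot k + 1) / 10 ^ 6) (q := (cellTop k - 1) / 10 ^ 6) (Q := cellTop k / 10 ^ 6)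
    (by gcongr; linarith) (by gcongr; linarith) (by gcongr; linarith) (by positivity)
    (y := u) (le_trans (by positivity) hu))
  rw [div_le_iff₀ (by norm_num), max_mul_of_nonneg _ _ (by norm_num),
    min_mul_of_nonneg _ _ (by norm_num)]
  refine (cast_cellRise_le s k).trans ?_
  rw [div_le_iff₀ (by norm_num)] at hu
  refine max_le_max (by simp) (min_le_min ?_ (le_of_eq ?_))
  · linarith
  · ring

lemma cellSieve_energy_le : cellSieve.energy ≤ cellEnergy / 10 ^ 18 := by
  refine (cellSieve.energy_le cellSieve_coef_nonneg cellSieve_gram_nonneg cellSieve_gram_le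
    cellSieve_gram_eq_zero).trans (le_of_eq ?_)
  rw [← (Fin.insertNthEquiv (fun _ => Fin 7) 0).sum_comp, Fintype.sum_prod_type]
  simp only [← (finTwoArrowEquiv (Fin 7)).symm.sum_comp, Fintype.sum_prod_type, cellEnergy]
  push_cast
  simp only [sum_div]
  refine sum_congr rfl fun a _ => sum_congr rfl fun b _ => sum_congr rfl fun d _ => ?_
  rw [Fin.prod_univ_three]
  simp [cellSieve, Fin.insertNthEquiv]
  ring

lemma cellSieve_tileForm_ge {f : ℝ → ℝ} (hf : Continuous f) {s : ℕ} {b : ℝ} (hs : 0 < s)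
    (hfa : ∀ u ≤ (s : ℝ) / 10 ^ 6, f u = 0) (hfb : ∀ u, b ≤ u → f u = 0)
    (hf0 : ∀ u, 0 ≤ f u) (j : Fin 3) :
    (∫ u, f u / u) * (cellForm s / 10 ^ 24) ≤ cellSieve.tileForm f j := by
  refine le_trans (le_of_eq ?_) (cellSieve.tileForm_ge cellSieve_coef_nonneg cellSieve_gram_nonneg
    (N := fun k => (cellLen k : ℝ) / 10 ^ 6) (fun k => by positivity) le_cellSieve_gram hf
    (a := s / 10 ^ 6) (b := b) (by positivity) hfa hfb hf0
    (θ := fun k => (cellRise s k : ℝ) / 10 ^ 6) (fun k => by positivity)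
    (fun k u hu => le_cellSieve_rise s k hu) j)
  congr 1
  simp only [← (finTwoArrowEquiv (Fin 7)).symm.sum_comp, Fintype.sum_prod_type, cellForm]
  push_cast
  simp only [sum_div]
  refine sum_congr rfl fun a _ => sum_congr rfl fun b _ => ?_
  have h : ∑ k, cellSieve.coef (j.insertNth k ((finTwoArrowEquiv (Fin 7)).symm (a, b))) *
      ((cellRise s k : ℝ) / 10 ^ 6) = (∑ k, (cellCoef k a b : ℝ) * cellRise s k) / 10 ^ 6 := by
    rw [sum_div]
    refine sum_congr rfl fun k _ => ?_
    have := cellCoef_insertNth j k ((finTwoArrowEquiv (Fin 7)).symm (a, b))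
    simp only [cellSieve, this]
    simp
    ring
  rw [h, Fin.prod_univ_two]
  simp
  ring

end CellSieve

section Tiles

open Finset MeasureTheory

/-- The left end point, in millionths, of a tile. -/
def tileBot (τ : Fin 247 × Fin 2000) : ℕ := 2000 * (τ.1 + 3) + τ.2

/-- The density of the small factor on a tile. -/
noncomputable def tileLeft (s : ℕ) : ℝ → ℝ :=
  plateau (s / 10 ^ 6) ((s + 1 / 1000) / 10 ^ 6) ((s + 1 - 1 / 1000) / 10 ^ 6) ((s + 1) / 10 ^ 6)

/-- The density of the large factor on a tile. -/
noncomputable def tileRight (s : ℕ) : ℝ → ℝ :=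
  plateau ((1000000 - s + 1 / 1000) / 10 ^ 6) ((1000000 - s + 2 / 1000) / 10 ^ 6)
    ((1002000 - (s + 1) - 1 / 1000) / 10 ^ 6) ((1002000 - (s + 1)) / 10 ^ 6)

lemma tileLeft_eq_zero_of_le {s : ℕ} {u : ℝ} (hu : u ≤ s / 10 ^ 6) : tileLeft s u = 0 :=
  plateau_eq_zero_of_le (by gcongr; linarith) hu

lemma tileLeft_eq_zero_of_ge {s : ℕ} {u : ℝ} (hu : ((s : ℝ) + 1) / 10 ^ 6 ≤ u) :
    tileLeft s u = 0 :=
  plateau_eq_zero_of_ge (by gcongr; linarith) hu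

lemma tilePair {s : ℕ} (hs : 0 < s) (hs' : s < 500000) :
    TilePair (tileLeft s) (tileRight s) (s / 10 ^ 6) ((1000000 - s + 1 / 1000) / 10 ^ 6)
      ((1002000 - (s + 1)) / 10 ^ 6) := by
  have h0 : (0 : ℝ) < s := by exact_mod_cast hs
  have h1 : (s : ℝ) + 1 ≤ 500000 := by exact_mod_cast hs'
  exact
    { continuous_left := continuous_plateau
      continuous_right := continuous_plateau
      left_low := fun u hu => tileLeft_eq_zero_of_le hu
      left_high := fun u hu => tileLeft_eq_zero_of_ge
        (le_trans (div_le_div_of_nonneg_right (by linarith) (by norm_num)) hu)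
      right_low := fun u hu => plateau_eq_zero_of_le
        (div_lt_div_of_pos_right (by linarith) (by norm_num)) hu
      right_high := fun u hu => plateau_eq_zero_of_ge
        (div_lt_div_of_pos_right (by linarith) (by norm_num)) hu
      pos := by positivity
      le_mid := div_le_div_of_nonneg_right (by linarith) (by norm_num)
      one_le := by linarith
      mid_le := div_le_div_of_nonneg_right (by linarith) (by norm_num) }

lemma eq_of_tileLeft_ne_zero {s s' : ℕ} {u : ℝ} (h : tileLeft s u ≠ 0) (h' : tileLeft s' u ≠ 0) :
    s = s' := by
  have key : ∀ {x y : ℕ}, tileLeft x u ≠ 0 → tileLeft y u ≠ 0 → x ≤ y := by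
    intro x y hx hy
    by_contra! hlt
    refine hx (tileLeft_eq_zero_of_le ?_)
    by_contra! hu
    refine hy (tileLeft_eq_zero_of_ge (hu.le.trans' ?_))
    have : (y : ℝ) + 1 ≤ x := by exact_mod_cast hlt
    gcongr
  exact le_antisymm (key h h') (key h' h)

lemma tileBot_injective : Function.Injective tileBot := by
  rintro ⟨i, t⟩ ⟨i', t'⟩ h
  simp only [tileBot] at h
  have := t.2
  have := t'.2
  ext <;> simp only <;> omega

lemma tileBot_pos (τ : Fin 247 × Fin 2000) : 0 < tileBot τ := by
  unfold tileBot; omega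

lemma tileBot_lt (τ : Fin 247 × Fin 2000) : tileBot τ < 500000 := by
  unfold tileBot; omega

lemma le_integral_tileLeft (τ : Fin 247 × Fin 2000) :
    (998 / 1000 : ℝ) / (2000 * (τ.1 + 4)) ≤ ∫ u, tileLeft (tileBot τ) u / u := by
  have h0 : (0 : ℝ) < tileBot τ := by exact_mod_cast tileBot_pos τ
  have h1 : (tileBot τ : ℝ) + 1 ≤ 2000 * (τ.1 + 4) := by
    have : tileBot τ + 1 ≤ 2000 * (τ.1 + 4) := by unfold tileBot; omega
    exact_mod_cast this
  refine le_trans (le_of_eq ?_) (le_integral_plateau_div (M := 2000 * (τ.1 + 4) / 10 ^ 6)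
    (by positivity) (by gcongr; linarith)
    (div_le_div_of_nonneg_right (by linarith) (by norm_num)) (by gcongr; linarith)
    (div_le_div_of_nonneg_right (by linarith) (by norm_num)))
  field_simp
  ring

lemma le_integral_tileRight (τ : Fin 247 × Fin 2000) :
    (1998997 / 1000 : ℝ) / (2000 * (498 - τ.1)) ≤ ∫ u, tileRight (tileBot τ) u / u := by
  have h0 : (tileBot τ : ℝ) + 1 ≤ 500000 := by exact_mod_cast tileBot_lt τ
  have h1 : 2000 * ((τ.1 : ℝ) + 3) ≤ tileBot τ := by
    have : 2000 * (τ.1 + 3) ≤ tileBot τ := by unfold tileBot; omega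
    exact_mod_cast this
  have h2 : (0 : ℝ) < 498 - τ.1 := by linarith
  refine le_trans (le_of_eq ?_) (le_integral_plateau_div (M := 2000 * (498 - τ.1) / 10 ^ 6)
    (div_pos (by linarith) (by norm_num)) (div_lt_div_of_pos_right (by linarith) (by norm_num))
    (div_le_div_of_nonneg_right (by linarith) (by norm_num))
    (div_lt_div_of_pos_right (by linarith) (by norm_num))
    (div_le_div_of_nonneg_right (by linarith) (by norm_num)))
  field_simp
  ring

lemma le_tileForm (τ : Fin 247 × Fin 2000) (j : Fin 3) :
    (1994 / (2000 ^ 2 * 10 ^ 24) : ℝ) *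
      (cellForm (2000 * (τ.1 + 3)) / (((τ.1 + 4) * (498 - τ.1) : ℕ) : ℝ)) ≤
    (∫ u, tileRight (tileBot τ) u / u) * cellSieve.tileForm (tileLeft (tileBot τ)) j := by
  have hle : 2000 * (τ.1 + 3) ≤ tileBot τ := by unfold tileBot; omega
  have h1 := le_integral_tileLeft τ
  have h2 := le_integral_tileRight τ
  have h3 := cellSieve_tileForm_ge (f := tileLeft (tileBot τ)) continuous_plateau
    (s := 2000 * (τ.1 + 3)) (by omega)
    (fun u hu => tileLeft_eq_zero_of_le (hu.trans (by gcongr)))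
    (fun u hu => tileLeft_eq_zero_of_ge hu) (fun u => plateau_nonneg) j
  generalize cellForm (2000 * (τ.1 + 3)) = F at h3 ⊢
  have h4 : (0 : ℝ) < 498 - τ.1 := by
    have : (τ.1 : ℝ) < 247 := by exact_mod_cast τ.1.2
    linarith
  have h5 : (((498 - τ.1 : ℕ)) : ℝ) = 498 - τ.1 := by
    rw [Nat.cast_sub (by omega)]; rfl
  have h6 : (0 : ℝ) ≤ (1998997 / 1000 : ℝ) / (2000 * (498 - τ.1)) := by positivity
  have h7 := (mul_le_mul_of_nonneg_right h1
    (by positivity : (0 : ℝ) ≤ (F : ℝ) / 10 ^ 24)).trans h3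
  refine le_trans ?_ (mul_le_mul h2 h7 (by positivity) (h6.trans h2))
  have h8 : (0 : ℝ) ≤ (F : ℝ) / ((τ.1 + 4) * (498 - τ.1)) := by positivity
  push_cast [h5]
  calc (1994 / (2000 ^ 2 * 10 ^ 24) : ℝ) *
        (F / ((τ.1 + 4) * (498 - τ.1)))
      ≤ (1998997 / 1000 * (998 / 1000) / (2000 ^ 2 * 10 ^ 24)) *
        (F / ((τ.1 + 4) * (498 - τ.1))) := by
        gcongr
        norm_num
    _ = _ := by
        field_simp

lemma cellSieve_gap : (2000 / 10 ^ 6 : ℝ) * cellSieve.energy <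
    ∑ j, ∑ τ, (∫ u, tileRight (tileBot τ) u / u) *
      cellSieve.tileForm (tileLeft (tileBot τ)) j := by
  set S := ∑ i ∈ range 247, cellForm (2000 * (i + 3)) / ((i + 4) * (498 - i)) with hS
  have h1 : (4000000 : ℝ) * cellEnergy < 5982 * S := by exact_mod_cast cellEnergy_lt
  have h2 : (S : ℝ) ≤ ∑ i : Fin 247,
      (cellForm (2000 * (i + 3)) / (((i + 4) * (498 - i) : ℕ) : ℝ)) := by
    rw [hS, sum_range]
    push_cast
    exact sum_le_sum fun i _ => by exact_mod_cast Nat.cast_div_le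
  have h3 : ∑ _j : Fin 3, ∑ τ : Fin 247 × Fin 2000, (1994 / (2000 ^ 2 * 10 ^ 24) : ℝ) *
      (cellForm (2000 * (τ.1 + 3)) / (((τ.1 + 4) * (498 - τ.1) : ℕ) : ℝ)) =
      5982 / (2000 * 10 ^ 24) * ∑ i : Fin 247,
      (cellForm (2000 * (i + 3)) / (((i + 4) * (498 - i) : ℕ) : ℝ)) := by
    rw [← mul_sum, Fintype.sum_prod_type]
    simp only [sum_const, card_univ, Fintype.card_fin, nsmul_eq_mul, ← mul_sum]
    ring
  have h4 := sum_le_sum fun j (_ : j ∈ (univ : Finset (Fin 3))) =>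
    sum_le_sum fun τ (_ : τ ∈ (univ : Finset (Fin 247 × Fin 2000))) => le_tileForm τ j
  rw [h3] at h4
  refine lt_of_le_of_lt (mul_le_mul_of_nonneg_left cellSieve_energy_le (by norm_num))
    (lt_of_lt_of_le ?_ h4)
  linarith

theorem AdmissibleForms.exists_pair_mem_E2 {D : ℕ} (hD : 24 ≤ D) {A B : Fin 3 → ℕ}
    (hAB : AdmissibleForms D A B) (C m₀ : ℕ) :
    ∃ m, m₀ < m ∧ ∃ i j, i ≠ j ∧ A i * m + B i ∈ E2 C ∧ A j * m + B j ∈ E2 C := by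
  refine cellSieve.exists_pair_mem_E2 (f := fun τ => tileLeft (tileBot τ))
    (h := fun τ => tileRight (tileBot τ)) (b := fun τ => ((tileBot τ : ℝ) + 1) / 10 ^ 6)
    (fun τ => tilePair (tileBot_pos τ) (tileBot_lt τ)) (fun τ u hu => tileLeft_eq_zero_of_ge hu)
    (fun τ u => plateau_le_one) (fun τ u => plateau_nonneg) (fun τ u => plateau_le_one)
    (fun τ τ' u h h' => tileBot_injective (eq_of_tileLeft_ne_zero h h')) (fun τ k => ?_)
    (ρ := 1 / 10 ^ 9) (η := 2000 / 10 ^ 6) (by norm_num) (by norm_num) (fun τ => ?_) (fun τ => ?_)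
    cellSieve_gap hD hAB C m₀
  · have h1 : (cellTop k : ℝ) ≤ 199990 := by exact_mod_cast cellTop_le k
    have h2 : (tileBot τ : ℝ) ≤ 500000 := by exact_mod_cast (tileBot_lt τ).le
    exact div_le_div_of_nonneg_right (by linarith) (by norm_num)
  · linarith
  · linarith

end Tiles

section Reduction

open Finset

lemma infinite_mul_add_one_mem_E2 {a : ℕ} (ha : 0 < a) (C : ℕ) :
    {x : ℕ | 0 < x ∧ a * x + 1 ∈ E2 C}.Infinite := by
  refine Set.infinite_of_forall_exists_gt fun n => ?_
  obtain ⟨p, hp, hpn, hpa⟩ := Nat.exists_prime_gt_modEq_one (max C (a * n + 1)) ha.ne'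
  obtain ⟨q, hq, hqp, hqa⟩ := Nat.exists_prime_gt_modEq_one p ha.ne'
  obtain ⟨h1, h2⟩ := max_lt_iff.mp hpn
  obtain ⟨x, hx⟩ : a ∣ p * q - 1 :=
    (Nat.modEq_iff_dvd' (Nat.mul_pos hp.pos hq.pos)).mp (hpa.mul hqa).symm
  have hx' : a * x + 1 = p * q := by
    have := Nat.mul_pos hp.pos hq.pos
    omega
  have hlt : n < x := by
    refine lt_of_mul_lt_mul_left (a := a) ?_ ha.le
    have := Nat.le_mul_of_pos_right p hq.pos
    omega
  exact ⟨x, ⟨by omega, p, q, hp, hq, hqp.ne, h1, h1.trans hqp, hx'⟩, hlt⟩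

lemma exists_mul_add_one_modEq {b r : ℕ} (hr : 0 < r) (h : r.Coprime b) :
    ∃ c, b * c + 1 ≡ r [MOD r * r] := by
  have : NeZero (r * r) := ⟨(Nat.mul_pos hr hr).ne'⟩
  have hu : (b : ZMod (r * r)) * (b : ZMod (r * r))⁻¹ = 1 :=
    ZMod.coe_mul_inv_eq_one b (Nat.Coprime.mul_right h.symm h.symm)
  refine ⟨(((r : ZMod (r * r)) - 1) * (b : ZMod (r * r))⁻¹).val, ?_⟩
  rw [← ZMod.natCast_eq_natCast_iff]
  push_cast
  rw [ZMod.natCast_val, ZMod.cast_id]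
  linear_combination ((r : ZMod (r * r)) - 1) * hu

variable {a r : Fin 3 → ℕ}

lemma exists_base (hr : ∀ i, 0 < r i) (hra : ∀ i, Nat.Coprime (r i) (a i))
    (hrr : ∀ i j, i ≠ j → Nat.Coprime (r i) (r j)) (D : ℕ) :
    ∃ x, (∀ i, a i * x + 1 ≡ r i [MOD r i * r i]) ∧
      ∀ p, p.Prime → p ≤ D → (∀ i, ¬ p ∣ r i) → p ∣ x := by
  set w := ∏ p ∈ range (D + 1) with p.Prime ∧ ∀ i, ¬ p ∣ r i, p with hw
  have hcop : ∀ i, (r i).Coprime w := fun i => Nat.Coprime.prod_right fun p hp => by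
    obtain ⟨_, hp, h⟩ := mem_filter.mp hp
    exact ((Nat.Prime.coprime_iff_not_dvd hp).mpr (h i)).symm
  choose c hc using fun i => exists_mul_add_one_modEq (hr i) ((hra i).mul_right (hcop i))
  obtain ⟨y, hy⟩ := Nat.chineseRemainderOfFinset c (fun i => r i * r i) univ
    (fun i _ => (Nat.mul_pos (hr i) (hr i)).ne') fun i _ j _ hij => by
      have := hrr i j hij
      exact Nat.Coprime.mul_left (this.mul_right this) (this.mul_right this)
  refine ⟨w * y, fun i => ?_, fun p hp hD h => ?_⟩
  · rw [← mul_assoc]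
    exact (((hy i (mem_univ i)).mul_left _).add_right 1).trans (hc i)
  · exact (dvd_prod_of_mem (fun p => p) (mem_filter.mpr ⟨by simp; omega, hp, h⟩)).mul_right y

/-- Along a suitable progression the quotients `(a i * x + 1) / r i` are admissible forms. -/
lemma exists_admissibleForms (ha : ∀ i, 0 < a i) (hr : ∀ i, 0 < r i)
    (hra : ∀ i, Nat.Coprime (r i) (a i))
    (hrad : ∀ i j, i ≠ j → Int.gcd (r i) ((a i : ℤ) - (a j : ℤ)) = 1)
    (hrr : ∀ i j, i ≠ j → Nat.Coprime (r i) (r j)) (hinj : Function.Injective a) :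
    ∃ D, 24 ≤ D ∧ ∃ A B : Fin 3 → ℕ, AdmissibleForms D A B ∧ ∃ M x, 0 < M ∧
      ∀ i m, r i * (A i * m + B i) = a i * (x + M * m) + 1 := by
  set D := 24 + ∑ i, a i + ∑ i, r i with hD
  have haD : ∀ i, a i ≤ D := fun i => by
    have := single_le_sum (fun i _ => Nat.zero_le (a i)) (mem_univ i)
    omega
  have hrD : ∀ i, r i ≤ D := fun i => by
    have := single_le_sum (fun i _ => Nat.zero_le (r i)) (mem_univ i)
    omega
  obtain ⟨x, hx, hxD⟩ := exists_base hr hra hrr D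
  choose s hs using fun i => dvd_prod_of_mem r (mem_univ i)
  have hB : ∀ i, r i ∣ a i * x + 1 := fun i =>
    ((hx i).of_mul_right (r i)).symm.dvd_iff (dvd_refl _) |>.mp (dvd_refl _)
  choose B hB using hB
  set M := (∏ i, r i) ^ 2 * D.factorial with hM
  have hM0 : 0 < M := Nat.mul_pos (pow_pos (prod_pos fun i _ => hr i) 2) D.factorial_pos
  have hpM : ∀ p, p.Prime → p ∣ M → p ≤ D := fun p hp h => by
    rcases (Nat.Prime.dvd_mul hp).mp h with h | h
    · obtain ⟨i, _, hi⟩ := (Prime.dvd_finsetProd_iff hp.prime r).mp (hp.dvd_of_dvd_pow h)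
      exact (Nat.le_of_dvd (hr i) hi).trans (hrD i)
    · exact (Nat.Prime.dvd_factorial hp).mp h
  have hA : ∀ i, r i * (a i * (r i * s i ^ 2) * D.factorial) = a i * M := fun i => by
    rw [hM, hs i]; ring
  refine ⟨D, by omega, fun i => a i * (r i * s i ^ 2) * D.factorial, B, ⟨fun i => ?_,
    fun i p hp => ?_, fun i => ?_, fun i j hij p hp hDp h => ?_⟩, M, x, hM0, fun i m => ?_⟩
  · refine Nat.pos_of_ne_zero fun h => ?_
    have := hA i
    rw [h, mul_zero] at this
    exact (Nat.mul_pos (ha i) hM0).ne this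
  · refine ⟨fun h => ?_, fun h => ((Nat.Prime.dvd_factorial hp).mpr h).mul_left _⟩
    rcases (Nat.Prime.dvd_mul hp).mp (hA i ▸ h.mul_left (r i)) with h | h
    · exact (Nat.le_of_dvd (ha i) h).trans (haD i)
    · exact hpM p hp h
  · refine Nat.coprime_of_dvd fun p hp h hpB => ?_
    have hpD : p ≤ D := by
      rcases (Nat.Prime.dvd_mul hp).mp (hA i ▸ h.mul_left (r i)) with h | h
      · exact (Nat.le_of_dvd (ha i) h).trans (haD i)
      · exact hpM p hp h
    have hpx : p ∣ a i * x + 1 := hB i ▸ hpB.mul_left _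
    by_cases hpr : ∀ j, ¬ p ∣ r j
    · exact hp.one_lt.ne' (Nat.dvd_one.mp
        ((Nat.dvd_add_right ((hxD p hp hpD hpr).mul_left _)).mp hpx))
    push Not at hpr
    obtain ⟨j, hj⟩ := hpr
    by_cases hij : j = i
    · subst hij
      have h1 : r j * B j ≡ r j * 1 [MOD r j * r j] := by rw [← hB, mul_one]; exact hx j
      have h2 : B j ≡ 1 [MOD p] := (Nat.ModEq.mul_left_cancel' (hr j).ne' h1).of_dvd hj
      exact hp.one_lt.ne' (Nat.dvd_one.mp ((h2.dvd_iff (dvd_refl p)).mp hpB))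
    · have hpx' : p ∣ a j * x + 1 := hB j ▸ hj.mul_right _
      have h1 : (p : ℤ) ∣ (a j : ℤ) - a i := by
        have e1 : (p : ℤ) ∣ (a i : ℤ) * x + 1 := by exact_mod_cast hpx
        have e2 : (p : ℤ) ∣ (a j : ℤ) * x + 1 := by exact_mod_cast hpx'
        have := (e1.mul_left (a j : ℤ)).sub (e2.mul_left (a i : ℤ))
        ring_nf at this ⊢
        exact this
      have h2 : (p : ℤ) ∣ 1 := by
        have := Int.dvd_coe_gcd (Int.natCast_dvd_natCast.mpr hj) h1
        rwa [hrad j i hij] at this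
      exact hp.one_lt.ne' (Nat.dvd_one.mp (by exact_mod_cast h2))
  · have := Fact.mk hp
    have hM' : (M : ZMod p) ≠ 0 := fun h0 =>
      hDp.not_ge (hpM p hp ((ZMod.natCast_eq_zero_iff _ _).mp h0))
    have cA : ∀ i, (r i : ZMod p) * ((a i * (r i * s i ^ 2) * D.factorial : ℕ) : ZMod p) =
        a i * M := fun i => by exact_mod_cast congrArg (Nat.cast (R := ZMod p)) (hA i)
    have cB : ∀ i, (a i : ZMod p) * x + 1 = r i * B i := fun i => by
      exact_mod_cast congrArg (Nat.cast (R := ZMod p)) (hB i)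
    have h1 : (a i : ZMod p) = a j := by
      refine mul_right_cancel₀ hM' ?_
      linear_combination (r i : ZMod p) * r j * h + r i * B i * cA j - r j * B j * cA i +
        (M : ZMod p) * a i * cB j - (M : ZMod p) * a j * cB i
    rw [ZMod.natCast_eq_natCast_iff] at h1
    exact hij (hinj (Nat.ModEq.eq_of_lt_of_lt h1 ((haD i).trans_lt hDp) ((haD j).trans_lt hDp)))
  · rw [mul_add, ← mul_assoc, hA, ← hB]; ring

end Reduction

/-- GGPY: given linear forms `Lᵢ(x) = aᵢ x + 1` and moduli `rᵢ` with the stated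
coprimality conditions, there are two indices `i < j` such that for infinitely many
positive integers `x` both `Lᵢ(x)/rᵢ` and `Lⱼ(x)/rⱼ` lie in `E₂(C)`. -/
theorem stmt_2 (a r : Fin 3 → ℕ)
    (ha : ∀ i, 0 < a i) (hr : ∀ i, 0 < r i)
    (hra : ∀ i, Nat.Coprime (r i) (a i))
    (hrad : ∀ i j, i ≠ j → Int.gcd (r i) ((a i : ℤ) - (a j : ℤ)) = 1)
    (hrr : ∀ i j, i ≠ j → Nat.Coprime (r i) (r j))
    (C : ℕ) (hC : 0 < C) :
    ∃ i j : Fin 3, i < j ∧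
      {x : ℕ | 0 < x ∧
        (r i ∣ a i * x + 1 ∧ (a i * x + 1) / r i ∈ E2 C) ∧
        (r j ∣ a j * x + 1 ∧ (a j * x + 1) / r j ∈ E2 C)}.Infinite := by
  by_cases hinj : Function.Injective a
  · obtain ⟨D, hD, A, B, hAB, M, x, hM, h⟩ := exists_admissibleForms ha hr hra hrad hrr hinj
    by_contra! hcon
    have hfin : (⋃ i, ⋃ j, ⋃ (_ : i < j), {x : ℕ | 0 < x ∧
        (r i ∣ a i * x + 1 ∧ (a i * x + 1) / r i ∈ E2 C) ∧
        (r j ∣ a j * x + 1 ∧ (a j * x + 1) / r j ∈ E2 C)}).Finite :=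
      Set.finite_iUnion fun i => Set.finite_iUnion fun j => Set.finite_iUnion fun hij =>
        hcon i j hij
    obtain ⟨N, hN⟩ := hfin.bddAbove
    obtain ⟨m, hm, i, j, hij, hi, hj⟩ := hAB.exists_pair_mem_E2 hD C N
    have hquot : ∀ k, A k * m + B k ∈ E2 C → r k ∣ a k * (x + M * m) + 1 ∧
        (a k * (x + M * m) + 1) / r k ∈ E2 C := fun k hk => by
      rw [← h k m, Nat.mul_div_cancel_left _ (hr k)]
      exact ⟨dvd_mul_right _ _, hk⟩
    have hle : m ≤ x + M * m := (Nat.le_mul_of_pos_left m hM).trans (Nat.le_add_left _ _)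
    have hmem : ∀ i j, i < j → A i * m + B i ∈ E2 C → A j * m + B j ∈ E2 C → False := by
      intro i j hij hi hj
      have := hN (Set.mem_iUnion.mpr ⟨i, Set.mem_iUnion.mpr ⟨j, Set.mem_iUnion.mpr
        ⟨hij, by omega, hquot i hi, hquot j hj⟩⟩⟩)
      omega
    rcases hij.lt_or_gt with hij | hij
    · exact hmem i j hij hi hj
    · exact hmem j i hij hj hi
  · have hone : ∀ i j, i ≠ j → a i = a j → r i = 1 := fun i j hij h => by
      have := hrad i j hij
      rwa [h, sub_self, Int.gcd_zero_right, Int.natAbs_natCast] at this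
    have key : ∀ i j, i < j → a i = a j → ∃ i j : Fin 3, i < j ∧ {x : ℕ | 0 < x ∧
        (r i ∣ a i * x + 1 ∧ (a i * x + 1) / r i ∈ E2 C) ∧
        (r j ∣ a j * x + 1 ∧ (a j * x + 1) / r j ∈ E2 C)}.Infinite := by
      intro i j hij h
      refine ⟨i, j, hij, (infinite_mul_add_one_mem_E2 (ha i) C).mono fun x hx => ?_⟩
      have hi := hone i j hij.ne h
      have hj := hone j i hij.ne' h.symm
      simp only [Set.mem_ofPred_eq, hi, hj, Nat.div_one, ← h, one_dvd, true_and]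
      exact ⟨hx.1, hx.2, hx.2⟩
    obtain ⟨i, j, h, hij⟩ : ∃ i j, a i = a j ∧ i ≠ j := by
      simpa [Function.Injective] using hinj
    rcases hij.lt_or_gt with hij | hij
    · exact key i j hij h
    · exact key j i hij h.symm
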